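/- Let n ≥ 3. There exists λ_n > 0, depending only on n, such that for every 0 < λ < λ_n the unit ball B_1 is, up to translation, the unique minimizer of E ↦ P(E) + λ·NL(E) among all sets of finite perimeter E ⊂ ℝⁿ with |E| = |B_1|. -/

import Mathlib

open MeasureTheory Metric Set

noncomputable section

/-- The divergence of a vector field on `ℝⁿ`. -/
def vdiv {n : ℕ} (φ : EuclideanSpace ℝ (Fin n) → EuclideanSpace ℝ (Fin n))
    (x : EuclideanSpace ℝ (Fin n)) : ℝ :=
  ∑ i, fderiv ℝ φ x (EuclideanSpace.single i 1) i

/-- The set of admissible values `∫_F div φ` in the variational definition of the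
perimeter: `φ` ranges over compactly supported `C¹` vector fields with `‖φ‖ ≤ 1`. -/
def perimVals {n : ℕ} (F : Set (EuclideanSpace ℝ (Fin n))) : Set ℝ :=
  { r | ∃ φ : EuclideanSpace ℝ (Fin n) → EuclideanSpace ℝ (Fin n),
      ContDiff ℝ 1 φ ∧ HasCompactSupport φ ∧ (∀ x, ‖φ x‖ ≤ 1) ∧
      r = ∫ x in F, vdiv φ x }

/-- The (distributional) perimeter `P(F)`. -/
def perimeter {n : ℕ} (F : Set (EuclideanSpace ℝ (Fin n))) : ℝ := sSup (perimVals F)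

/-- `F` is a set of finite perimeter: it is measurable and the variational
definition of the perimeter is finite. -/
def HasFinitePerimeter {n : ℕ} (F : Set (EuclideanSpace ℝ (Fin n))) : Prop :=
  MeasurableSet F ∧ BddAbove (perimVals F)

/-- The Newtonian interaction energy `NL(F) = ∫∫ χ_F(x)χ_F(y)|x-y|^{2-n}`. -/
def NL {n : ℕ} (F : Set (EuclideanSpace ℝ (Fin n))) : ℝ :=
  ∫ x in F, ∫ y in F, ‖x - y‖ ^ (2 - (n : ℝ))

/-- The function `f_E = χ_{B_1} - χ_E`. -/
def fE {n : ℕ} (E : Set (EuclideanSpace ℝ (Fin n))) (x : EuclideanSpace ℝ (Fin n)) : ℝ :=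
  (ball (0 : EuclideanSpace ℝ (Fin n)) 1).indicator 1 x - E.indicator 1 x

/-- The Newtonian potential `v(y) = ∫ (χ_{B_1} - χ_E)(x) |x-y|^{2-n} dx`. -/
def newtPot {n : ℕ} (E : Set (EuclideanSpace ℝ (Fin n))) (y : EuclideanSpace ℝ (Fin n)) : ℝ :=
  ∫ x, fE E x * ‖x - y‖ ^ (2 - (n : ℝ))

/-- The normalization constant `σ_{n,α}` of the Riesz potential. -/
def rieszConst (n : ℕ) (α : ℝ) : ℝ :=
  (Real.pi ^ ((n : ℝ) / 2) * 2 ^ α * Real.Gamma (α / 2) / Real.Gamma (((n : ℝ) - α) / 2))⁻¹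

/-- The Riesz potential `I_α f(x) = σ_{n,α} ∫ f(ξ)|x-ξ|^{α-n} dξ`. -/
def rieszPot {n : ℕ} (α : ℝ) (f : EuclideanSpace ℝ (Fin n) → ℝ)
    (x : EuclideanSpace ℝ (Fin n)) : ℝ :=
  rieszConst n α * ∫ ξ, f ξ * ‖x - ξ‖ ^ (α - (n : ℝ))

/-- The average of `g` over the sphere `∂B_r` with respect to the
`(n-1)`-dimensional Hausdorff measure. -/
def sphAvg {n : ℕ} (g : EuclideanSpace ℝ (Fin n) → ℝ) (r : ℝ) : ℝ :=
  (μH[(n : ℝ) - 1] (sphere (0 : EuclideanSpace ℝ (Fin n)) r)).toReal⁻¹ *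
    ∫ y in sphere (0 : EuclideanSpace ℝ (Fin n)) r, g y ∂μH[(n : ℝ) - 1]

/-- The average of `g` over the ball `B_r` with respect to the Lebesgue measure. -/
def ballAvg {n : ℕ} (g : EuclideanSpace ℝ (Fin n) → ℝ) (r : ℝ) : ℝ :=
  (volume (ball (0 : EuclideanSpace ℝ (Fin n)) r)).toReal⁻¹ *
    ∫ x in ball (0 : EuclideanSpace ℝ (Fin n)) r, g x

end

abbrev Eu (n : ℕ) := EuclideanSpace ℝ (Fin n)

variable {n k : ℕ}

theorem evf {α : Type*} {p : α → Prop} {l : Filter α} (h : ∀ x, p x) : ∀ᶠ x in l, p x := Filter.Eventually.of_forall h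

theorem ml {a b c : ℝ} (h : b ≤ c) (ha : 0 ≤ a) : a * b ≤ a * c := mul_le_mul_of_nonneg_left h ha

theorem mr {a b c : ℝ} (h : b ≤ c) (ha : 0 ≤ a) : b * a ≤ c * a := mul_le_mul_of_nonneg_right h ha

notation:max "bfp" => (by fun_prop)
notation:max "bpo" => (by positivity)
notation:max "bli" => (by linarith)
notation:max "bom" => (by omega)
notation:max "bnn" => (by norm_num)
notation:max "Es" k:max => Eu (k+1)
notation:max "BB" n:max => ball (0 : Eu n) 1

noncomputable def om (k : ℕ) : ℝ := (volume : Measure (Eu k)).real (ball 0 1)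

noncomputable def csL (k : ℕ) : (ℝ × Eu k) ≃L[ℝ] Es k :=
  ((ContinuousLinearEquiv.refl ℝ ℝ).prodCongr (PiLp.continuousLinearEquiv 2 ℝ (fun _ : Fin k => ℝ))).trans
    ((Fin.consEquivL ℝ (fun _ : Fin (k+1) => ℝ)).trans
      (PiLp.continuousLinearEquiv 2 ℝ (fun _ : Fin (k+1) => ℝ)).symm)

theorem csL_zero (p : ℝ × Eu k) : csL k p 0 = p.1 := by
  simp [csL, Fin.consEquivL]

theorem csL_succ (p : ℝ × Eu k) (i : Fin k) : csL k p i.succ = p.2 i := by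
  simp [csL, Fin.consEquivL]

theorem csL_norm_sq (p : ℝ × Eu k) : ‖csL k p‖^2 = p.1^2 + ‖p.2‖^2 := by
  rw [EuclideanSpace.norm_sq_eq, EuclideanSpace.norm_sq_eq, Fin.sum_univ_succ]
  simp [csL_zero, csL_succ]

theorem csL_mp (k : ℕ) : MeasurePreserving (csL k) (volume.prod volume) volume := by
  have h1 : MeasurePreserving (Prod.map id (@WithLp.ofLp 2 (Fin k → ℝ)))
      ((volume : Measure ℝ).prod (volume : Measure (Eu k))) (volume.prod volume) :=
    (MeasurePreserving.id volume).prod (PiLp.volume_preserving_ofLp (Fin k))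
  have h2 := (volume_preserving_piFinSuccAbove (fun _ : Fin (k+1) => ℝ) 0).symm
  have h3 := PiLp.volume_preserving_toLp (Fin (k+1))
  have h4 := h3.comp (h2.comp h1)
  have h5 : (csL k : ℝ × Eu k → Es k) = (@WithLp.toLp 2 (Fin (k+1) → ℝ)) ∘
      ((MeasurableEquiv.piFinSuccAbove (fun _ : Fin (k+1) => ℝ) 0).symm ∘
        Prod.map id (@WithLp.ofLp 2 (Fin k → ℝ))) := by
    funext p
    ext i
    refine Fin.cases ?_ (fun j => ?_) i
    · rw [csL_zero]; simp [MeasurableEquiv.piFinSuccAbove]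
    · rw [csL_succ]; simp [MeasurableEquiv.piFinSuccAbove]
  rw [h5]
  exact h4

theorem csL_me (k : ℕ) : MeasurableEmbedding (csL k) :=
  (csL k).toHomeomorph.toMeasurableEquiv.measurableEmbedding

theorem integral_csL (F : Es k → ℝ) : ∫ p : ℝ × Eu k, F (csL k p) = ∫ x, F x :=
  (csL_mp k).integral_comp (csL_me k) F

theorem integrable_csL {F : Es k → ℝ} :
    Integrable (fun p : ℝ × Eu k => F (csL k p)) ↔ Integrable F :=
  (csL_mp k).integrable_comp_emb (csL_me k)

theorem integral_slice {F : Es k → ℝ} (hF : Integrable F) :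
    ∫ x, F x = ∫ t : ℝ, ∫ y : Eu k, F (csL k (t, y)) := by
  rw [← integral_csL]
  exact integral_prod _ (integrable_csL.2 hF)

theorem integral_slice_swap {F : Es k → ℝ} (hF : Integrable F) :
    ∫ x, F x = ∫ y : Eu k, ∫ t : ℝ, F (csL k (t, y)) := by
  rw [← integral_csL]
  exact integral_prod_symm _ (integrable_csL.2 hF)

theorem csL_snd_le (p : ℝ × Eu k) : ‖p.2‖ ≤ ‖csL k p‖ := by
  have := csL_norm_sq p
  nlinarith [norm_nonneg (csL k p), norm_nonneg p.2, sq_nonneg p.1]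

theorem csL_fst_le (p : ℝ × Eu k) : |p.1| ≤ ‖csL k p‖ := by
  have := csL_norm_sq p
  exact abs_le_of_sq_le_sq (by nlinarith [norm_nonneg p.2, sq_nonneg ‖p.2‖]) (norm_nonneg _)

theorem om_pos (k : ℕ) : 0 < om k := by
  unfold om
  exact ENNReal.toReal_pos (measure_ball_pos _ _ one_pos).ne' measure_ball_lt_top.ne

theorem vol_ball (x : Eu k) {r : ℝ} (hr : 0 ≤ r) (hk : 1 ≤ k) :
    (volume : Measure (Eu k)).real (ball x r) = r^k * om k := by
  have : Nonempty (Fin k) := ⟨⟨0, hk⟩⟩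
  rw [Measure.real, Measure.addHaar_ball _ _ hr]
  simp [om, Measure.real, hr]

noncomputable def vB (k : ℕ) (z : ℝ) : ℝ := om k * (√(1 - z^2))^k

theorem vB_nonneg (k : ℕ) (z : ℝ) : 0 ≤ vB k z :=
  mul_nonneg (om_pos k).le (pow_nonneg (Real.sqrt_nonneg _) _)

theorem vB_cont (k : ℕ) : Continuous (vB k) := by unfold vB; fun_prop

theorem vB_pos {z : ℝ} (hz : |z| < 1) : 0 < vB k z := by
  have : z^2 < 1 := by rw [← sq_abs]; nlinarith [abs_nonneg z]
  exact mul_pos (om_pos k) (pow_pos (Real.sqrt_pos.2 bli) _)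

theorem vB_eq_zero (hk : 1 ≤ k) {z : ℝ} (hz : 1 ≤ |z|) : vB k z = 0 := by
  have : 1 ≤ z^2 := by rw [← sq_abs]; nlinarith [abs_nonneg z]
  rw [vB, Real.sqrt_eq_zero_of_nonpos bli, zero_pow bom, mul_zero]

theorem vB_even (k : ℕ) (z : ℝ) : vB k (-z) = vB k z := by simp [vB]

theorem vB_hcs (hk : 1 ≤ k) : HasCompactSupport (vB k) := by
  refine HasCompactSupport.intro (isCompact_Icc (a := -1) (b := (1:ℝ))) (fun z hz => ?_)
  apply vB_eq_zero hk
  by_contra h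
  push Not at h
  exact hz ⟨(abs_lt.1 h).1.le, (abs_lt.1 h).2.le⟩

theorem integral_ball_fst (hk : 1 ≤ k) {q : ℝ → ℝ} (hq : Continuous q) :
    ∫ x in BB (k+1), q (x 0) = ∫ z, vB k z * q z := by
  have hI : Integrable ((BB (k+1)).indicator (fun x : Es k => q (x 0))) := by
    rw [integrable_indicator_iff measurableSet_ball]
    apply IntegrableOn.mono_set _ ball_subset_closedBall
    apply ContinuousOn.integrableOn_compact (isCompact_closedBall _ _)
    apply Continuous.continuousOn; fun_prop
  rw [← integral_indicator measurableSet_ball, integral_slice hI]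
  congr 1; ext t
  have : (fun y : Eu k => (BB (k+1)).indicator (fun x : Es k => q (x 0)) (csL k (t, y)))
      = (ball (0 : Eu k) (√(1 - t^2))).indicator (fun _ => q t) := by
    ext y
    have : csL k (t, y) ∈ BB (k+1) ↔ y ∈ ball (0 : Eu k) (√(1 - t^2)) := by
      rw [mem_ball_zero_iff, mem_ball_zero_iff, Real.lt_sqrt (norm_nonneg _), ← sq_lt_one_iff₀ (norm_nonneg _),
        csL_norm_sq]
      constructor <;> intro h <;> simp at h ⊢ <;> linarith
    by_cases h : y ∈ ball (0 : Eu k) (√(1 - t^2))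
    · rw [indicator_of_mem h, indicator_of_mem (this.2 h), csL_zero]
    · rw [indicator_of_notMem h, indicator_of_notMem (mt this.1 h)]
  rw [this, integral_indicator measurableSet_ball, setIntegral_const, vol_ball _ (Real.sqrt_nonneg _) hk]
  simp only [vB, smul_eq_mul]; ring

theorem om_succ (hk : 1 ≤ k) : om (k+1) = ∫ z, vB k z := by
  have := integral_ball_fst hk (q := fun _ => 1) continuous_const
  simpa [om] using this

theorem om_one : om 1 = 2 := by
  have h := EuclideanSpace.volume_ball (Fin 1) (0 : Eu 1) 1
  have h2 : Real.Gamma (1/2 + 1) = √Real.pi / 2 := by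
    rw [Real.Gamma_add_one bnn, Real.Gamma_one_half_eq]; ring
  have h3 := Real.sqrt_pos.2 Real.pi_pos
  rw [om, Measure.real, h]
  simp only [Fintype.card_fin, Nat.cast_one, h2, pow_one, ENNReal.ofReal_one, one_mul]
  rw [ENNReal.toReal_ofReal bpo]
  field_simp

structure Adm (f : Eu n → ℝ) : Prop where
  cd : ContDiff ℝ 1 f
  cs : HasCompactSupport f
  nn : ∀ x, 0 ≤ f x
  le : ∀ x, f x ≤ 1

noncomputable def TV (f : Eu n → ℝ) : ℝ := ∫ x, ‖fderiv ℝ f x‖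

noncomputable def csi (k : ℕ) : Eu k →L[ℝ] Es k :=
  ((csL k) : (ℝ × Eu k) →L[ℝ] Es k).comp (ContinuousLinearMap.inr ℝ ℝ (Eu k))

noncomputable def e0 (k : ℕ) : Es k := csL k (1, 0)

theorem csL_eq (t : ℝ) (y : Eu k) : csL k (t, y) = t • e0 k + csi k y := by
  simp only [e0, csi, ← map_smul, ContinuousLinearMap.comp_apply, ContinuousLinearMap.inr_apply,
    ContinuousLinearEquiv.coe_coe, ← map_add]
  simp

theorem Adm.cont {f : Eu n → ℝ} (h : Adm f) : Continuous f := h.cd.continuous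

theorem Adm.diff {f : Eu n → ℝ} (h : Adm f) : Differentiable ℝ f :=
  h.cd.differentiable bnn

theorem Adm.integrable {f : Eu n → ℝ} (h : Adm f) : Integrable f :=
  h.cont.integrable_of_hasCompactSupport h.cs

theorem Adm.fcont {f : Eu n → ℝ} (h : Adm f) : Continuous (fderiv ℝ f) :=
  h.cd.continuous_fderiv bnn

theorem Adm.fcs {f : Eu n → ℝ} (h : Adm f) : HasCompactSupport (fderiv ℝ f) :=
  h.cs.fderiv ℝ

theorem Adm.tvint {f : Eu n → ℝ} (h : Adm f) : Integrable (fun x => ‖fderiv ℝ f x‖) :=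
  h.fcont.norm.integrable_of_hasCompactSupport h.fcs.norm

theorem TV_nonneg (f : Eu n → ℝ) : 0 ≤ TV f := integral_nonneg fun _ => norm_nonneg _

theorem slice_hasFDerivAt {f : Es k → ℝ} (h : Differentiable ℝ f) (t : ℝ) (y : Eu k) :
    HasFDerivAt (fun y => f (csL k (t, y))) ((fderiv ℝ f (csL k (t, y))).comp (csi k)) y := by
  have h1 : HasFDerivAt (fun y : Eu k => csL k (t, y)) (csi k) y := by
    have : (fun y : Eu k => csL k (t, y)) = fun y => t • e0 k + csi k y := by
      ext y; rw [csL_eq]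
    rw [this]
    exact (csi k).hasFDerivAt.const_add _
  exact (h _).hasFDerivAt.comp y h1

theorem slice_hcs {α : Type*} [Zero α] {G : Es k → α} (hG : HasCompactSupport G) (t : ℝ) :
    HasCompactSupport (fun y => G (csL k (t, y))) := by
  obtain ⟨R, hR⟩ := hG.isCompact.isBounded.subset_closedBall 0
  refine HasCompactSupport.intro (isCompact_closedBall (0 : Eu k) R) (fun y hy => ?_)
  by_contra h
  have h1 := hR (subset_tsupport _ h)
  rw [mem_closedBall_zero_iff] at h1 hy
  exact hy ((csL_snd_le (t, y)).trans h1)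

theorem sliceInt_cont {G : Es k → ℝ} (hG : Continuous G) (hc : HasCompactSupport G) :
    Continuous (fun t => ∫ y, G (csL k (t, y))) := by
  obtain ⟨R, hR⟩ := hc.isCompact.isBounded.subset_closedBall 0
  obtain ⟨C, hC⟩ := hG.bounded_above_of_compact_support hc
  apply continuous_of_dominated (bound := (closedBall (0 : Eu k) R).indicator (fun _ => C))
  · intro t; exact (by fun_prop : Continuous fun y => G (csL k (t, y))).aestronglyMeasurable
  · intro t
    refine evf fun y => ?_
    by_cases hy : y ∈ closedBall (0 : Eu k) R
    · rw [indicator_of_mem hy]; exact hC _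
    · rw [indicator_of_notMem hy]
      have : G (csL k (t, y)) = 0 := by
        by_contra h
        have h1 := hR (subset_tsupport _ h)
        rw [mem_closedBall_zero_iff] at h1 hy
        exact hy ((csL_snd_le (t, y)).trans h1)
      rw [this, norm_zero]
  · rw [integrable_indicator_iff measurableSet_closedBall]
    exact integrableOn_const (measure_closedBall_lt_top.ne)
  · refine evf fun y => ?_
    fun_prop

theorem sliceInt_hcs {G : Es k → ℝ} (hc : HasCompactSupport G) :
    HasCompactSupport (fun t => ∫ y, G (csL k (t, y))) := by
  obtain ⟨R, hR⟩ := hc.isCompact.isBounded.subset_closedBall 0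
  refine HasCompactSupport.intro (isCompact_Icc (a := -R) (b := R)) (fun t ht => ?_)
  have : ∀ y, G (csL k (t, y)) = 0 := by
    intro y
    by_contra h
    have h1 := hR (subset_tsupport _ h)
    rw [mem_closedBall_zero_iff] at h1
    exact ht (abs_le.1 ((csL_fst_le (t, y)).trans h1))
  simp [this]

theorem Adm.slice {f : Es k → ℝ} (h : Adm f) (t : ℝ) : Adm (fun y => f (csL k (t, y))) where
  cd := by
    have : (fun y : Eu k => f (csL k (t, y))) = f ∘ fun y => t • e0 k + csi k y := by
      ext y; simp [csL_eq]
    rw [this]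
    exact h.cd.comp (contDiff_const.add (csi k).contDiff)
  cs := slice_hcs h.cs t
  nn := fun y => h.nn _
  le := fun y => h.le _

theorem calib (L : Es k →L[ℝ] ℝ) (τ : ℝ) (hτ : |τ| ≤ 1) :
    -τ * L (e0 k) + √(1 - τ^2) * ‖L.comp (csi k)‖ ≤ ‖L‖ := by
  have h1 : τ^2 ≤ 1 := by rw [← sq_abs]; nlinarith [abs_nonneg τ]
  have hs := Real.sq_sqrt (sub_nonneg.2 h1)
  have hs0 := Real.sqrt_nonneg (1 - τ^2)
  set s := √(1 - τ^2)
  have key : ∀ y : Eu k, ‖y‖ ≤ 1 → -τ * L (e0 k) + s * L (csi k y) ≤ ‖L‖ := by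
    intro y hy
    have h2 : ‖csL k (-τ, s • y)‖ ≤ 1 := by
      rw [← sq_le_one_iff₀ (norm_nonneg _), csL_norm_sq]
      simp only [norm_smul, Real.norm_eq_abs, mul_pow, sq_abs, neg_sq]
      have := norm_nonneg y
      nlinarith [ml (show ‖y‖^2 ≤ 1 by nlinarith) (sq_nonneg s)]
    have h3 := L.le_opNorm (csL k (-τ, s • y))
    have h4 : L (csL k (-τ, s • y)) = -τ * L (e0 k) + s * L (csi k y) := by
      rw [csL_eq]; simp
    rw [h4, Real.norm_eq_abs] at h3
    have := le_abs_self (-τ * L (e0 k) + s * L (csi k y))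
    nlinarith [norm_nonneg L]
  have key2 : ‖s • L.comp (csi k)‖ ≤ ‖L‖ + τ * L (e0 k) := by
    have h0 : 0 ≤ ‖L‖ + τ * L (e0 k) := by
      have := key 0 (by simp); simp at this; linarith
    refine ContinuousLinearMap.opNorm_le_of_unit_norm h0 (fun y hy => ?_)
    simp only [smul_apply, ContinuousLinearMap.comp_apply, smul_eq_mul,
      Real.norm_eq_abs]
    rw [abs_le]
    constructor
    · have := key (-y) (by simp [hy]); rw [map_neg, map_neg] at this; linarith
    · have := key y hy.le; linarith
  rw [norm_smul, Real.norm_of_nonneg hs0] at key2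
  linarith

theorem slicing {f : Es k → ℝ} (h : Adm f) {τ : ℝ → ℝ} (hτ : ContDiff ℝ 1 τ)
    (hb : ∀ t, |τ t| ≤ 1) :
    (∫ t, (deriv τ t * ∫ y, f (csL k (t, y)))) + ∫ t, √(1 - τ t^2) * TV (fun y => f (csL k (t, y)))
      ≤ TV f := by
  have hx : Continuous fun x : Es k => x 0 := by fun_prop
  have hτc := hτ.continuous
  have hτ'c := hτ.continuous_deriv (le_refl _)
  have hfc := h.cont
  have hfc' := h.fcont
  have i1 : Integrable (fun x : Es k => τ (x 0) * fderiv ℝ f x (e0 k)) := by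
    apply Continuous.integrable_of_hasCompactSupport bfp
    exact (h.fcs.mono (fun x hx => by
      contrapose! hx; simp at hx; simp [hx])).mul_left
  have i2 : Integrable (fun x : Es k => deriv τ (x 0) * f x) := by
    apply Continuous.integrable_of_hasCompactSupport bfp
    exact h.cs.mul_left
  have i3 : Integrable (fun x : Es k => √(1 - τ (x 0)^2) * ‖(fderiv ℝ f x).comp (csi k)‖) := by
    apply Continuous.integrable_of_hasCompactSupport
    · have : Continuous fun x : Es k => (fderiv ℝ f x).comp (csi k) :=
        hfc'.clm_comp continuous_const
      fun_prop
    · exact (h.fcs.mono (fun x hx => by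
        contrapose! hx; simp at hx; simp [hx])).mul_left
  have e1 : ∫ x, τ (x 0) * fderiv ℝ f x (e0 k) = -∫ x, deriv τ (x 0) * f x := by
    have hd : ∀ x : Es k, HasFDerivAt (fun x : Es k => τ (x 0))
        (deriv τ (x 0) • (EuclideanSpace.proj 0 : Es k →L[ℝ] ℝ)) x := by
      intro x
      have h1 : HasDerivAt τ (deriv τ (x 0)) (x 0) :=
        (hτ.differentiable bnn _).hasDerivAt
      exact h1.comp_hasFDerivAt x (EuclideanSpace.proj 0 : Es k →L[ℝ] ℝ).hasFDerivAt
    have hd2 : ∀ x : Es k, fderiv ℝ (fun x : Es k => τ (x 0)) x (e0 k) = deriv τ (x 0) := by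
      intro x
      rw [(hd x).fderiv]
      simp [e0, csL_zero]
    have := integral_mul_fderiv_eq_neg_fderiv_mul_of_integrable (μ := (volume : Measure (Es k)))
      (f := fun x : Es k => τ (x 0)) (g := f) (v := e0 k) (by simpa only [hd2] using i2) i1
      (Continuous.integrable_of_hasCompactSupport bfp h.cs.mul_left)
      (fun x _ => (hd x).differentiableAt) (fun x _ => h.diff x)
    simpa only [hd2] using this
  have e2 : ∫ x, deriv τ (x 0) * f x = ∫ t, (deriv τ t * ∫ y, f (csL k (t, y))) := by
    rw [integral_slice i2]; simp only [csL_zero, integral_const_mul]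
  have e3 : ∫ x, √(1 - τ (x 0)^2) * ‖(fderiv ℝ f x).comp (csi k)‖ =
      ∫ t, √(1 - τ t^2) * TV (fun y => f (csL k (t, y))) := by
    rw [integral_slice i3]; simp only [csL_zero, integral_const_mul]
    simp only [TV, fun t y => (slice_hasFDerivAt h.diff t y).fderiv]
  rw [← e2, ← e3, TV]
  have : ∫ x, deriv τ (x 0) * f x = ∫ x, -(τ (x 0) * fderiv ℝ f x (e0 k)) := by
    rw [integral_neg, e1]; simp
  have i4 : Integrable (fun x : Es k => -(τ (x 0) * fderiv ℝ f x (e0 k))) := i1.neg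
  rw [this, ← integral_add i4 i3]
  apply integral_mono (i4.add i3) h.tvint
  intro x
  have := calib (fderiv ℝ f x) (τ (x 0)) (hb _)
  simp only [Pi.add_apply]
  linarith

theorem vB_anti {x z : ℝ} (h : |x| ≤ |z|) : vB k z ≤ vB k x := by
  unfold vB
  have : x^2 ≤ z^2 := sq_le_sq.2 h
  have h2 : √(1 - z^2) ≤ √(1 - x^2) := Real.sqrt_le_sqrt bli
  exact ml (pow_le_pow_left₀ (Real.sqrt_nonneg _) h2 _) (om_pos k).le

theorem vB_half (hk : 1 ≤ k) : ∫ z in (0:ℝ)..1, vB k z = om (k+1) / 2 := by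
  have h1 : ∫ z, vB k z = ∫ z in (-1:ℝ)..1, vB k z := by
    rw [intervalIntegral.integral_of_le bnn]
    symm
    apply setIntegral_eq_integral_of_forall_compl_eq_zero
    intro x hx
    apply vB_eq_zero hk
    by_contra h; push Not at h
    exact hx ⟨(abs_lt.1 h).1, (abs_lt.1 h).2.le⟩
  have h2 : ∫ z in (-1:ℝ)..0, vB k z = ∫ z in (0:ℝ)..1, vB k z := by
    have := intervalIntegral.integral_comp_neg (fun x => vB k x) (a := 0) (b := 1)
    simp only [vB_even, neg_zero] at this
    exact this.symm
  have h3 := intervalIntegral.integral_add_adjacent_intervals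
    ((vB_cont k).intervalIntegrable (μ := volume) (-1:ℝ) 0) ((vB_cont k).intervalIntegrable 0 1)
  rw [om_succ hk, h1, ← h3, h2]; ring

theorem Iic_hasDerivAt {c : ℝ → ℝ} (hc : Continuous c) (hi : Integrable c) (t : ℝ) :
    HasDerivAt (fun t => ∫ s in Iic t, c s) (c t) t := by
  have : (fun t => ∫ s in Iic t, c s) = fun t => (∫ s in Iic (0:ℝ), c s) + ∫ s in (0:ℝ)..t, c s := by
    ext t
    rw [← intervalIntegral.integral_Iic_sub_Iic hi.integrableOn hi.integrableOn]; ring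
  rw [this]
  exact (intervalIntegral.integral_hasDerivAt_right (hc.intervalIntegrable _ _)
    hc.aestronglyMeasurable.stronglyMeasurableAtFilter hc.continuousAt).const_add _

theorem Iic_bounds {c : ℝ → ℝ} (h0 : ∀ t, 0 ≤ c t) (hi : Integrable c) (t : ℝ) :
    0 ≤ ∫ s in Iic t, c s ∧ ∫ s in Iic t, c s ≤ ∫ s, c s :=
  ⟨integral_nonneg h0, setIntegral_le_integral hi (evf h0)⟩

theorem tau_exists (hk : 1 ≤ k) {c : ℝ → ℝ} (hc : Continuous c) (hi : Integrable c)
    (h0 : ∀ t, 0 ≤ c t) {l : ℝ} (hl : 0 < l) (hlc : l * ∫ t, c t < om (k+1)) :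
    ∃ τ : ℝ → ℝ, ContDiff ℝ 1 τ ∧ (∀ t, |τ t| < 1) ∧ (∀ t, deriv τ t * vB k (τ t) = l * c t) ∧
      ∀ t, ∫ z in (0:ℝ)..(τ t), vB k z = l * (∫ s in Iic t, c s) - l * (∫ s, c s) / 2 := by
  set C := ∫ t, c t
  have hC : 0 ≤ C := integral_nonneg h0
  have hV1c : Continuous fun z => ∫ x in (0:ℝ)..z, vB k x :=
    intervalIntegral.continuous_primitive (fun a b => (vB_cont k).intervalIntegrable a b) 0
  obtain ⟨z1, hz1, hz10, hz11⟩ : ∃ z1 : ℝ, l * C / 2 < ∫ x in (0:ℝ)..z1, vB k x ∧ 0 < z1 ∧ z1 < 1 := by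
    have h1 : ∀ᶠ z in nhds (1:ℝ), l * C / 2 < ∫ x in (0:ℝ)..z, vB k x := by
      apply hV1c.continuousAt.eventually_const_lt
      change l * C / 2 < ∫ x in (0:ℝ)..1, vB k x
      rw [vB_half hk]; linarith
    have h2 : ∀ᶠ z in nhdsWithin (1:ℝ) (Iio 1), l * C / 2 < ∫ x in (0:ℝ)..z, vB k x :=
      h1.filter_mono nhdsWithin_le_nhds
    have h3 : ∀ᶠ z in nhdsWithin (1:ℝ) (Iio 1), 0 < z :=
      (eventually_gt_nhds one_pos).filter_mono nhdsWithin_le_nhds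
    obtain ⟨z, h4, h5, h6⟩ := (h2.and (h3.and self_mem_nhdsWithin)).exists
    exact ⟨z, h4, h5, h6⟩
  set v : ℝ → ℝ := fun x => vB k (max (-z1) (min z1 x)) with hv
  have hvc : Continuous v := (vB_cont k).comp bfp
  set m := vB k z1
  have hm : 0 < m := vB_pos (by rw [abs_of_pos hz10]; exact hz11)
  have hvm : ∀ x, m ≤ v x := by
    intro x
    apply vB_anti
    rw [abs_of_pos hz10, abs_le]
    exact ⟨le_max_left _ _, max_le bli (min_le_left _ _)⟩
  set V : ℝ → ℝ := fun z => ∫ x in (0:ℝ)..z, v x with hV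
  have hVd : ∀ z, HasDerivAt V (v z) z := fun z =>
    intervalIntegral.integral_hasDerivAt_right (hvc.intervalIntegrable _ _)
      hvc.aestronglyMeasurable.stronglyMeasurableAtFilter hvc.continuousAt
  have hVm : StrictMono V := strictMono_of_hasDerivAt_pos hVd (fun z => hm.trans_le (hvm z))
  have hVcont : Continuous V := continuous_iff_continuousAt.2 fun z => (hVd z).continuousAt
  have hsub : ∀ a b, a ≤ b → m * (b - a) ≤ V b - V a := by
    intro a b hab
    rw [hV]; simp only
    rw [intervalIntegral.integral_interval_sub_left (hvc.intervalIntegrable _ _) (hvc.intervalIntegrable _ _)]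
    have := intervalIntegral.integral_mono_on hab (intervalIntegrable_const (c := m) (μ := volume))
      (hvc.intervalIntegrable a b) (fun x _ => hvm x)
    simp at this; linarith
  have hV0 : V 0 = 0 := by simp [hV]
  have hsurj : Function.Surjective V := by
    apply hVcont.surjective
    · apply Filter.tendsto_atTop_mono' _ _ ((Filter.tendsto_id).const_mul_atTop hm)
      filter_upwards [Filter.eventually_ge_atTop 0] with b hb
      have := hsub 0 b hb; simp [hV0] at this ⊢; linarith
    · apply Filter.tendsto_atBot_mono' _ _ ((Filter.tendsto_id).const_mul_atBot hm)
      filter_upwards [Filter.eventually_le_atBot 0] with b hb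
      have := hsub b 0 hb; simp [hV0] at this ⊢; linarith
  set e := hVm.orderIsoOfSurjective V hsurj
  have he : ∀ x, V (e.symm x) = x := fun x => e.apply_symm_apply x
  have hsd : ∀ x, HasDerivAt e.symm (v (e.symm x))⁻¹ x := fun x =>
    HasDerivAt.of_local_left_inverse e.symm.continuous.continuousAt (hVd _)
      (hm.trans_le (hvm _)).ne' (evf he)
  set S : ℝ → ℝ := fun t => l * (∫ s in Iic t, c s) - l * C / 2 with hS
  have hSd : ∀ t, HasDerivAt S (l * c t) t := fun t => ((Iic_hasDerivAt hc hi t).const_mul l).sub_const _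
  set τ : ℝ → ℝ := fun t => e.symm (S t) with hτ
  have hτd : ∀ t, HasDerivAt τ ((v (τ t))⁻¹ * (l * c t)) t := fun t => (hsd _).comp t (hSd t)
  have hτc : Continuous τ := continuous_iff_continuousAt.2 fun t => (hτd t).continuousAt
  have hVeq : ∀ z, |z| ≤ z1 → ∀ x ∈ uIcc 0 z, v x = vB k x := by
    intro z hz x hx
    have h1 := abs_le.1 hz
    have h2 : -z1 ≤ x ∧ x ≤ z1 := by
      rcases le_total 0 z with h | h
      · rw [uIcc_of_le h] at hx; exact ⟨by linarith [hx.1], by linarith [hx.2]⟩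
      · rw [uIcc_of_ge h] at hx; exact ⟨by linarith [hx.1], by linarith [hx.2]⟩
    simp only [hv]
    rw [min_eq_right h2.2, max_eq_right h2.1]
  have hVeq2 : ∀ z, |z| ≤ z1 → V z = ∫ x in (0:ℝ)..z, vB k x := fun z hz =>
    intervalIntegral.integral_congr (hVeq z hz)
  have hVz1 : l * C / 2 < V z1 := by rw [hVeq2 z1 (by rw [abs_of_pos hz10])]; exact hz1
  have hVz1' : V (-z1) < - (l * C / 2) := by
    rw [hVeq2 (-z1) (by rw [abs_neg, abs_of_pos hz10])]
    have := intervalIntegral.integral_comp_neg (fun x => vB k x) (a := 0) (b := z1)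
    simp only [vB_even, neg_zero] at this
    rw [intervalIntegral.integral_symm, ← this]; linarith
  have hτb : ∀ t, |τ t| < z1 := by
    intro t
    obtain ⟨b1, b2⟩ := Iic_bounds h0 hi t
    have hb1 := mul_nonneg hl.le b1
    have hb2 := ml b2 hl.le
    rw [abs_lt]
    constructor
    · rw [← hVm.lt_iff_lt, he]; simp only [hS]; linarith
    · rw [← hVm.lt_iff_lt, he]; simp only [hS]; linarith
  have hvτ : ∀ t, v (τ t) = vB k (τ t) := fun t => hVeq (τ t) (hτb t).le _ right_mem_uIcc
  refine ⟨τ, ?_, fun t => (hτb t).trans hz11, fun t => ?_, fun t => ?_⟩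
  · rw [contDiff_one_iff_deriv]
    refine ⟨fun t => (hτd t).differentiableAt, ?_⟩
    have : deriv τ = fun t => (v (τ t))⁻¹ * (l * c t) := funext fun t => (hτd t).deriv
    rw [this]
    exact ((hvc.comp hτc).inv₀ (fun t => (hm.trans_le (hvm _)).ne')).mul (continuous_const.mul hc)
  · rw [(hτd t).deriv, ← hvτ]
    field_simp [(hm.trans_le (hvm (τ t))).ne']
  · rw [← hVeq2 _ (hτb t).le]; exact he _

def Sob (k : ℕ) : Prop := ∀ f : Eu k → ℝ, Adm f →
  k * om k ^ (1/(k:ℝ)) * ∫ x, f x ^ (1 + 1/(k:ℝ)) ≤ (∫ x, f x) ^ (1/(k:ℝ)) * TV f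

noncomputable def aS (f : Es k → ℝ) (t : ℝ) : ℝ := ∫ y, f (csL k (t, y))
noncomputable def cS (f : Es k → ℝ) (t : ℝ) : ℝ := ∫ y, f (csL k (t, y)) ^ (1 + 1/(k:ℝ))
noncomputable def bS (f : Es k → ℝ) (t : ℝ) : ℝ := cS f t / aS f t ^ (1/(k:ℝ))

theorem rpow_cont_hcs {f : Eu k → ℝ} (h : Adm f) {p : ℝ} (hp : 0 < p) :
    Continuous (fun x => f x ^ p) ∧ HasCompactSupport (fun x => f x ^ p) := by
  refine ⟨h.cont.rpow_const (fun x => Or.inr hp.le), h.cs.mono (fun x hx => ?_)⟩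
  contrapose! hx; simp at hx; simp [hx, Real.zero_rpow hp.ne']

theorem rpow_int {f : Eu k → ℝ} (h : Adm f) {p : ℝ} (hp : 0 < p) :
    Integrable (fun x => f x ^ p) :=
  (rpow_cont_hcs h hp).1.integrable_of_hasCompactSupport (rpow_cont_hcs h hp).2

section
variable {f : Es k → ℝ}

theorem p_pos (k : ℕ) : 0 < 1 + 1/(k:ℝ) := by positivity

theorem aS_cont (h : Adm f) : Continuous (aS f) := sliceInt_cont h.cont h.cs
theorem aS_hcs (h : Adm f) : HasCompactSupport (aS f) := sliceInt_hcs h.cs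
theorem aS_int (h : Adm f) : Integrable (aS f) := (aS_cont h).integrable_of_hasCompactSupport (aS_hcs h)
theorem aS_nn (h : Adm f) (t : ℝ) : 0 ≤ aS f t := integral_nonneg fun _ => h.nn _
theorem cS_cont (h : Adm f) : Continuous (cS f) :=
  sliceInt_cont (rpow_cont_hcs h (p_pos k)).1 (rpow_cont_hcs h (p_pos k)).2
theorem cS_hcs (h : Adm f) : HasCompactSupport (cS f) :=
  sliceInt_hcs (G := fun x => f x ^ (1 + 1/(k:ℝ))) (rpow_cont_hcs h (p_pos k)).2
theorem cS_int (h : Adm f) : Integrable (cS f) := (cS_cont h).integrable_of_hasCompactSupport (cS_hcs h)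
theorem cS_nn (h : Adm f) (t : ℝ) : 0 ≤ cS f t :=
  integral_nonneg fun _ => Real.rpow_nonneg (h.nn _) _
theorem cS_le (h : Adm f) (t : ℝ) : cS f t ≤ aS f t := by
  apply integral_mono (rpow_int (h.slice t) (p_pos k)) (h.slice t).integrable
  intro y
  apply Real.rpow_le_self_of_le_one (h.nn _) (h.le _)
  have : 0 ≤ 1/(k:ℝ) := by positivity
  linarith
theorem aS_integral (h : Adm f) : ∫ t, aS f t = ∫ x, f x := (integral_slice h.integrable).symm
theorem cS_integral (h : Adm f) : ∫ t, cS f t = ∫ x, f x ^ (1 + 1/(k:ℝ)) :=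
  (integral_slice (rpow_int h (p_pos k))).symm
theorem bS_nn (h : Adm f) (t : ℝ) : 0 ≤ bS f t := div_nonneg (cS_nn h t) (Real.rpow_nonneg (aS_nn h t) _)

theorem sliceTV_eq (h : Adm f) : (fun t => TV (fun y => f (csL k (t, y)))) =
    fun t => ∫ y, ‖(fderiv ℝ f (csL k (t, y))).comp (csi k)‖ := by
  ext t; simp only [TV, fun t y => (slice_hasFDerivAt h.diff t y).fderiv]

theorem sliceTV_cont_hcs (h : Adm f) : Continuous (fun t => TV (fun y => f (csL k (t, y)))) ∧
    HasCompactSupport (fun t => TV (fun y => f (csL k (t, y)))) := by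
  rw [sliceTV_eq h]
  have h1 : Continuous fun x : Es k => ‖(fderiv ℝ f x).comp (csi k)‖ :=
    (h.fcont.clm_comp continuous_const).norm
  have h2 : HasCompactSupport fun x : Es k => ‖(fderiv ℝ f x).comp (csi k)‖ :=
    h.fcs.mono (fun x hx => by contrapose! hx; simp at hx; simp [hx])
  exact ⟨sliceInt_cont h1 h2, sliceInt_hcs (G := fun x => ‖(fderiv ℝ f x).comp (csi k)‖) h2⟩

theorem bS_le (hk : 1 ≤ k) (hS : Sob k) (h : Adm f) (t : ℝ) :
    k * om k ^ (1/(k:ℝ)) * bS f t ≤ TV (fun y => f (csL k (t, y))) := by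
  rcases (aS_nn h t).eq_or_lt with h0 | h0
  · have : bS f t = 0 := by
      have : 1/(k:ℝ) ≠ 0 := by positivity
      rw [bS, ← h0, Real.zero_rpow this, div_zero]
    rw [this, mul_zero]; exact TV_nonneg _
  · have hp := Real.rpow_pos_of_pos h0 (1/(k:ℝ))
    rw [bS, ← mul_div_assoc, div_le_iff₀ hp, mul_comm (TV _)]
    exact hS _ (h.slice t)

theorem bS_int (hk : 1 ≤ k) (hS : Sob k) (h : Adm f) : Integrable (bS f) := by
  have h1 := (sliceTV_cont_hcs h).1.integrable_of_hasCompactSupport (sliceTV_cont_hcs h).2 (μ := volume)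
  have hu : 0 < k * om k ^ (1/(k:ℝ)) := mul_pos bpo (Real.rpow_pos_of_pos (om_pos k) _)
  refine Integrable.mono' (h1.div_const (k * om k ^ (1/(k:ℝ)))) ?_ (evf fun t => ?_)
  · apply Measurable.aestronglyMeasurable
    exact (cS_cont h).measurable.div ((aS_cont h).measurable.pow_const _)
  · rw [Real.norm_of_nonneg (bS_nn h t), le_div_iff₀ hu, mul_comm]
    exact bS_le hk hS h t

theorem slice_lower (hk : 1 ≤ k) (hS : Sob k) (h : Adm f) {τ : ℝ → ℝ} (hτ : ContDiff ℝ 1 τ)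
    (hb : ∀ t, |τ t| ≤ 1) :
    (∫ t, deriv τ t * aS f t) + k * om k ^ (1/(k:ℝ)) * ∫ t, √(1 - τ t^2) * bS f t ≤ TV f := by
  refine le_trans ?_ (slicing h hτ hb)
  have hs1 : ∀ t, √(1 - τ t^2) ≤ 1 := fun t => by
    rw [Real.sqrt_le_one]; nlinarith [sq_nonneg (τ t)]
  have hsc : Continuous fun t => √(1 - τ t^2) := by have := hτ.continuous; fun_prop
  refine add_le_add le_rfl ?_
  rw [← integral_const_mul]
  apply integral_mono
  · apply Integrable.const_mul
    apply (bS_int hk hS h).bdd_mul (c := 1) hsc.aestronglyMeasurable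
    exact evf fun t => by
      rw [Real.norm_of_nonneg (Real.sqrt_nonneg _)]; exact hs1 t
  · exact (hsc.mul (sliceTV_cont_hcs h).1).integrable_of_hasCompactSupport (sliceTV_cont_hcs h).2.mul_left
  · intro t
    have := ml (bS_le hk hS h t) (Real.sqrt_nonneg (1 - τ t^2))
    simp only; nlinarith
end

theorem Sob_one : Sob 1 := by
  intro f h
  have hmp : MeasurePreserving (fun t : ℝ => (WithLp.toLp 2 (fun _ : Fin 1 => t) : Eu 1)) volume volume := by
    have h1 := PiLp.volume_preserving_toLp (Fin 1)
    have h2 := (volume_preserving_funUnique (Fin 1) ℝ).symm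
    exact h1.comp h2
  have hlin : ∀ t : ℝ, (WithLp.toLp 2 (fun _ : Fin 1 => t) : Eu 1) = t • WithLp.toLp 2 (fun _ : Fin 1 => (1:ℝ)) := by
    intro t; ext i; simp
  set e : Eu 1 := WithLp.toLp 2 (fun _ : Fin 1 => (1:ℝ)) with he
  have hne : ‖e‖ = 1 := by rw [EuclideanSpace.norm_eq]; simp [he]
  simp only [hlin] at hmp
  have hme : MeasurableEmbedding (fun t : ℝ => t • e) := by
    apply Continuous.measurableEmbedding bfp
    intro a b hab
    have := congrArg (fun x : Eu 1 => x 0) hab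
    simpa [he] using this
  have hsurj : ∀ x : Eu 1, ∃ t : ℝ, t • e = x := by
    intro x; refine ⟨x 0, ?_⟩; ext i; rw [Subsingleton.elim i 0]; simp [he]
  have hψ : ContDiff ℝ 1 fun t : ℝ => f (t • e) := h.cd.comp bfp
  have hψc : HasCompactSupport fun t : ℝ => f (t • e) := by
    obtain ⟨R, hR⟩ := h.cs.isCompact.isBounded.subset_closedBall 0
    refine HasCompactSupport.intro (isCompact_closedBall (0:ℝ) R) (fun t ht => ?_)
    by_contra hh
    have h1 := hR (subset_tsupport _ hh)
    rw [mem_closedBall_zero_iff] at h1 ht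
    rw [norm_smul, hne, mul_one] at h1; exact ht h1
  have hd : ∀ t : ℝ, deriv (fun t : ℝ => f (t • e)) t = fderiv ℝ f (t • e) e := by
    intro t
    have h1 : HasDerivAt (fun t : ℝ => t • e) e t := by
      simpa using (hasDerivAt_id t).smul_const e
    exact ((h.diff _).hasFDerivAt.comp_hasDerivAt t h1).deriv
  have hi' : Integrable (deriv fun t : ℝ => f (t • e)) :=
    (hψ.continuous_deriv le_rfl).integrable_of_hasCompactSupport hψc.deriv
  have hTV : ∫ t, |deriv (fun t : ℝ => f (t • e)) t| ≤ TV f := by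
    rw [TV, ← hmp.integral_comp hme]
    apply integral_mono hi'.abs
    · exact (hmp.integrable_comp_emb hme).2 h.tvint
    · intro t
      simp only [hd]
      have := (fderiv ℝ f (t • e)).le_opNorm e
      rwa [hne, mul_one] at this
  have key : ∀ x, 2 * f x ≤ TV f := by
    intro x
    obtain ⟨t, rfl⟩ := hsurj x
    have h1 := hψc.integral_Iic_deriv_eq hψ t
    have h2 := hψc.integral_Ioi_deriv_eq hψ t
    have h3 : ∫ s in Iic t, deriv (fun t : ℝ => f (t • e)) s ≤ ∫ s in Iic t, |deriv (fun t : ℝ => f (t • e)) s| :=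
      integral_mono hi'.integrableOn hi'.abs.integrableOn fun s => le_abs_self _
    have h4 : ∫ s in Ioi t, -deriv (fun t : ℝ => f (t • e)) s ≤ ∫ s in Ioi t, |deriv (fun t : ℝ => f (t • e)) s| :=
      integral_mono hi'.neg.integrableOn hi'.abs.integrableOn fun s => neg_le_abs _
    have h5 := setIntegral_union (μ := volume) (Iic_disjoint_Ioi le_rfl : Disjoint (Iic t) (Ioi t)) measurableSet_Ioi
      hi'.abs.integrableOn hi'.abs.integrableOn
    rw [Iic_union_Ioi, Measure.restrict_univ] at h5
    rw [integral_neg] at h4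
    linarith
  rw [om_one]
  norm_num
  rw [← integral_const_mul, ← integral_mul_const]
  apply integral_mono
  · apply Integrable.const_mul
    have := rpow_int h (p := 2) bnn
    simpa using this
  · exact h.integrable.mul_const _
  · intro x
    have := ml (key x) (h.nn x)
    simp only; nlinarith

noncomputable def qS (f : Es k → ℝ) (τ : ℝ → ℝ) (t : ℝ) : ℝ :=
  if aS f t = 0 then 1 else om k ^ (1/(k:ℝ)) * √(1 - τ t^2) / aS f t ^ (1/(k:ℝ))

section
variable {f : Es k → ℝ} {τ : ℝ → ℝ}

theorem sqrt_pos_tau {z : ℝ} (h : |z| < 1) : 0 < √(1 - z^2) := by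
  apply Real.sqrt_pos.2
  have : z^2 < 1 := by rw [← sq_abs]; nlinarith [abs_nonneg z]
  linarith

theorem qS_pos (h : Adm f) (hb : ∀ t, |τ t| < 1) (t : ℝ) : 0 < qS f τ t := by
  unfold qS
  split_ifs with h0
  · exact one_pos
  · have h1 : 0 < aS f t := lt_of_le_of_ne (aS_nn h t) (Ne.symm h0)
    exact div_pos (mul_pos (Real.rpow_pos_of_pos (om_pos k) _) (sqrt_pos_tau (hb t)))
      (Real.rpow_pos_of_pos h1 _)

theorem qS_pow (hk : 1 ≤ k) (h : Adm f) {t : ℝ} (h0 : aS f t ≠ 0) :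
    aS f t * qS f τ t ^ k = vB k (τ t) := by
  have hk0 : k ≠ 0 := by omega
  rw [qS, if_neg h0, div_pow, mul_pow, one_div, Real.rpow_inv_natCast_pow (om_pos k).le hk0,
    Real.rpow_inv_natCast_pow (aS_nn h t) hk0, vB]
  field_simp

theorem cS_zero (h : Adm f) {t : ℝ} (h0 : aS f t = 0) : cS f t = 0 :=
  le_antisymm (h0 ▸ cS_le h t) (cS_nn h t)

theorem bS_eq (hk : 1 ≤ k) (h : Adm f) (t : ℝ) :
    om k ^ (1/(k:ℝ)) * (√(1 - τ t^2) * bS f t) = cS f t * qS f τ t := by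
  by_cases h0 : aS f t = 0
  · rw [cS_zero h h0, bS, cS_zero h h0]; simp
  · rw [qS, if_neg h0, bS]; ring

theorem tau_a {l : ℝ} (hk : 1 ≤ k) (h : Adm f) (hb : ∀ t, |τ t| < 1)
    (hd : ∀ t, deriv τ t * vB k (τ t) = l * cS f t) (t : ℝ) :
    deriv τ t * aS f t = cS f t * (l * (qS f τ t ^ k)⁻¹) := by
  by_cases h0 : aS f t = 0
  · rw [cS_zero h h0, h0]; simp
  · have h1 := qS_pow (τ := τ) hk h h0
    have h2 := hd t
    have h3 := pow_pos (qS_pos h hb t) k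
    rw [← h1] at h2
    field_simp
    linarith

theorem cq_int (hk : 1 ≤ k) (hS : Sob k) (h : Adm f) (hτ : Continuous τ) :
    Integrable fun t => cS f t * qS f τ t := by
  simp only [← bS_eq hk h]
  apply Integrable.const_mul
  apply (bS_int hk hS h).bdd_mul (c := 1) (by fun_prop : Continuous fun t => √(1 - τ t^2)).aestronglyMeasurable
  exact evf fun t => by
    rw [Real.norm_of_nonneg (Real.sqrt_nonneg _), Real.sqrt_le_one]; nlinarith [sq_nonneg (τ t)]

theorem cqk_int {l : ℝ} (hk : 1 ≤ k) (h : Adm f) (hτ : ContDiff ℝ 1 τ) (hb : ∀ t, |τ t| < 1)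
    (hd : ∀ t, deriv τ t * vB k (τ t) = l * cS f t) :
    Integrable fun t => cS f t * (l * (qS f τ t ^ k)⁻¹) := by
  simp only [← tau_a hk h hb hd]
  exact ((hτ.continuous_deriv le_rfl).mul (aS_cont h)).integrable_of_hasCompactSupport (aS_hcs h).mul_left

theorem TV_ge {l : ℝ} (hk : 1 ≤ k) (hS : Sob k) (h : Adm f) (hτ : ContDiff ℝ 1 τ) (hb : ∀ t, |τ t| < 1)
    (hd : ∀ t, deriv τ t * vB k (τ t) = l * cS f t) :
    ∫ t, cS f t * (l * (qS f τ t ^ k)⁻¹ + k * qS f τ t) ≤ TV f := by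
  have h1 := slice_lower hk hS h hτ (fun t => (hb t).le)
  simp only [tau_a hk h hb hd] at h1
  have h2 : ∫ t, cS f t * (l * (qS f τ t ^ k)⁻¹ + k * qS f τ t) =
      (∫ t, cS f t * (l * (qS f τ t ^ k)⁻¹)) + k * ∫ t, cS f t * qS f τ t := by
    rw [← integral_const_mul, ← integral_add (cqk_int hk h hτ hb hd) ((cq_int hk hS h hτ.continuous).const_mul _)]
    congr 1; ext t; ring
  rw [h2]
  have h3 : (k:ℝ) * om k ^ (1/(k:ℝ)) * ∫ t, √(1 - τ t^2) * bS f t = k * ∫ t, cS f t * qS f τ t := by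
    rw [mul_assoc, ← integral_const_mul]; simp only [bS_eq hk h]
  rw [h3] at h1; exact h1

theorem amgm {l q : ℝ} (hl : 0 < l) (hq : 0 < q) :
    (k+1) * l ^ (1/((k:ℝ)+1)) ≤ l * (q^k)⁻¹ + k * q := by
  have hk1 : (0:ℝ) < k + 1 := by positivity
  have h := Real.geom_mean_le_arith_mean2_weighted (w₁ := 1/((k:ℝ)+1)) (w₂ := k/((k:ℝ)+1))
    (p₁ := l * (q^k)⁻¹) (p₂ := q) bpo bpo bpo hq.le (by field_simp; ring)
  have e1 : (l * (q^k)⁻¹) ^ (1/((k:ℝ)+1)) * q ^ (k/((k:ℝ)+1)) = l ^ (1/((k:ℝ)+1)) := by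
    rw [Real.mul_rpow hl.le bpo, ← Real.rpow_natCast q k, ← Real.rpow_neg hq.le,
      ← Real.rpow_mul hq.le, mul_assoc, ← Real.rpow_add hq]
    have : -(k:ℝ) * (1/((k:ℝ)+1)) + k/((k:ℝ)+1) = 0 := by ring
    rw [this]; simp
  rw [e1] at h
  have h2 := ml h hk1.le
  calc _ ≤ _ := h2
    _ = _ := by field_simp

theorem TV_ge_l {l : ℝ} (hk : 1 ≤ k) (hS : Sob k) (h : Adm f) (hl : 0 < l)
    (hlc : l * ∫ t, cS f t < om (k+1)) : (k+1) * l ^ (1/((k:ℝ)+1)) * ∫ t, cS f t ≤ TV f := by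
  obtain ⟨τ, hτ, hb, hd, -⟩ := tau_exists hk (cS_cont h) (cS_int h) (cS_nn h) hl hlc
  refine le_trans ?_ (TV_ge hk hS h hτ hb hd)
  rw [← integral_const_mul]
  apply integral_mono ((cS_int h).const_mul _)
  · have := (cqk_int hk h hτ hb hd).add ((cq_int hk hS h hτ.continuous).const_mul (k:ℝ))
    refine this.congr (evf fun t => ?_)
    simp only [Pi.add_apply]; ring
  · intro t
    have := ml (amgm (k := k) hl (qS_pos h hb t)) (cS_nn h t)
    simp only; linarith

theorem TV_ge_C (hk : 1 ≤ k) (hS : Sob k) (h : Adm f) (hC : 0 < ∫ t, cS f t) :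
    (k+1) * (om (k+1) / ∫ t, cS f t) ^ (1/((k:ℝ)+1)) * ∫ t, cS f t ≤ TV f := by
  set C := ∫ t, cS f t
  have hL : 0 < om (k+1) / C := div_pos (om_pos _) hC
  have hcont : ContinuousAt (fun l : ℝ => (k+1) * l ^ (1/((k:ℝ)+1)) * C) (om (k+1) / C) := by
    apply ContinuousAt.mul _ continuousAt_const
    apply ContinuousAt.mul continuousAt_const
    exact Real.continuousAt_rpow_const _ _ (Or.inl hL.ne')
  refine le_of_tendsto (hcont.tendsto.mono_left (nhdsWithin_le_nhds (s := Iio (om (k+1) / C)))) ?_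
  filter_upwards [self_mem_nhdsWithin, (eventually_gt_nhds hL).filter_mono nhdsWithin_le_nhds] with l h1 h2
  refine TV_ge_l hk hS h h2 ?_
  rw [mem_Iio, lt_div_iff₀ hC] at h1
  exact h1
end

theorem Sob_succ (hk : 1 ≤ k) (hS : Sob k) : Sob (k+1) := by
  intro f h
  set C := ∫ t, cS f t with hCdef
  have hk0 : (0:ℝ) < k := by positivity
  have hn0 : (0:ℝ) < k + 1 := by positivity
  have hCn : 0 ≤ C := integral_nonneg (cS_nn h)
  have hF : 0 ≤ ∫ x, f x := integral_nonneg h.nn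
  -- Hölder
  have hold : ∫ x, f x ^ (1 + 1/((k:ℝ)+1)) ≤ (∫ x, f x) ^ (1/((k:ℝ)+1)) * C ^ ((k:ℝ)/(k+1)) := by
    have hpq : Real.HolderConjugate ((k:ℝ)+1) (((k:ℝ)+1)/k) := by
      rw [Real.holderConjugate_iff]; constructor
      · linarith
      · field_simp; ring
    have hm : ∀ (p r : ℝ), 0 < p → 0 < r → MemLp (fun x => f x ^ p) (ENNReal.ofReal r) := by
      intro p r hp _
      exact (rpow_cont_hcs h hp).1.memLp_of_hasCompactSupport (rpow_cont_hcs h hp).2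
    have := integral_mul_le_Lp_mul_Lq_of_nonneg hpq (μ := (volume : Measure (Es k)))
      (f := fun x => f x ^ (1/((k:ℝ)+1))) (g := fun x => f x ^ (1:ℝ))
      (evf fun x => Real.rpow_nonneg (h.nn x) _)
      (evf fun x => Real.rpow_nonneg (h.nn x) _)
      (hm _ _ bpo bpo) (hm _ _ bpo bpo)
    have e1 : ∀ x, f x ^ (1/((k:ℝ)+1)) * f x ^ (1:ℝ) = f x ^ (1 + 1/((k:ℝ)+1)) := by
      intro x
      rw [← Real.rpow_add_of_nonneg (h.nn x) bpo bpo, add_comm]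
    have e2 : ∀ x, (f x ^ (1/((k:ℝ)+1))) ^ ((k:ℝ)+1) = f x := by
      intro x; rw [← Real.rpow_mul (h.nn x)]; field_simp; simp
    have e3 : ∀ x, (f x ^ (1:ℝ)) ^ (((k:ℝ)+1)/k) = f x ^ (1 + 1/(k:ℝ)) := by
      intro x; rw [Real.rpow_one]; congr 1; field_simp
    simp only [e1, e2, e3] at this
    rw [hCdef, cS_integral h]
    convert this using 2
    · field_simp
  push_cast
  rcases hCn.eq_or_lt with hC | hC
  · have h0 : ∫ x, f x ^ (1 + 1/((k:ℝ)+1)) ≤ 0 := by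
      rw [← hC, Real.zero_rpow bpo, mul_zero] at hold; exact hold
    have h1 : 0 ≤ (∫ x, f x) ^ (1/((k:ℝ)+1)) * TV f := mul_nonneg (Real.rpow_nonneg hF _) (TV_nonneg f)
    have h2 : 0 ≤ ((k:ℝ)+1) * om (k+1) ^ (1/((k:ℝ)+1)) := mul_nonneg hn0.le (Real.rpow_nonneg (om_pos _).le _)
    nlinarith
  · have h1 := TV_ge_C hk hS h hC
    have h2 : (om (k+1) / C) ^ (1/((k:ℝ)+1)) * C = om (k+1) ^ (1/((k:ℝ)+1)) * C ^ ((k:ℝ)/(k+1)) := by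
      rw [Real.div_rpow (om_pos _).le hC.le, div_mul_eq_mul_div, mul_div_assoc]
      congr 1
      rw [div_eq_iff (Real.rpow_pos_of_pos hC _).ne', ← Real.rpow_add hC]
      have : (k:ℝ)/(k+1) + 1/(k+1) = 1 := by field_simp
      rw [this, Real.rpow_one]
    have hp : 0 ≤ om (k+1) ^ (1/((k:ℝ)+1)) := Real.rpow_nonneg (om_pos _).le _
    have hp2 : 0 ≤ (∫ x, f x) ^ (1/((k:ℝ)+1)) := Real.rpow_nonneg hF _
    have h3 : ((k:ℝ)+1) * (om (k+1) ^ (1/((k:ℝ)+1)) * C ^ ((k:ℝ)/(k+1))) ≤ TV f := by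
      rw [← h2]; convert h1 using 1; ring
    calc ((k:ℝ)+1) * om (k+1) ^ (1/((k:ℝ)+1)) * ∫ x, f x ^ (1 + 1/((k:ℝ)+1))
        ≤ ((k:ℝ)+1) * om (k+1) ^ (1/((k:ℝ)+1)) * ((∫ x, f x) ^ (1/((k:ℝ)+1)) * C ^ ((k:ℝ)/(k+1))) :=
          ml hold (mul_nonneg hn0.le hp)
      _ = (∫ x, f x) ^ (1/((k:ℝ)+1)) * (((k:ℝ)+1) * (om (k+1) ^ (1/((k:ℝ)+1)) * C ^ ((k:ℝ)/(k+1)))) := by ring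
      _ ≤ _ := ml h3 hp2

theorem Sob_all (hk : 1 ≤ k) : Sob k := by
  induction k, hk using Nat.le_induction with
  | base => exact Sob_one
  | succ k hk ih => exact Sob_succ hk ih

noncomputable def K2 (k : ℕ) : ℝ := (k+2) + 2*((k:ℝ)+2)^2*(2+4*((k:ℝ)+2)^2)
noncomputable def ep (k : ℕ) : ℝ := (24*((k:ℝ)+2)*K2 k)⁻¹

theorem K2_ge (k : ℕ) : 1 ≤ K2 k := by
  unfold K2
  have : (0:ℝ) ≤ k := by positivity
  have : 0 ≤ 2*((k:ℝ)+2)^2*(2+4*((k:ℝ)+2)^2) := by positivity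
  linarith

theorem ep_pos (k : ℕ) : 0 < ep k := by
  have := K2_ge k
  unfold ep; positivity

theorem ep_le (k : ℕ) : 24 * k * ep k ≤ 1 ∧ ep k ≤ 1/8 ∧ K2 k * ep k ≤ 1/2 := by
  have h1 := K2_ge k
  have hk : (0:ℝ) ≤ k := by positivity
  have hpos : 0 < 24*((k:ℝ)+2)*K2 k := by positivity
  have h2 : ((k:ℝ)+2) * K2 k * ep k = 1/24 := by unfold ep; field_simp
  have h3 := ep_pos k
  have h4 : (k:ℝ) * ep k ≤ (k:ℝ) * (K2 k * ep k) :=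
    ml (by nlinarith) hk
  have h5 : 0 ≤ K2 k * ep k := by positivity
  have h6 : 0 ≤ (k:ℝ) * (K2 k * ep k) := by positivity
  refine ⟨by nlinarith, by nlinarith, by nlinarith⟩

theorem bern (k : ℕ) {q : ℝ} (hq : 0 < q) : (k:ℝ) * (q-1)^2 ≤ ((q^k)⁻¹ + k*q - (k+1)) * q := by
  have h := one_add_mul_le_pow (a := q⁻¹ - 1) (by have := inv_pos.2 hq; linarith) k
  have h2 : 1 + (q⁻¹ - 1) = q⁻¹ := by ring
  rw [h2, inv_pow] at h
  have h3 := mr h hq.le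
  have h4 : (1 + (k:ℝ) * (q⁻¹ - 1)) * q = q + k * (1 - q) := by field_simp
  rw [h4] at h3
  nlinarith

theorem rg_bound {N h r g : ℝ} (hN : 1 ≤ N) (hh : 0 ≤ h) (hr : r^2 ≤ h * (1+r)) (hg : |g| ≤ 1) :
    |r| * |g| ≤ g^2/(8*N) + (2+4*N)*h := by
  have hN0 : 0 < N := by linarith
  have hg0 := abs_nonneg g
  have hr0 := abs_nonneg r
  have h8 : 0 ≤ g^2/(8*N) := by positivity
  rcases le_total r 1 with h1 | h1
  · have h2 : r^2 ≤ 2*h := by nlinarith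
    have h3 : |r| * |g| ≤ g^2/(8*N) + 2*N*r^2 := by
      rw [← sq_abs g, ← sq_abs r, div_add' _ _ _ bpo, le_div_iff₀ bpo]
      nlinarith [sq_nonneg (|g| - 4*N*|r|)]
    nlinarith
  · have h2 : r ≤ 2*h := by nlinarith
    rw [abs_of_nonneg (by linarith : (0:ℝ) ≤ r)]
    have : r*|g| ≤ r := mul_le_of_le_one_right bli hg
    have : 0 ≤ N*h := by positivity
    linarith

set_option maxHeartbeats 1000000 in
theorem ptw (hk : 1 ≤ k) {l q g ξ y τ σ : ℝ} (hq : 0 < q) (hl0 : 0 ≤ l) (hl1 : l ≤ 1) (hg : |g| ≤ 1)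
    (hξ : |ξ| ≤ 1) (hy : |y| ≤ 1) (hτ : |τ| ≤ 1) (hσ0 : 0 ≤ σ) (hσ1 : σ ≤ 1) :
    (3/4)*g^2 - ξ^2/64 - K2 k * ((q^k)⁻¹ + k*q - (k+1)) - (k+2)*(1-l) ≤
    (l*(q^k)⁻¹)*g^2 + k*τ*y*g*(l*(q^k)⁻¹ - q) + ξ*σ*(1 - l*(q^k)⁻¹) - 3*k*ep k*q*y^2*g^2 := by
  have hk1 : (1:ℝ) ≤ k := by exact_mod_cast hk
  have hb := bern k hq
  set h := (q^k)⁻¹ + k*q - (k+1) with hh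
  set r := q - 1 with hr
  have hh0 : 0 ≤ h := by
    have : 0 ≤ h * q := le_trans bpo hb
    exact nonneg_of_mul_nonneg_left this hq
  have hx : l*(q^k)⁻¹ - 1 = l*h - l*k*r - (1-l) := by rw [hh, hr]; ring
  have hqr : q = 1 + r := by rw [hr]; ring
  have hr2 : r^2 ≤ h*(1+r) := by rw [← hqr]; exact le_trans (le_mul_of_one_le_left (sq_nonneg r) hk1) hb
  set X := l*(q^k)⁻¹ - 1 with hX
  have hxX : l*(q^k)⁻¹ = 1 + X := by rw [hX]; ring
  have hXb : |X| ≤ h + k*|r| + (1-l) := by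
    rw [hx]
    have e1 : |l*h| ≤ h := by rw [abs_of_nonneg bpo]; exact mul_le_of_le_one_left hh0 hl1
    have e2 : |l*k*r| ≤ k*|r| := by
      rw [abs_mul, abs_of_nonneg bpo]
      rw [mul_assoc]; exact mul_le_of_le_one_left bpo hl1
    have e3 : |1-l| = 1-l := abs_of_nonneg bli
    calc |l*h - l*k*r - (1-l)| ≤ |l*h - l*k*r| + |1-l| := abs_sub _ _
      _ ≤ |l*h| + |l*k*r| + |1-l| := by gcongr; exact abs_sub _ _
      _ ≤ _ := by rw [e3]; linarith
  rw [hxX]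
  set N := ((k:ℝ)+2)^2 with hN
  have hN1 : 1 ≤ N := by rw [hN]; linarith [sq_nonneg (k:ℝ)]
  have B1 := rg_bound hN1 hh0 hr2 hg
  have B2 := rg_bound hN1 hh0 hr2 hξ
  have hr0 := abs_nonneg r
  have hg0 := abs_nonneg g
  have hX0 := abs_nonneg X
  have T1 : -(|X| * |g|) ≤ X*g^2 := by
    have : |X*g^2| ≤ |X| * |g| := by
      rw [abs_mul, abs_pow]
      exact ml (by rw [sq]; exact mul_le_of_le_one_left hg0 hg) hX0
    linarith [neg_abs_le (X*g^2)]
  have T2 : -(k*(|X|+|r|)*|g|) ≤ k*τ*y*g*(1+X-q) := by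
    have : |k*τ*y*g*(1+X-q)| ≤ k*(|X|+|r|)*|g| := by
      have e : 1+X-q = X - r := by rw [hqr]; ring
      rw [e, abs_mul, abs_mul, abs_mul, abs_mul, Nat.abs_cast]
      have e1 : |X - r| ≤ |X|+|r| := abs_sub _ _
      have e2 : |τ| * |y| ≤ 1 := mul_le_one₀ hτ (abs_nonneg y) hy
      calc (k:ℝ)*|τ| * |y| * |g| * |X-r| = (k*|g| * |X-r|)*(|τ| * |y|) := by ring
        _ ≤ (k*|g| * |X-r|)*1 := by gcongr
        _ ≤ k*|g| *(|X|+|r|) := by rw [mul_one]; gcongr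
        _ = _ := by ring
    linarith [neg_abs_le (k*τ*y*g*(1+X-q))]
  have T3 : -(|X| * |ξ|) ≤ ξ*σ*(1-(1+X)) := by
    have : |ξ*σ*(1-(1+X))| ≤ |X| * |ξ| := by
      have e : 1-(1+X) = -X := by ring
      rw [e, abs_mul, abs_mul, abs_neg, abs_of_nonneg hσ0]
      calc |ξ| *σ*|X| = (|ξ| * |X|)*σ := by ring
        _ ≤ (|ξ| * |X|)*1 := by gcongr
        _ = _ := by ring
    linarith [neg_abs_le (ξ*σ*(1-(1+X)))]
  have T4 : 3*k*ep k*q*y^2*g^2 ≤ g^2/8 + |r| * |g|/8 := by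
    have h1 := (ep_le k).1
    have h2 := ep_pos k
    have hy2 : y^2 ≤ 1 := (sq_le_one_iff_abs_le_one y).2 hy
    have hg2 : g^2 ≤ |g| := by rw [← sq_abs, sq]; exact mul_le_of_le_one_left hg0 hg
    calc 3*k*ep k*q*y^2*g^2 = (3*(k*ep k))*(q*g^2)*y^2 := by ring
      _ ≤ (3*(k*ep k))*(q*g^2)*1 := by gcongr
      _ ≤ (1/8)*(q*g^2) := by
        rw [mul_one]; apply mr _ bpo; linarith
      _ = g^2/8 + r*g^2/8 := by rw [hqr]; ring
      _ ≤ g^2/8 + |r| * |g|/8 := by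
        have : r*g^2 ≤ |r| * |g| := by
          calc r*g^2 ≤ |r| *g^2 := mr (le_abs_self r) (sq_nonneg g)
            _ ≤ |r| * |g| := by gcongr
        linarith
  have X1 : |X| * |g| ≤ h + (1-l) + k*(|r| * |g|) := by
    have := mr hXb hg0
    linarith [ml hg hh0, ml hg (by linarith : 0 ≤ 1-l)]
  have X2 : |X| * |ξ| ≤ h + (1-l) + k*(|r| * |ξ|) := by
    have := mr hXb (abs_nonneg ξ)
    linarith [ml hξ hh0, ml hξ (by linarith : 0 ≤ 1-l)]
  have X3 : k*(|X|+|r|)*|g| ≤ k*(h + (1-l)) + k*(k+1)*(|r| * |g|) := by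
    have := ml X1 (by linarith : (0:ℝ) ≤ k)
    linarith
  have hN8 : 8*(k:ℝ) ≤ N := by rw [hN]; linarith [sq_nonneg ((k:ℝ)-2)]
  have hN2 : (k:ℝ) + k*(k+1) + 1/8 ≤ N := by rw [hN]; linarith [sq_nonneg (k:ℝ)]
  have Y1 : ((k:ℝ) + k*(k+1) + 1/8)*(|r| * |g|) ≤ g^2/8 + N*((2+4*N)*h) := by
    calc ((k:ℝ) + k*(k+1) + 1/8)*(|r| * |g|) ≤ N*(|r| * |g|) := by gcongr
      _ ≤ N*(g^2/(8*N) + (2+4*N)*h) := by gcongr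
      _ = _ := by field_simp
  have Y2 : (k:ℝ)*(|r| * |ξ|) ≤ ξ^2/64 + N*((2+4*N)*h) := by
    calc (k:ℝ)*(|r| * |ξ|) ≤ (N/8)*(|r| * |ξ|) := by gcongr; linarith
      _ ≤ (N/8)*(ξ^2/(8*N) + (2+4*N)*h) := by gcongr
      _ = ξ^2/64 + (N/8)*((2+4*N)*h) := by field_simp; ring
      _ ≤ _ := by
        have : 0 ≤ N*((2+4*N)*h) := by positivity
        linarith
  have hK : K2 k * h = (k+2)*h + 2*(N*((2+4*N)*h)) := by rw [K2, ← hN]; ring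
  rw [hK]
  linarith

theorem sqrt_tilt {τ w : ℝ} (hτ : |τ| ≤ 1) (hw : |w| ≤ 1/8) :
    √(1-τ^2) * (1 - τ*w - 3*w^2) ≤ √(1 - (τ + w*(1-τ^2))^2) ∧ |τ + w*(1-τ^2)| ≤ 1 := by
  have h1 : τ^2 ≤ 1 := by rw [← sq_abs]; nlinarith [abs_nonneg τ]
  set p := 1-τ^2 with hp
  have hp0 : 0 ≤ p := by linarith
  have hp1 : p ≤ 1 := by nlinarith [sq_nonneg τ]
  have e : 1 - (τ + w*p)^2 = p*(1 - (2*τ*w + p*w^2)) := by rw [hp]; ring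
  have hw2' : w^2 ≤ 1/64 := by rw [← sq_abs]; nlinarith [abs_nonneg w]
  have hpw : p*w^2 ≤ w^2 := by nlinarith [sq_nonneg w]
  have hτw : |τ*w| ≤ 1/8 := by rw [abs_mul]; exact (mul_le_of_le_one_left (abs_nonneg w) hτ).trans hw
  obtain ⟨hτw1, hτw2⟩ := abs_le.1 hτw
  have hpw0 : 0 ≤ p*w^2 := by positivity
  set z := 2*τ*w + p*w^2 with hz
  have hz1 : z ≤ 1/2 := by rw [hz]; linarith
  have hz2 : -1/2 ≤ z := by rw [hz]; linarith
  constructor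
  · rw [e, Real.sqrt_mul hp0]
    apply ml _ (Real.sqrt_nonneg _)
    have hA : 1 - z/2 - z^2/2 ≤ √(1-z) := by
      apply Real.le_sqrt_of_sq_le
      have : (1 - z/2 - z^2/2)^2 = (1-z) * (1 - z^2*(3+z)/4) := by ring
      rw [this]
      have : 0 ≤ z^2*(3+z)/4 := by have : 0 ≤ 3+z := by linarith
                                   positivity
      nlinarith
    refine le_trans ?_ hA
    have hτ2w : (τ*w)^2 ≤ w^2 := by rw [mul_pow]; nlinarith [sq_nonneg w]
    have : z^2 ≤ 5*w^2 := by
      have : z = w*(2*τ + p*w) := by rw [hz]; ring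
      rw [this, mul_pow]
      have hpw1 : |p*w| ≤ 1/8 := by
        rw [abs_mul, abs_of_nonneg hp0]; exact (mul_le_of_le_one_left (abs_nonneg w) hp1).trans hw
      obtain ⟨hτ1, hτ2⟩ := abs_le.1 hτ
      obtain ⟨a1, a2⟩ := abs_le.1 hpw1
      have : (2*τ+p*w)^2 ≤ 5 := by
        have : |2*τ+p*w| ≤ 17/8 := abs_le.2 ⟨by linarith, by linarith⟩
        rw [← sq_abs]; nlinarith [abs_nonneg (2*τ+p*w)]
      exact (ml this (sq_nonneg w)).trans bli
    rw [hz] at this ⊢; linarith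
  · have h0 : 0 ≤ 1 - (τ + w*p)^2 := by rw [e]; exact mul_nonneg hp0 bli
    rw [← sq_le_one_iff_abs_le_one]; linarith

noncomputable def sg (s : ℝ) : ℝ := Real.sin (Real.arctan s)
noncomputable def sgd (s : ℝ) : ℝ := Real.cos (Real.arctan s) * (1 / (1 + s^2))

theorem sg_deriv (s : ℝ) : HasDerivAt sg (sgd s) s :=
  (Real.hasDerivAt_sin _).comp s (Real.hasDerivAt_arctan s)
theorem sg_cont : Continuous sg := Real.continuous_sin.comp Real.continuous_arctan
theorem sgd_cont : Continuous sgd := by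
  unfold sgd
  refine (Real.continuous_cos.comp Real.continuous_arctan).mul (continuous_const.div bfp fun s => ?_)
  positivity
theorem sg_abs (s : ℝ) : |sg s| ≤ 1 := Real.abs_sin_le_one _
theorem sgd_nn (s : ℝ) : 0 ≤ sgd s := mul_nonneg (Real.cos_arctan_pos s).le bpo
theorem sgd_le (s : ℝ) : sgd s ≤ 1 := by
  have h2 : 1 / (1 + s^2) ≤ 1 := by rw [div_le_one bpo]; nlinarith [sq_nonneg s]
  exact mul_le_one₀ (Real.cos_le_one _) bpo h2
theorem sg_eq (s : ℝ) : sg s = s / √(1 + s^2) := Real.sin_arctan s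
theorem sg_nn {s : ℝ} (hs : 0 ≤ s) : 0 ≤ sg s := by rw [sg_eq]; positivity
theorem sg_np {s : ℝ} (hs : s ≤ 0) : sg s ≤ 0 := by
  rw [sg_eq]; exact div_nonpos_of_nonpos_of_nonneg hs bpo

theorem vB_deriv (hk : 1 ≤ k) {z : ℝ} (hz : |z| < 1) :
    HasDerivAt (vB k) (-(k * z / (1 - z^2)) * vB k z) z := by
  have hp : 0 < 1 - z^2 := by have := (sq_lt_one_iff_abs_lt_one z).2 hz; linarith
  have hs := Real.sqrt_pos.2 hp
  have h1 : HasDerivAt (fun z : ℝ => 1 - z^2) (-(2*z)) z := by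
    simpa using (hasDerivAt_pow 2 z).const_sub 1
  have h2 := ((h1.sqrt hp.ne').pow k).const_mul (om k)
  refine h2.congr_deriv ?_
  obtain ⟨j, rfl⟩ : ∃ j, k = j+1 := ⟨k-1, by omega⟩
  simp only [vB, Nat.add_sub_cancel]
  have e : 1 - z^2 = √(1-z^2) * √(1-z^2) := (Real.mul_self_sqrt hp.le).symm
  rw [show ((j+1:ℕ):ℝ) * z / (1 - z^2) = ((j+1:ℕ):ℝ) * z / (√(1-z^2) * √(1-z^2)) by rw [← e]]
  field_simp
  ring

theorem tailv (hk : 1 ≤ k) {a : ℝ} (h0 : 0 ≤ a) (h1 : a ≤ 1) :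
    om (k+1)/2 - ∫ z in (0:ℝ)..a, vB k z ≤ (1-a) * vB k a := by
  have ii : ∀ x y, IntervalIntegrable (vB k) volume x y := fun x y => (vB_cont k).intervalIntegrable x y
  rw [← vB_half hk, intervalIntegral.integral_interval_sub_left (ii _ _) (ii _ _)]
  have : ∫ z in a..1, vB k z ≤ ∫ z in a..1, vB k a := by
    apply intervalIntegral.integral_mono_on h1 (ii _ _) (by simp)
    intro x hx
    exact vB_anti (by rw [abs_of_nonneg h0, abs_of_nonneg (h0.trans hx.1)]; exact hx.1)
  simpa using this

theorem vB_int_neg (a : ℝ) : ∫ z in (0:ℝ)..(-a), vB k z = - ∫ z in (0:ℝ)..a, vB k z := by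
  have := intervalIntegral.integral_comp_neg (a := 0) (b := a) (vB k)
  simp only [vB_even, neg_zero] at this
  rw [this, intervalIntegral.integral_symm]

theorem tail_bound (hk : 1 ≤ k) {A C l z : ℝ} (hz : |z| < 1) (hlc : l * C ≤ om (k+1))
    (hI : ∫ z in (0:ℝ)..z, vB k z = l * A - l * C / 2) {G : ℝ} (hl : 0 ≤ l) (h1 : |G| ≤ A) (h2 : |G| ≤ C - A) :
    l * |G| ≤ (1 - z^2) * vB k z := by
  have hv := vB_nonneg k z
  have hz2 : z^2 = |z|^2 := (sq_abs z).symm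
  have key : l * |G| ≤ om (k+1)/2 - ∫ x in (0:ℝ)..|z|, vB k x := by
    rcases le_total 0 z with h | h
    · rw [abs_of_nonneg h, hI]
      have := ml h2 hl
      linarith
    · rw [abs_of_nonpos h, vB_int_neg, hI]
      have := ml h1 hl
      linarith
  have h3 := tailv hk (abs_nonneg z) hz.le
  have h4 : vB k |z| = vB k z := by rcases abs_choice z with h | h <;> rw [h]; rw [vB_even]
  rw [h4] at h3
  refine key.trans (h3.trans ?_)
  apply mr _ hv
  rw [hz2]; nlinarith [abs_nonneg z]

theorem exists_center {c τ : ℝ → ℝ} (hc : Continuous c) (hcs : HasCompactSupport c) (h0 : ∀ t, 0 ≤ c t)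
    (hτ : Continuous τ) (hb : ∀ t, |τ t| < 1) : ∃ m, ∫ t, c t * sg (t - m - τ t) = 0 := by
  have hi : Integrable c := hc.integrable_of_hasCompactSupport hcs
  obtain ⟨R, hR⟩ := hcs.isCompact.isBounded.subset_closedBall 0
  have hR' : ∀ t, c t ≠ 0 → |t| ≤ R := fun t ht => by simpa using hR (subset_tsupport _ ht)
  have hcont : Continuous (fun m => ∫ t, c t * sg (t - m - τ t)) := by
    apply continuous_of_dominated (bound := c)
    · intro m; exact (hc.mul (sg_cont.comp bfp)).aestronglyMeasurable
    · intro m; refine evf fun t => ?_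
      rw [Real.norm_eq_abs, abs_mul, abs_of_nonneg (h0 t)]
      exact mul_le_of_le_one_right (h0 t) (sg_abs _)
    · exact hi
    · refine evf fun t => ?_
      exact continuous_const.mul (sg_cont.comp bfp)
  refine mem_range_of_exists_le_of_exists_ge (c := (0:ℝ)) hcont
    ⟨R+1, integral_nonpos fun t => ?_⟩ ⟨-R-1, integral_nonneg fun t => ?_⟩
  · change c t * _ ≤ 0
    by_cases ht : c t = 0
    · simp [ht]
    · have h1 := abs_le.1 (hR' t ht); have h2 := abs_lt.1 (hb t)
      exact mul_nonpos_of_nonneg_of_nonpos (h0 t) (sg_np bli)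
  · change 0 ≤ c t * _
    by_cases ht : c t = 0
    · simp [ht]
    · have h1 := abs_le.1 (hR' t ht); have h2 := abs_lt.1 (hb t)
      exact mul_nonneg (h0 t) (sg_nn bli)

theorem prim_hcs {u : ℝ → ℝ} (hu : Continuous u) (hcs : HasCompactSupport u) (h0 : ∫ t, u t = 0) :
    HasCompactSupport (fun t => ∫ s in Iic t, u s) := by
  obtain ⟨R, hR⟩ := hcs.isCompact.isBounded.subset_closedBall 0
  have hR' : ∀ t, R < |t| → u t = 0 := fun t ht => by
    by_contra hh
    have := hR (subset_tsupport _ hh)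
    simp at this; linarith
  refine HasCompactSupport.intro (isCompact_Icc (a := -R) (b := R)) fun t ht => ?_
  rw [mem_Icc, not_and_or] at ht
  rcases ht with ht | ht
  · rw [not_le] at ht
    refine setIntegral_eq_zero_of_forall_eq_zero fun s hs => hR' s ?_
    have : s ≤ t := hs
    exact lt_of_lt_of_le bli (neg_le_abs s)
  · rw [not_le] at ht
    have hi : Integrable u := hu.integrable_of_hasCompactSupport hcs
    have h2 := integral_add_compl (measurableSet_Iic (a := t)) hi
    have h3 : ∫ s in (Iic t)ᶜ, u s = 0 := by
      refine setIntegral_eq_zero_of_forall_eq_zero fun s hs => hR' s ?_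
      have : t < s := by simpa using hs
      exact lt_of_lt_of_le bli (le_abs_self s)
    rw [h3, h0, add_zero] at h2; exact h2

structure TauD (k : ℕ) (c τ : ℝ → ℝ) (l : ℝ) : Prop where
  hk : 1 ≤ k
  cc : Continuous c
  ccs : HasCompactSupport c
  c0 : ∀ t, 0 ≤ c t
  l0 : 0 < l
  hlc : l * ∫ t, c t ≤ om (k+1)
  τc : ContDiff ℝ 1 τ
  τb : ∀ t, |τ t| < 1
  τd : ∀ t, deriv τ t * vB k (τ t) = l * c t
  τI : ∀ t, ∫ z in (0:ℝ)..(τ t), vB k z = l * (∫ s in Iic t, c s) - l * (∫ s, c s) / 2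

noncomputable def xiF (k : ℕ) (c τ : ℝ → ℝ) (l m t : ℝ) : ℝ :=
  l * (∫ s in Iic t, c s * sg (s - m - τ s)) / vB k (τ t)

section
variable {c τ : ℝ → ℝ} {l m : ℝ}

theorem TauD.rho (T : TauD k c τ l) (t : ℝ) : 0 < 1 - τ t^2 := by
  have := (sq_lt_one_iff_abs_lt_one (τ t)).2 (T.τb t); linarith

theorem TauD.ci (T : TauD k c τ l) : Integrable c := T.cc.integrable_of_hasCompactSupport T.ccs

theorem TauD.gc (T : TauD k c τ l) (m : ℝ) : Continuous fun t => sg (t - m - τ t) :=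
  sg_cont.comp (by have := T.τc.continuous; fun_prop)

theorem TauD.uc (T : TauD k c τ l) (m : ℝ) : Continuous fun t => c t * sg (t - m - τ t) := T.cc.mul (T.gc m)

theorem xi_bound (T : TauD k c τ l) (hm : ∫ t, c t * sg (t - m - τ t) = 0) (t : ℝ) :
    |xiF k c τ l m t| ≤ 1 - τ t^2 := by
  have hv := vB_pos (k := k) (T.τb t)
  rw [xiF, abs_div, abs_of_pos hv, div_le_iff₀ hv, abs_mul, abs_of_pos T.l0]
  have hui : Integrable (fun t => c t * sg (t - m - τ t)) :=
    (T.cc.mul (T.gc m)).integrable_of_hasCompactSupport T.ccs.mul_right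
  have hle : ∀ t, ‖c t * sg (t - m - τ t)‖ ≤ c t := fun t => by
    rw [Real.norm_eq_abs, abs_mul, abs_of_nonneg (T.c0 t)]
    exact mul_le_of_le_one_right (T.c0 t) (sg_abs _)
  have hc2 := integral_add_compl (measurableSet_Iic (a := t)) T.ci
  have hu2 := integral_add_compl (measurableSet_Iic (a := t)) hui
  refine tail_bound T.hk (T.τb t) T.hlc (T.τI t) T.l0.le ?_ ?_
  · exact norm_integral_le_of_norm_le T.ci.integrableOn (evf hle)
  · have e : ∫ s in Iic t, c s * sg (s - m - τ s) = - ∫ s in (Iic t)ᶜ, c s * sg (s - m - τ s) := by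
      rw [hm] at hu2; linarith
    rw [e, abs_neg]
    have : |∫ s in (Iic t)ᶜ, c s * sg (s - m - τ s)| ≤ ∫ s in (Iic t)ᶜ, c s :=
      norm_integral_le_of_norm_le T.ci.integrableOn (evf hle)
    linarith

theorem xi_deriv (T : TauD k c τ l) (m t : ℝ) : HasDerivAt (xiF k c τ l m)
    (l * (c t * sg (t - m - τ t)) / vB k (τ t) +
      k * τ t * (xiF k c τ l m t / (1 - τ t^2)) * deriv τ t) t := by
  have hv := vB_pos (k := k) (T.τb t)
  have hr := T.rho t
  have hui : Integrable (fun t => c t * sg (t - m - τ t)) :=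
    (T.cc.mul (T.gc m)).integrable_of_hasCompactSupport T.ccs.mul_right
  have h1 := (Iic_hasDerivAt (T.uc m) hui t).const_mul l
  have hτ : HasDerivAt τ (deriv τ t) t := (T.τc.differentiable one_ne_zero t).hasDerivAt
  have h2 := (vB_deriv T.hk (T.τb t)).comp t hτ
  refine (h1.div h2 hv.ne').congr_deriv ?_
  simp only [xiF, Function.comp]
  field_simp
  ring

theorem xi_cont (T : TauD k c τ l) (m : ℝ) : Continuous (xiF k c τ l m) :=
  continuous_iff_continuousAt.2 fun t => (xi_deriv T m t).continuousAt

theorem xi_contDiff (T : TauD k c τ l) (m : ℝ) : ContDiff ℝ 1 (xiF k c τ l m) := by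
  rw [contDiff_one_iff_deriv]
  refine ⟨fun t => (xi_deriv T m t).differentiableAt, ?_⟩
  rw [funext fun t => (xi_deriv T m t).deriv]
  have h1 := T.cc; have h2 := T.gc m; have h3 := T.τc.continuous
  have h4 := T.τc.continuous_deriv le_rfl
  have h5 := xi_cont T m
  have h6 : Continuous fun t => vB k (τ t) := (vB_cont k).comp h3
  refine Continuous.add ?_ ?_
  · exact (continuous_const.mul (h1.mul h2)).div h6 fun t => (vB_pos (T.τb t)).ne'
  · exact ((continuous_const.mul h3).mul (h5.div bfp fun t => (T.rho t).ne')).mul h4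

theorem xi_hcs (T : TauD k c τ l) (hm : ∫ t, c t * sg (t - m - τ t) = 0) :
    HasCompactSupport (xiF k c τ l m) := by
  have := prim_hcs (T.uc m) T.ccs.mul_right hm
  refine HasCompactSupport.mono this fun t ht => ?_
  contrapose! ht
  simp only [Function.mem_support, not_not] at ht ⊢
  simp [xiF, ht]

theorem hardy (T : TauD k c τ l) (hm : ∫ t, c t * sg (t - m - τ t) = 0) :
    ∫ t, c t * xiF k c τ l m t ^ 2 ≤ 4 * ∫ t, c t * sg (t - m - τ t)^2 := by
  have hτ : ∀ t, HasDerivAt τ (deriv τ t) t := fun t => (T.τc.differentiable one_ne_zero t).hasDerivAt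
  set ξ := xiF k c τ l m with hξ
  have hd : ∀ t, HasDerivAt (fun t => τ t * vB k (τ t) * ξ t^2)
      (l * (c t * ξ t^2) + k * τ t^2 / (1 - τ t^2) * (l * (c t * ξ t^2))
        + 2 * τ t * (l * (c t * sg (t - m - τ t))) * ξ t) t := by
    intro t
    have hv := vB_pos (k := k) (T.τb t)
    have hr := T.rho t
    have h2 := (vB_deriv T.hk (T.τb t)).comp t (hτ t)
    have h3 := ((hτ t).mul h2).mul ((xi_deriv T m t).pow 2)
    refine h3.congr_deriv ?_
    have e := T.τd t
    rw [← hξ]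
    have e2 : l * (c t * ξ t^2) = deriv τ t * vB k (τ t) * ξ t^2 := by rw [e]; ring
    rw [e2]
    simp only [Function.comp, Pi.mul_apply, Pi.pow_apply]
    field_simp
    ring
  have hcs : HasCompactSupport (fun t => τ t * vB k (τ t) * ξ t^2) := by
    have := xi_hcs T hm
    refine HasCompactSupport.mul_left (this.comp_left (g := fun x => x^2) (by simp))
  have hcd : ContDiff ℝ 1 (fun t => τ t * vB k (τ t) * ξ t^2) := by
    rw [contDiff_one_iff_deriv]
    refine ⟨fun t => (hd t).differentiableAt, ?_⟩
    rw [funext fun t => (hd t).deriv]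
    have h1 := T.cc; have h2 := T.gc m; have h3 := T.τc.continuous
    have h5 : Continuous ξ := xi_cont T m
    refine Continuous.add (Continuous.add bfp (Continuous.mul ?_ bfp)) bfp
    exact Continuous.div bfp bfp fun t => (T.rho t).ne'
  have hi0 : Integrable (deriv fun t => τ t * vB k (τ t) * ξ t^2) :=
    (hcd.continuous_deriv le_rfl).integrable_of_hasCompactSupport hcs.deriv
  have hz := integral_eq_zero_of_hasDerivAt_of_integrable
    (fun t => (hd t).differentiableAt.hasDerivAt) hi0 (hcd.continuous.integrable_of_hasCompactSupport hcs)
  have i1 : Integrable (fun t => c t * ξ t^2) :=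
    (T.cc.mul ((xi_cont T m).pow 2)).integrable_of_hasCompactSupport T.ccs.mul_right
  have i2 : Integrable (fun t => c t * sg (t - m - τ t)^2) :=
    (T.cc.mul ((T.gc m).pow 2)).integrable_of_hasCompactSupport T.ccs.mul_right
  have hmono := integral_mono ((i1.const_mul (l/2)).sub (i2.const_mul (2*l))) hi0 fun t => ?_
  · simp only [Pi.sub_apply] at hmono
    rw [hz, integral_sub (i1.const_mul _) (i2.const_mul _), integral_const_mul, integral_const_mul] at hmono
    have := T.l0
    by_contra hcon
    push Not at hcon
    nlinarith
  · simp only [Pi.sub_apply]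
    rw [(hd t).deriv]
    have hc := T.c0 t; have hl := T.l0; have hr := T.rho t
    have hA : 0 ≤ k * τ t^2 / (1 - τ t^2) * (l * (c t * ξ t^2)) := by positivity
    have hB : -(ξ t^2/2 + 2 * sg (t - m - τ t)^2) ≤ 2 * τ t * sg (t - m - τ t) * ξ t := by
      have h1 : τ t^2 ≤ 1 := by linarith
      have h2 : (τ t * sg (t - m - τ t))^2 ≤ sg (t - m - τ t)^2 := by
        rw [mul_pow]; exact mul_le_of_le_one_left (sq_nonneg _) h1
      have := sq_nonneg (2 * (τ t * sg (t - m - τ t)) + ξ t)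
      linarith
    have := ml hB (mul_nonneg hl.le hc)
    linarith
end

section
variable {f : Es k → ℝ} {τ : ℝ → ℝ} {l m : ℝ}

theorem y_bound {ξ ρ : ℝ} (hρ : 0 < ρ) (h : |ξ| ≤ ρ) : |ξ / ρ| ≤ 1 := by
  rw [abs_div, abs_of_pos hρ, div_le_one hρ]; exact h

theorem core_alg {l c a x q iq h K e g ξ y τ σ A : ℝ} (hc : 0 ≤ c) (hca : c ≤ a) (he : 0 ≤ e)
    (hl2 : l ≤ 1) (hh : h = iq + k*q - (k+1)) (hx : x = l*iq) (hq : 0 ≤ q)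
    (hh0 : 0 ≤ h) (hKe : K*e ≤ l) (hξ : |ξ| ≤ 1) (hσ0 : 0 ≤ σ) (hσ1 : σ ≤ 1)
    (hA : A = x*g^2 + k*τ*y*g*(x-q) + ξ*σ*(1-x) - 3*k*e*q*y^2*g^2)
    (hp : (3/4)*g^2 - ξ^2/64 - K*h - (k+2)*(1-l) ≤ A) :
    l*(k+1)*c + e*((3/4)*(c*g^2) - c*ξ^2/64 - (k+2)*(1-l)*c - (a-c)) ≤
    c*x + e*(c*x*g^2 + k*τ*y*g*(c*x) + ξ*σ*(a - c*x)) +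
      k*(c*q*(1 - τ*(e*(y*g)) - 3*(e*(y*g))^2)) := by
  have h1 : -(a-c) ≤ ξ*σ*(a-c) := by
    have h2 : |ξ*σ| ≤ 1 := by rw [abs_mul, abs_of_nonneg hσ0]; exact mul_le_one₀ hξ hσ0 hσ1
    have h3 := (abs_le.1 h2).1
    have := mr h3 (by linarith : 0 ≤ a - c)
    linarith
  have h4 : l*(h+(k+1)) ≤ x + k*q := by
    rw [hh, hx]
    have : l*(k*q) ≤ k*q := mul_le_of_le_one_left bpo hl2
    linarith
  have h5 : K*e*h ≤ l*h := mr hKe hh0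
  have h6 := ml hp (mul_nonneg he hc)
  have h7 := ml h4 hc
  have h8 := ml h5 hc
  have h9 := ml h1 he
  have e1 : c*x + e*(c*x*g^2 + k*τ*y*g*(c*x) + ξ*σ*(a - c*x)) +
      k*(c*q*(1 - τ*(e*(y*g)) - 3*(e*(y*g))^2)) = c*(x+k*q) + e*c*A + e*(ξ*σ*(a-c)) := by
    rw [hA]; ring
  rw [e1]
  linarith

set_option maxHeartbeats 800000 in
theorem core_ptw (h : Adm f) (T : TauD k (cS f) τ l)
    (hl1 : 1/2 ≤ l) (hl2 : l ≤ 1) (hm : ∫ t, cS f t * sg (t - m - τ t) = 0) (t : ℝ) :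
    l*(k+1)*cS f t + ep k * ((3/4)*(cS f t * sg (t - m - τ t)^2) - cS f t * xiF k (cS f) τ l m t^2/64
      - (k+2)*(1-l)*cS f t - (aS f t - cS f t)) ≤
    deriv (fun t => τ t + ep k * (xiF k (cS f) τ l m t * sg (t - m - τ t))) t * aS f t +
      k * om k ^ (1/(k:ℝ)) * (√(1 - (τ t + ep k * (xiF k (cS f) τ l m t * sg (t - m - τ t)))^2) * bS f t) := by
  have hτ : HasDerivAt τ (deriv τ t) t := (T.τc.differentiable one_ne_zero t).hasDerivAt
  set ξ := xiF k (cS f) τ l m with hξdef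
  set g := sg (t - m - τ t) with hg
  have hgd : HasDerivAt (fun t => sg (t - m - τ t)) (sgd (t - m - τ t) * (1 - deriv τ t)) t := by
    have h1 : HasDerivAt (fun t => t - m - τ t) (1 - deriv τ t) t := ((hasDerivAt_id t).sub_const m).sub hτ
    exact (sg_deriv _).comp t h1
  have hd : deriv (fun t => τ t + ep k * (ξ t * sg (t - m - τ t))) t =
      deriv τ t + ep k * ((l * (cS f t * g) / vB k (τ t) + k * τ t * (ξ t / (1 - τ t^2)) * deriv τ t) * g
        + ξ t * (sgd (t - m - τ t) * (1 - deriv τ t))) :=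
    (hτ.add (((xi_deriv T m t).mul hgd).const_mul (ep k))).deriv
  rw [hd]
  by_cases ha : aS f t = 0
  · have hc := cS_zero h ha
    simp [ha, hc, bS]
  have hv := vB_pos (k := k) (T.τb t)
  have hr := T.rho t
  have hb := T.τb
  have hξ := xi_bound T hm t
  rw [← hξdef] at hξ
  have hy := y_bound hr hξ
  set y := ξ t / (1 - τ t^2) with hydef
  have hξ1 : |ξ t| ≤ 1 := hξ.trans (by nlinarith [sq_nonneg (τ t)])
  have hg1 : |g| ≤ 1 := sg_abs _
  set q := qS f τ t with hq
  have hq0 : 0 < q := qS_pos h hb t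
  have hep := ep_pos k
  obtain ⟨he1, he2, he3⟩ := ep_le k
  have hp := ptw T.hk hq0 T.l0.le hl2 hg1 hξ1 hy (hb t).le (sgd_nn (t - m - τ t)) (sgd_le (t - m - τ t))
  have hqk : aS f t * q^k = vB k (τ t) := qS_pow T.hk h ha
  have htau := tau_a T.hk h hb T.τd t
  rw [← hq] at htau
  set x := l * (q^k)⁻¹ with hx
  set c := cS f t with hc
  set a := aS f t with haa
  have hcl : l * (c * g) / vB k (τ t) * a = c * x * g := by
    rw [← hqk, hx]; field_simp
  have hw : |ep k * (y * g)| ≤ 1/8 := by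
    rw [abs_mul, abs_of_pos hep, abs_mul]
    have : |y| * |g| ≤ 1 := mul_le_one₀ hy (abs_nonneg g) hg1
    nlinarith [abs_nonneg (y*g), abs_nonneg y, abs_nonneg g]
  obtain ⟨hs1, -⟩ := sqrt_tilt (hb t).le hw
  have hw2 : ep k * (y * g) * (1 - τ t^2) = ep k * (ξ t * g) := by rw [hydef]; field_simp
  rw [hw2] at hs1
  have hbS := bS_nn h t
  have hom : 0 ≤ om k ^ (1/(k:ℝ)) := Real.rpow_nonneg (om_pos k).le _
  have hb3 := ml (mr hs1 hbS) hom
  have hb4 : om k ^ (1/(k:ℝ)) * (√(1 - τ t^2) * (1 - τ t * (ep k * (y*g)) - 3*(ep k * (y*g))^2) * bS f t)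
      = c * q * (1 - τ t * (ep k * (y*g)) - 3*(ep k * (y*g))^2) := by
    rw [hc, hq, ← bS_eq T.hk h t]; ring
  rw [hb4] at hb3
  have hk0 : (0:ℝ) ≤ k := by positivity
  have hb5 := ml hb3 hk0
  have hh0 : 0 ≤ (q^k)⁻¹ + k*q - (k+1) := by
    have := bern k hq0
    have h2 : 0 ≤ ((q^k)⁻¹ + k*q - (k+1)) * q := le_trans bpo this
    exact nonneg_of_mul_nonneg_left h2 hq0
  have hKe : K2 k * ep k ≤ l := he3.trans hl1
  have main := core_alg (k := k) (cS_nn h t) (cS_le h t) hep.le hl2 rfl hx hq0.le hh0 hKe hξ1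
    (sgd_nn (t - m - τ t)) (sgd_le (t - m - τ t)) rfl hp
  refine main.trans ?_
  have e1 : (deriv τ t + ep k * ((l * (c * g) / vB k (τ t) + k * τ t * y * deriv τ t) * g
        + ξ t * (sgd (t - m - τ t) * (1 - deriv τ t)))) * a =
      deriv τ t * a + ep k * (l * (c * g) / vB k (τ t) * a * g + k * τ t * y * g * (deriv τ t * a)
        + ξ t * sgd (t - m - τ t) * (a - deriv τ t * a)) := by ring
  rw [e1, hcl, htau]
  have e2 : c * x * g * g = c * x * g^2 := by ring
  rw [e2]
  linarith

theorem M3core (hS : Sob k) (h : Adm f) (T : TauD k (cS f) τ l)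
    (hl1 : 1/2 ≤ l) (hl2 : l ≤ 1) (hm : ∫ t, cS f t * sg (t - m - τ t) = 0) :
    ep k * (11/16) * ∫ t, cS f t * sg (t - m - τ t)^2 ≤ TV f - l*(k+1)*(∫ t, cS f t) +
      ep k * ((k+2)*(1-l)*(∫ t, cS f t) + ((∫ t, aS f t) - ∫ t, cS f t)) := by
  set κ := fun t => τ t + ep k * (xiF k (cS f) τ l m t * sg (t - m - τ t)) with hκ
  have hep := ep_pos k
  have hgC : ContDiff ℝ 1 (fun t => sg (t - m - τ t)) := by
    have : ContDiff ℝ 1 sg := contDiff_one_iff_deriv.2 ⟨fun s => (sg_deriv s).differentiableAt, by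
      rw [funext fun s => (sg_deriv s).deriv]; exact sgd_cont⟩
    exact this.comp ((contDiff_id.sub contDiff_const).sub T.τc)
  have hκC : ContDiff ℝ 1 κ := T.τc.add (contDiff_const.mul ((xi_contDiff T m).mul hgC))
  have hκb : ∀ t, |κ t| ≤ 1 := fun t => by
    have hr := T.rho t
    have hy := y_bound hr (xi_bound T hm t)
    have hg1 : |sg (t - m - τ t)| ≤ 1 := sg_abs _
    have hw : |ep k * (xiF k (cS f) τ l m t / (1 - τ t^2) * sg (t - m - τ t))| ≤ 1/8 := by
      rw [abs_mul, abs_of_pos hep, abs_mul]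
      have := mul_le_one₀ hy (abs_nonneg (sg (t - m - τ t))) hg1
      exact (mul_le_of_le_one_right hep.le this).trans (ep_le k).2.1
    have := (sqrt_tilt (T.τb t).le hw).2
    have e : ep k * (xiF k (cS f) τ l m t / (1 - τ t^2) * sg (t - m - τ t)) * (1 - τ t^2) =
        ep k * (xiF k (cS f) τ l m t * sg (t - m - τ t)) := by field_simp
    rw [e] at this
    exact this
  have hsl := slice_lower T.hk hS h hκC hκb
  have i1 : Integrable (fun t => deriv κ t * aS f t) :=
    ((hκC.continuous_deriv le_rfl).mul (aS_cont h)).integrable_of_hasCompactSupport (aS_hcs h).mul_left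
  have i2 : Integrable (fun t => √(1 - κ t^2) * bS f t) := by
    refine (bS_int T.hk hS h).bdd_mul (c := 1) ?_ (evf fun t => ?_)
    · have := hκC.continuous
      exact Continuous.aestronglyMeasurable bfp
    · rw [Real.norm_eq_abs, abs_of_nonneg (Real.sqrt_nonneg _)]
      exact Real.sqrt_le_one.2 (by nlinarith [sq_nonneg (κ t)])
  have ic := cS_int h
  have ia := aS_int h
  have ig : Integrable (fun t => cS f t * sg (t - m - τ t)^2) :=
    (T.cc.mul ((T.gc m).pow 2)).integrable_of_hasCompactSupport T.ccs.mul_right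
  have ix : Integrable (fun t => cS f t * xiF k (cS f) τ l m t^2) :=
    (T.cc.mul ((xi_cont T m).pow 2)).integrable_of_hasCompactSupport T.ccs.mul_right
  have hmono := integral_mono (((ic.const_mul (l*(k+1) + ep k * (1-(k+2)*(1-l)))).add
    (ig.const_mul (ep k*(3/4)))).add ((ix.const_mul (-ep k/64)).add (ia.const_mul (-ep k))))
    (i1.add (i2.const_mul (k * om k ^ (1/(k:ℝ))))) fun t => by
      have := core_ptw h T hl1 hl2 hm t
      simp only [Pi.add_apply]
      linarith
  rw [integral_add' ((ic.const_mul _).add (ig.const_mul _)) ((ix.const_mul _).add (ia.const_mul _)),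
    integral_add' (ic.const_mul _) (ig.const_mul _), integral_add' (ix.const_mul _) (ia.const_mul _),
    integral_add' i1 (i2.const_mul _), integral_const_mul, integral_const_mul, integral_const_mul,
    integral_const_mul, integral_const_mul] at hmono
  have hh := ml (hardy T hm) hep.le
  have := hmono.trans hsl
  linarith
end

structure Def (f : Eu n → ℝ) (d : ℝ) : Prop where
  adm : Adm f
  dpos : 0 < d
  tv : TV f ≤ n * om n + d
  vol : |(∫ x, f x) - om n| ≤ d
  bd : ∫ x, f x * (1 - f x) ≤ d

theorem sg_sq (s : ℝ) : sg s^2 = s^2 / (1+s^2) := by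
  rw [sg_eq, div_pow, Real.sq_sqrt bpo]

theorem sg_min (s : ℝ) : min |s| 2 ≤ 3 * |sg s| := by
  have h : (min |s| 2)^2 ≤ (3 * |sg s|)^2 := by
    rw [mul_pow, sq_abs, sg_sq, ← sq_abs s, mul_div_assoc', le_div_iff₀ bpo]
    rcases le_total |s| 2 with h | h
    · rw [min_eq_left h]; nlinarith [abs_nonneg s, mul_nonneg (sq_nonneg |s|) (by nlinarith [abs_nonneg s] : 0 ≤ 4 - |s|^2)]
    · rw [min_eq_right h]; nlinarith
  exact (abs_le_of_sq_le_sq' h bpo).2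

theorem sg_half {s : ℝ} (h : 1 ≤ |s|) : 1 ≤ 2 * sg s^2 := by
  rw [sg_sq, ← sq_abs s, mul_div_assoc', le_div_iff₀ bpo]; nlinarith

theorem fst_int {f : Es k → ℝ} (h : Adm f) {q : ℝ → ℝ} (hq : Continuous q) :
    ∫ x, f x * q (x 0) = ∫ t, aS f t * q t := by
  have hi : Integrable (fun x => f x * q (x 0)) :=
    (h.cont.mul (hq.comp bfp)).integrable_of_hasCompactSupport h.cs.mul_right
  rw [integral_slice hi]
  simp only [csL_zero, aS, integral_mul_const]

theorem int_lin3 {α : Type*} [MeasurableSpace α] {μ : Measure α} {u v w : α → ℝ} (a b c : ℝ)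
    (hu : Integrable u μ) (hv : Integrable v μ) (hw : Integrable w μ) :
    Integrable (fun t => a * u t + b * v t + c * w t) μ ∧
    ∫ t, (a * u t + b * v t + c * w t) ∂μ = a * (∫ t, u t ∂μ) + b * (∫ t, v t ∂μ) + c * ∫ t, w t ∂μ := by
  have h1 := hu.const_mul a; have h2 := hv.const_mul b; have h3 := hw.const_mul c
  have h12 : Integrable (fun t => a * u t + b * v t) μ := h1.add h2
  refine ⟨h12.add h3, ?_⟩
  rw [integral_add h12 h3, integral_add h1 h2]
  simp only [integral_const_mul]

section
variable {f : Es k → ℝ} {τ : ℝ → ℝ} {l m d : ℝ}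

theorem sq_int (h : Adm f) : Integrable (fun x => f x * (1 - f x)) :=
  (h.cont.mul (continuous_const.sub h.cont)).integrable_of_hasCompactSupport h.cs.mul_right

theorem Def.cS_ge (hk : 1 ≤ k) (D : Def f d) : (∫ x, f x) - d ≤ ∫ t, cS f t := by
  have h := D.adm
  rw [cS_integral h]
  have h1 := integral_mono (h.integrable.sub (sq_int h)) (rpow_int h (p_pos k)) fun x => by
    have h0 := h.nn x
    have e1 : (fun x => f x) x - f x * (1 - f x) = f x ^ (2:ℝ) := by norm_num; ring
    change f x - f x * (1 - f x) ≤ f x ^ (1 + 1/(k:ℝ))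
    change f x - f x * (1 - f x) = _ at e1
    rw [e1]
    rcases h0.eq_or_lt with h3 | h3
    · rw [← h3, Real.zero_rpow bnn, Real.zero_rpow (p_pos k).ne']
    · apply Real.rpow_le_rpow_of_exponent_ge h3 (h.le x)
      have : (1:ℝ) ≤ k := by exact_mod_cast hk
      have : 1/(k:ℝ) ≤ 1 := by rw [div_le_one bli]; exact this
      linarith
  rw [integral_sub' h.integrable (sq_int h)] at h1
  have := D.bd
  linarith

theorem Def.cS_bounds (hk : 1 ≤ k) (D : Def f d) : om (k+1) - 2*d ≤ ∫ t, cS f t ∧ ∫ t, cS f t ≤ om (k+1) + d ∧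
    (∫ t, aS f t) - ∫ t, cS f t ≤ d := by
  have h := D.adm
  have h1 := D.cS_ge hk
  have h2 := integral_mono (cS_int h) (aS_int h) (cS_le h)
  rw [aS_integral h] at *
  have h3 := abs_le.1 D.vol
  exact ⟨by linarith, by linarith, by linarith⟩

theorem subst_bound (T : TauD k (cS f) τ l) {q : ℝ → ℝ} {M : ℝ} (hq : Continuous q) (hM : ∀ x, |q x| ≤ M) :
    |l * (∫ t, cS f t * q (τ t)) - ∫ z, vB k z * q z| ≤ M * (om (k+1) - l * ∫ t, cS f t) := by
  obtain ⟨R, hR⟩ := T.ccs.isCompact.isBounded.subset_closedBall 0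
  have hR' : ∀ t, R < |t| → cS f t = 0 := fun t ht => by
    by_contra hh
    have := hR (subset_tsupport _ hh)
    simp at this; linarith
  set a := -(|R|+1) with ha
  set b := |R|+1 with hb
  have hRb : R < b := by have := le_abs_self R; linarith
  have hb0 : 0 < b := by positivity
  have hsupp : ∀ u : ℝ → ℝ, (fun t => cS f t * u t).support ⊆ Ioc a b := fun u t ht => by
    by_contra hh
    apply ht
    have : R < |t| := by
      by_contra h2
      have h3 := abs_le.1 (not_lt.1 h2)
      exact hh ⟨by linarith, by linarith⟩
    simp [hR' t this]
  have h1 : l * (∫ t, cS f t * q (τ t)) = ∫ z in (τ a)..(τ b), vB k z * q z := by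
    have hg : Continuous (fun z => vB k z * q z) := (vB_cont k).mul hq
    rw [← intervalIntegral.integral_comp_mul_deriv (f := τ) (f' := deriv τ)
      (fun t _ => (T.τc.differentiable one_ne_zero t).hasDerivAt)
      ((T.τc.continuous_deriv le_rfl).continuousOn) hg,
      ← intervalIntegral.integral_eq_integral_of_support_subset (hsupp _), ← intervalIntegral.integral_const_mul]
    congr 1; ext t
    simp only [Function.comp]
    calc _ = (l * cS f t) * q (τ t) := by ring
      _ = _ := by rw [← T.τd t]; ring
  have h2 : ∫ z, vB k z * q z = ∫ z in (-1:ℝ)..1, vB k z * q z := by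
    refine (intervalIntegral.integral_eq_integral_of_support_subset fun z hz => ?_).symm
    by_contra hh
    apply hz
    have : 1 ≤ |z| := by
      by_contra h2
      have h3 := abs_lt.1 (not_le.1 h2)
      exact hh ⟨by linarith, by linarith⟩
    simp [vB_eq_zero T.hk this]
  have ii : ∀ x y, IntervalIntegrable (fun z => vB k z * q z) volume x y := fun x y =>
    ((vB_cont k).mul hq).intervalIntegrable x y
  have iv : ∀ x y, IntervalIntegrable (vB k) volume x y := fun x y => (vB_cont k).intervalIntegrable x y
  have hIa : ∫ s in Iic a, cS f s = 0 := by
    refine setIntegral_eq_zero_of_forall_eq_zero fun s hs => hR' s ?_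
    have : s ≤ a := hs
    exact lt_of_lt_of_le bli (neg_le_abs s)
  have hIb : ∫ s in Iic b, cS f s = ∫ s, cS f s := by
    have h2 := integral_add_compl (measurableSet_Iic (a := b)) T.ci
    have h3 : ∫ s in (Iic b)ᶜ, cS f s = 0 := by
      refine setIntegral_eq_zero_of_forall_eq_zero fun s hs => hR' s ?_
      have : b < s := by simpa using hs
      exact lt_of_lt_of_le bli (le_abs_self s)
    linarith
  have ta := T.τI a
  have tb := T.τI b
  rw [hIa] at ta; rw [hIb] at tb
  have ba := abs_lt.1 (T.τb a); have bb := abs_lt.1 (T.τb b)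
  have key : ∀ x y, x ≤ y → |∫ z in x..y, vB k z * q z| ≤ M * ∫ z in x..y, vB k z := fun x y hxy => by
    rw [← intervalIntegral.integral_const_mul, ← Real.norm_eq_abs]
    apply intervalIntegral.norm_integral_le_of_norm_le hxy _ ((iv x y).const_mul M)
    refine evf fun z _ => ?_
    rw [Real.norm_eq_abs, abs_mul, abs_of_nonneg (vB_nonneg k z), mul_comm]
    exact mr (hM z) (vB_nonneg k z)
  have k1 := key (-1) (τ a) ba.1.le
  have k2 := key (τ b) 1 bb.2.le
  have e1 : ∫ z in (-1:ℝ)..(τ a), vB k z = om (k+1)/2 - l * (∫ s, cS f s)/2 := by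
    have := intervalIntegral.integral_interval_sub_left (iv 0 (τ a)) (iv 0 (-1))
    rw [vB_int_neg, vB_half T.hk, ta] at this
    linarith
  have e2 : ∫ z in (τ b)..1, vB k z = om (k+1)/2 - l * (∫ s, cS f s)/2 := by
    have := intervalIntegral.integral_interval_sub_left (iv 0 1) (iv 0 (τ b))
    rw [vB_half T.hk, tb] at this
    linarith
  have e3 := intervalIntegral.integral_add_adjacent_intervals (ii (-1) (τ a)) (ii (τ a) (τ b))
  have e4 := intervalIntegral.integral_add_adjacent_intervals (ii (-1) (τ b)) (ii (τ b) 1)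
  rw [h1, h2]
  rw [e1] at k1; rw [e2] at k2
  have k1' := abs_le.1 k1; have k2' := abs_le.1 k2
  rw [abs_le]; constructor <;> linarith

theorem M3 (hk : 1 ≤ k) : ∃ K d0 : ℝ, 0 < K ∧ 0 < d0 ∧ ∀ (f : Es k → ℝ) (d : ℝ), Def f d → d ≤ d0 → ∃ m : ℝ,
    (∀ (M : ℝ) (q : ℝ → ℝ), Continuous q → (∀ x, |q x| ≤ M) → (∀ x y, |q x - q y| ≤ M * |x - y|) →
      |(∫ x, f x * q (x 0 - m)) - ∫ x in BB (k+1), q (x 0)| ≤ K * M * √d) ∧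
    (∀ ψ : ℝ → ℝ, Continuous ψ → (∀ s, 0 ≤ ψ s) → (∀ s, ψ s ≤ 1) → (∀ s, |s| ≤ 2 → ψ s = 0) →
      ∫ x, f x * ψ (x 0 - m) ≤ K * d) := by
  have hω := om_pos (k+1)
  have hep := ep_pos k
  set ω := om (k+1) with hωdef
  obtain ⟨K1, hK1d⟩ : ∃ K1, K1 = ((1+4*((k:ℝ)+1)) + ep k * (3*(k+2)+1)) / (ep k * (11/16)) := ⟨_, rfl⟩
  have hK1 : 0 < K1 := by rw [hK1d]; positivity
  refine ⟨3*K1 + 4*ω + 20, min (ω/4) 1, by positivity, by positivity, fun f d D hd => ?_⟩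
  have hd1 : d ≤ ω/4 := hd.trans (min_le_left _ _)
  have hd2 : d ≤ 1 := hd.trans (min_le_right _ _)
  have hd0 := D.dpos
  have h := D.adm
  obtain ⟨c1, c2, c3⟩ := D.cS_bounds hk
  rw [← hωdef] at c1 c2
  set C := ∫ t, cS f t with hC
  obtain ⟨l, hl⟩ : ∃ l, l = 1 - 2*d/ω := ⟨_, rfl⟩
  have hlω : l * ω = ω - 2*d := by rw [hl]; field_simp
  have hl2 : l ≤ 1 := by have : 0 ≤ 2*d/ω := by positivity
                         linarith
  have hl1 : 1/2 ≤ l := by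
    by_contra hcon; push Not at hcon; nlinarith
  have hl0 : 0 < l := by linarith
  have hlC : l * C < ω := by nlinarith
  have hlC2 : ω - 4*d ≤ l * C := by nlinarith
  obtain ⟨τ, t1, t2, t3, t4⟩ := tau_exists hk (cS_cont h) (cS_int h) (cS_nn h) hl0 hlC
  have T : TauD k (cS f) τ l := ⟨hk, cS_cont h, cS_hcs h, cS_nn h, hl0, hlC.le, t1, t2, t3, t4⟩
  obtain ⟨m, hm⟩ := exists_center T.cc T.ccs T.c0 t1.continuous t2
  have core := M3core (Sob_all hk) h T hl1 hl2 hm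
  have ig : Integrable (fun t => cS f t * sg (t - m - τ t)^2) :=
    (T.cc.mul ((T.gc m).pow 2)).integrable_of_hasCompactSupport T.ccs.mul_right
  have hg2 : ∫ t, cS f t * sg (t - m - τ t)^2 ≤ K1 * d := by
    have htv := D.tv
    rw [← hωdef] at htv; push_cast at htv
    have hk0 : (0:ℝ) ≤ k := by positivity
    have b1 : ((k:ℝ)+1)*(ω - 4*d) ≤ ((k:ℝ)+1)*(l*C) := ml hlC2 bpo
    have b2 : (1-l)*C ≤ 3*d := by
      have : (1-l)*ω = 2*d := by linarith
      have h5 : (1-l)*C ≤ (1-l)*(ω + ω/4) := ml bli bli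
      linarith
    have b3 := ml b2 (by positivity : (0:ℝ) ≤ k+2)
    have b4 := ml (add_le_add b3 c3) hep.le
    rw [hK1d, div_mul_eq_mul_div, le_div_iff₀ bpo]
    linarith
  have ic := T.ci
  have ia := aS_int h
  refine ⟨m, fun M q hq hM hLip => ?_, fun ψ hψ hψ0 hψ1 hψ2 => ?_⟩
  · have hM0 : 0 ≤ M := (abs_nonneg _).trans (hM 0)
    have hqm : Continuous (fun s => q (s - m)) := by fun_prop
    have hqτ : Continuous (fun s => q (τ s)) := hq.comp t1.continuous
    rw [fst_int h hqm, integral_ball_fst hk hq]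
    have s1 := subst_bound T hq hM
    have iaq : Integrable (fun t => aS f t * q (t - m)) :=
      ((aS_cont h).mul hqm).integrable_of_hasCompactSupport (aS_hcs h).mul_right
    have icq : Integrable (fun t => cS f t * q (τ t)) :=
      (T.cc.mul hqτ).integrable_of_hasCompactSupport T.ccs.mul_right
    set r := √d with hr
    have hr0 : 0 < r := Real.sqrt_pos.2 hd0
    have hrd : r * r = d := Real.mul_self_sqrt hd0.le
    have hdr : d ≤ r := by
      rw [← hrd]; exact mul_le_of_le_one_right hr0.le (by rw [hr]; exact Real.sqrt_le_one.2 hd2)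
    have s2 : |(∫ t, aS f t * q (t - m)) - l * ∫ t, cS f t * q (τ t)| ≤
        M * ((∫ t, aS f t) - C) + 3 * M * (r⁻¹ * (∫ t, cS f t * sg (t - m - τ t)^2) + r * C) + (1-l) * M * C := by
      rw [← integral_const_mul, ← integral_sub iaq (icq.const_mul l), hC]
      obtain ⟨ib, e⟩ := int_lin3 M (3*M*r + (1-l)*M - M) (3*M*r⁻¹) ia ic ig
      rw [show M * ((∫ t, aS f t) - ∫ t, cS f t) + 3 * M * (r⁻¹ * (∫ t, cS f t * sg (t - m - τ t)^2)
            + r * ∫ t, cS f t) + (1-l) * M * ∫ t, cS f t = M * (∫ t, aS f t) + (3*M*r + (1-l)*M - M) * (∫ t, cS f t)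
            + (3*M*r⁻¹) * ∫ t, cS f t * sg (t - m - τ t)^2 by ring]
      rw [← e, ← Real.norm_eq_abs]
      refine norm_integral_le_of_norm_le ib (evf fun t => ?_)
      rw [Real.norm_eq_abs]
      have ca := cS_le h t
      have cc := cS_nn h t
      have dec : aS f t * q (t-m) - l * (cS f t * q (τ t)) = (aS f t - cS f t) * q (t-m) +
          cS f t * (q (t-m) - q (τ t)) + (1-l) * (cS f t * q (τ t)) := by ring
      rw [dec]
      have g1 : |q (t-m) - q (τ t)| ≤ 3 * M * |sg (t-m-τ t)| := by
        have a1 := hLip (t-m) (τ t)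
        have a2 : |q (t-m) - q (τ t)| ≤ M * 2 := (abs_sub _ _).trans (by linarith [hM (t-m), hM (τ t)])
        have a3 := ml (sg_min (t-m-τ t)) hM0
        have a4 : |q (t-m) - q (τ t)| ≤ M * min |t-m-τ t| 2 := by
          rcases min_choice |t-m-τ t| 2 with hh | hh <;> rw [hh] <;> assumption
        linarith
      have g2 : |sg (t-m-τ t)| ≤ r⁻¹ * sg (t-m-τ t)^2 + r := by
        rw [← sq_abs]
        have : r⁻¹ * |sg (t-m-τ t)|^2 + r - |sg (t-m-τ t)| = r⁻¹ * ((|sg (t-m-τ t)| - r/2)^2 + 3/4*r^2) := by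
          field_simp; ring
        have h7 : 0 ≤ r⁻¹ * ((|sg (t-m-τ t)| - r/2)^2 + 3/4*r^2) := by positivity
        linarith
      have z1 : |(aS f t - cS f t) * q (t-m)| ≤ M * (aS f t - cS f t) := by
        rw [abs_mul, abs_of_nonneg (by linarith : 0 ≤ aS f t - cS f t), mul_comm]
        exact mr (hM _) bli
      have z2 : |cS f t * (q (t-m) - q (τ t))| ≤ cS f t * (3 * M * (r⁻¹ * sg (t-m-τ t)^2 + r)) := by
        rw [abs_mul, abs_of_nonneg cc]
        exact ml (g1.trans (ml g2 bpo)) cc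
      have z3 : |(1-l) * (cS f t * q (τ t))| ≤ (1-l) * (cS f t * M) := by
        rw [abs_mul, abs_of_nonneg (by linarith : 0 ≤ 1-l), abs_mul, abs_of_nonneg cc]
        exact ml (ml (hM _) cc) bli
      have := (abs_add_three ((aS f t - cS f t) * q (t-m)) (cS f t * (q (t-m) - q (τ t)))
        ((1-l) * (cS f t * q (τ t)))).trans (add_le_add (add_le_add z1 z2) z3)
      refine this.trans (le_of_eq (by ring))
    have f1 : r⁻¹ * (∫ t, cS f t * sg (t - m - τ t)^2) ≤ K1 * r := by
      calc _ ≤ r⁻¹ * (K1 * d) := by gcongr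
        _ = K1 * r := by rw [← hrd]; field_simp
    have f2 : r * C ≤ (5/4*ω) * r := by nlinarith
    have f3 : (1-l) * C ≤ 3 * d := by
      have : (1-l)*ω = 2*d := by linarith
      have h5 : (1-l)*C ≤ (1-l)*(ω + ω/4) := ml bli bli
      linarith
    have tri := abs_add_le ((∫ t, aS f t * q (t - m)) - l * ∫ t, cS f t * q (τ t))
      (l * (∫ t, cS f t * q (τ t)) - ∫ z, vB k z * q z)
    rw [sub_add_sub_cancel] at tri
    refine tri.trans ((add_le_add s2 s1).trans ?_)
    have tot : ((∫ t, aS f t) - C) + 3 * (r⁻¹ * (∫ t, cS f t * sg (t - m - τ t)^2) + r * C) + (1-l) * C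
        + (ω - l * C) ≤ (3*K1 + 4*ω + 20) * r := by
      have := mul_pos hω hr0
      linarith
    have := ml tot hM0
    linarith
  · have hψm : Continuous (fun s => ψ (s - m)) := by fun_prop
    rw [fst_int h hψm]
    have iaq : Integrable (fun t => aS f t * ψ (t - m)) :=
      ((aS_cont h).mul hψm).integrable_of_hasCompactSupport (aS_hcs h).mul_right
    have hmono := integral_mono iaq ((ia.sub ic).add (ig.const_mul 2)) fun t => by
      simp only [Pi.add_apply, Pi.sub_apply]
      have ca := cS_le h t
      have cc := cS_nn h t
      have z1 : (aS f t - cS f t) * ψ (t-m) ≤ aS f t - cS f t := mul_le_of_le_one_right bli (hψ1 _)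
      have z2 : ψ (t-m) ≤ 2 * sg (t-m-τ t)^2 := by
        by_cases hs : |t-m| ≤ 2
        · rw [hψ2 _ hs]; positivity
        · refine (hψ1 _).trans (sg_half ?_)
          have := t2 t
          have h3 := abs_sub_abs_le_abs_sub (t-m) (τ t)
          push Not at hs; linarith
      have := ml z2 cc
      linarith
    rw [integral_add' (ia.sub ic) (ig.const_mul 2), integral_sub' ia ic, integral_const_mul] at hmono
    nlinarith
end

theorem Adm.comp_iso {f : Eu n → ℝ} (h : Adm f) (L : Eu n ≃ₗᵢ[ℝ] Eu n) : Adm (fun x => f (L x)) :=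
  ⟨h.cd.comp L.contDiff, h.cs.comp_homeomorph L.toHomeomorph, fun x => h.nn _, fun x => h.le _⟩

theorem Adm.trans {f : Eu n → ℝ} (h : Adm f) (c : Eu n) : Adm (fun x => f (x + c)) :=
  ⟨h.cd.comp (contDiff_id.add contDiff_const), h.cs.comp_homeomorph (Homeomorph.addRight c), fun x => h.nn _, fun x => h.le _⟩

theorem iso_int (L : Eu n ≃ₗᵢ[ℝ] Eu n) (g : Eu n → ℝ) : ∫ x, g (L x) = ∫ x, g x :=
  L.measurePreserving.integral_comp L.toHomeomorph.measurableEmbedding g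

theorem iso_ball (L : Eu n ≃ₗᵢ[ℝ] Eu n) (g : Eu n → ℝ) :
    ∫ x in BB n, g (L x) = ∫ x in BB n, g x := by
  have h := L.measurePreserving.setIntegral_preimage_emb L.toHomeomorph.measurableEmbedding g (ball 0 1)
  rw [← h]; congr 2; ext x; simp

theorem fderiv_iso {f : Eu n → ℝ} (h : Adm f) (L : Eu n ≃ₗᵢ[ℝ] Eu n) (x : Eu n) :
    fderiv ℝ (fun x => f (L x)) x = (fderiv ℝ f (L x)).comp (L.toContinuousLinearEquiv : Eu n →L[ℝ] Eu n) :=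
  ((h.diff (L x)).hasFDerivAt.comp x (L.toContinuousLinearEquiv : Eu n →L[ℝ] Eu n).hasFDerivAt).fderiv

theorem Def.comp_iso {f : Eu n → ℝ} {d : ℝ} (D : Def f d) (L : Eu n ≃ₗᵢ[ℝ] Eu n) :
    Def (fun x => f (L x)) d := by
  refine ⟨D.adm.comp_iso L, D.dpos, ?_, ?_, ?_⟩
  · have : TV (fun x => f (L x)) = TV f := by
      unfold TV
      rw [← iso_int L (fun x => ‖fderiv ℝ f x‖)]
      congr 1; ext x; rw [fderiv_iso D.adm]
      exact ContinuousLinearMap.opNorm_comp_linearIsometryEquiv _ L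
    rw [this]; exact D.tv
  · rw [iso_int L f]; exact D.vol
  · rw [iso_int L (fun x => f x * (1 - f x))]; exact D.bd

theorem Def.trans {f : Eu n → ℝ} {d : ℝ} (D : Def f d) (c : Eu n) :
    Def (fun x => f (x + c)) d := by
  refine ⟨D.adm.trans c, D.dpos, ?_, ?_, ?_⟩
  · have : TV (fun x => f (x + c)) = TV f := by
      unfold TV
      rw [← integral_add_right_eq_self (fun x => ‖fderiv ℝ f x‖) c]
      congr 1; ext x; rw [fderiv_comp_add_right]
    rw [this]; exact D.tv
  · rw [integral_add_right_eq_self f c]; exact D.vol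
  · rw [integral_add_right_eq_self (fun x => f x * (1 - f x)) c]; exact D.bd

theorem exists_iso {v e : Eu n} (hv : ‖v‖ = ‖e‖) : ∃ L : Eu n ≃ₗᵢ[ℝ] Eu n, L v = e ∧ ∀ x, L (L x) = x :=
  ⟨_, Submodule.reflection_sub hv, fun x => Submodule.reflection_reflection _ _⟩

theorem M3a (hk : 1 ≤ k) : ∃ K d0 : ℝ, 0 < K ∧ 0 < d0 ∧ ∀ (f : Es k → ℝ) (d : ℝ), Def f d → d ≤ d0 →
   ∀ e : Es k, ‖e‖ = 1 → ∃ m : ℝ,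
    (∀ (M : ℝ) (q : ℝ → ℝ), Continuous q → (∀ x, |q x| ≤ M) → (∀ x y, |q x - q y| ≤ M * |x - y|) →
      |(∫ x, f x * q (inner ℝ e x - m)) - ∫ x in BB (k+1), q (inner ℝ e x)| ≤ K * M * √d) ∧
    (∀ ψ : ℝ → ℝ, Continuous ψ → (∀ s, 0 ≤ ψ s) → (∀ s, ψ s ≤ 1) → (∀ s, |s| ≤ 2 → ψ s = 0) →
      ∫ x, f x * ψ (inner ℝ e x - m) ≤ K * d) := by
  obtain ⟨K, d0, hK, hd0, H⟩ := M3 hk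
  refine ⟨K, d0, hK, hd0, fun f d D hd e he => ?_⟩
  obtain ⟨L, hL, hLL⟩ := exists_iso (v := (EuclideanSpace.single 0 1 : Es k)) (e := e) (by simp [he])
  have key : ∀ x, inner ℝ e (L x) = x 0 := fun x => by
    rw [← hL, L.inner_map_map, EuclideanSpace.inner_single_left]; simp
  obtain ⟨m, h1, h2⟩ := H _ d (D.comp_iso L) hd
  refine ⟨m, fun M q hq hb hl => ?_, fun ψ hc h0 h1' h2' => ?_⟩
  · have := h1 M q hq hb hl
    rw [← iso_int L (fun x => f x * q (inner ℝ e x - m)), ← iso_ball L (fun x => q (inner ℝ e x))]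
    simpa only [key] using this
  · have := h2 ψ hc h0 h1' h2'
    rw [← iso_int L (fun x => f x * ψ (inner ℝ e x - m))]
    simpa only [key] using this

structure Cen (K R0 : ℝ) (f : Eu n → ℝ) (d : ℝ) : Prop where
  df : Def f d
  pw : ∀ (e : Eu n) (M : ℝ) (q : ℝ → ℝ), ‖e‖ = 1 → Continuous q → (∀ x, |q x| ≤ M) →
    (∀ x y, |q x - q y| ≤ M * |x - y|) →
    |(∫ x, f x * q (inner ℝ e x)) - ∫ x in BB n, q (inner ℝ e x)| ≤ K * M * √d
  tail : ∫ x in {x | R0 ≤ ‖x‖}, f x ≤ K * d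

noncomputable def clip (R s : ℝ) : ℝ := max (-R) (min s R)

theorem clip_cont (R : ℝ) : Continuous (clip R) := by unfold clip; fun_prop

theorem clip_abs {R : ℝ} (hR : 0 ≤ R) (s : ℝ) : |clip R s| ≤ R :=
  abs_le.2 ⟨le_max_left _ _, max_le bli (min_le_right _ _)⟩

theorem clip_mono (R : ℝ) : Monotone (clip R) := fun a b h => max_le_max le_rfl (min_le_min_right _ h)

theorem clip_lip (R s t : ℝ) : |clip R s - clip R t| ≤ |s - t| := by
  unfold clip
  refine (abs_max_sub_max_le_max _ _ _ _).trans (max_le (by simp) ?_)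
  refine (abs_min_sub_min_le_max _ _ _ _).trans (max_le le_rfl (by simp))

theorem clip_id {R s : ℝ} (h : |s| ≤ R) : clip R s = s := by
  have := abs_le.1 h
  unfold clip; rw [min_eq_left this.2, max_eq_right this.1]

theorem clip_neg {R : ℝ} (hR : 0 ≤ R) (s : ℝ) : clip R (-s) = - clip R s := by
  unfold clip
  rcases le_total s R with h | h <;> rcases le_total (-s) R with h' | h' <;>
   rcases le_total (-R) s with h2 | h2 <;> rcases le_total (-R) (-s) with h2' | h2' <;>
   simp only [min_eq_left, min_eq_right, max_eq_left, max_eq_right, h, h', h2, h2', neg_neg] <;> first | linarith | skip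
  all_goals (first | (rw [max_eq_right bli, max_eq_left bli]; linarith) | (rw [max_eq_right bli, max_eq_right bli]; linarith) | (rw [max_eq_right bli]; done) | (rw [max_eq_right bli]; linarith) )

theorem clip_shift {R s m : ℝ} (hs : |s| ≤ R - 1) (hm : 0 ≤ m) : min m 1 ≤ clip R s - clip R (s - m) := by
  rw [clip_id bli]
  have := abs_le.1 hs
  unfold clip
  have h1 : max (-R) (min (s-m) R) ≤ max (-R) (s - m) := max_le_max le_rfl (min_le_left _ _)
  rcases max_choice (-R) (s-m) with h | h <;> rw [h] at h1
  · linarith [min_le_right m 1]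
  · linarith [min_le_left m 1]

noncomputable def psi (s : ℝ) : ℝ := min (max (|s| - 2) 0) 1

theorem psi_cont : Continuous psi := by unfold psi; fun_prop
theorem psi_nn (s : ℝ) : 0 ≤ psi s := le_min (le_max_right _ _) zero_le_one
theorem psi_le (s : ℝ) : psi s ≤ 1 := min_le_right _ _
theorem psi_zero {s : ℝ} (h : |s| ≤ 2) : psi s = 0 := by
  unfold psi; rw [max_eq_right bli]; simp
theorem psi_one {s : ℝ} (h : 3 ≤ |s|) : psi s = 1 := by
  unfold psi; rw [max_eq_left bli, min_eq_right bli]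

theorem box_or (x : Eu n) : (∀ i, |x i| ≤ 3) ∨ 1 ≤ ∑ i, psi (x i) := by
  by_cases h : ∀ i, |x i| ≤ 3
  · exact Or.inl h
  · push Not at h
    obtain ⟨i, hi⟩ := h
    right
    rw [← psi_one hi.le]
    exact Finset.single_le_sum (f := fun i => psi (x i)) (fun j _ => psi_nn _) (Finset.mem_univ i)

theorem norm_le_sum (x : Eu n) : ‖x‖ ≤ ∑ i, |x i| := by
  rw [EuclideanSpace.norm_eq]
  apply Real.sqrt_le_iff.2
  refine ⟨Finset.sum_nonneg fun i _ => abs_nonneg _, ?_⟩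
  exact Finset.sum_sq_le_sq_sum_of_nonneg fun i _ => abs_nonneg _

theorem abs_le_norm (x : Eu n) (i : Fin n) : |x i| ≤ ‖x‖ := EuclideanSpace.norm_eq x ▸ by
  rw [← Real.norm_eq_abs]
  apply Real.le_sqrt_of_sq_le
  exact Finset.single_le_sum (f := fun i => ‖x i‖^2) (fun j _ => sq_nonneg _) (Finset.mem_univ i)

theorem ball_odd (q : Eu n → ℝ) (h : ∀ x, q (-x) = - q x) : ∫ x in BB n, q x = 0 := by
  have := iso_ball (LinearIsometryEquiv.neg ℝ) q
  simp only [LinearIsometryEquiv.coe_neg, h, integral_neg] at this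
  linarith

theorem Adm.intmul {f : Eu n → ℝ} (h : Adm f) {g : Eu n → ℝ} (hg : Continuous g) :
    Integrable (fun x => f x * g x) :=
  (h.cont.mul hg).integrable_of_hasCompactSupport h.cs.mul_right

theorem sqrt_ge {d : ℝ} (h0 : 0 < d) (h1 : d ≤ 1) : d ≤ √d := Real.le_sqrt_of_sq_le (by nlinarith)

theorem shift_small {f : Eu n → ℝ} {d K : ℝ} (D : Def f d) (hK : 0 < K) (hd : d ≤ 1)
    (hd2 : (1 + n * K) * d ≤ om n / 2)
    (h1 : ∀ i : Fin n, |∫ x, f x * clip (3*n+1) (x i)| ≤ K * (3*n+1) * √d)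
    (h2 : ∀ i : Fin n, ∫ x, f x * psi (x i) ≤ K * d)
    {e : Eu n} (he : ‖e‖ = 1) {m : ℝ} (hm : 0 ≤ m)
    (h3 : |∫ x, f x * clip (3*n+1) (inner ℝ e x - m)| ≤ K * (3*n+1) * √d) :
    min m 1 * (om n / 2) ≤ ((3*n+1) * (1+n) * n * K + n * (K * (3*n+1)) + K * (3*n+1)) * √d := by
  have h := D.adm
  have hn : (0:ℝ) ≤ n := n.cast_nonneg
  have hRp : (0:ℝ) ≤ 3*n+1 := by positivity
  set R : ℝ := 3*n+1 with hR
  have hei : ∀ i, |e i| ≤ 1 := fun i => (abs_le_norm e i).trans he.le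
  have hin : ∀ x : Eu n, inner ℝ e x = ∑ i, e i * x i := fun x => by
    rw [PiLp.inner_apply]; exact Finset.sum_congr rfl fun i _ => by simp [mul_comm]
  have hbox : ∀ x : Eu n, (∀ i, |x i| ≤ 3) → |inner ℝ e x| ≤ 3 * n := fun x hx => by
    rw [hin]
    refine (Finset.abs_sum_le_sum_abs _ _).trans ?_
    calc ∑ i, |e i * x i| ≤ ∑ i : Fin n, (3:ℝ) := Finset.sum_le_sum fun i _ => by
          rw [abs_mul]; nlinarith [abs_nonneg (e i), abs_nonneg (x i), hei i, hx i]
      _ = 3 * n := by simp [mul_comm]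
  have hcs : ∀ x : Eu n, |∑ i, e i * clip R (x i)| ≤ n * R := fun x => by
    refine (Finset.abs_sum_le_sum_abs _ _).trans ?_
    calc ∑ i, |e i * clip R (x i)| ≤ ∑ i : Fin n, R := Finset.sum_le_sum fun i _ => by
          rw [abs_mul]
          exact (mul_le_mul (hei i) (clip_abs hRp _) (abs_nonneg _) zero_le_one).trans bli
      _ = n * R := by simp
  have hps : ∀ x : Eu n, 0 ≤ ∑ i, psi (x i) := fun x => Finset.sum_nonneg fun i _ => psi_nn _
  have hA : ∀ x : Eu n, clip R (inner ℝ e x) - ∑ i, e i * clip R (x i) ≤ R * (1+n) * ∑ i, psi (x i) := by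
    intro x
    rcases box_or x with hx | hx
    · have : clip R (inner ℝ e x) - ∑ i, e i * clip R (x i) = 0 := by
        rw [clip_id (by linarith [hbox x hx]), hin, sub_eq_zero]
        refine Finset.sum_congr rfl fun i _ => ?_
        have hn1 : (1:ℝ) ≤ n := by exact_mod_cast Fin.pos i
        rw [clip_id (by linarith [hx i])]
      rw [this]; exact mul_nonneg bpo (hps x)
    · have := (abs_le.1 (clip_abs hRp (inner ℝ e x))).2
      have := (abs_le.1 (hcs x)).1
      have : R * (1+n) * 1 ≤ R * (1+n) * ∑ i, psi (x i) := ml hx bpo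
      linarith
  have hB : ∀ x : Eu n, min m 1 * (1 - ∑ i, psi (x i)) ≤ clip R (inner ℝ e x) - clip R (inner ℝ e x - m) := by
    intro x
    have hm0 : 0 ≤ min m 1 := le_min hm zero_le_one
    rcases box_or x with hx | hx
    · refine le_trans ?_ (clip_shift (by linarith [hbox x hx]) hm)
      nlinarith [hps x]
    · have : clip R (inner ℝ e x - m) ≤ clip R (inner ℝ e x) := clip_mono R bli
      nlinarith
  have cps : Continuous fun x : Eu n => ∑ i, psi (x i) := by
    refine continuous_finset_sum _ fun i _ => psi_cont.comp bfp
  have ccs : Continuous fun x : Eu n => ∑ i, e i * clip R (x i) := by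
    refine continuous_finset_sum _ fun i _ => continuous_const.mul ((clip_cont R).comp bfp)
  have cc1 : Continuous fun x : Eu n => clip R (inner ℝ e x) := (clip_cont R).comp bfp
  have cc2 : Continuous fun x : Eu n => clip R (inner ℝ e x - m) := (clip_cont R).comp bfp
  have i1 := h.intmul cc1
  have i2 := h.intmul cc2
  have i3 := h.intmul ccs
  have i4 := h.intmul cps
  have e4 : ∫ x, f x * ∑ i, psi (x i) ≤ n * (K * d) := by
    simp only [Finset.mul_sum]
    have hi : ∀ i : Fin n, Integrable fun x : Eu n => f x * psi (x i) := fun i =>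
      h.intmul (psi_cont.comp bfp)
    rw [integral_finset_sum _ fun i _ => hi i]
    calc _ ≤ ∑ i : Fin n, K * d := Finset.sum_le_sum fun i _ => h2 i
      _ = n * (K*d) := by simp
  have e3 : ∫ x, f x * ∑ i, e i * clip R (x i) ≤ n * (K * R * √d) := by
    simp only [Finset.mul_sum]
    have hi : ∀ i : Fin n, Integrable fun x : Eu n => f x * (e i * clip R (x i)) := fun i =>
      h.intmul (continuous_const.mul ((clip_cont R).comp bfp))
    rw [integral_finset_sum _ fun i _ => hi i]
    calc _ ≤ ∑ i : Fin n, K * R * √d := Finset.sum_le_sum fun i _ => by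
          have : ∫ x, f x * (e i * clip R (x i)) = e i * ∫ x, f x * clip R (x i) := by
            rw [← integral_const_mul]; congr 1; ext x; ring
          rw [this]
          refine (le_abs_self _).trans ?_
          rw [abs_mul]
          exact (mul_le_mul (hei i) (h1 i) (abs_nonneg _) zero_le_one).trans bli
      _ = n * (K*R*√d) := by simp
  have E1 : (∫ x, f x * clip R (inner ℝ e x)) ≤ (∫ x, f x * ∑ i, e i * clip R (x i)) + R * (1+n) * ∫ x, f x * ∑ i, psi (x i) := by
    rw [← integral_const_mul, ← integral_add i3 (i4.const_mul _)]
    refine integral_mono i1 (i3.add (i4.const_mul _)) fun x => ?_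
    have := ml (hA x) (h.nn x)
    simp only [Pi.add_apply]; linarith
  have E2 : min m 1 * ((∫ x, f x) - ∫ x, f x * ∑ i, psi (x i)) ≤
      (∫ x, f x * clip R (inner ℝ e x)) - ∫ x, f x * clip R (inner ℝ e x - m) := by
    rw [← integral_sub h.integrable i4, ← integral_const_mul, ← integral_sub i1 i2]
    refine integral_mono ((h.integrable.sub i4).const_mul _) (i1.sub i2) fun x => ?_
    have := ml (hB x) (h.nn x)
    simp only; linarith
  have hv := (abs_le.1 D.vol).1
  have h3' := (abs_le.1 h3).1
  have hsq := sqrt_ge D.dpos hd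
  have hm0 : 0 ≤ min m 1 := le_min hm zero_le_one
  have E3 : min m 1 * (om n / 2) ≤ min m 1 * ((∫ x, f x) - ∫ x, f x * ∑ i, psi (x i)) :=
    ml bli hm0
  have E4 : R * (1+n) * ∫ x, f x * ∑ i, psi (x i) ≤ R * (1+n) * (n * (K * √d)) :=
    ml (e4.trans (by gcongr)) bpo
  linarith

theorem M4 (hk : 1 ≤ k) : ∃ K d0 : ℝ, 0 < K ∧ 0 < d0 ∧ d0 ≤ 1 ∧ d0 ≤ om (k+1) / 2 ∧ ∀ (f : Es k → ℝ) (d : ℝ), Def f d → d ≤ d0 →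
    ∃ c, Cen K (3*(k+1)) (fun x => f (x + c)) d := by
  obtain ⟨K, d0, hK, hd0, H⟩ := M3a hk
  have hω := om_pos (k+1)
  obtain ⟨N, hN⟩ : ∃ N : ℝ, N = ((k+1 : ℕ) : ℝ) := ⟨_, rfl⟩
  have hN0 : 0 < N := by rw [hN]; positivity
  obtain ⟨C, hC⟩ : ∃ C, C = (3*N+1) * (1+N) * N * K + N * (K * (3*N+1)) + K * (3*N+1) := ⟨_, rfl⟩
  have hC0 : 0 < C := by rw [hC]; positivity
  set ω := om (k+1) with hωd
  refine ⟨K + 2*C/ω * (2*ω) + N*K, min (min d0 1) (min (ω/2/(1+N*K)) ((ω/4/C)^2)), by positivity, by positivity, (min_le_left _ _).trans (min_le_right _ _),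
    (min_le_right _ _).trans ((min_le_left _ _).trans (div_le_self bpo (by nlinarith [mul_pos hN0 hK]))), ?_⟩
  intro f d D hd
  have hd1 : d ≤ d0 := hd.trans ((min_le_left _ _).trans (min_le_left _ _))
  have hd2 : d ≤ 1 := hd.trans ((min_le_left _ _).trans (min_le_right _ _))
  have hd3 : d ≤ ω/2/(1+N*K) := hd.trans ((min_le_right _ _).trans (min_le_left _ _))
  have hd4 : d ≤ (ω/4/C)^2 := hd.trans ((min_le_right _ _).trans (min_le_right _ _))
  have hds : √d ≤ ω/4/C := Real.sqrt_le_iff.2 ⟨by positivity, hd4⟩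
  have hd3' : (1+N*K) * d ≤ ω/2 := by rw [le_div_iff₀ bpo] at hd3; linarith
  choose m hm1 hm2 using fun i : Fin (k+1) => H f d D hd1 (EuclideanSpace.single i 1) (by simp)
  obtain ⟨c, hc⟩ : ∃ c : Es k, ∀ i, c i = m i := ⟨WithLp.toLp 2 m, fun i => rfl⟩
  refine ⟨c, ?_⟩
  have D' := D.trans c
  have hsi : ∀ (i : Fin (k+1)) (x : Es k), inner ℝ (EuclideanSpace.single i (1:ℝ)) x = x i := fun i x => by
    rw [EuclideanSpace.inner_single_left]; simp
  have tr : ∀ (i : Fin (k+1)) (q : ℝ → ℝ), ∫ x, f (x + c) * q (x i) = ∫ x, f x * q (inner ℝ (EuclideanSpace.single i (1:ℝ)) x - m i) := by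
    intro i q
    rw [← integral_add_right_eq_self (fun x => f x * q (inner ℝ (EuclideanSpace.single i (1:ℝ)) x - m i)) c]
    congr 1; ext x; rw [hsi, ← hc]; simp
  have hR : 0 ≤ 3*N+1 := by positivity
  have lipc : ∀ x y, |clip (3*N+1) x - clip (3*N+1) y| ≤ (3*N+1) * |x-y| := fun x y =>
    (clip_lip _ _ _).trans (le_mul_of_one_le_left (abs_nonneg _) bli)
  have oddc : ∀ e : Es k, ∫ x in ball (0:Es k) 1, clip (3*N+1) (inner ℝ e x) = 0 := fun e =>
    ball_odd _ fun x => by rw [inner_neg_right, clip_neg hR]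
  have a1 : ∀ i : Fin (k+1), |∫ x, f (x + c) * clip (3*N+1) (x i)| ≤ K * (3*N+1) * √d := by
    intro i
    have := hm1 i (3*N+1) _ (clip_cont _) (clip_abs hR) lipc
    rwa [oddc, sub_zero, ← tr] at this
  have a2 : ∀ i : Fin (k+1), ∫ x, f (x + c) * psi (x i) ≤ K * d := by
    intro i; rw [tr]; exact hm2 i psi psi_cont psi_nn psi_le fun s hs => psi_zero hs
  have hsm : ∀ e : Es k, ‖e‖ = 1 → ∀ μ : ℝ, 0 ≤ μ →
      |∫ x, f (x + c) * clip (3*N+1) (inner ℝ e x - μ)| ≤ K * (3*N+1) * √d → μ ≤ 2*C/ω * √d := by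
    intro e he μ hμ h3
    have := shift_small D' hK hd2 (by rw [← hN]; exact hd3') (by rw [← hN]; exact a1) a2 he hμ (by rw [← hN]; exact h3)
    rw [← hN, ← hC, ← hωd] at this
    have hb : C * √d ≤ ω/4 := by rw [le_div_iff₀ hC0] at hds; linarith
    have hlt : min μ 1 < 1 := by nlinarith
    have hmin : min μ 1 = μ := min_eq_left (by by_contra hh; rw [min_eq_right bli] at hlt; linarith)
    rw [hmin] at this
    rw [div_mul_eq_mul_div, le_div_iff₀ hω]; linarith
  refine ⟨D', ?_, ?_⟩
  · intro e M q he hq hb hl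
    have hM : 0 ≤ M := (abs_nonneg _).trans (hb 0)
    obtain ⟨μ, h1, -⟩ := H _ d D' hd1 e he
    have hcl := h1 (3*N+1) _ (clip_cont _) (clip_abs hR) lipc
    rw [oddc, sub_zero] at hcl
    have hμ : |μ| ≤ 2*C/ω * √d := by
      rcases le_total 0 μ with h0 | h0
      · rw [abs_of_nonneg h0]; exact hsm e he μ h0 hcl
      · rw [abs_of_nonpos h0]
        refine hsm (-e) (by simpa using he) (-μ) bli ?_
        have : ∀ x : Es k, clip (3*N+1) (inner ℝ (-e) x - -μ) = - clip (3*N+1) (inner ℝ e x - μ) := fun x => by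
          rw [← clip_neg hR, inner_neg_left]; congr 1; ring
        simp only [this, mul_neg, integral_neg, abs_neg]; exact hcl
    have hq1 := h1 M q hq hb hl
    have i1 := D'.adm.intmul (g := fun x => q (inner ℝ e x)) (hq.comp bfp)
    have i2 := D'.adm.intmul (g := fun x => q (inner ℝ e x - μ)) (hq.comp bfp)
    have hdiff : |(∫ x, f (x + c) * q (inner ℝ e x)) - ∫ x, f (x + c) * q (inner ℝ e x - μ)| ≤ M * |μ| * (2*ω) := by
      rw [← integral_sub i1 i2]
      have : ∫ x, f (x+c) ≤ 2 * ω := by linarith [(abs_le.1 D'.vol).2, hd3', mul_nonneg (mul_nonneg hN0.le hK.le) D.dpos.le]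
      calc _ ≤ ∫ x, f (x+c) * (M * |μ|) := by
            rw [← Real.norm_eq_abs]
            refine norm_integral_le_of_norm_le (D'.adm.integrable.mul_const _) (evf fun x => ?_)
            rw [← mul_sub, norm_mul, Real.norm_eq_abs, Real.norm_eq_abs, abs_of_nonneg (D.adm.nn _)]
            have := hl (inner ℝ e x) (inner ℝ e x - μ)
            rw [sub_sub_cancel] at this
            exact ml this (D.adm.nn _)
        _ = (M * |μ|) * ∫ x, f (x+c) := by rw [integral_mul_const]; ring
        _ ≤ _ := ml this bpo
    have h5 : M * |μ| * (2*ω) ≤ M * (2*C/ω * √d) * (2*ω) := by gcongr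
    have h6 := abs_sub_le (∫ x, f (x + c) * q (inner ℝ e x)) (∫ x, f (x + c) * q (inner ℝ e x - μ)) (∫ x in ball (0:Es k) 1, q (inner ℝ e x))
    have h7 : 0 ≤ N*K*M*√d := by positivity
    calc _ ≤ _ := h6
      _ ≤ M * (2*C/ω * √d) * (2*ω) + K*M*√d + N*K*M*√d := by linarith
      _ = _ := by ring
  · have cps : Continuous fun x : Es k => ∑ i, psi (x i) := by
      refine continuous_finset_sum _ fun i _ => psi_cont.comp bfp
    have e4 : ∫ x, f (x+c) * ∑ i, psi (x i) ≤ N * (K * d) := by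
      simp only [Finset.mul_sum]
      have hi : ∀ i : Fin (k+1), Integrable fun x : Es k => f (x+c) * psi (x i) := fun i =>
        D'.adm.intmul (psi_cont.comp bfp)
      rw [integral_finset_sum _ fun i _ => hi i]
      calc _ ≤ ∑ i : Fin (k+1), K * d := Finset.sum_le_sum fun i _ => a2 i
        _ = N * (K*d) := by simp [hN]
    have hme : MeasurableSet {x : Es k | 3 * ((k:ℝ)+1) ≤ ‖x‖} := measurableSet_le measurable_const measurable_norm
    rw [← integral_indicator hme]
    calc _ ≤ ∫ x, f (x+c) * ∑ i, psi (x i) := by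
          refine integral_mono (D'.adm.integrable.indicator hme) (D'.adm.intmul cps) fun x => ?_
          by_cases hx : x ∈ {x : Es k | 3 * ((k:ℝ)+1) ≤ ‖x‖}
          · simp only [indicator_of_mem hx]
            refine le_mul_of_one_le_right (D.adm.nn _) ?_
            by_contra hh
            have hex : ∃ i, 3 ≤ |x i| := by
              by_contra h3
              push Not at h3
              have : ∑ i, |x i| < ∑ i : Fin (k+1), (3:ℝ) := Finset.sum_lt_sum_of_nonempty Finset.univ_nonempty fun i _ => h3 i
              have h8 : 3 * ((k:ℝ)+1) ≤ ‖x‖ := hx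
              have h9 := norm_le_sum x
              simp at this
              linarith
            obtain ⟨i, hi⟩ := hex
            apply hh
            rw [← psi_one hi]
            exact Finset.single_le_sum (f := fun i => psi (x i)) (fun j _ => psi_nn _) (Finset.mem_univ i)
          · simp only [indicator_of_notMem hx]
            exact mul_nonneg (D.adm.nn _) (Finset.sum_nonneg fun i _ => psi_nn _)
      _ ≤ N * (K*d) := e4
      _ ≤ _ := by
          have : 0 ≤ (K + 2*C/ω * (2*ω)) * d := mul_nonneg bpo D.dpos.le
          nlinarith

noncomputable def gB (f : Eu n → ℝ) (x : Eu n) : ℝ := f x - (BB n).indicator (fun _ => (1:ℝ)) x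

theorem chiB_int : Integrable ((BB n).indicator (fun _ => (1:ℝ))) :=
  (integrable_indicator_iff measurableSet_ball).2 (integrableOn_const measure_ball_lt_top.ne)

theorem Adm.gB_int {f : Eu n → ℝ} (h : Adm f) : Integrable (gB f) := h.integrable.sub chiB_int

theorem Adm.gB_abs_le {f : Eu n → ℝ} (h : Adm f) (x : Eu n) : |gB f x| ≤ 1 := by
  unfold gB
  by_cases hx : x ∈ BB n
  · rw [indicator_of_mem hx, abs_le]; constructor <;> linarith [h.nn x, h.le x]
  · rw [indicator_of_notMem hx, abs_le]; constructor <;> linarith [h.nn x, h.le x]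

theorem gB_in {f : Eu n → ℝ} {x : Eu n} (hx : ‖x‖ < 1) : gB f x = f x - 1 := by
  unfold gB; rw [indicator_of_mem (by simpa using hx)]

theorem gB_out {f : Eu n → ℝ} {x : Eu n} (hx : 1 ≤ ‖x‖) : gB f x = f x := by
  unfold gB; rw [indicator_of_notMem (by simpa using hx)]; simp

theorem Adm.gB_intmul {f : Eu n → ℝ} (h : Adm f) {q : Eu n → ℝ} (hq : Continuous q) :
    Integrable (fun x => gB f x * q x) ∧ ∫ x, gB f x * q x = (∫ x, f x * q x) - ∫ x in BB n, q x := by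
  have i1 := h.intmul hq
  have i2 : Integrable ((BB n).indicator q) := by
    rw [integrable_indicator_iff measurableSet_ball]
    exact (hq.continuousOn.integrableOn_compact (isCompact_closedBall 0 1)).mono_set ball_subset_closedBall
  have e : (fun x => gB f x * q x) = fun x => f x * q x - (BB n).indicator q x := by
    ext x; unfold gB; by_cases hx : x ∈ BB n
    · simp only [indicator_of_mem hx]; ring
    · simp only [indicator_of_notMem hx]; ring
  rw [e]
  exact ⟨i1.sub i2, by rw [integral_sub i1 i2, integral_indicator measurableSet_ball]⟩

theorem exp_lip {a u v : ℝ} (hu : u ≤ a) (hv : v ≤ a) : |Real.exp u - Real.exp v| ≤ Real.exp a * |u - v| := by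
  have := Convex.norm_image_sub_le_of_norm_deriv_le (f := Real.exp) (s := Iic a) (C := Real.exp a) (x := v) (y := u)
    (fun x _ => Real.differentiableAt_exp) (fun x hx => by
      rw [Real.deriv_exp, Real.norm_eq_abs, abs_of_pos (Real.exp_pos _)]; exact Real.exp_le_exp.2 hx) (convex_Iic a) hv hu
  simpa using this

def Tst (K R0 R : ℝ) (h : Es k → ℝ) : Prop := ∃ (C : ℝ) (t : Es k → ℝ), 0 ≤ C ∧ Continuous t ∧
  (∀ x, ‖x‖ ≤ R → t x = h x) ∧ (∀ x, |t x| ≤ C) ∧ ∀ f d, Cen K R0 f d → |∫ x, gB f x * t x| ≤ C * √d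

theorem Tst_exp {K R0 R : ℝ} (hK : 0 ≤ K) (hR : 0 ≤ R) (ξ : Es k) : Tst K R0 R (fun x => Real.exp (inner ℝ ξ x)) := by
  obtain ⟨e, he, hξ⟩ : ∃ e : Es k, ‖e‖ = 1 ∧ ‖ξ‖ • e = ξ := by
    by_cases h : ξ = 0
    · exact ⟨EuclideanSpace.single 0 1, by simp, by simp [h]⟩
    · have : ‖ξ‖ ≠ 0 := by simpa using h
      refine ⟨‖ξ‖⁻¹ • ξ, by rw [norm_smul, norm_inv, norm_norm, inv_mul_cancel₀ this], by rw [smul_smul, mul_inv_cancel₀ this, one_smul]⟩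
  obtain ⟨r, hr⟩ : ∃ r, r = ‖ξ‖ := ⟨_, rfl⟩
  have hr0 : 0 ≤ r := hr ▸ norm_nonneg _
  rw [← hr] at hξ
  have hrR : 0 ≤ r * R := by positivity
  obtain ⟨q, hq⟩ : ∃ q : ℝ → ℝ, q = fun s => Real.exp (clip (r*R) (r*s)) := ⟨_, rfl⟩
  obtain ⟨M, hM⟩ : ∃ M, M = (1+r) * Real.exp (r*R) := ⟨_, rfl⟩
  have hM0 : 0 ≤ M := by rw [hM]; positivity
  have hc : Continuous q := by rw [hq]; exact Real.continuous_exp.comp ((clip_cont _).comp bfp)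
  have hM1 : Real.exp (r*R) ≤ M := by rw [hM]; nlinarith [Real.exp_pos (r*R)]
  have hle : ∀ s, clip (r*R) s ≤ r*R := fun s => (abs_le.1 (clip_abs hrR s)).2
  have hb : ∀ s, |q s| ≤ M := fun s => by
    rw [hq]; simp only [abs_of_pos (Real.exp_pos _)]
    exact (Real.exp_le_exp.2 (hle _)).trans hM1
  have hl : ∀ s t, |q s - q t| ≤ M * |s - t| := fun s t => by
    rw [hq]; simp only
    refine (exp_lip (hle _) (hle _)).trans ?_
    have h1 := clip_lip (r*R) (r*s) (r*t)
    rw [← mul_sub, abs_mul, abs_of_nonneg hr0] at h1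
    calc _ ≤ Real.exp (r*R) * (r * |s-t|) := by gcongr
      _ ≤ _ := by rw [hM]; nlinarith [mul_nonneg (Real.exp_pos (r*R)).le (abs_nonneg (s-t))]
  have hct : Continuous fun x : Es k => q (inner ℝ e x) := hc.comp bfp
  refine ⟨K * M + M, fun x => q (inner ℝ e x), by positivity, hct, ?_, ?_, ?_⟩
  · intro x hx
    have h1 : r * inner ℝ e x = inner ℝ ξ x := by rw [← hξ, real_inner_smul_left]
    rw [hq]; simp only [h1]
    rw [clip_id]
    refine (abs_real_inner_le_norm _ _).trans ?_
    rw [← hr]; gcongr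
  · intro x; exact (hb _).trans (by nlinarith [mul_nonneg hK hM0])
  · intro f d hf
    rw [(hf.df.adm.gB_intmul hct).2]
    refine (hf.pw e M q he hc hb hl).trans ?_
    nlinarith [mul_nonneg hM0 (Real.sqrt_nonneg d)]

def expMon (k : ℕ) : Submonoid C(Es k, ℝ) where
  carrier := {h | ∃ ξ : Es k, ∀ x, h x = Real.exp (inner ℝ ξ x)}
  mul_mem' := by
    rintro a b ⟨ξ, h1⟩ ⟨ζ, h2⟩
    exact ⟨ξ + ζ, fun x => by rw [inner_add_left, Real.exp_add, ContinuousMap.mul_apply, h1, h2]⟩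
  one_mem' := ⟨0, fun x => by simp⟩

theorem Tst_span {K R0 R : ℝ} (hK : 0 ≤ K) (hR : 0 ≤ R) {h : C(Es k, ℝ)}
    (hh : h ∈ Submodule.span ℝ (expMon k : Set C(Es k, ℝ))) : Tst K R0 R h := by
  induction hh using Submodule.span_induction with
  | mem x hx =>
    obtain ⟨ξ, h1⟩ := hx
    have : (x : Es k → ℝ) = fun x => Real.exp (inner ℝ ξ x) := funext h1
    rw [this]; exact Tst_exp hK hR ξ
  | zero => exact ⟨0, 0, le_rfl, continuous_const, fun x _ => rfl, by simp, by simp⟩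
  | add a b _ _ h1 h2 =>
    obtain ⟨C1, t1, p1, c1, e1, b1, i1⟩ := h1
    obtain ⟨C2, t2, p2, c2, e2, b2, i2⟩ := h2
    refine ⟨C1 + C2, fun x => t1 x + t2 x, by positivity, c1.add c2, fun x hx => by change t1 x + t2 x = a x + b x; rw [e1 x hx, e2 x hx],
      fun x => (abs_add_le _ _).trans (add_le_add (b1 x) (b2 x)), fun f d hf => ?_⟩
    simp only [mul_add]
    rw [integral_add (hf.df.adm.gB_intmul c1).1 (hf.df.adm.gB_intmul c2).1]
    refine (abs_add_le _ _).trans ?_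
    linarith [i1 f d hf, i2 f d hf]
  | smul a b _ h1 =>
    obtain ⟨C1, t1, p1, c1, e1, b1, i1⟩ := h1
    refine ⟨|a| * C1, fun x => a * t1 x, by positivity, c1.const_mul a, fun x hx => by change a * t1 x = a * b x; rw [e1 x hx],
      fun x => by rw [abs_mul]; exact ml (b1 x) (abs_nonneg _), fun f d hf => ?_⟩
    have : ∫ x, gB f x * (a * t1 x) = a * ∫ x, gB f x * t1 x := by
      rw [← integral_const_mul]; congr 1; ext x; ring
    rw [this, abs_mul, mul_assoc]
    exact ml (i1 f d hf) (abs_nonneg _)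

theorem M4a {K R0 : ℝ} (hK : 0 ≤ K) (hR0 : 1 ≤ R0) {F : Es k → ℝ} (hF : Continuous F)
    (hcs : HasCompactSupport F) {η : ℝ} (hη : 0 < η) : ∃ KF : ℝ, 0 ≤ KF ∧ ∀ f d, Cen K R0 f d → d ≤ 1 →
    |∫ x, gB f x * F x| ≤ KF * √d + η * ∫ x, |gB f x| := by
  obtain ⟨R1, hR1⟩ := hcs.isCompact.isBounded.subset_closedBall (0 : Es k)
  obtain ⟨CF, hCF⟩ := hcs.exists_bound_of_continuous hF
  set R := max R1 R0
  have hR : 0 ≤ R := by linarith [le_max_right R1 R0]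
  let A := Algebra.adjoin ℝ (expMon k : Set C(Es k, ℝ))
  have hsep : A.SeparatesPoints := by
    intro x y hxy
    refine ⟨fun z => Real.exp (inner ℝ (x-y) z), ⟨⟨fun z => Real.exp (inner ℝ (x-y) z), by fun_prop⟩, Algebra.subset_adjoin ⟨x-y, fun z => rfl⟩, rfl⟩, ?_⟩
    simp only [ne_eq, Real.exp_eq_exp]
    intro h
    have : inner ℝ (x-y) (x-y) = (0:ℝ) := by rw [inner_sub_right, h, sub_self]
    exact hxy (sub_eq_zero.1 (inner_self_eq_zero.1 this))
  obtain ⟨p, hpA, hp⟩ := ContinuousMap.exists_mem_subalgebra_near_continuous_of_isCompact_of_separatesPoints hsep ⟨F, hF⟩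
    (isCompact_closedBall (0 : Es k) R) hη
  have hps : p ∈ Submodule.span ℝ (expMon k : Set C(Es k, ℝ)) := by
    have : p ∈ Subalgebra.toSubmodule A := hpA
    rwa [Algebra.adjoin_eq_span, Submonoid.closure_eq] at this
  obtain ⟨C, t, hC, ct, et, bt, it⟩ := Tst_span (K := K) (R0 := R0) hK hR hps
  have hCF0 : 0 ≤ CF := (norm_nonneg _).trans (hCF 0)
  refine ⟨C + (CF + C) * K, by positivity, fun f d hf hd => ?_⟩
  have hme : MeasurableSet {x : Es k | R0 ≤ ‖x‖} := measurableSet_le measurable_const measurable_norm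
  have a := hf.df.adm
  have i1 := (a.gB_intmul hF).1
  have i2 := (a.gB_intmul ct).1
  have i3 := a.gB_int.abs
  have i4 := a.integrable.indicator hme
  have main : |(∫ x, gB f x * F x) - ∫ x, gB f x * t x| ≤ η * (∫ x, |gB f x|) + (CF + C) * ∫ x in {x | R0 ≤ ‖x‖}, f x := by
    rw [← integral_sub i1 i2, ← integral_indicator hme, ← integral_const_mul, ← integral_const_mul,
      ← integral_add (i3.const_mul _) (i4.const_mul _), ← Real.norm_eq_abs]
    refine norm_integral_le_of_norm_le ((i3.const_mul _).add (i4.const_mul _)) (evf fun x => ?_)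
    rw [← mul_sub, norm_mul, Real.norm_eq_abs, Real.norm_eq_abs]
    rcases le_or_gt ‖x‖ R with hx | hx
    · have h1 := hp x (by simpa using hx)
      rw [Real.norm_eq_abs, abs_sub_comm] at h1
      have h2 : |F x - t x| ≤ η := by rw [et x hx]; exact h1.le
      have h3 : 0 ≤ (CF + C) * indicator {x : Es k | R0 ≤ ‖x‖} f x :=
        mul_nonneg bpo (indicator_nonneg (fun x _ => a.nn x) _)
      nlinarith [ml h2 (abs_nonneg (gB f x))]
    · have h0 : R0 ≤ ‖x‖ := (le_max_right R1 R0).trans hx.le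
      rw [indicator_of_mem (show x ∈ {x : Es k | R0 ≤ ‖x‖} from h0), gB_out (hR0.trans h0), abs_of_nonneg (a.nn x)]
      have h2 : |F x - t x| ≤ CF + C := (abs_sub _ _).trans (add_le_add (hCF x) (bt x))
      nlinarith [ml h2 (a.nn x), mul_nonneg hη.le (a.nn x)]
  have h1 := it f d hf
  have h2 := hf.tail
  have h3 : (CF + C) * ∫ x in {x | R0 ≤ ‖x‖}, f x ≤ (CF + C) * (K * √d) := by
    refine ml (h2.trans ?_) bpo
    exact ml (sqrt_ge hf.df.dpos hd) hK
  have h4 := abs_sub_abs_le_abs_sub (∫ x, gB f x * F x) (∫ x, gB f x * t x)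
  linarith

theorem M4u {K R0 : ℝ} (hK : 0 ≤ K) (hR0 : 1 ≤ R0) {Y : Type*} [TopologicalSpace Y] {S : Set Y} (hS : IsCompact S)
    {F : Y → Es k → ℝ} (hF : Continuous (fun p : Y × Es k => F p.1 p.2)) {R : ℝ}
    (hcs : ∀ y x, R ≤ ‖x‖ → F y x = 0) {η : ℝ} (hη : 0 < η) : ∃ KF : ℝ, 0 ≤ KF ∧ ∀ y ∈ S, ∀ f d, Cen K R0 f d → d ≤ 1 →
    |∫ x, gB f x * F y x| ≤ KF * √d + η * ∫ x, |gB f x| := by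
  have hFy : ∀ y, Continuous (F y) := fun y => hF.comp (by fun_prop : Continuous fun x : Es k => (y, x))
  refine hS.induction_on (p := fun S => ∃ KF : ℝ, 0 ≤ KF ∧ ∀ y ∈ S, ∀ f d, Cen K R0 f d → d ≤ 1 →
    |∫ x, gB f x * F y x| ≤ KF * √d + η * ∫ x, |gB f x|) ⟨0, le_rfl, by simp⟩ ?_ ?_ ?_
  · rintro s t hst ⟨KF, h0, h1⟩; exact ⟨KF, h0, fun y hy => h1 y (hst hy)⟩
  · rintro s t ⟨K1, h1, h1'⟩ ⟨K2, h2, h2'⟩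
    refine ⟨K1 + K2, by positivity, ?_⟩
    rintro y (hy | hy) f d hf hd
    · nlinarith [h1' y hy f d hf hd, mul_nonneg h2 (Real.sqrt_nonneg d)]
    · nlinarith [h2' y hy f d hf hd, mul_nonneg h1 (Real.sqrt_nonneg d)]
  · intro y _
    have hc : HasCompactSupport (F y) := HasCompactSupport.intro (isCompact_closedBall (0 : Es k) R) fun x hx =>
      hcs y x (by simp at hx; exact hx.le)
    obtain ⟨KF, h0, h1⟩ := M4a hK hR0 (hFy y) hc (half_pos hη)
    have hev : ∀ᶠ z in nhds y, ∀ x ∈ closedBall (0 : Es k) R, |F z x - F y x| < η / 2 := by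
      refine (isCompact_closedBall (0 : Es k) R).eventually_forall_of_forall_eventually fun x _ => ?_
      have : Continuous fun p : Y × Es k => |F p.1 p.2 - F y p.2| := (hF.sub ((hFy y).comp continuous_snd)).abs
      exact this.continuousAt.eventually_lt continuousAt_const (by simp; linarith)
    refine ⟨_, mem_nhdsWithin_of_mem_nhds hev, KF, h0, fun z hz f d hf hd => ?_⟩
    have a := hf.df.adm
    have i1 := (a.gB_intmul (hFy z)).1
    have i2 := (a.gB_intmul (hFy y)).1
    have i3 := a.gB_int.abs
    have : |(∫ x, gB f x * F z x) - ∫ x, gB f x * F y x| ≤ η/2 * ∫ x, |gB f x| := by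
      rw [← integral_sub i1 i2, ← integral_const_mul, ← Real.norm_eq_abs]
      refine norm_integral_le_of_norm_le (i3.const_mul _) (evf fun x => ?_)
      rw [← mul_sub, norm_mul, Real.norm_eq_abs, Real.norm_eq_abs, mul_comm]
      refine mr ?_ (abs_nonneg _)
      rcases le_or_gt ‖x‖ R with hx | hx
      · exact (hz x (by simpa using hx)).le
      · rw [hcs z x hx.le, hcs y x hx.le]; simp; linarith
    have h4 := abs_sub_abs_le_abs_sub (∫ x, gB f x * F z x) (∫ x, gB f x * F y x)
    have := h1 f d hf hd
    linarith

noncomputable def phi (x : Eu n) : Eu n := (2 / (1 + ‖x‖^2)) • x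
noncomputable def bb (f : Eu n → ℝ) (x : Eu n) : ℝ := ‖fderiv ℝ f x‖ + fderiv ℝ f x (phi x)
noncomputable def beta (f : Eu n → ℝ) : ℝ := ∫ x, bb f x
noncomputable def wt (x : Eu n) : ℝ := min |1 - ‖x‖| 1
noncomputable def Gam (f : Eu n → ℝ) : ℝ := ∫ x, |gB f x| * wt x
noncomputable def Dv (x : Eu n) : ℝ := 2 * n / (1 + ‖x‖^2) - 4 * ‖x‖^2 / (1 + ‖x‖^2)^2

theorem phi_cont : Continuous (phi : Eu n → Eu n) := by
  unfold phi
  have : Continuous fun x : Eu n => 2 / (1 + ‖x‖^2) := continuous_const.div bfp (fun x => by positivity)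
  exact this.smul continuous_id

theorem Adm.bb_cont {f : Eu n → ℝ} (h : Adm f) : Continuous (bb f) :=
  h.fcont.norm.add (h.fcont.clm_apply phi_cont)

theorem Adm.bb_cs {f : Eu n → ℝ} (h : Adm f) : HasCompactSupport (bb f) := by
  refine h.fcs.mono fun x hx => ?_
  simp only [Function.mem_support, bb] at hx ⊢
  intro h0; apply hx; rw [h0]; simp

theorem Adm.bb_int {f : Eu n → ℝ} (h : Adm f) : Integrable (bb f) :=
  h.bb_cont.integrable_of_hasCompactSupport h.bb_cs

theorem bb_ge {f : Eu n → ℝ} {x v : Eu n} (h : ‖phi x + v‖ ≤ 1) : - fderiv ℝ f x v ≤ bb f x := by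
  have h1 := (fderiv ℝ f x).le_opNorm (phi x + v)
  rw [Real.norm_eq_abs, map_add] at h1
  have h2 := (abs_le.1 h1).1
  have h3 : ‖fderiv ℝ f x‖ * ‖phi x + v‖ ≤ ‖fderiv ℝ f x‖ := mul_le_of_le_one_right (norm_nonneg _) h
  unfold bb; linarith

theorem phi_norm (x : Eu n) : ‖phi x‖ = 2 * ‖x‖ / (1 + ‖x‖^2) := by
  unfold phi; rw [norm_smul, Real.norm_eq_abs, abs_of_pos bpo]; ring

theorem one_sub_phi (x : Eu n) : 1 - ‖phi x‖ = (1 - ‖x‖)^2 / (1 + ‖x‖^2) := by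
  rw [phi_norm]; field_simp; ring

theorem phi_le (x : Eu n) : ‖phi x‖ ≤ 1 := by
  have : 0 ≤ 1 - ‖phi x‖ := by rw [one_sub_phi]; positivity
  linarith

theorem bb_nonneg {f : Eu n → ℝ} (x : Eu n) : 0 ≤ bb f x := by
  have := bb_ge (f := f) (x := x) (v := 0) (by simpa using phi_le x)
  simpa using this

theorem bb_far {f : Eu n → ℝ} {x : Eu n} {ε : ℝ} (h0 : 0 < ε) (h1 : ε ≤ 1) (hx : ε ≤ |1 - ‖x‖|) :
    ε^2 * ‖fderiv ℝ f x‖ ≤ 5 * bb f x := by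
  have h2 : (1 - ‖phi x‖) * ‖fderiv ℝ f x‖ ≤ bb f x := by
    have h3 := (fderiv ℝ f x).le_opNorm (phi x)
    rw [Real.norm_eq_abs] at h3
    have := (abs_le.1 h3).1
    unfold bb; linarith
  have h4 : ε^2 ≤ 5 * (1 - ‖phi x‖) := by
    rw [one_sub_phi, mul_div_assoc', le_div_iff₀ bpo]
    set u := |1 - ‖x‖| with hu
    have hu2 : u^2 = (1-‖x‖)^2 := sq_abs _
    have hr : ‖x‖ ≤ 1 + u := by linarith [neg_abs_le (1 - ‖x‖)]
    have hr0 := norm_nonneg x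
    have hr2 : ‖x‖^2 ≤ (1+u)^2 := by gcongr
    have he2 : ε^2 ≤ u^2 := by gcongr
    have he1 : ε^2 ≤ 1 := by nlinarith
    rw [← hu2]
    rcases le_total u 1 with h | h
    · nlinarith [mul_le_mul he2 (show 1 + ‖x‖^2 ≤ 5 by nlinarith) bpo (sq_nonneg u)]
    · nlinarith [mul_le_mul he1 (show 1 + ‖x‖^2 ≤ 5*u^2 by nlinarith) bpo zero_le_one]
  nlinarith [mr h4 (norm_nonneg (fderiv ℝ f x))]

theorem euler_int {u : Eu n → ℝ} (hu : ContDiff ℝ 1 u) (hc : HasCompactSupport u) :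
    ∫ x, fderiv ℝ u x x = - (n * ∫ x, u x) := by
  have hfc : Continuous (fderiv ℝ u) := hu.continuous_fderiv one_ne_zero
  have hcs : HasCompactSupport (fderiv ℝ u) := hc.fderiv ℝ
  have hui : Integrable u := hu.continuous.integrable_of_hasCompactSupport hc
  have key : ∀ i : Fin n, Integrable (fun x : Eu n => x i * fderiv ℝ u x (EuclideanSpace.single i 1)) ∧
      ∫ x : Eu n, x i * fderiv ℝ u x (EuclideanSpace.single i 1) = - ∫ x, u x := by
    intro i
    have hd : ∀ x : Eu n, HasFDerivAt (fun x : Eu n => x i) (EuclideanSpace.proj i : Eu n →L[ℝ] ℝ) x :=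
      fun x => (EuclideanSpace.proj i : Eu n →L[ℝ] ℝ).hasFDerivAt
    have e1 : ∀ x : Eu n, fderiv ℝ (fun x : Eu n => x i) x (EuclideanSpace.single i 1) = 1 := fun x => by
      rw [(hd x).fderiv]; simp
    have i2 : Integrable (fun x : Eu n => x i * fderiv ℝ u x (EuclideanSpace.single i 1)) := by
      refine (Continuous.integrable_of_hasCompactSupport ?_ ?_)
      · exact Continuous.mul bfp (hfc.clm_apply continuous_const)
      · refine hcs.mono fun x hx => ?_
        simp only [Function.mem_support] at hx ⊢
        intro h0; apply hx; rw [h0]; simp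
    refine ⟨i2, ?_⟩
    have := integral_mul_fderiv_eq_neg_fderiv_mul_of_integrable (μ := (volume : Measure (Eu n)))
      (f := fun x : Eu n => x i) (g := u) (v := EuclideanSpace.single i 1) (by simp only [e1, one_mul]; exact hui) i2
      ((Continuous.mul bfp hu.continuous).integrable_of_hasCompactSupport hc.mul_left)
      (fun x _ => (hd x).differentiableAt) (fun x _ => hu.differentiable one_ne_zero x)
    simpa only [e1, one_mul] using this
  have e2 : ∀ x : Eu n, fderiv ℝ u x x = ∑ i, x i * fderiv ℝ u x (EuclideanSpace.single i 1) := by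
    intro x
    have := (EuclideanSpace.basisFun (Fin n) ℝ).sum_repr x
    generalize fderiv ℝ u x = Lx
    conv_lhs => rw [← this]
    rw [map_sum]; refine Finset.sum_congr rfl fun i _ => ?_
    rw [map_smul]; simp
  simp only [e2]
  rw [integral_finset_sum _ fun i _ => (key i).1]
  simp [(key _).2]

theorem int_phi {f : Eu n → ℝ} (h : Adm f) : ∫ x, fderiv ℝ f x (phi x) = - ∫ x, f x * Dv x := by
  have hX : ∀ x : Eu n, HasFDerivAt (fun x : Eu n => (1 + ‖x‖^2)⁻¹) (-((1+‖x‖^2)^2)⁻¹ • (2 • innerSL ℝ x)) x := fun x => by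
    have h1 : HasFDerivAt (fun x : Eu n => 1 + ‖x‖^2) (2 • innerSL ℝ x) x :=
      (hasStrictFDerivAt_norm_sq x).hasFDerivAt.const_add 1
    exact (hasDerivAt_inv bpo).comp_hasFDerivAt x h1
  have hcX : ContDiff ℝ 1 (fun x : Eu n => (1 + ‖x‖^2)⁻¹) := (contDiff_const.add (contDiff_norm_sq ℝ)).inv fun x => by positivity
  have hu := euler_int (h.cd.mul hcX) h.cs.mul_right
  have e1 : ∀ x : Eu n, fderiv ℝ (f * fun x : Eu n => (1 + ‖x‖^2)⁻¹) x x =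
     (1/2) * fderiv ℝ f x (phi x) - f x * (2 * ‖x‖^2/(1+‖x‖^2)^2) := by
    intro x
    rw [((h.diff x).hasFDerivAt.mul (hX x)).fderiv]
    simp only [phi, ContinuousLinearMap.add_apply, ContinuousLinearMap.smul_apply, map_smul, smul_eq_mul, innerSL_apply_apply,
      real_inner_self_eq_norm_sq]
    simp only [nsmul_eq_mul, Nat.cast_ofNat]
    field_simp; ring
  change ∫ x, fderiv ℝ (f * fun x : Eu n => (1 + ‖x‖^2)⁻¹) x x = -(n * ∫ x, f x * (1 + ‖x‖^2)⁻¹) at hu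
  simp only [e1] at hu
  have i1 : Integrable fun x => fderiv ℝ f x (phi x) := by
    refine (h.fcont.clm_apply phi_cont).integrable_of_hasCompactSupport (h.fcs.mono fun x hx => ?_)
    simp only [Function.mem_support] at hx ⊢
    intro h0; apply hx; rw [h0]; simp
  have c2 : Continuous fun x : Eu n => 2 * ‖x‖^2/(1+‖x‖^2)^2 := (by fun_prop : Continuous fun x : Eu n => 2 * ‖x‖^2).div bfp fun x => by positivity
  have i2 := h.intmul c2
  have i3 := h.intmul hcX.continuous
  rw [integral_sub (i1.const_mul _) i2, integral_const_mul] at hu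
  have e2 : ∫ x, f x * Dv x = 2 * n * (∫ x, f x * (1 + ‖x‖^2)⁻¹) - 2 * ∫ x, f x * (2 * ‖x‖^2/(1+‖x‖^2)^2) := by
    rw [← integral_const_mul, ← integral_const_mul, ← integral_sub (i3.const_mul _) (i2.const_mul _)]
    congr 1; ext x; unfold Dv; field_simp; ring
  linarith

theorem Dv_cont : Continuous (Dv : Eu n → ℝ) := by
  unfold Dv
  exact (continuous_const.div bfp fun x => by positivity).sub ((by fun_prop : Continuous fun x : Eu n => 4 * ‖x‖^2).div bfp fun x => by positivity)

theorem wt_cont : Continuous (wt : Eu n → ℝ) := by unfold wt; fun_prop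
theorem wt_nn (x : Eu n) : 0 ≤ wt x := le_min (abs_nonneg _) zero_le_one
theorem wt_le (x : Eu n) : wt x ≤ 1 := min_le_right _ _

theorem Dv_wt (x : Eu n) : |Dv x - (n - 1)| ≤ (2 * n + 10) * wt x := by
  obtain ⟨r, hr⟩ : ∃ r, r = ‖x‖ := ⟨_, rfl⟩
  have hr0 : 0 ≤ r := hr ▸ norm_nonneg _
  have e : Dv x - (n-1) = ((1 - r^2) / (2 * (1 + r^2))) * (2*n - 4 + 4 * (1/(1+r^2) + 1/2)) := by
    unfold Dv; rw [← hr]; field_simp; ring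
  have h1 : |(1 - r^2) / (2 * (1 + r^2))| ≤ wt x := by
    unfold wt; rw [← hr, abs_div, abs_of_pos (show 0 < 2*(1+r^2) by positivity), div_le_iff₀ bpo]
    rcases le_total |1-r| 1 with h | h
    · rw [min_eq_left h, show 1 - r^2 = (1-r)*(1+r) by ring, abs_mul, abs_of_nonneg (show 0 ≤ 1 + r by linarith)]
      exact ml (by nlinarith [sq_nonneg (r-1)]) (abs_nonneg _)
    · rw [min_eq_right h]; exact abs_le.2 ⟨by nlinarith, by nlinarith⟩
  have h2 : |2*(n:ℝ) - 4 + 4 * (1/(1+r^2) + 1/2)| ≤ 2*(n:ℝ)+10 := by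
    have : 1/(1+r^2) ≤ 1 := by rw [div_le_one bpo]; nlinarith
    have : 0 ≤ 1/(1+r^2) := by positivity
    have : (0:ℝ) ≤ n := n.cast_nonneg
    exact abs_le.2 ⟨by linarith, by linarith⟩
  rw [e, abs_mul, mul_comm]
  exact mul_le_mul h2 h1 (abs_nonneg _) bpo

theorem ball_Dv (hn : 2 ≤ n) : ∫ x in BB n, Dv x = n * om n := by
  have : Nontrivial (Eu n) := by
    have : Nonempty (Fin n) := ⟨⟨0, by omega⟩⟩
    infer_instance
  let h : ℝ → ℝ := fun r => 2 * n / (1 + r^2) - 4 * r^2 / (1 + r^2)^2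
  have e1 : ∫ x in BB n, Dv x = ∫ x : Eu n, (Iio (1:ℝ)).indicator h ‖x‖ := by
    rw [← integral_indicator measurableSet_ball]
    congr 1; ext x
    by_cases hx : ‖x‖ < 1
    · rw [indicator_of_mem (by simpa using hx), indicator_of_mem (by simpa using hx)]; rfl
    · rw [indicator_of_notMem (by simpa using hx), indicator_of_notMem (by simpa using hx)]
  rw [e1, integral_fun_norm_addHaar]
  have e2 : ∫ y in Ioi (0:ℝ), y^(Module.finrank ℝ (Eu n) - 1) • (Iio (1:ℝ)).indicator h y = ∫ y in (0:ℝ)..1, y^(n-1) * h y := by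
    rw [intervalIntegral.integral_of_le zero_le_one, integral_Ioc_eq_integral_Ioo, ← integral_indicator measurableSet_Ioo, ← integral_indicator measurableSet_Ioi]
    congr 1; ext y
    simp only [finrank_euclideanSpace, Fintype.card_fin, smul_eq_mul]
    by_cases h1 : 0 < y
    · by_cases h2 : y < 1
      · rw [indicator_of_mem (by simpa using h1), indicator_of_mem (by simpa using h2), indicator_of_mem (by simpa using ⟨h1, h2⟩)]
      · rw [indicator_of_mem (by simpa using h1), indicator_of_notMem (by simpa using h2), indicator_of_notMem (by simp; intro _; linarith)]; simp
    · rw [indicator_of_notMem (by simpa using h1), indicator_of_notMem (by simp; intro h3; linarith)]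
  have e3 : ∫ y in (0:ℝ)..1, y^(n-1) * h y = 1 := by
    have hd : ∀ y : ℝ, HasDerivAt (fun y => 2 * y^n / (1+y^2)) (y^(n-1) * h y) y := fun y => by
      have h1 : HasDerivAt (fun y : ℝ => 2 * y^n) (2 * (n * y^(n-1))) y := (hasDerivAt_pow n y).const_mul 2
      have h2 : HasDerivAt (fun y : ℝ => 1 + y^2) (2 * y) y := by simpa using (hasDerivAt_pow 2 y).const_add 1
      refine (h1.div h2 bpo).congr_deriv (Eq.symm ?_)
      have hp : y^n = y^(n-1) * y := by rw [← pow_succ]; congr 1; omega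
      rw [hp]
      change _ * (2 * n / (1 + y^2) - 4 * y^2 / (1 + y^2)^2) = _
      field_simp; ring
    have hc : Continuous fun y : ℝ => y^(n-1) * h y := by
      refine (continuous_pow _).mul ((continuous_const.div bfp fun x => by positivity).sub ((by fun_prop : Continuous fun x : ℝ => 4 * x^2).div bfp fun x => by positivity))
    rw [intervalIntegral.integral_eq_sub_of_hasDerivAt (fun y _ => hd y) (hc.intervalIntegrable _ _)]
    rw [zero_pow bom]; norm_num
  rw [e2, e3]; simp [om]

theorem Adm.Gam_int {f : Eu n → ℝ} (h : Adm f) : Integrable (fun x => |gB f x| * wt x) := by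
  refine h.gB_int.abs.mono' (h.gB_int.abs.aestronglyMeasurable.mul wt_cont.aestronglyMeasurable) (evf fun x => ?_)
  rw [norm_mul, Real.norm_eq_abs, Real.norm_eq_abs, abs_abs, abs_of_nonneg (wt_nn x)]
  exact mul_le_of_le_one_right (abs_nonneg _) (wt_le x)

theorem Gam_nn {f : Eu n → ℝ} : 0 ≤ Gam f := integral_nonneg fun x => mul_nonneg (abs_nonneg _) (wt_nn x)

theorem beta_nn {f : Eu n → ℝ} : 0 ≤ beta f := integral_nonneg fun x => bb_nonneg x

theorem gB_mean {f : Eu n → ℝ} (h : Adm f) : ∫ x, gB f x = (∫ x, f x) - om n := by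
  have := (h.gB_intmul (q := fun _ => 1) continuous_const).2
  simpa [om] using this

theorem beta_le (hn : 2 ≤ n) {f : Eu n → ℝ} {d : ℝ} (D : Def f d) : beta f ≤ n * d + (2*n+10) * Gam f := by
  have h := D.adm
  have i1 : Integrable fun x => fderiv ℝ f x (phi x) := by
    have := h.bb_int.sub h.tvint
    refine this.congr (evf fun x => ?_)
    simp [bb]
  have e1 : beta f = TV f - ∫ x, f x * Dv x := by
    unfold beta bb TV; rw [integral_add h.tvint i1, int_phi h]; ring
  obtain ⟨i2, e2⟩ := h.gB_intmul (Dv_cont (n := n))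
  rw [ball_Dv hn] at e2
  have e3 : (∫ x, gB f x * Dv x) = (∫ x, gB f x * (Dv x - (n-1))) + (n-1) * ((∫ x, f x) - om n) := by
    rw [← gB_mean h, ← integral_const_mul, ← integral_add (h.gB_intmul (q := fun x => Dv x - ((n:ℝ)-1)) (Dv_cont.sub continuous_const)).1 (h.gB_int.const_mul _)]
    congr 1; ext x; ring
  have e4 : |∫ x, gB f x * (Dv x - (n-1))| ≤ (2*n+10) * Gam f := by
    unfold Gam; rw [← integral_const_mul, ← Real.norm_eq_abs]
    refine norm_integral_le_of_norm_le (h.Gam_int.const_mul _) (evf fun x => ?_)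
    rw [norm_mul, Real.norm_eq_abs, Real.norm_eq_abs]
    nlinarith [ml (Dv_wt x) (abs_nonneg (gB f x))]
  have hv := (abs_le.1 D.vol).1
  have hn' : (0:ℝ) ≤ n - 1 := by
    have : (2:ℝ) ≤ n := by exact_mod_cast hn
    linarith
  have h5 := ml hv hn'
  have h6 := D.tv
  have h7 := (abs_le.1 e4).1
  linarith

theorem pow_shell (n : ℕ) {t : ℝ} (h0 : 0 ≤ t) (h1 : t ≤ 1) : (1+t)^n - (1-t)^n ≤ (2^n + n) * t := by
  have ha : (1+t)^n ≤ 1 + (2^n - 1) * t := by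
    induction n with
    | zero => simp
    | succ n ih =>
      have h2 : (1:ℝ) ≤ 2^n := one_le_pow₀ one_le_two
      rw [pow_succ, pow_succ]
      nlinarith [mr ih (show 0 ≤ 1 + t by linarith), mul_nonneg (sub_nonneg.2 h2) (mul_nonneg h0 (sub_nonneg.2 h1))]
  have hb := one_add_mul_le_pow (a := -t) bli n
  rw [← sub_eq_add_neg] at hb
  nlinarith

theorem L1_le {f : Eu n → ℝ} {d : ℝ} (D : Def f d) : ∫ x, |gB f x| ≤ 2 * om n + d := by
  have h := D.adm
  have : ∫ x, |gB f x| ≤ ∫ x, (f x + (BB n).indicator (fun _ => (1:ℝ)) x) := by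
    refine integral_mono h.gB_int.abs (h.integrable.add chiB_int) fun x => ?_
    have h1 : 0 ≤ (BB n).indicator (fun _ => (1:ℝ)) x := indicator_nonneg (fun _ _ => zero_le_one) _
    have := h.nn x
    simp only [gB]; exact abs_le.2 ⟨by linarith, by linarith⟩
  rw [integral_add h.integrable chiB_int, integral_indicator measurableSet_ball] at this
  have h2 : ∫ x in BB n, (1:ℝ) = om n := by simp [om]
  have := (abs_le.1 D.vol).2
  linarith

theorem bath (hn : 1 ≤ n) : ∃ C : ℝ, 0 < C ∧ ∀ g : Eu n → ℝ, Integrable g → (∀ x, |g x| ≤ 1) → ∫ x, |g x| ≤ 3 * om n →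
    Integrable (fun x => |g x| * wt x) → (∫ x, |g x|)^2 ≤ C * ∫ x, |g x| * wt x := by
  have hω := om_pos n
  obtain ⟨C, hC⟩ : ∃ C, C = (2^n + n) * om n + 3 * om n := ⟨_, rfl⟩
  have hC0 : 0 < C := by rw [hC]; positivity
  refine ⟨4*C, by positivity, fun g gi gb g3 wi => ?_⟩
  set G := ∫ x, |g x|
  have hG : 0 ≤ G := integral_nonneg fun x => abs_nonneg _
  obtain ⟨t, ht⟩ : ∃ t, t = G / (2*C) := ⟨_, rfl⟩
  have ht0 : 0 ≤ t := by rw [ht]; positivity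
  have ht1 : t ≤ 1 := by
    rw [ht, div_le_one bpo, hC]
    nlinarith [mul_pos (show (0:ℝ) < 2^n + n by positivity) hω]
  have hms : MeasurableSet (ball (0 : Eu n) (1+t) \ ball (0 : Eu n) (1-t)) := measurableSet_ball.diff measurableSet_ball
  have hsf : volume (ball (0 : Eu n) (1+t) \ ball (0 : Eu n) (1-t)) ≠ ⊤ :=
    ((measure_mono sdiff_subset).trans_lt measure_ball_lt_top).ne
  have hvol : (volume : Measure (Eu n)).real (ball (0 : Eu n) (1+t) \ ball (0 : Eu n) (1-t)) ≤ C * t := by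
    rw [measureReal_diff (ball_subset_ball bli) measurableSet_ball (measure_ball_lt_top.ne), vol_ball _ bli hn, vol_ball _ bli hn, hC]
    nlinarith [mr (pow_shell n ht0 ht1) hω.le, mul_nonneg hω.le ht0]
  have i3 : Integrable ((ball (0 : Eu n) (1+t) \ ball (0 : Eu n) (1-t)).indicator (fun _ => (1:ℝ))) :=
    (integrable_indicator_iff hms).2 (integrableOn_const hsf)
  have key : t * (G - C * t) ≤ ∫ x, |g x| * wt x := by
    calc t * (G - C * t) ≤ t * (G - (volume : Measure (Eu n)).real (ball (0 : Eu n) (1+t) \ ball (0 : Eu n) (1-t))) := by gcongr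
      _ = ∫ x, t * (|g x| - (ball (0 : Eu n) (1+t) \ ball (0 : Eu n) (1-t)).indicator (fun _ => (1:ℝ)) x) := by
          rw [integral_const_mul, integral_sub gi.abs i3, integral_indicator hms]; simp [G]
      _ ≤ _ := by
          refine integral_mono ((gi.abs.sub i3).const_mul _) wi fun x => ?_
          by_cases hx : x ∈ ball (0 : Eu n) (1+t) \ ball (0 : Eu n) (1-t)
          · simp only [indicator_of_mem hx]
            have := mul_nonneg (abs_nonneg (g x)) (wt_nn x)
            nlinarith [gb x]
          · simp only [indicator_of_notMem hx, sub_zero]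
            rw [mul_comm]
            refine ml ?_ (abs_nonneg _)
            refine le_min ?_ ht1
            simp only [mem_sdiff, mem_ball, dist_zero_right, not_and, not_not] at hx
            by_contra hh
            push Not at hh
            have := abs_lt.1 hh
            linarith [hx bli]
  have : t * (G - C*t) = G^2 / (4*C) := by rw [ht]; field_simp; ring
  rw [this, div_le_iff₀ bpo] at key
  linarith

theorem line_up {h h' B : ℝ → ℝ} {a b : ℝ} (hab : a ≤ b) (hd : ∀ x ∈ Icc a b, HasDerivAt h (h' x) x)
    (hB : Continuous B) (hle : ∀ x ∈ Icc a b, h' x ≤ B x) : h b - h a ≤ ∫ x in Icc a b, B x := by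
  have hBd : ∀ x, HasDerivAt (fun x => h a + ∫ t in a..x, B t) (B x) x := fun x =>
    (intervalIntegral.integral_hasDerivAt_right (hB.intervalIntegrable _ _) (hB.stronglyMeasurableAtFilter _ _) hB.continuousAt).const_add _
  have := image_le_of_deriv_right_le_deriv_boundary (f := h) (f' := h') (B := fun x => h a + ∫ t in a..x, B t) (B' := B) (a := a) (b := b)
    (fun x hx => (hd x hx).continuousAt.continuousWithinAt) (fun x hx => (hd x ⟨hx.1, hx.2.le⟩).hasDerivWithinAt) (by simp)
    (fun x hx => (hBd x).continuousAt.continuousWithinAt) (fun x hx => (hBd x).hasDerivWithinAt) (fun x hx => hle x ⟨hx.1, hx.2.le⟩) (right_mem_Icc.2 hab)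
  rw [intervalIntegral.integral_of_le hab, ← integral_Icc_eq_integral_Ioc] at this
  linarith

theorem line_abs {h h' B : ℝ → ℝ} {a b : ℝ} (hab : a ≤ b) (hd : ∀ x ∈ Icc a b, HasDerivAt h (h' x) x)
    (hB : Continuous B) (hle : ∀ x ∈ Icc a b, |h' x| ≤ B x) : |h b - h a| ≤ ∫ x in Icc a b, B x := by
  have h1 := line_up hab hd hB fun x hx => (le_abs_self _).trans (hle x hx)
  have h2 := line_up (h := fun x => - h x) hab (fun x hx => (hd x hx).neg) hB fun x hx => (neg_le_abs _).trans (hle x hx)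
  exact abs_le.2 ⟨by linarith, h1⟩

section
variable {X Y : Type*} [TopologicalSpace X] [MeasurableSpace X] [OpensMeasurableSpace X] [TopologicalSpace Y] [MeasurableSpace Y] [OpensMeasurableSpace Y]
  [SecondCountableTopology X] [SecondCountableTopology Y] [T2Space X] [T2Space Y]

theorem cc_int {μ : Measure X} {ν : Measure Y} [SFinite μ] [SFinite ν] [IsFiniteMeasureOnCompacts μ] [IsFiniteMeasureOnCompacts ν]
    {g : X → Y → ℝ} (hg : Continuous (Function.uncurry g)) {S : Set X} {T : Set Y} (hS : IsCompact S) (hT : IsCompact T) :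
    Integrable (Function.uncurry g) ((μ.restrict S).prod (ν.restrict T)) := by
  rw [Measure.prod_restrict]
  obtain ⟨C, hC⟩ := (hS.prod hT).exists_bound_of_continuousOn hg.continuousOn
  refine Measure.integrableOn_of_bounded (M := C) ?_ (hg.measurable.aestronglyMeasurable) ?_
  · rw [Measure.prod_prod]; exact ENNReal.mul_ne_top hS.measure_lt_top.ne hT.measure_lt_top.ne
  · exact (ae_restrict_iff' (hS.measurableSet.prod hT.measurableSet)).2 (evf fun x hx => hC x hx)

theorem swap_cc {μ : Measure X} {ν : Measure Y} [SFinite μ] [SFinite ν] [IsFiniteMeasureOnCompacts μ] [IsFiniteMeasureOnCompacts ν]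
    {g : X → Y → ℝ} (hg : Continuous (Function.uncurry g)) {S : Set X} {T : Set Y} (hS : IsCompact S) (hT : IsCompact T) :
    ∫ x in S, ∫ y in T, g x y ∂ν ∂μ = ∫ y in T, ∫ x in S, g x y ∂μ ∂ν :=
  integral_integral_swap (cc_int hg hS hT)
end

theorem trans_le {B : Eu n → ℝ} (hB : Continuous B) (h0 : ∀ x, 0 ≤ B x) {A S : Set (Eu n)} (hA : IsCompact A)
    (hS : MeasurableSet S) (hi : IntegrableOn B S) (v : Eu n) (hv : ∀ x ∈ A, x + v ∈ S) :
    ∫ x in A, B (x + v) ≤ ∫ x in S, B x := by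
  rw [← integral_indicator hA.measurableSet, ← integral_indicator hS, ← integral_add_right_eq_self (S.indicator B) v]
  refine integral_mono ?_ ?_ fun x => ?_
  · rw [integrable_indicator_iff hA.measurableSet]
    exact (hB.comp bfp).continuousOn.integrableOn_compact hA
  · exact ((integrable_indicator_iff hS).2 hi).comp_add_right v
  · by_cases hx : x ∈ A
    · simp only [indicator_of_mem hx, indicator_of_mem (hv x hx)]; exact le_rfl
    · simp only [indicator_of_notMem hx]; exact indicator_nonneg (fun x _ => h0 x) _

theorem duo_le {B : Eu n → ℝ} (hB : Continuous B) (h0 : ∀ x, 0 ≤ B x) {A S Z : Set (Eu n)} (hA : IsCompact A)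
    (hS : MeasurableSet S) (hi : IntegrableOn B S) (hZ : IsCompact Z) {ρ : Eu n → ℝ} (hρ : Continuous ρ) (hρ0 : ∀ z, 0 ≤ ρ z)
    (hv : ∀ x ∈ A, ∀ z ∈ Z, x + z ∈ S) :
    ∫ x in A, ∫ z in Z, ρ z * B (x + z) ≤ (∫ z in Z, ρ z) * ∫ x in S, B x := by
  rw [swap_cc (by unfold Function.uncurry; fun_prop) hA hZ, ← integral_mul_const]
  have hc : Continuous fun z => ∫ x in A, ρ z * B (x+z) :=
    continuous_parametric_integral_of_continuous (by unfold Function.uncurry; fun_prop) hA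
  refine setIntegral_mono_on (hc.continuousOn.integrableOn_compact hZ) ((hρ.continuousOn.integrableOn_compact hZ).mul_const _) hZ.measurableSet fun z hz => ?_
  rw [integral_const_mul]
  exact ml (trans_le hB h0 hA hS hi z fun x hx => hv x hx z hz) (hρ0 z)

theorem tri_le {B : Eu n → ℝ} (hB : Continuous B) (h0 : ∀ x, 0 ≤ B x) {A S Z : Set (Eu n)} (hA : IsCompact A)
    (hS : MeasurableSet S) (hi : IntegrableOn B S) (hZ : IsCompact Z) {ρ : Eu n → ℝ} (hρ : Continuous ρ) (hρ0 : ∀ z, 0 ≤ ρ z)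
    (hv : ∀ x ∈ A, ∀ z ∈ Z, ∀ t ∈ Icc (0:ℝ) 1, x + t • z ∈ S) :
    ∫ x in A, ∫ z in Z, ρ z * ∫ t in Icc (0:ℝ) 1, B (x + t • z) ≤ (∫ z in Z, ρ z) * ∫ x in S, B x := by
  have hc1 : Continuous (Function.uncurry fun (x z : Eu n) => ρ z * ∫ t in Icc (0:ℝ) 1, B (x + t • z)) := by
    refine (hρ.comp continuous_snd).mul ?_
    exact continuous_parametric_integral_of_continuous (f := fun (p : Eu n × Eu n) t => B (p.1 + t • p.2)) (by unfold Function.uncurry; fun_prop) isCompact_Icc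
  rw [swap_cc hc1 hA hZ, ← integral_mul_const]
  have hc : Continuous fun z => ∫ x in A, ρ z * ∫ t in Icc (0:ℝ) 1, B (x + t • z) :=
    continuous_parametric_integral_of_continuous (f := fun z x => ρ z * ∫ t in Icc (0:ℝ) 1, B (x + t • z)) (hc1.comp continuous_swap) hA
  refine setIntegral_mono_on (hc.continuousOn.integrableOn_compact hZ) ((hρ.continuousOn.integrableOn_compact hZ).mul_const _) hZ.measurableSet fun z hz => ?_
  rw [integral_const_mul]
  refine ml ?_ (hρ0 z)
  rw [swap_cc (by unfold Function.uncurry; fun_prop) hA isCompact_Icc]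
  have hc3 : Continuous fun t : ℝ => ∫ x in A, B (x + t • z) :=
    continuous_parametric_integral_of_continuous (by unfold Function.uncurry; fun_prop) hA
  calc _ ≤ ∫ t in Icc (0:ℝ) 1, ∫ x in S, B x :=
        setIntegral_mono_on (hc3.continuousOn.integrableOn_compact isCompact_Icc) (integrableOn_const (by simp)) measurableSet_Icc
          fun t ht => trans_le hB h0 hA hS hi (t • z) fun x hx => hv x hx z hz t ht
    _ = _ := by simp

theorem exists_bump (n : ℕ) {r : ℝ} (hr : 0 < r) : ∃ ρ : Eu n → ℝ, Continuous ρ ∧ (∀ z, 0 ≤ ρ z) ∧ (∀ z, r ≤ ‖z‖ → ρ z = 0) ∧ ∫ z, ρ z = 1 ∧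
    ∫ z in closedBall 0 r, ρ z = 1 := by
  let b : ContDiffBump (0 : Eu n) := ⟨r/2, r, by positivity, by linarith⟩
  have h3 : ∀ z, r ≤ ‖z‖ → b.normed volume z = 0 := fun z hz => by
    have : z ∉ Function.support (b.normed volume) := by
      rw [b.support_normed_eq]; simpa [b] using hz
    simpa using this
  refine ⟨b.normed volume, b.continuous_normed, b.nonneg_normed, h3, b.integral_normed, ?_⟩
  rw [← b.integral_normed (μ := volume)]
  refine setIntegral_eq_integral_of_forall_compl_eq_zero fun z hz => h3 z ?_
  simp at hz; exact hz.le

theorem half_aux {f u : ℝ} (f0 : 0 ≤ f) (f1 : f ≤ 1) (hu : |u| ≤ 1/4) : f ≤ 4 * |f - u| + 2 * (f * (1 - f)) := by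
  have a := abs_le.1 hu
  rcases le_total f (1/2) with h | h
  · nlinarith [abs_nonneg (f-u)]
  · have := le_abs_self (f - u)
    nlinarith

theorem half_aux' {f u : ℝ} (f0 : 0 ≤ f) (f1 : f ≤ 1) (hu : |u - 1| ≤ 1/4) : 1 - f ≤ 4 * |f - u| + 2 * (f * (1 - f)) := by
  have := half_aux (f := 1 - f) (u := 1 - u) bli bli (by rwa [abs_sub_comm])
  rw [show 1 - f - (1 - u) = -(f - u) by ring, abs_neg] at this
  linarith

theorem moll_le {f : Eu n → ℝ} (h : Adm f) {ε ε' : ℝ} (hε : 0 < ε) (hε1 : ε ≤ 1) (h0 : 0 < ε') (h2 : ε' ≤ ε/2)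
    {x z : Eu n} (hx : ε ≤ |1 - ‖x‖|) (hz : ‖z‖ ≤ ε') :
    |f (x+z) - f x| ≤ ε' * (20/ε^2) * ∫ t in Icc (0:ℝ) 1, bb f (x + t • z) := by
  have hd : ∀ t ∈ Icc (0:ℝ) 1, HasDerivAt (fun t : ℝ => f (x + t • z)) (fderiv ℝ f (x + t • z) z) t := fun t _ => by
    have h1 : HasDerivAt (fun t : ℝ => x + t • z) z t := by
      simpa using ((hasDerivAt_id t).smul_const z).const_add x
    exact (h.diff.differentiableAt (x := x + t • z)).hasFDerivAt.comp_hasDerivAt t h1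
  have hb : Continuous fun t : ℝ => ε' * (20/ε^2) * bb f (x + t • z) :=
    continuous_const.mul (h.bb_cont.comp bfp)
  have := line_abs zero_le_one hd hb fun t ht => by
    have h3 : ‖t • z‖ ≤ ε/2 := by
      rw [norm_smul, Real.norm_of_nonneg ht.1]
      calc t * ‖z‖ ≤ 1 * ‖z‖ := by gcongr; exact ht.2
        _ ≤ ε/2 := by linarith
    have h4 : ε/2 ≤ |1 - ‖x + t • z‖| := by
      have h5 := abs_norm_sub_norm_le (x + t • z) x
      rw [add_sub_cancel_left] at h5
      have h6 := abs_sub_abs_le_abs_sub (1 - ‖x‖) (1 - ‖x + t • z‖)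
      rw [show 1 - ‖x‖ - (1 - ‖x + t • z‖) = ‖x + t • z‖ - ‖x‖ by ring] at h6
      linarith
    have h7 := bb_far (f := f) bli bli h4
    have h8 : ‖fderiv ℝ f (x + t • z)‖ ≤ 20/ε^2 * bb f (x + t • z) := by
      rw [div_mul_eq_mul_div, le_div_iff₀ bpo]; linarith
    calc |fderiv ℝ f (x + t • z) z| ≤ ‖fderiv ℝ f (x + t • z)‖ * ‖z‖ := (fderiv ℝ f (x + t • z)).le_opNorm z
      _ ≤ (20/ε^2 * bb f (x + t • z)) * ε' := by
        apply mul_le_mul h8 hz (norm_nonneg _) ((norm_nonneg _).trans h8)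
      _ = _ := by ring
  simp only [one_smul, zero_smul, add_zero] at this
  rwa [integral_const_mul] at this

theorem Far {K R0 ε δ : ℝ} (hK : 0 ≤ K) (hR0 : 1 ≤ R0) (hε : 0 < ε) (hε1 : ε ≤ 1) (hδ : 0 < δ) :
    ∃ K1 d1 : ℝ, 0 < K1 ∧ 0 < d1 ∧ ∀ (f : Es k → ℝ) (d : ℝ), Cen K R0 f d → d ≤ d1 →
      ∫ x in {x | ε ≤ |1 - ‖x‖|}, |gB f x| ≤ δ * beta f + K1 * d := by
  obtain ⟨ε', hε'⟩ : ∃ e, e = min (ε/2) (δ*ε^2/80) := ⟨_, rfl⟩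
  have e0 : 0 < ε' := by rw [hε']; positivity
  have e1 : ε' ≤ ε/2 := by rw [hε']; exact min_le_left _ _
  have e2 : 4 * (ε' * (20/ε^2)) ≤ δ := by
    have : ε' ≤ δ*ε^2/80 := by rw [hε']; exact min_le_right _ _
    calc 4 * (ε' * (20/ε^2)) ≤ 4 * (δ*ε^2/80 * (20/ε^2)) := by gcongr
      _ = δ := by field_simp; ring
  obtain ⟨ρ, rc, r0, rz, r1, r2⟩ := exists_bump (k+1) e0
  have hω := om_pos (k+1)
  obtain ⟨KF, hKF, hM⟩ := M4u (k := k) hK hR0 (Y := closedBall (0 : Es k) R0) (S := univ) isCompact_univ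
    (F := fun y x => ρ (x - y)) bfp (R := R0 + ε') (fun y x hx => rz _ (by
      have := norm_sub_norm_le x y
      have hy : ‖(y : Es k)‖ ≤ R0 := mem_closedBall_zero_iff.1 y.2
      linarith)) (η := 1/(24 * om (k+1))) bpo
  obtain ⟨d1, hd1⟩ : ∃ d1, d1 = min (min 1 (om (k+1))) ((1/(8*(KF+1)))^2) := ⟨_, rfl⟩
  refine ⟨2+K, d1, by positivity, by rw [hd1]; positivity, fun f d C hd => ?_⟩
  have h := C.df.adm
  have dp := C.df.dpos
  have da : d ≤ 1 := hd.trans (by rw [hd1]; exact (min_le_left _ _).trans (min_le_left _ _))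
  have db : d ≤ om (k+1) := hd.trans (by rw [hd1]; exact (min_le_left _ _).trans (min_le_right _ _))
  have dc : √d ≤ 1/(8*(KF+1)) := by
    rw [Real.sqrt_le_left bpo]
    exact hd.trans (by rw [hd1]; exact min_le_right _ _)
  have hsm : KF * √d + 1/(24 * om (k+1)) * ∫ x, |gB f x| ≤ 1/4 := by
    have a1 : KF * √d ≤ 1/8 := by
      calc KF * √d ≤ (KF+1) * (1/(8*(KF+1))) := by gcongr; linarith
        _ = 1/8 := by field_simp
    have a2 : 1/(24 * om (k+1)) * ∫ x, |gB f x| ≤ 1/8 := by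
      calc _ ≤ 1/(24 * om (k+1)) * (3 * om (k+1)) := by gcongr; linarith [L1_le C.df]
        _ = 1/8 := by field_simp; norm_num
    linarith
  set Z := closedBall (0 : Es k) ε' with hZ
  have hZc : IsCompact Z := isCompact_closedBall _ _
  set A : Set (Es k) := {x | ε ≤ |1 - ‖x‖|} ∩ closedBall 0 R0 with hA
  have hAcl : IsClosed {x : Es k | ε ≤ |1 - ‖x‖|} := isClosed_le continuous_const bfp
  have hAc : IsCompact A := (isCompact_closedBall _ _).inter_left hAcl
  set I : Es k → ℝ := fun x => ∫ z in Z, ρ z * ∫ t in Icc (0:ℝ) 1, bb f (x + t • z) with hI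
  have hIc : Continuous I := by
    refine continuous_parametric_integral_of_continuous ?_ hZc
    refine (rc.comp continuous_snd).mul ?_
    exact continuous_parametric_integral_of_continuous (f := fun (p : Es k × Es k) t => bb f (p.1 + t • p.2)) (h.bb_cont.comp bfp) isCompact_Icc
  have hI2 : ∫ x in A, I x ≤ beta f := by
    have := tri_le h.bb_cont (bb_nonneg (f := f)) hAc MeasurableSet.univ h.bb_int.integrableOn hZc rc r0 (fun _ _ _ _ _ _ => mem_univ _)
    rw [r2, one_mul, setIntegral_univ] at this
    exact this
  have key : ∀ x ∈ A, |gB f x| ≤ 4 * (ε' * (20/ε^2) * I x) + 2 * (f x * (1 - f x)) := by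
    rintro x ⟨hx, hxR⟩
    obtain ⟨u, hu⟩ : ∃ u, u = ∫ z in Z, ρ z * f (x + z) := ⟨_, rfl⟩
    have iz : ∀ {q : Es k → ℝ}, Continuous q → IntegrableOn q Z := fun hq => hq.continuousOn.integrableOn_compact hZc
    have fc := h.cont
    have bc := h.bb_cont
    have hfu : |f x - u| ≤ ε' * (20/ε^2) * I x := by
      have a1 : f x - u = ∫ z in Z, ρ z * (f x - f (x+z)) := by
        have : f x = ∫ z in Z, ρ z * f x := by rw [integral_mul_const, r2, one_mul]
        rw [hu]; nth_rewrite 1 [this]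
        rw [← integral_sub (iz bfp) (iz bfp)]
        exact integral_congr_ae (evf fun z => by ring)
      rw [a1, hI, ← integral_const_mul, ← Real.norm_eq_abs]
      have hc : Continuous fun z => ∫ t in Icc (0:ℝ) 1, bb f (x + t • z) :=
        continuous_parametric_integral_of_continuous (f := fun z (t : ℝ) => bb f (x + t • z)) (h.bb_cont.comp bfp) isCompact_Icc
      refine norm_integral_le_of_norm_le (iz bfp) ?_
      refine (ae_restrict_iff' hZc.measurableSet).2 (evf fun z hz => ?_)
      rw [norm_mul, Real.norm_of_nonneg (r0 z), Real.norm_eq_abs, abs_sub_comm]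
      have := moll_le h hε hε1 e0 e1 hx (z := z) (by simpa [hZ] using hz)
      calc ρ z * |f (x+z) - f x| ≤ ρ z * (ε' * (20/ε^2) * ∫ t in Icc (0:ℝ) 1, bb f (x + t • z)) := by gcongr; exact r0 z
        _ = _ := by ring
    have hg := hM ⟨x, hxR⟩ (mem_univ _) f d C da
    have hg1 : ∫ y, gB f y * ρ (y - x) = ∫ z in Z, gB f (x + z) * ρ z := by
      rw [← integral_add_left_eq_self (fun y => gB f y * ρ (y - x)) x, ← integral_indicator hZc.measurableSet]
      refine integral_congr_ae (evf fun z => ?_)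
      by_cases hz : z ∈ Z
      · simp [indicator_of_mem hz]
      · simp only [indicator_of_notMem hz, add_sub_cancel_left]
        rw [rz z (by simp [hZ] at hz; exact hz.le), mul_zero]
    have hg2 := hg.trans hsm
    change |∫ y, gB f y * ρ (y - x)| ≤ 1/4 at hg2
    rw [hg1] at hg2
    have hnear : ∀ z ∈ Z, |‖x + z‖ - ‖x‖| ≤ ε/2 := fun z hz => by
      have h5 := abs_norm_sub_norm_le (x + z) x
      rw [add_sub_cancel_left] at h5
      have : ‖z‖ ≤ ε' := by simpa [hZ] using hz
      linarith
    rcases le_total 1 ‖x‖ with h1 | h1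
    · have hx' : 1 + ε ≤ ‖x‖ := by
        rw [mem_setOf_eq, abs_of_nonpos bli] at hx; linarith
      have : ∫ z in Z, gB f (x + z) * ρ z = u := by
        rw [hu]; refine setIntegral_congr_fun hZc.measurableSet fun z hz => ?_
        have := abs_le.1 (hnear z hz)
        change gB f (x+z) * ρ z = _
        rw [gB_out bli, mul_comm]
      rw [this] at hg2
      rw [gB_out h1, abs_of_nonneg (h.nn x)]
      have := half_aux (h.nn x) (h.le x) hg2
      linarith
    · have hx' : ‖x‖ ≤ 1 - ε := by
        rw [mem_setOf_eq, abs_of_nonneg bli] at hx; linarith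
      have : ∫ z in Z, gB f (x + z) * ρ z = u - 1 := by
        rw [hu]; nth_rewrite 1 [← r2]
        rw [← integral_sub (iz bfp) (iz bfp)]
        refine setIntegral_congr_fun hZc.measurableSet fun z hz => ?_
        have := abs_le.1 (hnear z hz)
        change gB f (x+z) * ρ z = _
        rw [gB_in bli]; ring
      rw [this] at hg2
      rw [gB_in bli, abs_sub_comm, abs_of_nonneg (by linarith [h.le x])]
      have := half_aux' (h.nn x) (h.le x) hg2
      linarith
  have gi := h.gB_int.abs
  have hsq := sq_int h
  have step : ∫ x in A, |gB f x| ≤ δ * beta f + 2 * d := by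
    have b1 : ∫ x in A, |gB f x| ≤ ∫ x in A, (4 * (ε' * (20/ε^2) * I x) + 2 * (f x * (1 - f x))) := by
      refine setIntegral_mono_on gi.integrableOn ?_ hAc.measurableSet key
      exact ((((hIc.continuousOn.integrableOn_compact hAc).const_mul _).const_mul _)).add (hsq.integrableOn.const_mul _)
    rw [integral_add (((hIc.continuousOn.integrableOn_compact hAc).const_mul _).const_mul _) (hsq.integrableOn.const_mul _),
      integral_const_mul, integral_const_mul, integral_const_mul] at b1
    have b2 : ∫ x in A, f x * (1 - f x) ≤ d :=
      (setIntegral_le_integral hsq (evf fun x => mul_nonneg (h.nn x) (by linarith [h.le x]))).trans C.df.bd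
    have b3 : 4 * (ε' * (20/ε^2) * ∫ x in A, I x) ≤ δ * beta f := by
      calc _ ≤ 4 * (ε' * (20/ε^2) * beta f) := by gcongr
        _ = 4 * (ε' * (20/ε^2)) * beta f := by ring
        _ ≤ _ := by gcongr; exact beta_nn
    linarith
  have hT : MeasurableSet {x : Es k | R0 ≤ ‖x‖} := (isClosed_le continuous_const bfp).measurableSet
  have tl : ∫ x in {x : Es k | R0 ≤ ‖x‖}, |gB f x| ≤ K * d := by
    refine le_trans (le_of_eq ?_) C.tail
    refine setIntegral_congr_fun hT fun x hx => ?_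
    change |gB f x| = f x
    rw [gB_out (hR0.trans hx), abs_of_nonneg (h.nn x)]
  have un : ∫ x in {x : Es k | ε ≤ |1 - ‖x‖|}, |gB f x| ≤ (∫ x in A, |gB f x|) + ∫ x in {x : Es k | R0 ≤ ‖x‖}, |gB f x| := by
    rw [← integral_indicator hAcl.measurableSet, ← integral_indicator hAc.measurableSet, ← integral_indicator hT,
      ← integral_add ((integrable_indicator_iff hAc.measurableSet).2 gi.integrableOn) ((integrable_indicator_iff hT).2 gi.integrableOn)]
    refine integral_mono ((integrable_indicator_iff hAcl.measurableSet).2 gi.integrableOn)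
      (((integrable_indicator_iff hAc.measurableSet).2 gi.integrableOn).add ((integrable_indicator_iff hT).2 gi.integrableOn)) fun x => ?_
    have n1 : 0 ≤ A.indicator (fun x => |gB f x|) x := indicator_nonneg (fun _ _ => abs_nonneg _) _
    have n2 : 0 ≤ {x : Es k | R0 ≤ ‖x‖}.indicator (fun x => |gB f x|) x := indicator_nonneg (fun _ _ => abs_nonneg _) _
    by_cases hx : ε ≤ |1 - ‖x‖|
    · change {x : Es k | ε ≤ |1 - ‖x‖|}.indicator (fun x => |gB f x|) x ≤ _
      rw [indicator_of_mem (show x ∈ {x : Es k | ε ≤ |1 - ‖x‖|} from hx)]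
      rcases le_total R0 ‖x‖ with hr | hr
      · rw [indicator_of_mem (show x ∈ {x : Es k | R0 ≤ ‖x‖} from hr)] at *; linarith
      · rw [indicator_of_mem (show x ∈ A from ⟨hx, by simpa using hr⟩)] at *; linarith
    · rw [indicator_of_notMem (show x ∉ {x : Es k | ε ≤ |1 - ‖x‖|} from hx)]
      change 0 ≤ _ + _; linarith
  linarith

theorem icc_int {q : ℝ → ℝ} (hq : Continuous q) {a b : ℝ} : IntegrableOn q (Icc a b) := hq.continuousOn.integrableOn_compact isCompact_Icc

theorem bath1 {m : ℝ → ℝ} (hm : Continuous m) (m0 : ∀ s, 0 ≤ m s) (m1 : ∀ s, m s ≤ 1) {ε : ℝ} :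
    (∫ s in Icc 0 ε, m s)^2 ≤ 4 * ∫ s in Icc 0 ε, m s * s := by
  set V := ∫ s in Icc 0 ε, m s with hV
  have V0 : 0 ≤ V := setIntegral_nonneg measurableSet_Icc fun s _ => m0 s
  have i1 : IntegrableOn (fun s => V/2 * (Icc 0 (V/2)).indicator (fun _ => (1:ℝ)) s) (Icc 0 ε) :=
    (((integrable_indicator_iff (f := fun _ : ℝ => (1:ℝ)) (μ := volume) measurableSet_Icc).2 (icc_int continuous_const)).const_mul (V/2)).integrableOn
  have : ∫ s in Icc 0 ε, (V/2 * m s - V/2 * (Icc 0 (V/2)).indicator (fun _ => (1:ℝ)) s) ≤ ∫ s in Icc 0 ε, m s * s := by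
    refine setIntegral_mono_on (((icc_int hm).const_mul _).sub i1) (icc_int bfp) measurableSet_Icc fun s hs => ?_
    by_cases h : s ∈ Icc 0 (V/2)
    · rw [indicator_of_mem h]
      nlinarith [mul_nonneg (m0 s) hs.1, mul_nonneg (sub_nonneg.2 (m1 s)) V0]
    · rw [indicator_of_notMem h]
      have : V/2 < s := by
        by_contra hc; exact h ⟨hs.1, not_lt.1 hc⟩
      nlinarith [m0 s]
  rw [integral_sub ((icc_int hm).const_mul _) i1, integral_const_mul, integral_const_mul, ← hV] at this
  have h2 : ∫ s in Icc 0 ε, (Icc 0 (V/2)).indicator (fun _ => (1:ℝ)) s ≤ V/2 := by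
    refine (setIntegral_le_integral ((integrable_indicator_iff measurableSet_Icc).2 (by simp)) (evf fun s => indicator_nonneg (by simp) _)).trans ?_
    rw [integral_indicator measurableSet_Icc]; simp [show 0 ≤ V/2 by linarith]
  nlinarith

theorem D4A {p q ζ : ℝ → ℝ} {ε a : ℝ} (hε : 0 < ε) (hp : Continuous p) (hq : Continuous q) (hζ : Continuous ζ)
    (p0 : ∀ s, 0 ≤ p s) (p1 : ∀ s, p s ≤ 1) (q0 : ∀ s, 0 ≤ q s) (q1 : ∀ s, q s ≤ 1) (z0 : ∀ s, 0 ≤ ζ s) (z1 : ∀ s, ζ s ≤ 1)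
    (zz : ∀ s ∈ Icc 0 (ε/2), ζ s = 1) (ha : a < 1/4)
    (mq : ∀ s t, 0 ≤ s → s ≤ t → t ≤ ε → q t ≤ q s + a)
    (mpq : ∀ s t, s ∈ Icc 0 ε → t ∈ Icc 0 ε → p s + q t ≤ 1 + a) {s0 : ℝ} (hs0 : s0 ∈ Icc 0 (ε/2)) (hq0 : 3/4 < q s0) :
    ∫ s in Icc 0 (ε/2), (p s + q s) * s ≤ 40 * (∫ s in Icc 0 ε, (p s * (1 - p s) + q s * (1 - q s)) * s)
      + 4 * ((∫ s in Icc 0 ε, ζ s * p s) - ∫ s in Icc 0 ε, ζ s * q s)^2 := by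
  set Vp := ∫ s in Icc 0 ε, ζ s * p s with hVp
  set Vq := ∫ s in Icc 0 ε, ζ s * q s with hVq
  have sub : Icc 0 (ε/2) ⊆ Icc 0 ε := Icc_subset_Icc_right bli
  have ph : ∀ s ∈ Icc 0 ε, p s ≤ 1/2 := fun s hs => by have := mpq s s0 hs (sub hs0); linarith
  set Qp := ∫ s in Icc 0 ε, p s * (1 - p s) * s with hQp
  set Qq := ∫ s in Icc 0 ε, q s * (1 - q s) * s with hQq
  have Qp0 : 0 ≤ Qp := setIntegral_nonneg measurableSet_Icc fun s hs => mul_nonneg (mul_nonneg (p0 s) (by linarith [p1 s])) hs.1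
  have Qq0 : 0 ≤ Qq := setIntegral_nonneg measurableSet_Icc fun s hs => mul_nonneg (mul_nonneg (q0 s) (by linarith [q1 s])) hs.1
  have eQ : ∫ s in Icc 0 ε, (p s * (1 - p s) + q s * (1 - q s)) * s = Qp + Qq := by
    rw [hQp, hQq, ← integral_add (icc_int bfp) (icc_int bfp)]
    exact integral_congr_ae (evf fun s => by ring)
  have Vq0 : 0 ≤ Vq := setIntegral_nonneg measurableSet_Icc fun s _ => mul_nonneg (z0 s) (q0 s)
  have Vqh : ∫ s in Icc 0 (ε/2), q s ≤ Vq := by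
    rw [hVq]
    calc ∫ s in Icc 0 (ε/2), q s = ∫ s in Icc 0 (ε/2), ζ s * q s := setIntegral_congr_fun measurableSet_Icc fun s hs => by simp [zz s hs]
      _ ≤ _ := setIntegral_mono_set (icc_int bfp) (evf fun s => mul_nonneg (z0 s) (q0 s)) (evf sub)
  have sV : ∀ s ∈ Icc 0 (ε/2), 3/4 < q s → s ≤ 2 * Vq := fun s hs hqs => by
    have h1 : ∫ t in Icc 0 s, (1/2 : ℝ) ≤ ∫ t in Icc 0 s, q t :=
      setIntegral_mono_on (icc_int continuous_const) (icc_int hq) measurableSet_Icc fun t ht => by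
        have := mq t s ht.1 ht.2 (sub hs).2; linarith
    have h2 : ∫ t in Icc 0 s, q t ≤ ∫ t in Icc 0 (ε/2), q t :=
      setIntegral_mono_set (icc_int hq) (evf fun s => q0 s) (evf (Icc_subset_Icc_right hs.2))
    have h3 : ∫ t in Icc 0 s, (1/2 : ℝ) = s/2 := by simp [hs.1]; ring
    linarith
  have b1 : ∫ s in Icc 0 (ε/2), (p s + q s) * s ≤ ∫ s in Icc 0 (ε/2), (2 * (p s * (1 - p s) * s) + (4 * (q s * (1 - q s) * s) + 2 * Vq * q s)) := by
    refine setIntegral_mono_on (icc_int bfp) (icc_int bfp) measurableSet_Icc fun s hs => ?_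
    have c1 : p s * s ≤ 2 * (p s * (1 - p s) * s) := by
      have := mul_nonneg (mul_nonneg (p0 s) hs.1) (by linarith [ph s (sub hs)] : 0 ≤ 1 - 2 * p s)
      linarith
    have c2 : q s * s ≤ 4 * (q s * (1 - q s) * s) + 2 * Vq * q s := by
      have c4 : 0 ≤ q s * (1 - q s) * s := mul_nonneg (mul_nonneg (q0 s) (by linarith [q1 s])) hs.1
      rcases le_or_gt (q s) (3/4) with h | h
      · have c3 := mul_nonneg (mul_nonneg (q0 s) hs.1) (by linarith : 0 ≤ 3 - 4 * q s)
        have := mul_nonneg Vq0 (q0 s)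
        linarith
      · have := mr (sV s hs h) (q0 s)
        linarith
    linarith
  rw [integral_add (icc_int bfp) (icc_int bfp), integral_add (icc_int bfp) (icc_int bfp),
    integral_const_mul, integral_const_mul, integral_const_mul] at b1
  have m1 : ∫ s in Icc 0 (ε/2), p s * (1 - p s) * s ≤ Qp :=
    setIntegral_mono_set (icc_int bfp) ((ae_restrict_iff' measurableSet_Icc).2 (evf fun s hs => mul_nonneg (mul_nonneg (p0 s) (by linarith [p1 s])) hs.1)) (evf sub)
  have m2 : ∫ s in Icc 0 (ε/2), q s * (1 - q s) * s ≤ Qq :=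
    setIntegral_mono_set (icc_int bfp) ((ae_restrict_iff' measurableSet_Icc).2 (evf fun s hs => mul_nonneg (mul_nonneg (q0 s) (by linarith [q1 s])) hs.1)) (evf sub)
  have m3 : 2 * Vq * ∫ s in Icc 0 (ε/2), q s ≤ 2 * Vq * Vq := by gcongr
  have m4 : Vp^2 ≤ 8 * Qp := by
    refine (bath1 (m := fun s => ζ s * p s) bfp (fun s => mul_nonneg (z0 s) (p0 s)) (fun s => mul_le_one₀ (z1 s) (p0 s) (p1 s)) (ε := ε)).trans ?_
    have : ∫ s in Icc 0 ε, ζ s * p s * s ≤ ∫ s in Icc 0 ε, 2 * (p s * (1 - p s) * s) := by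
      refine setIntegral_mono_on (icc_int bfp) (icc_int bfp) measurableSet_Icc fun s hs => ?_
      have c0 := mul_nonneg (p0 s) hs.1
      have c1 := mul_nonneg c0 (by linarith [ph s hs] : 0 ≤ 1 - 2 * p s)
      have c2 := mul_nonneg c0 (by linarith [z1 s] : 0 ≤ 1 - ζ s)
      linarith
    rw [integral_const_mul] at this
    linarith
  rw [eQ]
  nlinarith [sq_nonneg (2 * Vp - Vq)]

theorem D4m {p q ζ : ℝ → ℝ} {ε a : ℝ} (hε : 0 < ε) (hp : Continuous p) (hq : Continuous q) (hζ : Continuous ζ)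
    (p0 : ∀ s, 0 ≤ p s) (p1 : ∀ s, p s ≤ 1) (q0 : ∀ s, 0 ≤ q s) (q1 : ∀ s, q s ≤ 1) (z0 : ∀ s, 0 ≤ ζ s) (z1 : ∀ s, ζ s ≤ 1)
    (zz : ∀ s ∈ Icc 0 (ε/2), ζ s = 1) (a0 : 0 ≤ a)
    (mp : ∀ s t, 0 ≤ s → s ≤ t → t ≤ ε → p t ≤ p s + a)
    (mq : ∀ s t, 0 ≤ s → s ≤ t → t ≤ ε → q t ≤ q s + a)
    (mpq : ∀ s t, s ∈ Icc 0 ε → t ∈ Icc 0 ε → p s + q t ≤ 1 + a) :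
    ∫ s in Icc 0 (ε/2), (p s + q s) * s ≤ 40 * (∫ s in Icc 0 ε, (p s * (1 - p s) + q s * (1 - q s)) * s)
      + 4 * ((∫ s in Icc 0 ε, ζ s * p s) - ∫ s in Icc 0 ε, ζ s * q s)^2 + 4 * ε^2 * a := by
  have sub : Icc 0 (ε/2) ⊆ Icc 0 ε := Icc_subset_Icc_right bli
  have Q0 : ∀ s ∈ Icc 0 ε, 0 ≤ (p s * (1 - p s) + q s * (1 - q s)) * s := fun s hs =>
    mul_nonneg (add_nonneg (mul_nonneg (p0 s) (by linarith [p1 s])) (mul_nonneg (q0 s) (by linarith [q1 s]))) hs.1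
  have Qn := setIntegral_nonneg (μ := volume) measurableSet_Icc Q0
  have ea : 0 ≤ 4 * ε^2 * a := by positivity
  rcases le_or_gt (1/4) a with ha | ha
  · have : ∫ s in Icc 0 (ε/2), (p s + q s) * s ≤ ∫ s in Icc 0 (ε/2), ε :=
      setIntegral_mono_on (icc_int bfp) (icc_int bfp) measurableSet_Icc fun s hs => by
        have := mr (by linarith [p1 s, q1 s] : p s + q s ≤ 2) hs.1
        linarith [hs.2]
    have h3 : ∫ s in Icc 0 (ε/2), ε = ε^2/2 := by simp [(half_pos hε).le]; ring
    have h4 : 4 * ε^2 * (1/4) ≤ 4 * ε^2 * a := by gcongr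
    have := sq_nonneg ((∫ s in Icc 0 ε, ζ s * p s) - ∫ s in Icc 0 ε, ζ s * q s)
    have := sq_nonneg ε
    linarith
  · by_cases hA : ∃ s0 ∈ Icc 0 (ε/2), 3/4 < q s0
    · obtain ⟨s0, hs0, h0⟩ := hA
      have := D4A hε hp hq hζ p0 p1 q0 q1 z0 z1 zz ha mq mpq hs0 h0
      linarith
    by_cases hB : ∃ s0 ∈ Icc 0 (ε/2), 3/4 < p s0
    · obtain ⟨s0, hs0, h0⟩ := hB
      have := D4A hε hq hp hζ q0 q1 p0 p1 z0 z1 zz ha mp (fun s t hs ht => by linarith [mpq t s ht hs]) hs0 h0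
      rw [sub_sq_comm]
      simp only [add_comm (q _), add_comm (q _ * _)] at this
      linarith
    · push Not at hA hB
      have h1 : ∫ s in Icc 0 (ε/2), (p s + q s) * s ≤ ∫ s in Icc 0 (ε/2), 4 * ((p s * (1 - p s) + q s * (1 - q s)) * s) :=
        setIntegral_mono_on (icc_int bfp) (icc_int bfp) measurableSet_Icc fun s hs => by
          have c1 := mul_nonneg (mul_nonneg (p0 s) hs.1) (by linarith [hB s hs] : 0 ≤ 3 - 4 * p s)
          have c2 := mul_nonneg (mul_nonneg (q0 s) hs.1) (by linarith [hA s hs] : 0 ≤ 3 - 4 * q s)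
          linarith
      rw [integral_const_mul] at h1
      have h2 := setIntegral_mono_set (icc_int (q := fun s => (p s * (1 - p s) + q s * (1 - q s)) * s) bfp) ((ae_restrict_iff' measurableSet_Icc).2 (evf Q0)) (evf sub : Icc 0 (ε/2) ≤ᵐ[volume] Icc 0 ε)
      have := sq_nonneg ((∫ s in Icc 0 ε, ζ s * p s) - ∫ s in Icc 0 ε, ζ s * q s)
      linarith

noncomputable def Hh (y : Eu k) : ℝ := √(1 - ‖y‖^2)
noncomputable def Ph (y : Eu k) (s : ℝ) : Es k := csL k (s + Hh y, y)

theorem Hh_cont : Continuous (Hh : Eu k → ℝ) := by unfold Hh; fun_prop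
theorem Ph_cont : Continuous (fun p : Eu k × ℝ => Ph p.1 p.2) := by
  unfold Ph; have := Hh_cont (k := k); fun_prop
theorem Hh_nn (y : Eu k) : 0 ≤ Hh y := Real.sqrt_nonneg _
theorem Hh_sq {y : Eu k} (hy : ‖y‖ ≤ 1) : Hh y^2 = 1 - ‖y‖^2 := Real.sq_sqrt (by nlinarith [norm_nonneg y])
theorem Hh_le (y : Eu k) : Hh y ≤ 1 := by
  unfold Hh; exact Real.sqrt_le_iff.2 ⟨zero_le_one, by nlinarith [norm_nonneg y]⟩

theorem Hh_ge {y : Eu k} {ρ h : ℝ} (h0 : 0 < h) (hρ : ρ^2 + h^2 ≤ 1) (hy : ‖y‖ ≤ ρ) : h ≤ Hh y := by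
  unfold Hh; apply Real.le_sqrt_of_sq_le; nlinarith [norm_nonneg y]

theorem Ph_sq {y : Eu k} (s : ℝ) (hy : ‖y‖ ≤ 1) : ‖Ph y s‖^2 = 1 + s * (s + 2 * Hh y) := by
  unfold Ph; rw [csL_norm_sq]; have := Hh_sq hy; simp only; nlinarith

theorem csL_inner (p q : ℝ × Eu k) : inner ℝ (csL k p) (csL k q) = p.1 * q.1 + inner ℝ p.2 q.2 := by
  have h1 := csL_norm_sq (p + q)
  rw [map_add, norm_add_sq_real, csL_norm_sq, csL_norm_sq] at h1
  have h2 := norm_add_sq_real p.2 q.2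
  simp only [Prod.fst_add, Prod.snd_add] at h1
  nlinarith

theorem Hh_deriv {y z : Eu k} {t : ℝ} (hy : ‖y + t • z‖ < 1) :
    HasDerivAt (fun t : ℝ => Hh (y + t • z)) (- inner ℝ (y + t • z) z / Hh (y + t • z)) t := by
  have h1 : HasDerivAt (fun t : ℝ => y + t • z) z t := by
    simpa using ((hasDerivAt_id t).smul_const z).const_add y
  have h2 : HasDerivAt (fun t : ℝ => 1 - ‖y + t • z‖^2) (-(2 * inner ℝ (y + t • z) z)) t := by
    simpa using (h1.norm_sq).const_sub 1
  have h3 : 1 - ‖y + t • z‖^2 ≠ 0 := by nlinarith [norm_nonneg (y + t • z)]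
  refine (h2.sqrt h3).congr_deriv ?_
  unfold Hh
  have h4 : 0 < √(1 - ‖y + t • z‖^2) := Real.sqrt_pos.2 (by nlinarith [norm_nonneg (y + t • z)])
  rw [div_eq_div_iff bpo bpo]; ring

structure Geo (h0 : ℝ) (y : Eu k) (s : ℝ) : Prop where
  hp : 0 < h0
  h1 : h0 ≤ 1
  yl : ‖y‖ < 1
  hH : h0 ≤ Hh y
  hs : |s| ≤ h0/2

theorem Geo.s1 {h0 s : ℝ} {y : Eu k} (g : Geo h0 y s) : h0 ≤ s + 2 * Hh y := by
  have := abs_le.1 g.hs; linarith [g.hH, g.hp]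

theorem Geo.sq_le {h0 s : ℝ} {y : Eu k} (g : Geo h0 y s) : ‖Ph y s‖^2 ≤ 4 := by
  rw [Ph_sq s g.yl.le]
  have := abs_le.1 g.hs; have := Hh_le y; have := g.s1; have := g.h1; have := g.hp
  nlinarith

theorem Geo.lt_iff {h0 s : ℝ} {y : Eu k} (g : Geo h0 y s) : ‖Ph y s‖ < 1 ↔ s < 0 := by
  rw [← sq_lt_one_iff₀ (norm_nonneg _), Ph_sq s g.yl.le]
  have := g.s1; have := g.hp
  constructor
  · intro h; by_contra hc; push Not at hc; nlinarith [mul_nonneg hc (by linarith : 0 ≤ s + 2 * Hh y)]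
  · intro h; nlinarith [mul_pos (neg_pos.2 h) (by linarith : 0 < s + 2 * Hh y)]

theorem Geo.up {h0 s : ℝ} {y : Eu k} (g : Geo h0 y s) (f : Es k → ℝ) :
    h0/5 * fderiv ℝ f (Ph y s) (csL k (1, 0)) ≤ bb f (Ph y s) := by
  have hp := g.hp
  have := bb_ge (f := f) (x := Ph y s) (v := -((h0/5) • csL k (1, 0))) (by
    rw [← sub_eq_add_neg, ← sq_le_one_iff₀ (norm_nonneg _), norm_sub_sq_real, inner_smul_right]
    have e1 : inner ℝ (phi (Ph y s)) (csL k (1, 0)) = 2/(1+‖Ph y s‖^2) * (s + Hh y) := by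
      unfold phi; rw [real_inner_smul_left]; congr 1; unfold Ph; rw [csL_inner]; simp
    have e2 : ‖(h0/5) • csL k (1, 0)‖^2 = (h0/5)^2 := by
      rw [norm_smul, mul_pow, csL_norm_sq, Real.norm_eq_abs, sq_abs]; simp
    rw [e1, e2]
    have e3 : ‖phi (Ph y s)‖^2 ≤ 1 := by
      rw [sq_le_one_iff₀ (norm_nonneg _)]; exact phi_le _
    have e4 : h0/5 ≤ 2/(1+‖Ph y s‖^2) * (s + Hh y) := by
      have a1 : 2/5 ≤ 2/(1+‖Ph y s‖^2) := by gcongr; linarith [g.sq_le]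
      have a2 : h0/2 ≤ s + Hh y := by have := abs_le.1 g.hs; linarith [g.hH]
      nlinarith
    nlinarith)
  rw [map_neg, map_smul, smul_eq_mul] at this
  linarith

theorem Geo.tan {h0 s ε' : ℝ} {y z : Eu k} (g : Geo h0 y s) (f : Es k → ℝ) (he : 0 < ε') (hz : ‖z‖ ≤ ε') :
    |s| * |fderiv ℝ f (Ph y s) (csL k (-inner ℝ y z / Hh y, z))| ≤ ε' * (200/h0^3) * bb f (Ph y s) := by
  have hp := g.hp
  have hHp : 0 < Hh y := hp.trans_le g.hH
  set T := csL k (-inner ℝ y z / Hh y, z) with hT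
  have cs : |inner ℝ y z| ≤ ‖z‖ := by
    refine (abs_real_inner_le_norm _ _).trans ?_
    nlinarith [g.yl, norm_nonneg z]
  have q1 : |inner ℝ y z / Hh y| ≤ ‖z‖/h0 := by
    rw [abs_div, abs_of_pos hHp]; gcongr; exact g.hH
  have T2 : ‖T‖^2 ≤ 2 * (‖z‖/h0)^2 := by
    rw [hT, csL_norm_sq, neg_div, neg_sq, ← sq_abs]
    have : ‖z‖ ≤ ‖z‖/h0 := by rw [le_div_iff₀ hp]; nlinarith [norm_nonneg z, g.h1]
    simp only
    nlinarith [abs_nonneg (inner ℝ y z / Hh y), norm_nonneg z]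
  have iT : |inner ℝ (phi (Ph y s)) T| ≤ 2 * (|s| * (‖z‖/h0)) := by
    have : inner ℝ (phi (Ph y s)) T = 2/(1+‖Ph y s‖^2) * (-(s * (inner ℝ y z / Hh y))) := by
      unfold phi; rw [real_inner_smul_left]; congr 1; unfold Ph; rw [hT, csL_inner]; simp only; field_simp; ring
    rw [this, abs_mul, abs_neg, abs_mul, abs_of_pos bpo]
    have : 2/(1+‖Ph y s‖^2) ≤ 2 := by
      rw [div_le_iff₀ bpo]; nlinarith [sq_nonneg ‖Ph y s‖]
    gcongr
  have np : ‖phi (Ph y s)‖^2 ≤ 1 - s^2*h0^2/25 := by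
    rw [phi_norm, div_pow, div_le_iff₀ bpo]
    have e := Ph_sq s g.yl.le
    have a1 := g.sq_le
    set r := ‖Ph y s‖^2 with hr
    have : (r - 1)^2 ≥ s^2 * h0^2 := by
      rw [e, add_sub_cancel_left, mul_pow]; gcongr; exact g.s1
    have a3 : s^2*h0^2/25 * (1+r)^2 ≤ s^2*h0^2 := by
      have : (1+r)^2 ≤ 25 := by nlinarith [sq_nonneg ‖Ph y s‖]
      have := ml this (by positivity : 0 ≤ s^2*h0^2/25)
      linarith
    have : (2 * ‖Ph y s‖)^2 = 4 * r := by rw [hr]; ring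
    nlinarith
  set τ := h0^3/200 * |s| / ε' with hτ
  have τ0 : 0 ≤ τ := by positivity
  have τz : τ * (‖z‖/h0) ≤ h0^2/200 * |s| := by
    rw [hτ]
    calc h0^3/200 * |s| / ε' * (‖z‖/h0) ≤ h0^3/200 * |s| / ε' * (ε'/h0) := by gcongr
      _ = _ := by field_simp
  have key : ∀ σ : ℝ, |σ| = τ → ‖phi (Ph y s) + σ • T‖ ≤ 1 := fun σ hσ => by
    rw [← sq_le_one_iff₀ (norm_nonneg _), norm_add_sq_real, inner_smul_right, norm_smul, mul_pow, Real.norm_eq_abs, hσ]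
    have b1 : σ * inner ℝ (phi (Ph y s)) T ≤ τ * (2 * (|s| * (‖z‖/h0))) := by
      refine (le_abs_self _).trans ?_
      rw [abs_mul, hσ]; gcongr
    have b2 : τ * (2 * (|s| * (‖z‖/h0))) ≤ 2 * |s| * (h0^2/200 * |s|) := by
      calc _ = 2 * |s| * (τ * (‖z‖/h0)) := by ring
        _ ≤ _ := by gcongr
    have b3 : τ^2 * ‖T‖^2 ≤ 2 * (h0^2/200 * |s|)^2 := by
      calc τ^2 * ‖T‖^2 ≤ τ^2 * (2 * (‖z‖/h0)^2) := by gcongr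
        _ = 2 * (τ * (‖z‖/h0))^2 := by ring
        _ ≤ _ := by gcongr
    have b4 : (h0^2/200 * |s|)^2 ≤ h0^2 * s^2/ 40000 := by
      rw [mul_pow, sq_abs, div_pow]
      have : (h0^2)^2 ≤ h0^2 := by nlinarith [g.h1, sq_nonneg h0, mul_le_one₀ g.h1 hp.le g.h1]
      have := mr this (sq_nonneg s)
      linarith
    have b5 : 2 * |s| * (h0^2/200 * |s|) = h0^2 * s^2/100 := by rw [← sq_abs s]; ring
    have := mul_nonneg (sq_nonneg h0) (sq_nonneg s)
    linarith
  have k1 := bb_ge (f := f) (key τ (abs_of_nonneg τ0))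
  have k2 := bb_ge (f := f) (key (-τ) (by rw [abs_neg, abs_of_nonneg τ0]))
  rw [map_smul, smul_eq_mul] at k1 k2
  have k3 : τ * |fderiv ℝ f (Ph y s) T| ≤ bb f (Ph y s) := by
    rw [← abs_of_nonneg τ0, ← abs_mul, abs_le]; constructor <;> linarith
  calc |s| * |fderiv ℝ f (Ph y s) T| = ε' * (200/h0^3) * (τ * |fderiv ℝ f (Ph y s) T|) := by rw [hτ]; field_simp
    _ ≤ _ := by gcongr

structure NS (h0 ρ0 ρ1 ε ε' : ℝ) (κ : Eu k → ℝ) (ζ : ℝ → ℝ) : Prop where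
  hp : 0 < h0
  h1 : h0 ≤ 1
  hρ : ρ1^2 + h0^2 ≤ 1
  ρ0n : 0 ≤ ρ0
  ρ01 : ρ0 + ε' ≤ ρ1
  ep : 0 < ε
  eh : ε ≤ h0/2
  e'p : 0 < ε'
  kc : Continuous κ
  k0 : ∀ z, 0 ≤ κ z
  kz : ∀ z, ε' ≤ ‖z‖ → κ z = 0
  k1 : ∫ z in closedBall 0 ε', κ z = 1
  zc : Continuous ζ
  z0 : ∀ s, 0 ≤ ζ s
  z1 : ∀ s, ζ s ≤ 1
  ze : ∀ s, ζ (-s) = ζ s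
  zz : ∀ s ∈ Icc 0 (ε/2), ζ s = 1
  zf : ∀ s, ε ≤ |s| → ζ s = 0

noncomputable def AA (ε : ℝ) (f : Es k → ℝ) (y : Eu k) : ℝ := ∫ s in Icc (-ε) ε, bb f (Ph y s)
noncomputable def pp (ε' : ℝ) (κ : Eu k → ℝ) (f : Es k → ℝ) (y : Eu k) (s : ℝ) : ℝ :=
  ∫ z in closedBall 0 ε', κ z * f (Ph (y+z) s)

section
variable {h0 ρ0 ρ1 ε ε' : ℝ} {κ : Eu k → ℝ} {ζ : ℝ → ℝ} (N : NS h0 ρ0 ρ1 ε ε' κ ζ) {f : Es k → ℝ} (h : Adm f)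

theorem ph_comp {X : Type*} [TopologicalSpace X] {F : Es k → ℝ} (hF : Continuous F) {a : X → Eu k} {b : X → ℝ} (ha : Continuous a) (hb : Continuous b) :
    Continuous fun x => F (Ph (a x) (b x)) := hF.comp (Ph_cont.comp (ha.prodMk hb))

theorem NS.r1 (N : NS h0 ρ0 ρ1 ε ε' κ ζ) : ρ1 < 1 := by
  have := N.hρ; have := N.hp; have := N.ρ0n; have := N.ρ01; have := N.e'p; nlinarith

theorem NS.geo (N : NS h0 ρ0 ρ1 ε ε' κ ζ) {y : Eu k} {s : ℝ} (hy : ‖y‖ ≤ ρ1) (hs : s ∈ Icc (-ε) ε) : Geo h0 y s :=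
  ⟨N.hp, N.h1, hy.trans_lt N.r1, Hh_ge N.hp N.hρ hy, (abs_le.2 hs).trans N.eh⟩

theorem NS.add (N : NS h0 ρ0 ρ1 ε ε' κ ζ) {y z : Eu k} {t : ℝ} (hy : ‖y‖ ≤ ρ0) (hz : z ∈ closedBall (0 : Eu k) ε') (ht : t ∈ Icc (0:ℝ) 1) : ‖y + t • z‖ ≤ ρ1 := by
  have h1 := norm_add_le y (t • z)
  have h2 : ‖z‖ ≤ ε' := by simpa using hz
  rw [norm_smul, Real.norm_of_nonneg ht.1] at h1
  have : t * ‖z‖ ≤ 1 * ε' := mul_le_mul ht.2 h2 (norm_nonneg _) zero_le_one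
  linarith [N.ρ01]

theorem NS.add1 (N : NS h0 ρ0 ρ1 ε ε' κ ζ) {y z : Eu k} (hy : ‖y‖ ≤ ρ0) (hz : z ∈ closedBall (0 : Eu k) ε') : ‖y + z‖ ≤ ρ1 := by
  simpa using N.add hy hz (right_mem_Icc.2 zero_le_one)

theorem AA_cont (h : Adm f) : Continuous (AA ε f : Eu k → ℝ) :=
  continuous_parametric_integral_of_continuous (ph_comp h.bb_cont continuous_fst continuous_snd) isCompact_Icc

theorem AA_nn (y : Eu k) : 0 ≤ AA ε f y := setIntegral_nonneg measurableSet_Icc fun _ _ => bb_nonneg _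

include N h

theorem E1_mono {y : Eu k} (hy : ‖y‖ ≤ ρ1) {s t : ℝ} (hs : -ε ≤ s) (hst : s ≤ t) (ht : t ≤ ε) :
    f (Ph y t) ≤ f (Ph y s) + 5/h0 * AA ε f y := by
  have hp := N.hp
  have hd : ∀ r ∈ Icc s t, HasDerivAt (fun r : ℝ => f (Ph y r)) (fderiv ℝ f (Ph y r) (csL k (1, 0))) r := fun r _ => by
    have h1 : HasDerivAt (fun r : ℝ => Ph y r) (csL k (1, 0)) r := by
      unfold Ph
      exact ((csL k).hasFDerivAt).comp_hasDerivAt r (((hasDerivAt_id r).add_const (Hh y)).prodMk (hasDerivAt_const r y))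
    exact (h.diff.differentiableAt (x := Ph y r)).hasFDerivAt.comp_hasDerivAt r h1
  have hc : Continuous fun r : ℝ => 5/h0 * bb f (Ph y r) := continuous_const.mul (ph_comp h.bb_cont continuous_const continuous_id)
  have := line_up hst hd hc fun r hr => by
    have := (N.geo hy ⟨hs.trans hr.1, hr.2.trans ht⟩).up f
    rw [div_mul_eq_mul_div, le_div_iff₀ hp]; linarith
  rw [integral_const_mul] at this
  have h2 : ∫ r in Icc s t, bb f (Ph y r) ≤ AA ε f y :=
    setIntegral_mono_set (icc_int (ph_comp h.bb_cont continuous_const continuous_id)) (evf fun r => bb_nonneg _) (evf (Icc_subset_Icc hs ht))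
  have : 5/h0 * ∫ r in Icc s t, bb f (Ph y r) ≤ 5/h0 * AA ε f y := by gcongr
  linarith

theorem E1_tan {y z : Eu k} (hy : ‖y‖ ≤ ρ0) (hz : z ∈ closedBall (0 : Eu k) ε') {s : ℝ} (hs : s ∈ Icc (-ε) ε) :
    |s| * |f (Ph (y+z) s) - f (Ph y s)| ≤ ε' * (200/h0^3) * ∫ t in Icc (0:ℝ) 1, bb f (Ph (y + t • z) s) := by
  have hd : ∀ t ∈ Icc (0:ℝ) 1, HasDerivAt (fun t : ℝ => s * f (Ph (y + t • z) s)) (s * fderiv ℝ f (Ph (y + t • z) s) (csL k (-inner ℝ (y + t • z) z / Hh (y + t • z), z))) t := fun t ht => by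
    have hl : ‖y + t • z‖ < 1 := (N.add hy hz ht).trans_lt N.r1
    have h0 : HasDerivAt (fun t : ℝ => y + t • z) z t := by
      simpa using ((hasDerivAt_id t).smul_const z).const_add y
    have h1 : HasDerivAt (fun t : ℝ => Ph (y + t • z) s) (csL k (-inner ℝ (y + t • z) z / Hh (y + t • z), z)) t := by
      unfold Ph
      exact ((csL k).hasFDerivAt).comp_hasDerivAt t (((Hh_deriv hl).const_add s).prodMk h0)
    exact ((h.diff.differentiableAt (x := Ph (y + t • z) s)).hasFDerivAt.comp_hasDerivAt t h1).const_mul s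
  have hc : Continuous fun t : ℝ => ε' * (200/h0^3) * bb f (Ph (y + t • z) s) := continuous_const.mul (ph_comp h.bb_cont bfp continuous_const)
  have := line_abs zero_le_one hd hc fun t ht => by
    rw [abs_mul]
    exact (N.geo (N.add hy hz ht) hs).tan f N.e'p (by simpa using hz)
  simp only [one_smul, zero_smul, add_zero] at this
  rwa [integral_const_mul, ← mul_sub, abs_mul] at this

theorem pp_cont : Continuous fun p : Eu k × ℝ => pp ε' κ f p.1 p.2 := by
  have := N.kc
  refine continuous_parametric_integral_of_continuous (f := fun (p : Eu k × ℝ) z => κ z * f (Ph (p.1+z) p.2)) ?_ (isCompact_closedBall _ _)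
  exact (N.kc.comp continuous_snd).mul (ph_comp h.cont bfp bfp)

theorem pz_int {q : Eu k → ℝ} (hq : Continuous q) : IntegrableOn q (closedBall 0 ε') := hq.continuousOn.integrableOn_compact (isCompact_closedBall _ _)

theorem kf_int (y : Eu k) (s : ℝ) : IntegrableOn (fun z => κ z * f (Ph (y+z) s)) (closedBall 0 ε') :=
  pz_int N h (N.kc.mul (ph_comp h.cont bfp bfp))

theorem pp_nn (y : Eu k) (s : ℝ) : 0 ≤ pp ε' κ f y s :=
  setIntegral_nonneg measurableSet_closedBall fun z _ => mul_nonneg (N.k0 z) (h.nn _)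

theorem pp_le (y : Eu k) (s : ℝ) : pp ε' κ f y s ≤ 1 := by
  rw [← N.k1]
  refine setIntegral_mono_on (kf_int N h y s) (pz_int N h N.kc) measurableSet_closedBall fun z _ => ?_
  exact mul_le_of_le_one_right (N.k0 z) (h.le _)

theorem pp_mono {y : Eu k} (hy : ‖y‖ ≤ ρ0) {s t : ℝ} (hs : -ε ≤ s) (hst : s ≤ t) (ht : t ≤ ε) :
    pp ε' κ f y t ≤ pp ε' κ f y s + 5/h0 * ∫ z in closedBall 0 ε', κ z * AA ε f (y+z) := by
  have hA : Continuous fun z => κ z * AA ε f (y+z) := N.kc.mul ((AA_cont h).comp bfp)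
  unfold pp
  rw [← integral_const_mul, ← integral_add (kf_int N h y s) ((pz_int N h hA).const_mul _)]
  refine setIntegral_mono_on (kf_int N h y t) ((kf_int N h y s).add ((pz_int N h hA).const_mul _)) measurableSet_closedBall fun z hz => ?_
  have := ml (E1_mono N h (N.add1 hy hz) hs hst ht) (N.k0 z)
  linarith

theorem pp_diff {y : Eu k} (hy : ‖y‖ ≤ ρ0) {s : ℝ} (hs : s ∈ Icc (-ε) ε) :
    |s| * |f (Ph y s) - pp ε' κ f y s| ≤ ε' * (200/h0^3) * ∫ z in closedBall 0 ε', κ z * ∫ t in Icc (0:ℝ) 1, bb f (Ph (y + t • z) s) := by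
  have a1 : s * (f (Ph y s) - pp ε' κ f y s) = ∫ z in closedBall 0 ε', κ z * (s * (f (Ph y s) - f (Ph (y+z) s))) := by
    have : f (Ph y s) = ∫ z in closedBall 0 ε', κ z * f (Ph y s) := by rw [integral_mul_const, N.k1, one_mul]
    unfold pp; nth_rewrite 1 [this]
    rw [← integral_sub ((pz_int N h N.kc).mul_const _) (kf_int N h y s), ← integral_const_mul]
    exact integral_congr_ae (evf fun z => by ring)
  rw [← abs_mul, a1, ← integral_const_mul, ← Real.norm_eq_abs]
  have hc : Continuous fun z => ∫ t in Icc (0:ℝ) 1, bb f (Ph (y + t • z) s) :=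
    continuous_parametric_integral_of_continuous (f := fun z (t : ℝ) => bb f (Ph (y + t • z) s)) (ph_comp h.bb_cont bfp continuous_const) isCompact_Icc
  refine norm_integral_le_of_norm_le (pz_int N h (continuous_const.mul (N.kc.mul hc))) ?_
  refine (ae_restrict_iff' measurableSet_closedBall).2 (evf fun z hz => ?_)
  rw [norm_mul, Real.norm_of_nonneg (N.k0 z), Real.norm_eq_abs, abs_mul, abs_sub_comm]
  have := ml (E1_tan N h hy hz hs) (N.k0 z)
  linarith

theorem E_le {y : Eu k} (hy : ‖y‖ ≤ ρ0) :
    ∫ s in Icc (-ε) ε, |s| * |f (Ph y s) - pp ε' κ f y s| ≤ ε' * (200/h0^3) * ∫ z in closedBall 0 ε', κ z * ∫ t in Icc (0:ℝ) 1, AA ε f (y + t • z) := by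
  have pc := pp_cont N h
  have hc1 : Continuous fun s => |s| * |f (Ph y s) - pp ε' κ f y s| :=
    continuous_abs.mul ((ph_comp h.cont continuous_const continuous_id).sub (pc.comp (by fun_prop : Continuous fun s : ℝ => (y, s)))).abs
  have hin : Continuous (Function.uncurry fun (p : ℝ × Eu k) (t : ℝ) => bb f (Ph (y + t • p.2) p.1)) := ph_comp h.bb_cont bfp bfp
  have hc2 : Continuous (Function.uncurry fun (s : ℝ) (z : Eu k) => κ z * ∫ t in Icc (0:ℝ) 1, bb f (Ph (y + t • z) s)) :=
    (N.kc.comp continuous_snd).mul (continuous_parametric_integral_of_continuous (f := fun (p : ℝ × Eu k) (t : ℝ) => bb f (Ph (y + t • p.2) p.1)) hin isCompact_Icc)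
  have hc3 : Continuous fun s : ℝ => ∫ z in closedBall 0 ε', κ z * ∫ t in Icc (0:ℝ) 1, bb f (Ph (y + t • z) s) :=
    continuous_parametric_integral_of_continuous hc2 (isCompact_closedBall _ _)
  have b := setIntegral_mono_on (μ := volume) (icc_int (a := -ε) (b := ε) hc1) ((icc_int hc3).const_mul (ε' * (200/h0^3))) measurableSet_Icc fun s hs => pp_diff N h hy hs
  rw [integral_const_mul] at b
  refine b.trans (le_of_eq ?_)
  congr 1
  rw [swap_cc hc2 isCompact_Icc (isCompact_closedBall _ _)]
  refine setIntegral_congr_fun measurableSet_closedBall fun z _ => ?_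
  change ∫ s in Icc (-ε) ε, κ z * ∫ t in Icc (0:ℝ) 1, bb f (Ph (y + t • z) s) = _
  rw [integral_const_mul, swap_cc (X := ℝ) (Y := ℝ) (g := fun s t => bb f (Ph (y + t • z) s)) (ph_comp h.bb_cont bfp bfp) isCompact_Icc isCompact_Icc]
  rfl
end

theorem fold {g : ℝ → ℝ} (hg : Continuous g) {ε : ℝ} (he : 0 ≤ ε) : ∫ s in Icc (-ε) ε, g s = ∫ s in Icc 0 ε, (g s + g (-s)) := by
  have hg2 : Continuous fun s => g (-s) := hg.comp continuous_neg
  rw [integral_add (icc_int hg) (icc_int hg2)]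
  rw [integral_Icc_eq_integral_Ioc, integral_Icc_eq_integral_Ioc, integral_Icc_eq_integral_Ioc, ← intervalIntegral.integral_of_le bli, ← intervalIntegral.integral_of_le he,
    ← intervalIntegral.integral_of_le he, intervalIntegral.integral_comp_neg, neg_zero, add_comm]
  exact (intervalIntegral.integral_add_adjacent_intervals (hg.intervalIntegrable _ _) (hg.intervalIntegrable _ _)).symm

theorem sq_lip {a b : ℝ} (ha : 0 ≤ a) (ha1 : a ≤ 1) (hb : 0 ≤ b) (hb1 : b ≤ 1) : b * (1 - b) ≤ a * (1 - a) + |a - b| := by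
  have : b * (1 - b) - a * (1 - a) = (b - a) * (1 - a - b) := by ring
  have h2 : (b - a) * (1 - a - b) ≤ |b - a| * 1 := by
    refine (le_abs_self _).trans ?_
    rw [abs_mul]; gcongr; exact abs_le.2 ⟨by linarith, by linarith⟩
  rw [abs_sub_comm]; linarith

section
variable {h0 ρ0 ρ1 ε ε' : ℝ} {κ : Eu k → ℝ} {ζ : ℝ → ℝ} (N : NS h0 ρ0 ρ1 ε ε' κ ζ) {f : Es k → ℝ} (h : Adm f)

noncomputable def UU (ε ε' : ℝ) (κ : Eu k → ℝ) (ζ : ℝ → ℝ) (f : Es k → ℝ) (y : Eu k) : ℝ :=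
  (∫ s in Icc 0 ε, ζ s * pp ε' κ f y s) - ∫ s in Icc 0 ε, ζ s * (1 - pp ε' κ f y (-s))

include N h

theorem E2_y {y : Eu k} (hy : ‖y‖ ≤ ρ0) : ∫ s in Icc 0 (ε/2), (f (Ph y s) + (1 - f (Ph y (-s)))) * s ≤
    40 * ε * (∫ s in Icc (-ε) ε, f (Ph y s) * (1 - f (Ph y s)))
    + 41 * (ε' * (200/h0^3) * ∫ z in closedBall 0 ε', κ z * ∫ t in Icc (0:ℝ) 1, AA ε f (y + t • z))
    + 4 * (UU ε ε' κ ζ f y)^2 + 4 * ε^2 * (5/h0 * ∫ z in closedBall 0 ε', κ z * AA ε f (y+z)) := by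
  have E := E_le N h hy
  have e0 := N.ep
  have hp := N.hp
  have a0 : 0 ≤ 5/h0 * ∫ z in closedBall 0 ε', κ z * AA ε f (y+z) := mul_nonneg bpo (setIntegral_nonneg measurableSet_closedBall fun z _ => mul_nonneg (N.k0 z) (AA_nn _))
  have pc : Continuous fun s => pp ε' κ f y s := (pp_cont N h).comp (by fun_prop : Continuous fun s : ℝ => (y, s))
  have fc : Continuous fun s => f (Ph y s) := ph_comp h.cont continuous_const continuous_id
  have pm := fun (s t : ℝ) => pp_mono N h hy (s := s) (t := t)
  have p0 := pp_nn N h y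
  have p1 := pp_le N h y
  have f0 : ∀ s, 0 ≤ f (Ph y s) := fun s => h.nn _
  have f1 : ∀ s, f (Ph y s) ≤ 1 := fun s => h.le _
  unfold UU
  generalize hp' : (fun s => pp ε' κ f y s) = p at *
  simp only [fun s => congrFun hp' s] at *
  generalize hF' : (fun s => f (Ph y s)) = F at *
  simp only [fun s => congrFun hF' s] at *
  generalize (5/h0 * ∫ z in closedBall 0 ε', κ z * AA ε f (y+z)) = a at *
  generalize (ε' * (200/h0^3) * ∫ z in closedBall 0 ε', κ z * ∫ t in Icc (0:ℝ) 1, AA ε f (y + t • z)) = J at *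
  have zc := N.zc
  have m := D4m (p := p) (q := fun s => 1 - p (-s)) e0 pc bfp zc p0 p1 (fun s => by linarith [p1 (-s)]) (fun s => by linarith [p0 (-s)]) N.z0 N.z1 N.zz a0
    (fun s t hs hst ht => pm s t bli hst ht) (fun s t hs hst ht => by linarith [pm (-t) (-s) bli bli bli])
    (fun s t hs ht => by linarith [pm (-t) s (by linarith [ht.2]) (by linarith [ht.1, hs.1]) hs.2])
  have Q : ∫ s in Icc 0 ε, (p s * (1 - p s) + (1 - p (-s)) * (1 - (1 - p (-s)))) * s ≤ ε * (∫ s in Icc (-ε) ε, F s * (1 - F s)) + J := by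
    have e1 : ∫ s in Icc 0 ε, (p s * (1 - p s) + (1 - p (-s)) * (1 - (1 - p (-s)))) * s = ∫ s in Icc (-ε) ε, p s * (1 - p s) * |s| := by
      rw [fold bfp e0.le]
      refine setIntegral_congr_fun measurableSet_Icc fun s hs => ?_
      simp only [abs_neg, abs_of_nonneg hs.1]; ring
    have e2 : ∫ s in Icc (-ε) ε, p s * (1 - p s) * |s| ≤ ∫ s in Icc (-ε) ε, (ε * (F s * (1 - F s)) + |s| * |F s - p s|) := by
      refine setIntegral_mono_on (icc_int bfp) (icc_int bfp) measurableSet_Icc fun s hs => ?_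
      have := mr (sq_lip (f0 s) (f1 s) (p0 s) (p1 s)) (abs_nonneg s)
      have := mr (abs_le.2 hs) (mul_nonneg (f0 s) (by linarith [f1 s] : 0 ≤ 1 - F s))
      linarith
    rw [integral_add (icc_int bfp) (icc_int bfp), integral_const_mul] at e2
    linarith
  have L : ∫ s in Icc 0 (ε/2), (F s + (1 - F (-s))) * s ≤ (∫ s in Icc 0 (ε/2), (p s + (1 - p (-s))) * s) + J := by
    have e1 : ∫ s in Icc 0 (ε/2), (F s + (1 - F (-s))) * s ≤ ∫ s in Icc 0 (ε/2), ((p s + (1 - p (-s))) * s + (|s| * |F s - p s| + |-s| * |F (-s) - p (-s)|)) := by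
      refine setIntegral_mono_on (icc_int bfp) (icc_int bfp) measurableSet_Icc fun s hs => ?_
      rw [abs_neg, abs_of_nonneg hs.1]
      have := ml (le_abs_self (F s - p s)) hs.1
      have := ml (neg_abs_le (F (-s) - p (-s))) hs.1
      linarith
    rw [integral_add (icc_int bfp) (icc_int bfp)] at e1
    have e2 : ∫ s in Icc 0 (ε/2), (|s| * |F s - p s| + |-s| * |F (-s) - p (-s)|) ≤ ∫ s in Icc 0 ε, (|s| * |F s - p s| + |-s| * |F (-s) - p (-s)|) :=
      setIntegral_mono_set (icc_int bfp) (evf fun s => by positivity) (evf (Icc_subset_Icc_right bli))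
    rw [← fold (g := fun s => |s| * |F s - p s|) bfp e0.le] at e2
    linarith
  linarith

omit N in
theorem gB_ph {y : Eu k} {s : ℝ} (g : Geo h0 y s) : gB f (Ph y s) = f (Ph y s) - (Iio (0:ℝ)).indicator (fun _ => (1:ℝ)) s := by
  by_cases hs : s < 0
  · rw [gB_in (g.lt_iff.2 hs), indicator_of_mem (by simpa using hs)]
  · rw [gB_out (not_lt.1 fun hc => hs (g.lt_iff.1 hc)), indicator_of_notMem (by simpa using hs), sub_zero]

theorem UU_eq {y : Eu k} (hy : ‖y‖ ≤ ρ0) : UU ε ε' κ ζ f y = ∫ x, gB f x * (ζ (((csL k).symm x).1 - Hh ((csL k).symm x).2) * κ (((csL k).symm x).2 - y)) := by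
  have zc := N.zc
  have kc := N.kc
  have hH := Hh_cont (k := k)
  have e0 := N.ep
  have hi : Integrable fun x => gB f x * (ζ (((csL k).symm x).1 - Hh ((csL k).symm x).2) * κ (((csL k).symm x).2 - y)) := by
    have hkb : ∃ C, ∀ z, ‖κ z‖ ≤ C := by
      refine kc.bounded_above_of_compact_support (HasCompactSupport.intro (isCompact_closedBall 0 ε') fun z hz => N.kz z ?_)
      simp at hz; exact hz.le
    obtain ⟨C, hC⟩ := hkb
    refine h.gB_int.mul_bdd (c := 1 * C) (by fun_prop : Continuous fun x => (ζ (((csL k).symm x).1 - Hh ((csL k).symm x).2) * κ (((csL k).symm x).2 - y))).aestronglyMeasurable (evf fun x => ?_)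
    rw [norm_mul]
    refine mul_le_mul ?_ (hC _) (norm_nonneg _) zero_le_one
    rw [Real.norm_of_nonneg (N.z0 _)]; exact N.z1 _
  rw [integral_slice_swap hi]
  simp only [ContinuousLinearEquiv.symm_apply_apply]
  have e1 : ∀ y' : Eu k, ∫ t : ℝ, gB f (csL k (t, y')) * (ζ (t - Hh y') * κ (y' - y)) = κ (y' - y) * ∫ s : ℝ, gB f (Ph y' s) * ζ s := fun y' => by
    rw [← integral_add_right_eq_self (fun t => gB f (csL k (t, y')) * (ζ (t - Hh y') * κ (y' - y))) (Hh y'), ← integral_const_mul]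
    refine integral_congr_ae (evf fun s => ?_)
    simp only [add_sub_cancel_right, Ph]; ring
  simp only [e1]
  rw [← integral_add_left_eq_self (fun y' => κ (y' - y) * ∫ s : ℝ, gB f (Ph y' s) * ζ s) y]
  simp only [add_sub_cancel_left]
  have e2 : ∫ z : Eu k, κ z * ∫ s : ℝ, gB f (Ph (y+z) s) * ζ s = ∫ z in closedBall 0 ε', κ z * ∫ s : ℝ, gB f (Ph (y+z) s) * ζ s := by
    rw [← integral_indicator measurableSet_closedBall]
    refine integral_congr_ae (evf fun z => ?_)
    by_cases hz : z ∈ closedBall (0 : Eu k) ε'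
    · simp [indicator_of_mem hz]
    · simp only [indicator_of_notMem hz]
      rw [N.kz z (by simp at hz; exact hz.le), zero_mul]
  rw [e2]
  have e3 : ∀ z ∈ closedBall (0 : Eu k) ε', ∫ s : ℝ, gB f (Ph (y+z) s) * ζ s = (∫ s in Icc 0 ε, ζ s * f (Ph (y+z) s)) - ∫ s in Icc 0 ε, ζ s * (1 - f (Ph (y+z) (-s))) := fun z hz => by
    have fc : Continuous fun s => f (Ph (y+z) s) := ph_comp h.cont continuous_const continuous_id
    have c1 : Continuous fun s => ζ s * f (Ph (y+z) s) := zc.mul fc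
    have a1 : ∫ s : ℝ, gB f (Ph (y+z) s) * ζ s = ∫ s in Icc (-ε) ε, (ζ s * f (Ph (y+z) s) - (Iio (0:ℝ)).indicator ζ s) := by
      rw [← integral_indicator measurableSet_Icc]
      refine integral_congr_ae (evf fun s => ?_)
      by_cases hs : s ∈ Icc (-ε) ε
      · simp only [indicator_of_mem hs]
        rw [gB_ph h (N.geo (N.add1 hy hz) hs)]
        by_cases h0 : s ∈ Iio (0:ℝ)
        · simp only [indicator_of_mem h0]; ring
        · simp only [indicator_of_notMem h0]; ring
      · simp only [indicator_of_notMem hs]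
        rw [N.zf s (le_of_lt (by rw [← not_le, abs_le]; exact hs)), mul_zero]
    have a2 : ∫ s in Icc (-ε) ε, (Iio (0:ℝ)).indicator ζ s = ∫ s in Icc 0 ε, ζ s := by
      rw [integral_indicator measurableSet_Iio, Measure.restrict_restrict measurableSet_Iio]
      have : Iio (0:ℝ) ∩ Icc (-ε) ε = Ico (-ε) 0 := by
        ext s; simp only [mem_inter_iff, mem_Iio, mem_Icc, mem_Ico]
        exact ⟨fun a => ⟨a.2.1, a.1⟩, fun a => ⟨a.2, a.1, by linarith⟩⟩
      rw [this, integral_Ico_eq_integral_Ioc, ← intervalIntegral.integral_of_le bli, integral_Icc_eq_integral_Ioc, ← intervalIntegral.integral_of_le bli]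
      have := intervalIntegral.integral_comp_neg (a := 0) (b := ε) ζ
      rw [neg_zero] at this
      rw [← this]
      simp only [N.ze]
    have c2 : IntegrableOn ((Iio (0:ℝ)).indicator ζ) (Icc (-ε) ε) := (icc_int zc).indicator measurableSet_Iio
    have c3 : Continuous fun s => ζ s * f (Ph (y+z) (-s)) := zc.mul (ph_comp h.cont continuous_const bfp)
    rw [a1, integral_sub (icc_int c1) c2, a2, fold c1 e0.le]
    simp only [N.ze, mul_sub, mul_one]
    rw [integral_add (icc_int c1) (icc_int c3), integral_sub (icc_int zc) (icc_int c3)]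
    ring
  have j1 : Continuous (Function.uncurry fun (s : ℝ) (z : Eu k) => ζ s * (κ z * f (Ph (y+z) s))) :=
    (zc.comp continuous_fst).mul ((kc.comp continuous_snd).mul (ph_comp h.cont bfp bfp))
  have j2 : Continuous (Function.uncurry fun (s : ℝ) (z : Eu k) => ζ s * (κ z * f (Ph (y+z) (-s)))) :=
    (zc.comp continuous_fst).mul ((kc.comp continuous_snd).mul (ph_comp h.cont bfp bfp))
  have e4 : ∫ z in closedBall 0 ε', κ z * ∫ s : ℝ, gB f (Ph (y+z) s) * ζ s = ∫ z in closedBall 0 ε', ((∫ s in Icc 0 ε, ζ s * (κ z * f (Ph (y+z) s))) + (∫ s in Icc 0 ε, ζ s * (κ z * f (Ph (y+z) (-s)))) - κ z * ∫ s in Icc 0 ε, ζ s) := by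
    refine setIntegral_congr_fun measurableSet_closedBall fun z hz => ?_
    change κ z * _ = _
    have c3 : Continuous fun s => ζ s * f (Ph (y+z) (-s)) := zc.mul (ph_comp h.cont continuous_const bfp)
    rw [e3 z hz]
    simp only [mul_left_comm _ (κ z), mul_sub, mul_one]
    rw [integral_sub (icc_int zc) (icc_int c3), integral_const_mul, integral_const_mul]
    ring
  have p1 : Continuous fun z : Eu k => ∫ s in Icc 0 ε, ζ s * (κ z * f (Ph (y+z) s)) :=
    continuous_parametric_integral_of_continuous (f := fun (z : Eu k) (s : ℝ) => ζ s * (κ z * f (Ph (y+z) s))) (j1.comp continuous_swap) isCompact_Icc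
  have p2 : Continuous fun z : Eu k => ∫ s in Icc 0 ε, ζ s * (κ z * f (Ph (y+z) (-s))) :=
    continuous_parametric_integral_of_continuous (f := fun (z : Eu k) (s : ℝ) => ζ s * (κ z * f (Ph (y+z) (-s)))) (j2.comp continuous_swap) isCompact_Icc
  rw [e4, integral_sub (pz_int N h bfp) ((pz_int N h kc).mul_const _), integral_add (pz_int N h p1) (pz_int N h p2), integral_mul_const, N.k1,
    ← swap_cc j1 isCompact_Icc (isCompact_closedBall _ _), ← swap_cc j2 isCompact_Icc (isCompact_closedBall _ _)]
  unfold UU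
  have pc := pp_cont N h
  have pc1 : Continuous fun s => pp ε' κ f y (-s) := pc.comp (by fun_prop : Continuous fun s : ℝ => (y, -s))
  simp only [integral_const_mul, mul_sub, mul_one]
  rw [integral_sub (icc_int zc) (icc_int bfp)]
  unfold pp
  ring
end

theorem slice_cs {B : Es k → ℝ} (hB : Continuous B) (hc : HasCompactSupport B) (y : Eu k) :
    Integrable fun t : ℝ => B (csL k (t, y)) := by
  refine Continuous.integrable_of_hasCompactSupport (hB.comp bfp) ?_
  obtain ⟨R, hR⟩ := hc.isCompact.isBounded.subset_closedBall 0
  refine HasCompactSupport.intro (isCompact_Icc (a := -R) (b := R)) (fun t ht => ?_)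
  by_contra h
  have h1 := hR (subset_tsupport _ h)
  rw [mem_closedBall_zero_iff] at h1
  exact ht (abs_le.1 ((csL_fst_le (t, y)).trans h1))

theorem slab {B : Es k → ℝ} (hB : Continuous B) (hc : HasCompactSupport B) (h0 : ∀ x, 0 ≤ B x) (ρ ε : ℝ) :
    ∫ y in closedBall (0 : Eu k) ρ, ∫ s in Icc (-ε) ε, B (Ph y s) ≤ ∫ x, B x := by
  have hi := hB.integrable_of_hasCompactSupport hc (μ := volume)
  have c1 : Continuous fun y : Eu k => ∫ s in Icc (-ε) ε, B (Ph y s) :=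
    continuous_parametric_integral_of_continuous (ph_comp hB continuous_fst continuous_snd) isCompact_Icc
  have i2 : Integrable fun y : Eu k => ∫ t : ℝ, B (csL k (t, y)) := (integrable_csL.2 hi).integral_prod_right
  rw [integral_slice_swap hi]
  refine le_trans ?_ (setIntegral_le_integral (s := closedBall 0 ρ) i2 (evf fun y => integral_nonneg fun t => h0 _))
  refine setIntegral_mono_on (c1.continuousOn.integrableOn_compact (isCompact_closedBall _ _)) i2.integrableOn measurableSet_closedBall fun y _ => ?_
  have i3 := (slice_cs hB hc y).comp_add_right (Hh y)
  rw [← integral_add_right_eq_self (fun t => B (csL k (t, y))) (Hh y)]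
  exact setIntegral_le_integral i3 (evf fun t => h0 _)

theorem refl_icc (q : ℝ → ℝ) {e : ℝ} (he : 0 ≤ e) : ∫ s in Icc (-e) 0, q s = ∫ s in Icc 0 e, q (-s) := by
  rw [integral_Icc_eq_integral_Ioc, integral_Icc_eq_integral_Ioc, ← intervalIntegral.integral_of_le bli, ← intervalIntegral.integral_of_le he,
    intervalIntegral.integral_comp_neg, neg_zero]

def Sec (k : ℕ) (θ ε1 : ℝ) : Set (Es k) := {x | |1 - ‖x‖| ≤ ε1 ∧ θ * ‖x‖ ≤ x 0}

theorem Sec_meas {θ ε1 : ℝ} : MeasurableSet (Sec k θ ε1) :=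
  ((isClosed_le (f := fun x : Es k => |1 - ‖x‖|) (g := fun _ => ε1) bfp continuous_const).inter
    (isClosed_le (f := fun x : Es k => θ * ‖x‖) (g := fun x => x 0) bfp bfp)).measurableSet

theorem Sec_geo {θ ε1 s : ℝ} {y : Eu k} (t0 : 0 < θ) (t1 : θ ≤ 1) (e0 : 0 < ε1) (e1 : ε1 ≤ θ^2/8) (hx : Ph y s ∈ Sec k θ ε1) :
    ‖y‖ ≤ √(1 - θ^2/2) ∧ |s| ≤ 6*ε1/θ ∧ |1 - ‖Ph y s‖| ≤ |s| := by
  obtain ⟨h1, h2⟩ := hx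
  have hn : ‖Ph y s‖^2 = (s + Hh y)^2 + ‖y‖^2 := csL_norm_sq _
  have h3 : (Ph y s) 0 = s + Hh y := csL_zero _
  rw [h3] at h2
  have hr0 := norm_nonneg (Ph y s)
  set r := ‖Ph y s‖ with hr
  have h4 := abs_le.1 h1
  have tr : 0 ≤ θ * r := by positivity
  have th2 : θ^2 ≤ 1 := by nlinarith
  have a1 : ‖y‖^2 ≤ 1 - θ^2/2 := by
    have b1 : (θ*r)^2 ≤ (s + Hh y)^2 := by gcongr
    have b2 : r^2 ≤ 1 + 3 * ε1 := by nlinarith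
    have b3 : r^2*(1-θ^2) ≤ (1+3*ε1)*(1-θ^2) := mr b2 bli
    nlinarith
  have a2 : ‖y‖ ≤ √(1 - θ^2/2) := Real.le_sqrt_of_sq_le a1
  have y1 : ‖y‖ ≤ 1 := by nlinarith [norm_nonneg y]
  have H2 := Hh_sq y1
  have Hp : θ/2 ≤ Hh y := by
    unfold Hh; apply Real.le_sqrt_of_sq_le; nlinarith
  have id : s * (s + 2 * Hh y) = (r - 1) * (r + 1) := by nlinarith
  have id2 : |s| * (s + 2 * Hh y) = |1 - r| * (r + 1) := by
    have := congrArg abs id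
    rwa [abs_mul, abs_mul, abs_of_nonneg (by linarith : 0 ≤ s + 2 * Hh y), abs_of_nonneg (by linarith : 0 ≤ r + 1), abs_sub_comm] at this
  have tle : s + Hh y ≤ r := by nlinarith [sq_nonneg ‖y‖]
  have H1 := Hh_le y
  refine ⟨a2, ?_, ?_⟩
  · rw [le_div_iff₀ t0]
    have : |s| * (θ/2) ≤ |s| * (s + 2 * Hh y) := by gcongr; linarith
    have : |1 - r| * (r + 1) ≤ ε1 * 3 := by gcongr; nlinarith
    linarith
  · by_contra hc
    push Not at hc
    have : |s| * (r + 1) < |1 - r| * (r + 1) := by gcongr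
    have : |s| * (s + 2 * Hh y) ≤ |s| * (r + 1) := ml bli (abs_nonneg _)
    linarith

theorem Sec_int {θ ε1 e : ℝ} (t0 : 0 < θ) (t1 : θ ≤ 1) (e0 : 0 < ε1) (e1 : ε1 ≤ θ^2/8) (he : 6*ε1/θ ≤ e) (he2 : e ≤ θ/4)
    {f : Es k → ℝ} (h : Adm f) :
    ∫ x in Sec k θ ε1, |gB f x| * wt x ≤ ∫ y in closedBall (0 : Eu k) √(1 - θ^2/2), ∫ s in Icc 0 e, (f (Ph y s) + (1 - f (Ph y (-s)))) * s := by
  have ep : 0 < e := lt_of_lt_of_le bpo he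
  have hi : Integrable ((Sec k θ ε1).indicator fun x => |gB f x| * wt x) := h.Gam_int.indicator Sec_meas
  rw [← integral_indicator Sec_meas, integral_slice_swap hi, ← integral_indicator measurableSet_closedBall]
  have c1 : Continuous fun y : Eu k => ∫ s in Icc 0 e, (f (Ph y s) + (1 - f (Ph y (-s)))) * s := by
    refine continuous_parametric_integral_of_continuous (f := fun (y : Eu k) (s : ℝ) => (f (Ph y s) + (1 - f (Ph y (-s)))) * s) ?_ isCompact_Icc
    exact ((ph_comp h.cont continuous_fst continuous_snd).add (continuous_const.sub (ph_comp h.cont continuous_fst bfp))).mul continuous_snd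
  refine integral_mono_of_nonneg (evf fun y => integral_nonneg fun t => indicator_nonneg (fun x _ => mul_nonneg (abs_nonneg _) (wt_nn x)) _)
    ((integrable_indicator_iff measurableSet_closedBall).2 (c1.continuousOn.integrableOn_compact (isCompact_closedBall _ _))) (evf fun y => ?_)
  change ∫ t : ℝ, (Sec k θ ε1).indicator (fun x => |gB f x| * wt x) (csL k (t, y)) ≤ _
  rw [← integral_add_right_eq_self (fun t => (Sec k θ ε1).indicator (fun x => |gB f x| * wt x) (csL k (t, y))) (Hh y)]
  change ∫ s : ℝ, (Sec k θ ε1).indicator (fun x => |gB f x| * wt x) (Ph y s) ≤ _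
  by_cases hy : y ∈ closedBall (0 : Eu k) √(1 - θ^2/2)
  · rw [indicator_of_mem hy]
    have c2 : Continuous fun s => f (Ph y s) := ph_comp h.cont continuous_const continuous_id
    have c3 : Continuous fun s => f (Ph y (-s)) := ph_comp h.cont continuous_const continuous_neg
    have d1 : Continuous fun s => f (Ph y s) * s := c2.mul continuous_id
    have d2 : Continuous fun s => (1 - f (Ph y s)) * (-s) := (continuous_const.sub c2).mul continuous_neg
    have d3 : Continuous fun s => (1 - f (Ph y (-s))) * - -s := d2.comp continuous_neg
    have j1 : Integrable ((Icc 0 e).indicator fun s => f (Ph y s) * s) := (integrable_indicator_iff measurableSet_Icc).2 (icc_int d1)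
    have j2 : Integrable ((Icc (-e) 0).indicator fun s => (1 - f (Ph y s)) * (-s)) := (integrable_indicator_iff measurableSet_Icc).2 (icc_int d2)
    have e1 : ∫ s in Icc 0 e, (f (Ph y s) + (1 - f (Ph y (-s)))) * s = ∫ s, ((Icc 0 e).indicator (fun s => f (Ph y s) * s) s + (Icc (-e) 0).indicator (fun s => (1 - f (Ph y s)) * (-s)) s) := by
      rw [integral_add j1 j2, integral_indicator measurableSet_Icc, integral_indicator measurableSet_Icc, refl_icc _ ep.le, ← integral_add (icc_int d1) (icc_int d3)]
      refine setIntegral_congr_fun measurableSet_Icc fun s _ => ?_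
      ring
    rw [e1]
    refine integral_mono_of_nonneg (evf fun s => indicator_nonneg (fun x _ => mul_nonneg (abs_nonneg _) (wt_nn x)) _) (j1.add j2) (evf fun s => ?_)
    have n1 : 0 ≤ (Icc 0 e).indicator (fun s => f (Ph y s) * s) s := indicator_nonneg (fun s hs => mul_nonneg (h.nn _) hs.1) _
    have n2 : 0 ≤ (Icc (-e) 0).indicator (fun s => (1 - f (Ph y s)) * (-s)) s := indicator_nonneg (fun s hs => mul_nonneg (by linarith [h.le (Ph y s)]) (by linarith [hs.2])) _
    by_cases hx : Ph y s ∈ Sec k θ ε1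
    · change (Sec k θ ε1).indicator (fun x => |gB f x| * wt x) (Ph y s) ≤ _ + _
      rw [indicator_of_mem hx]
      obtain ⟨g1, g2, g3⟩ := Sec_geo t0 t1 e0 ‹_› hx
      have se := abs_le.1 (g2.trans he)
      have hw : wt (Ph y s) ≤ |s| := (min_le_left _ _).trans g3
      have th2 : θ^2 ≤ 1 := by nlinarith
      have hG : Geo (θ/2) y s := by
        have q : √(1 - θ^2/2)^2 = 1 - θ^2/2 := Real.sq_sqrt bli
        refine ⟨by linarith, by linarith, ?_, Hh_ge (ρ := √(1 - θ^2/2)) bli (by rw [q]; nlinarith) g1, by linarith [g2.trans he]⟩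
        nlinarith [Real.sqrt_nonneg (1 - θ^2/2)]
      rcases lt_or_ge s 0 with hs | hs
      · rw [indicator_of_mem (show s ∈ Icc (-e) 0 from ⟨se.1, hs.le⟩)] at n2 ⊢
        rw [gB_in (hG.lt_iff.2 hs), abs_sub_comm, abs_of_nonneg (by linarith [h.le (Ph y s)])]
        rw [abs_of_neg hs] at hw
        have := ml hw (by linarith [h.le (Ph y s)] : 0 ≤ 1 - f (Ph y s))
        linarith
      · rw [indicator_of_mem (show s ∈ Icc 0 e from ⟨hs, se.2⟩)] at n1 ⊢
        rw [gB_out (not_lt.1 fun hc => hs.not_gt (hG.lt_iff.1 hc)), abs_of_nonneg (h.nn _)]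
        rw [abs_of_nonneg hs] at hw
        have := ml hw (h.nn (Ph y s))
        linarith
    · change (Sec k θ ε1).indicator (fun x => |gB f x| * wt x) (Ph y s) ≤ _ + _
      rw [indicator_of_notMem hx]; linarith
  · rw [indicator_of_notMem hy]
    refine le_of_eq (integral_eq_zero_of_ae (evf fun s => ?_))
    refine indicator_of_notMem (fun hx => hy ?_) _
    have := (Sec_geo t0 t1 e0 ‹_› hx).1
    simpa using this

theorem near_aux {a h b c ε ρ : ℝ} (h1 : |a - h| < ε) (he : ε ≤ 1/4) (hh0 : 0 ≤ h) (hh1 : h ≤ 1) (hb : b ≤ 1) (hb0 : 0 ≤ b)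
    (hc : c^2 = a^2 + b^2) (hc3 : 3 ≤ c) : False := by
  have h5 := abs_lt.1 h1
  have h8 : a^2 ≤ 4 := by
    rw [show (4:ℝ) = 2^2 by norm_num]
    exact sq_le_sq' bli bli
  have h9 : b^2 ≤ 1 := by nlinarith
  nlinarith

theorem sint4 {Y : Set (Eu k)} (hY : IsCompact Y) {g a b c : Eu k → ℝ} {p q r s e : ℝ} (cg : Continuous g) (ca : Continuous a) (cb : Continuous b) (cc : Continuous c)
    (h : ∀ y ∈ Y, g y ≤ p * a y + q * b y + e + r * c y) :
    ∫ y in Y, g y ≤ p * (∫ y in Y, a y) + q * (∫ y in Y, b y) + volume.real Y * e + r * ∫ y in Y, c y := by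
  have yi : ∀ {q : Eu k → ℝ}, Continuous q → IntegrableOn q Y := fun hq => hq.continuousOn.integrableOn_compact hY
  have i1 : IntegrableOn (fun y => p * a y) Y := yi bfp
  have i2 : IntegrableOn (fun y => q * b y) Y := yi bfp
  have i3 : IntegrableOn (fun y : Eu k => e) Y := yi bfp
  have i4 : IntegrableOn (fun y => r * c y) Y := yi bfp
  have i12 : IntegrableOn (fun y => p * a y + q * b y) Y := yi bfp
  have i123 : IntegrableOn (fun y => p * a y + q * b y + e) Y := yi bfp
  have S := setIntegral_mono_on (yi cg) (yi (by fun_prop : Continuous fun y => p * a y + q * b y + e + r * c y)) hY.measurableSet h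
  rw [integral_add i123 i4, integral_add i12 i3, integral_add i1 i2, integral_const_mul, integral_const_mul, integral_const_mul, setIntegral_const, smul_eq_mul] at S
  exact S

set_option maxHeartbeats 1000000 in
theorem NearS {K R0 θ δ : ℝ} (hK : 0 ≤ K) (hR0 : 1 ≤ R0) (t0 : 0 < θ) (t1 : θ ≤ 1) (hδ : 0 < δ) :
    ∃ ε1 K1 d1 : ℝ, 0 < ε1 ∧ 0 < K1 ∧ 0 < d1 ∧ ∀ (f : Es k → ℝ) (d : ℝ), Cen K R0 f d → d ≤ d1 →
      ∫ x in Sec k θ ε1, |gB f x| * wt x ≤ δ * (beta f + Gam f) + K1 * d := by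
  have th2 : θ^2 ≤ 1 := by nlinarith
  obtain ⟨h0, hh0⟩ : ∃ h0, h0 = θ/2 := ⟨_, rfl⟩
  have h0p : 0 < h0 := by linarith
  obtain ⟨ρ0, hρ0⟩ : ∃ ρ0, ρ0 = √(1 - θ^2/2) := ⟨_, rfl⟩
  obtain ⟨ρ1, hρ1⟩ : ∃ ρ1, ρ1 = √(1 - θ^2/4) := ⟨_, rfl⟩
  have r0n : 0 ≤ ρ0 := by rw [hρ0]; positivity
  have r1n : 0 ≤ ρ1 := by rw [hρ1]; positivity
  have q0 : ρ0^2 = 1 - θ^2/2 := by rw [hρ0]; exact Real.sq_sqrt bli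
  have q1 : ρ1^2 = 1 - θ^2/4 := by rw [hρ1]; exact Real.sq_sqrt bli
  have r01 : ρ0 < ρ1 := by
    have : 0 < θ^2 := by positivity
    nlinarith
  have r1 : ρ1 < 1 := by
    have : 0 < θ^2 := by positivity
    nlinarith
  obtain ⟨ε, hε⟩ : ∃ e, e = min (θ/4) (δ*h0/40) := ⟨_, rfl⟩
  have ep : 0 < ε := by rw [hε]; positivity
  have ea : ε ≤ θ/4 := by rw [hε]; exact min_le_left _ _
  have eb : ε ≤ δ*h0/40 := by rw [hε]; exact min_le_right _ _
  have ec : 4 * ε^2 * (5/h0) ≤ δ/2 := by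
    calc 4 * ε^2 * (5/h0) ≤ 4 * ε * (5/h0) := by
          have : ε^2 ≤ ε := by nlinarith
          gcongr
      _ ≤ 4 * (δ*h0/40) * (5/h0) := by gcongr
      _ = δ/2 := by field_simp; norm_num
  obtain ⟨ε', hε'⟩ : ∃ e, e = min (ρ1 - ρ0) (δ*h0^3/16400) := ⟨_, rfl⟩
  have e'p : 0 < ε' := by rw [hε']; exact lt_min bli bpo
  have e'a : ε' ≤ ρ1 - ρ0 := by rw [hε']; exact min_le_left _ _
  have e'b : 41 * (ε' * (200/h0^3)) ≤ δ/2 := by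
    calc 41 * (ε' * (200/h0^3)) ≤ 41 * (δ*h0^3/16400 * (200/h0^3)) := by gcongr; rw [hε']; exact min_le_right _ _
      _ = δ/2 := by field_simp; norm_num
  obtain ⟨ε1, hε1⟩ : ∃ e, e = min (θ^2/8) (ε*θ/12) := ⟨_, rfl⟩
  have e1p : 0 < ε1 := by rw [hε1]; positivity
  have e1a : ε1 ≤ θ^2/8 := by rw [hε1]; exact min_le_left _ _
  have e1b : 6 * ε1/θ ≤ ε/2 := by
    rw [div_le_iff₀ t0]
    have : ε1 ≤ ε*θ/12 := by rw [hε1]; exact min_le_right _ _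
    linarith
  obtain ⟨κ, kc, k0, kz, -, k2⟩ := exists_bump k e'p
  obtain ⟨ζ, hζ⟩ : ∃ ζ : ℝ → ℝ, ζ = fun s => max 0 (min 1 (2 - 2*|s|/ε)) := ⟨_, rfl⟩
  have zc : Continuous ζ := by rw [hζ]; fun_prop
  have N : NS h0 ρ0 ρ1 ε ε' κ ζ :=
    { hp := h0p, h1 := by linarith, hρ := by rw [q1, hh0]; linarith [sq_nonneg θ], ρ0n := r0n, ρ01 := by linarith, ep := ep, eh := by linarith,
      e'p := e'p, kc := kc, k0 := k0, kz := kz, k1 := k2, zc := zc, z0 := fun s => by rw [hζ]; exact le_max_left _ _,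
      z1 := fun s => by rw [hζ]; exact max_le zero_le_one (min_le_left _ _)
      ze := fun s => by rw [hζ]; simp only [abs_neg]
      zz := fun s hs => by
        rw [hζ]; simp only
        have : 2*|s|/ε ≤ 1 := by rw [div_le_iff₀ ep, abs_of_nonneg hs.1]; linarith [hs.2]
        rw [min_eq_left bli, max_eq_right zero_le_one]
      zf := fun s hs => by
        rw [hζ]; simp only
        have : 2 ≤ 2*|s|/ε := by rw [le_div_iff₀ ep]; linarith
        exact max_eq_left ((min_le_right _ _).trans bli) }
  have hω := om_pos (k+1)
  obtain ⟨C, Cp, hC⟩ := bath (n := k+1) bom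
  obtain ⟨v, hv⟩ : ∃ v, v = volume.real (closedBall (0 : Eu k) ρ0) := ⟨_, rfl⟩
  have v0 : 0 ≤ v := by rw [hv]; exact measureReal_nonneg
  obtain ⟨η, hη⟩ : ∃ η, η = min 1 (δ/(8*(v+1)*C)) := ⟨_, rfl⟩
  have ηp : 0 < η := by rw [hη]; positivity
  have ηa : 8 * v * (η^2 * C) ≤ δ := by
    have a1 : η ≤ 1 := by rw [hη]; exact min_le_left _ _
    have a2 : η^2 ≤ δ/(8*(v+1)*C) := by
      have : η ≤ δ/(8*(v+1)*C) := by rw [hη]; exact min_le_right _ _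
      nlinarith
    calc 8 * v * (η^2 * C) ≤ 8 * (v+1) * (δ/(8*(v+1)*C) * C) := by gcongr; linarith
      _ = δ := by field_simp
  have hHc := Hh_cont (k := k)
  obtain ⟨KF, hKF, hM⟩ := M4u (k := k) hK hR0 (Y := closedBall (0 : Eu k) ρ0) (S := univ) isCompact_univ
    (F := fun y x => ζ (((csL k).symm x).1 - Hh ((csL k).symm x).2) * κ (((csL k).symm x).2 - y)) bfp (R := 3) (fun y x hx => by
      obtain ⟨p, rfl⟩ := (csL k).surjective x
      rw [ContinuousLinearEquiv.symm_apply_apply]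
      have hy : ‖(y : Eu k)‖ ≤ ρ0 := mem_closedBall_zero_iff.1 y.2
      by_cases h1 : ε ≤ |p.1 - Hh p.2|
      · rw [N.zf _ h1, zero_mul]
      by_cases h2 : ε' ≤ ‖p.2 - y‖
      · rw [kz _ h2, mul_zero]
      exfalso
      push Not at h1 h2
      have h3 := csL_norm_sq p
      have h4 : ‖p.2‖ ≤ 1 := by have := norm_sub_norm_le p.2 y; linarith
      exact near_aux (ρ := 0) h1 bli (Hh_nn p.2) (Hh_le p.2) h4 (norm_nonneg _) h3 hx) (η := η) ηp
  refine ⟨ε1, 40 * ε + 8 * v * KF^2 + 1, min 1 (om (k+1)), e1p, by positivity, by positivity, fun f d D hd => ?_⟩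
  have h := D.df.adm
  have dp := D.df.dpos
  have da : d ≤ 1 := hd.trans (min_le_left _ _)
  have db : d ≤ om (k+1) := hd.trans (min_le_right _ _)
  have L1 := L1_le D.df
  have bt := hC (gB f) h.gB_int h.gB_abs_le bli h.Gam_int
  change _ ≤ C * Gam f at bt
  set G := ∫ x, |gB f x| with hG
  have G0 : 0 ≤ G := integral_nonneg fun x => abs_nonneg _
  set Y0 := closedBall (0 : Eu k) ρ0 with hY0
  have Yc : IsCompact Y0 := isCompact_closedBall _ _
  have yi : ∀ {q : Eu k → ℝ}, Continuous q → IntegrableOn q Y0 := fun hq => hq.continuousOn.integrableOn_compact Yc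
  have U2 : ∀ y ∈ Y0, (UU ε ε' κ ζ f y)^2 ≤ 2 * KF^2 * d + 2 * η^2 * G^2 := fun y hy => by
    rw [UU_eq N h (mem_closedBall_zero_iff.1 hy)]
    have := hM ⟨y, hy⟩ (mem_univ _) f d D da
    have sd := Real.sq_sqrt dp.le
    rw [← sq_abs]
    refine ((sq_le_sq₀ (abs_nonneg _) bpo).2 this).trans ?_
    nlinarith [sq_nonneg (KF * √d - η * G)]
  have Ac := AA_cont (ε := ε) h
  have fc := h.cont
  have c1 : Continuous fun y : Eu k => ∫ s in Icc 0 (ε/2), (f (Ph y s) + (1 - f (Ph y (-s)))) * s := by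
    refine continuous_parametric_integral_of_continuous (f := fun (y : Eu k) (s : ℝ) => (f (Ph y s) + (1 - f (Ph y (-s)))) * s) ?_ isCompact_Icc
    exact ((ph_comp h.cont continuous_fst continuous_snd).add (continuous_const.sub (ph_comp h.cont continuous_fst bfp))).mul continuous_snd
  have fcs : Continuous fun x => f x * (1 - f x) := by fun_prop
  have c2 : Continuous fun y : Eu k => ∫ s in Icc (-ε) ε, f (Ph y s) * (1 - f (Ph y s)) :=
    continuous_parametric_integral_of_continuous (ph_comp fcs continuous_fst continuous_snd) isCompact_Icc
  have c3 : Continuous fun y : Eu k => ∫ z in closedBall 0 ε', κ z * ∫ t in Icc (0:ℝ) 1, AA ε f (y + t • z) := by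
    refine continuous_parametric_integral_of_continuous (f := fun (y z : Eu k) => κ z * ∫ t in Icc (0:ℝ) 1, AA ε f (y + t • z)) ?_ (isCompact_closedBall _ _)
    refine (kc.comp continuous_snd).mul ?_
    exact continuous_parametric_integral_of_continuous (f := fun (p : Eu k × Eu k) t => AA ε f (p.1 + t • p.2)) (Ac.comp bfp) isCompact_Icc
  have c4 : Continuous fun y : Eu k => ∫ z in closedBall 0 ε', κ z * AA ε f (y + z) := by
    refine continuous_parametric_integral_of_continuous (f := fun (y z : Eu k) => κ z * AA ε f (y + z)) ?_ (isCompact_closedBall _ _)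
    exact (kc.comp continuous_snd).mul (Ac.comp bfp)
  have A1 : ∫ y in closedBall (0 : Eu k) ρ1, AA ε f y ≤ beta f := slab h.bb_cont h.bb_cs bb_nonneg ρ1 ε
  have A1i : IntegrableOn (AA ε f) (closedBall (0 : Eu k) ρ1) := Ac.continuousOn.integrableOn_compact (isCompact_closedBall _ _)
  have I2 : ∫ y in Y0, ∫ s in Icc (-ε) ε, f (Ph y s) * (1 - f (Ph y s)) ≤ d := by
    refine (slab fcs ?_ (fun x => mul_nonneg (h.nn x) (by linarith [h.le x])) ρ0 ε).trans D.df.bd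
    exact h.cs.mul_right
  have I3 : ∫ y in Y0, ∫ z in closedBall 0 ε', κ z * ∫ t in Icc (0:ℝ) 1, AA ε f (y + t • z) ≤ beta f := by
    have := tri_le Ac AA_nn Yc measurableSet_closedBall A1i (isCompact_closedBall _ _) kc k0 (fun y hy z hz t ht => mem_closedBall_zero_iff.2 (N.add (mem_closedBall_zero_iff.1 hy) hz ht))
    rw [k2, one_mul] at this
    exact this.trans A1
  have I4 : ∫ y in Y0, ∫ z in closedBall 0 ε', κ z * AA ε f (y + z) ≤ beta f := by
    have := duo_le Ac AA_nn Yc measurableSet_closedBall A1i (isCompact_closedBall _ _) kc k0 (fun y hy z hz => mem_closedBall_zero_iff.2 (N.add1 (mem_closedBall_zero_iff.1 hy) hz))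
    rw [k2, one_mul] at this
    exact this.trans A1
  have S1 := Sec_int t0 t1 e1p e1a e1b bli h
  rw [← hρ0] at S1
  have S2 := sint4 (s := 0) Yc c1 c2 c3 c4 (p := 40 * ε) (q := 41 * (ε' * (200/h0^3))) (e := 4 * (2 * KF^2 * d + 2 * η^2 * G^2)) (r := 4 * ε^2 * (5/h0)) (fun y hy => by
      have b := E2_y N h (mem_closedBall_zero_iff.1 hy)
      have := U2 y hy
      refine b.trans ?_
      linarith)
  rw [← hv] at S2
  have B0 : 0 ≤ beta f := beta_nn
  have W1 := ml I2 (by positivity : 0 ≤ 40 * ε)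
  have W2 := ml I3 (by positivity : 0 ≤ 41 * (ε' * (200/h0^3)))
  have W3 := ml I4 (by positivity : 0 ≤ 4 * ε^2 * (5/h0))
  have W4 := mr e'b B0
  have W5 := mr ec B0
  have W6 := ml bt (by positivity : 0 ≤ 8 * v * η^2)
  have W7 := mr ηa (Gam_nn (f := f))
  linarith

theorem Cen.comp_iso {K R0 d : ℝ} {f : Eu n → ℝ} (D : Cen K R0 f d) (L : Eu n ≃ₗᵢ[ℝ] Eu n) : Cen K R0 (fun x => f (L x)) d where
  df := D.df.comp_iso L
  pw e M q he hq hM hl := by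
    have h := D.pw (L e) M q (by rw [L.norm_map, he]) hq hM hl
    have e1 : ∫ x, f (L x) * q (inner ℝ e x) = ∫ x, f x * q (inner ℝ (L e) x) := by
      rw [← iso_int L (fun x => f x * q (inner ℝ (L e) x))]; simp only [L.inner_map_map]
    have e2 : ∫ x in BB n, q (inner ℝ e x) = ∫ x in BB n, q (inner ℝ (L e) x) := by
      rw [← iso_ball L (fun x => q (inner ℝ (L e) x))]; simp only [L.inner_map_map]
    rw [e1, e2]; exact h
  tail := by
    refine le_trans (le_of_eq ?_) D.tail
    have m : MeasurableSet {x : Eu n | R0 ≤ ‖x‖} := measurableSet_le measurable_const measurable_norm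
    rw [← integral_indicator m, ← integral_indicator m, ← iso_int L (indicator _ f)]
    congr 1; ext x
    simp only [indicator, mem_setOf_eq, L.norm_map]

theorem gB_iso (f : Eu n → ℝ) (L : Eu n ≃ₗᵢ[ℝ] Eu n) (x : Eu n) : gB (fun x => f (L x)) x = gB f (L x) := by
  simp only [gB, indicator, mem_ball_zero_iff, L.norm_map]

theorem wt_iso (L : Eu n ≃ₗᵢ[ℝ] Eu n) (x : Eu n) : wt (L x) = wt x := by simp only [wt, L.norm_map]

theorem Gam_iso (f : Eu n → ℝ) (L : Eu n ≃ₗᵢ[ℝ] Eu n) : Gam (fun x => f (L x)) = Gam f := by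
  unfold Gam; rw [← iso_int L (fun x => |gB f x| * wt x)]; simp only [gB_iso, wt_iso]

theorem beta_iso {f : Eu n → ℝ} (h : Adm f) (L : Eu n ≃ₗᵢ[ℝ] Eu n) : beta (fun x => f (L x)) = beta f := by
  unfold beta; rw [← iso_int L (fun x => bb f x)]
  congr 1; ext x
  have hp : L (phi x) = phi (L x) := by simp only [phi, L.norm_map, map_smul]
  unfold bb
  rw [fderiv_iso h L x, ← hp]
  congr 1
  exact (fderiv ℝ f (L x)).opNorm_comp_linearIsometryEquiv L

theorem big_coord (hn : 1 ≤ n) (x : Eu n) : ∃ i, 1 / (n:ℝ) * ‖x‖ ≤ |x i| := by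
  by_contra! h
  have : Nonempty (Fin n) := ⟨⟨0, hn⟩⟩
  have h1 := norm_le_sum x
  have h2 := Finset.sum_lt_sum_of_nonempty (s := Finset.univ) Finset.univ_nonempty fun i _ => h i
  simp only [Finset.sum_const, Finset.card_univ, Fintype.card_fin, nsmul_eq_mul] at h2
  have : (n:ℝ) ≠ 0 := by positivity
  field_simp at h2
  linarith

theorem ax_iso (j : Fin (k+1) × Bool) : ∃ L : Es k ≃ₗᵢ[ℝ] Es k, ∀ x, L x 0 = (if j.2 then 1 else -1) * x j.1 := by
  obtain ⟨L, h1, h2⟩ := exists_iso (v := (if j.2 then (1:ℝ) else -1) • EuclideanSpace.single j.1 (1:ℝ)) (e := EuclideanSpace.single (0 : Fin (k+1)) (1:ℝ)) (by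
    rw [norm_smul]; split_ifs <;> simp)
  refine ⟨L, fun x => ?_⟩
  have a : inner ℝ (EuclideanSpace.single (0 : Fin (k+1)) (1:ℝ)) (L x) = L x 0 := by simp [EuclideanSpace.inner_single_left]
  rw [← a, ← h1, L.inner_map_map, inner_smul_left, EuclideanSpace.inner_single_left]
  simp

theorem Near {K R0 δ : ℝ} (hK : 0 ≤ K) (hR0 : 1 ≤ R0) (hδ : 0 < δ) :
    ∃ ε1 K1 d1 : ℝ, 0 < ε1 ∧ 0 < K1 ∧ 0 < d1 ∧ ∀ (f : Es k → ℝ) (d : ℝ), Cen K R0 f d → d ≤ d1 →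
      ∫ x in {x | |1 - ‖x‖| ≤ ε1}, |gB f x| * wt x ≤ (2 * (k+1)) * (δ * (beta f + Gam f) + K1 * d) := by
  obtain ⟨ε1, K1, d1, a1, a2, a3, H⟩ := NearS (k := k) (θ := 1 / (k+1 : ℕ)) hK hR0 bpo (by
    rw [div_le_one bpo]; norm_cast; omega) hδ
  refine ⟨ε1, K1, d1, a1, a2, a3, fun f d D hd => ?_⟩
  choose L hL using ax_iso (k := k)
  have h := D.df.adm
  have hi : ∀ j, Integrable (fun x => (Sec k (1 / (k+1 : ℕ)) ε1).indicator (fun x => |gB f ((L j).symm x)| * wt x) (L j x)) := fun j => by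
    have := ((h.comp_iso (L j).symm).Gam_int.indicator (Sec_meas (k := k) (θ := 1 / (k+1 : ℕ)) (ε1 := ε1)))
    simp only [gB_iso] at this
    exact ((L j).measurePreserving.integrable_comp_emb (L j).toHomeomorph.measurableEmbedding).2 this
  have m : MeasurableSet {x : Es k | |1 - ‖x‖| ≤ ε1} := measurableSet_le bfp measurable_const
  rw [← integral_indicator m]
  calc _ ≤ ∫ x, ∑ j, (Sec k (1 / (k+1 : ℕ)) ε1).indicator (fun x => |gB f ((L j).symm x)| * wt x) (L j x) := by
        refine integral_mono (h.Gam_int.indicator m) (integrable_finset_sum _ fun j _ => hi j) fun x => ?_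
        have nn : ∀ j, 0 ≤ (Sec k (1 / (k+1 : ℕ)) ε1).indicator (fun x => |gB f ((L j).symm x)| * wt x) (L j x) := fun j =>
          indicator_nonneg (fun y _ => mul_nonneg (abs_nonneg _) (wt_nn y)) _
        by_cases hx : |1 - ‖x‖| ≤ ε1
        · obtain ⟨i, hi⟩ := big_coord bom x
          have : ∃ b : Bool, 1 / ((k+1 : ℕ) : ℝ) * ‖x‖ ≤ (if b then 1 else -1) * x i := by
            rcases abs_cases (x i) with c | c
            · exact ⟨true, by simp; simp at hi; linarith⟩
            · exact ⟨false, by simp; simp at hi; linarith⟩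
          obtain ⟨b, hb⟩ := this
          refine le_trans (le_of_eq ?_) (Finset.single_le_sum (fun j _ => nn j) (Finset.mem_univ (i, b)))
          rw [indicator_of_mem (show x ∈ {x : Es k | |1 - ‖x‖| ≤ ε1} from hx), indicator_of_mem]
          · simp only [LinearIsometryEquiv.symm_apply_apply, wt_iso]
          · exact ⟨by rw [LinearIsometryEquiv.norm_map]; exact hx, by rw [LinearIsometryEquiv.norm_map, hL]; exact hb⟩
        · rw [indicator_of_notMem (show x ∉ {x : Es k | |1 - ‖x‖| ≤ ε1} from hx)]
          exact Finset.sum_nonneg fun j _ => nn j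
    _ = ∑ j, ∫ x in Sec k (1 / (k+1 : ℕ)) ε1, |gB (fun x => f ((L j).symm x)) x| * wt x := by
        rw [integral_finset_sum _ fun j _ => hi j]
        refine Finset.sum_congr rfl fun j _ => ?_
        rw [iso_int (L j) (fun x => (Sec k (1 / (k+1 : ℕ)) ε1).indicator (fun x => |gB f ((L j).symm x)| * wt x) x), integral_indicator Sec_meas]
        simp only [gB_iso]
    _ ≤ ∑ j : Fin (k+1) × Bool, (δ * (beta f + Gam f) + K1 * d) := by
        refine Finset.sum_le_sum fun j _ => ?_
        have := H _ d (D.comp_iso (L j).symm) hd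
        rwa [beta_iso h, Gam_iso] at this
    _ = _ := by simp; ring

theorem M5 (hk : 1 ≤ k) : ∃ K d1 : ℝ, 0 < K ∧ 0 < d1 ∧ d1 ≤ om (k+1) / 2 ∧ ∀ (f : Es k → ℝ) (d : ℝ), Def f d → d ≤ d1 →
    ∃ c, Gam (fun x => f (x + c)) ≤ K * d := by
  obtain ⟨K, d0, hK, h1, h2, h3, H⟩ := M4 hk
  obtain ⟨n, hn⟩ : ∃ n : ℝ, n = k + 1 := ⟨_, rfl⟩
  have np : 0 < n := by rw [hn]; positivity
  obtain ⟨δ, hδ⟩ : ∃ δ, δ = 1 / (2*(2*n+1)*(2*n+11)) := ⟨_, rfl⟩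
  have δp : 0 < δ := by rw [hδ]; positivity
  have δe : (2*n+1) * δ * (2*n+11) = 1/2 := by rw [hδ]; field_simp
  have R1 : (1:ℝ) ≤ 3*(k+1) := by have : (0:ℝ) ≤ k := by positivity
                                  linarith
  obtain ⟨ε1, K1, d1, a1, a2, a3, H1⟩ := Near (k := k) hK.le R1 δp
  obtain ⟨K2, d2, b2, b3, H2⟩ := Far (k := k) hK.le R1 (ε := min ε1 1) bpo (min_le_right _ _) δp
  refine ⟨2 * ((2*n+1)*δ*n + 2*n*K1 + K2), min d0 (min d1 d2), by positivity, by positivity, (min_le_left _ _).trans h3, fun f d D hd => ?_⟩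
  obtain ⟨c, Cc⟩ := H f d D (hd.trans (min_le_left _ _))
  refine ⟨c, ?_⟩
  obtain ⟨g, hg⟩ : ∃ g, g = fun x => f (x + c) := ⟨_, rfl⟩
  rw [← hg] at Cc ⊢
  have h := Cc.df.adm
  have N := H1 g d Cc (hd.trans ((min_le_right _ _).trans (min_le_left _ _)))
  have F := H2 g d Cc (hd.trans ((min_le_right _ _).trans (min_le_right _ _)))
  have B := beta_le bom Cc.df
  push_cast at B
  rw [← hn] at N B
  have S : Gam g ≤ (∫ x in {x | |1 - ‖x‖| ≤ ε1}, |gB g x| * wt x) + ∫ x in {x | min ε1 1 ≤ |1-‖x‖|}, |gB g x| := by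
    have m1 : MeasurableSet {x : Es k | |1 - ‖x‖| ≤ ε1} := measurableSet_le bfp measurable_const
    have m2 : MeasurableSet {x : Es k | min ε1 1 ≤ |1-‖x‖|} := measurableSet_le measurable_const bfp
    rw [← integral_indicator m1, ← integral_indicator m2, ← integral_add (h.Gam_int.indicator m1) (h.gB_int.abs.indicator m2)]
    refine integral_mono h.Gam_int ((h.Gam_int.indicator m1).add (h.gB_int.abs.indicator m2)) fun x => ?_
    have w := wt_nn x; have w1 := wt_le x; have ga := abs_nonneg (gB g x)
    have u1 : 0 ≤ ({x : Es k | min ε1 1 ≤ |1-‖x‖|}).indicator (fun x => |gB g x|) x := indicator_nonneg (fun _ _ => abs_nonneg _) _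
    change _ ≤ indicator _ _ x + indicator _ _ x
    by_cases hx : |1 - ‖x‖| ≤ ε1
    · rw [indicator_of_mem (show x ∈ {x : Es k | |1 - ‖x‖| ≤ ε1} from hx)]
      simp only at u1 ⊢
      linarith
    · rw [indicator_of_notMem (show x ∉ {x : Es k | |1 - ‖x‖| ≤ ε1} from hx), indicator_of_mem (show x ∈ {x : Es k | min ε1 1 ≤ |1-‖x‖|} from (min_le_left _ _).trans (le_of_not_ge hx))]
      simp only
      nlinarith
  have b0 : 0 ≤ beta g := beta_nn
  have g0 : 0 ≤ Gam g := Gam_nn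
  have e1 : beta g + Gam g ≤ n * d + (2*n+11) * Gam g := by linarith
  have e2 := ml e1 (by positivity : 0 ≤ (2*n+1)*δ)
  have e3 : 0 ≤ δ * Gam g := by positivity
  have e4 : (2*n+1) * δ * ((2*n+11) * Gam g) = 1/2 * Gam g := by rw [← δe]; ring
  have e5 : 0 ≤ n * (δ * (beta g + Gam g)) := by positivity
  linarith

noncomputable def cvl {F : Type*} [NormedAddCommGroup F] [NormedSpace ℝ F] (g : Eu n → F) (ρ : Eu n → ℝ) (x : Eu n) : F := ∫ t, ρ (x - t) • g t

section
variable {F : Type*} [NormedAddCommGroup F] [NormedSpace ℝ F] [CompleteSpace F] {g : Eu n → F} {ρ : Eu n → ℝ}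

theorem cvl_eq : cvl g ρ = MeasureTheory.convolution g ρ (ContinuousLinearMap.lsmul ℝ ℝ).flip volume := by
  ext x; rfl

theorem cvl_cd (hg : LocallyIntegrable g) (h1 : ContDiff ℝ 1 ρ) (hc : HasCompactSupport ρ) : ContDiff ℝ 1 (cvl g ρ) := by
  rw [cvl_eq]; exact hc.contDiff_convolution_right _ hg h1

theorem cvl_cs (hg : HasCompactSupport g) (hc : HasCompactSupport ρ) : HasCompactSupport (cvl g ρ) := by
  rw [cvl_eq]; exact hg.convolution _ hc

theorem cvl_fd (hg : LocallyIntegrable g) (h1 : ContDiff ℝ 1 ρ) (hc : HasCompactSupport ρ) (x v : Eu n) :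
    Integrable (fun t => fderiv ℝ ρ (x - t) v • g t) ∧ fderiv ℝ (cvl g ρ) x v = ∫ t, fderiv ℝ ρ (x - t) v • g t := by
  have hfc : Continuous (fderiv ℝ ρ) := h1.continuous_fderiv one_ne_zero
  have i : Integrable (fun t => (ContinuousLinearMap.precompR (Eu n) (ContinuousLinearMap.lsmul ℝ ℝ (E := F)).flip) (g t) (fderiv ℝ ρ (x - t))) :=
    (hc.fderiv ℝ).convolutionExists_right _ hg hfc x
  have h := (hc.hasFDerivAt_convolution_right (ContinuousLinearMap.lsmul ℝ ℝ (E := F)).flip hg h1 x).fderiv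
  refine ⟨i.apply_continuousLinearMap v, ?_⟩
  rw [cvl_eq, h, convolution_def, ContinuousLinearMap.integral_apply i]
  rfl
end

section
variable {w : Eu n → ℝ} {ρ : Eu n → ℝ} {φ : Eu n → Eu n}

theorem cvl_vdiv (h1 : ContDiff ℝ 1 ρ) (hc : HasCompactSupport ρ) (hφ : Continuous φ) (y : Eu n) :
    vdiv (cvl φ ρ) y = ∫ t, fderiv ℝ ρ (y - t) (φ t) := by
  have hl := hφ.locallyIntegrable (μ := volume)
  have key : ∀ i, (fderiv ℝ (cvl φ ρ) y (EuclideanSpace.single i 1)) i = ∫ t, fderiv ℝ ρ (y - t) (EuclideanSpace.single i 1) * φ t i := fun i => by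
    obtain ⟨a, b⟩ := cvl_fd hl h1 hc y (EuclideanSpace.single i 1)
    rw [b]
    exact ((EuclideanSpace.proj i : Eu n →L[ℝ] ℝ).integral_comp_comm a).symm
  unfold vdiv
  simp only [key]
  rw [← integral_finset_sum]
  · congr 1; ext t
    conv_rhs => rw [← (EuclideanSpace.basisFun (Fin n) ℝ).sum_repr (φ t), map_sum]
    refine Finset.sum_congr rfl fun i _ => ?_
    simp [mul_comm]
  · intro i _
    exact (EuclideanSpace.proj i : Eu n →L[ℝ] ℝ).integrable_comp (cvl_fd hl h1 hc y (EuclideanSpace.single i 1)).1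

theorem cvl_dual (h1 : ContDiff ℝ 1 ρ) (hc : HasCompactSupport ρ) (he : ∀ x, ρ (-x) = ρ x) (hφ : Continuous φ) (hcφ : HasCompactSupport φ)
    (hw : Integrable w) : ∫ y, w y * vdiv (cvl φ ρ) y = - ∫ x, fderiv ℝ (cvl w ρ) x (φ x) := by
  have hfc : Continuous (fderiv ℝ ρ) := h1.continuous_fderiv one_ne_zero
  obtain ⟨M, hM⟩ := (hc.fderiv ℝ).exists_bound_of_continuous hfc
  have hodd : ∀ x, fderiv ℝ ρ (-x) = - fderiv ℝ ρ x := fun x => by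
    have h := ((h1.differentiable one_ne_zero (-x)).hasFDerivAt.comp x (hasFDerivAt_id x).neg).fderiv
    have e : (ρ ∘ (-id)) = ρ := funext he
    have e2 : fderiv ℝ ρ x = (fderiv ℝ ρ (-x)).comp (-ContinuousLinearMap.id ℝ (Eu n)) := by
      rw [← h]; congr 1; exact e.symm
    rw [e2]; ext v; simp
  have I : Integrable (Function.uncurry fun y t => w y * fderiv ℝ ρ (y - t) (φ t)) (volume.prod volume) := by
    refine Integrable.mono' ((hw.norm.mul_prod (hφ.integrable_of_hasCompactSupport hcφ).norm).mul_const M) ?_ ?_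
    · refine (hw.aestronglyMeasurable.comp_fst).mul ?_
      refine Continuous.aestronglyMeasurable ?_
      exact (hfc.comp (continuous_fst.sub continuous_snd)).clm_apply (hφ.comp continuous_snd)
    · refine evf fun p => ?_
      simp only [Function.uncurry, norm_mul]
      have := (fderiv ℝ ρ (p.1 - p.2)).le_opNorm (φ p.2)
      calc _ ≤ ‖w p.1‖ * (M * ‖φ p.2‖) := by gcongr; exact this.trans (by gcongr; exact hM _)
        _ = _ := by ring
  calc _ = ∫ y, ∫ t, w y * fderiv ℝ ρ (y - t) (φ t) := by
        congr 1; ext y; rw [cvl_vdiv h1 hc hφ, integral_const_mul]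
    _ = ∫ t, ∫ y, w y * fderiv ℝ ρ (y - t) (φ t) := integral_integral_swap I
    _ = ∫ t, - fderiv ℝ (cvl w ρ) t (φ t) := by
        congr 1; ext t
        rw [(cvl_fd hw.locallyIntegrable h1 hc t (φ t)).2, ← integral_neg]
        congr 1; ext y
        rw [← neg_sub, hodd]; simp [mul_comm]
    _ = _ := integral_neg _

theorem vdiv_smul {g : Eu n → ℝ} {ψ : Eu n → Eu n} (hg : Differentiable ℝ g) (hψ : Differentiable ℝ ψ) (x : Eu n) :
    vdiv (fun x => g x • ψ x) x = g x * vdiv ψ x + fderiv ℝ g x (ψ x) := by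
  unfold vdiv
  rw [fderiv_fun_smul (hg x) (hψ x), Finset.mul_sum]
  conv_rhs => rw [← (EuclideanSpace.basisFun (Fin n) ℝ).sum_repr (ψ x), map_sum]
  rw [← Finset.sum_add_distrib]
  refine Finset.sum_congr rfl fun i _ => ?_
  simp [mul_comm]

theorem vdiv_cont {ψ : Eu n → Eu n} (hψ : ContDiff ℝ 1 ψ) : Continuous (vdiv ψ) := by
  have := hψ.continuous_fderiv one_ne_zero
  unfold vdiv; fun_prop

theorem cvl_norm (h1 : Continuous ρ) (hc : HasCompactSupport ρ) (h0 : ∀ x, 0 ≤ ρ x) (hi : ∫ x, ρ x = 1) {F : Type*} [NormedAddCommGroup F] [NormedSpace ℝ F]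
    {g : Eu n → F} (hb : ∀ x, ‖g x‖ ≤ 1) (x : Eu n) : ‖cvl g ρ x‖ ≤ 1 := by
  have hI : Integrable fun t => ρ (x - t) := (h1.integrable_of_hasCompactSupport hc).comp_sub_left x
  calc _ ≤ ∫ t, ρ (x - t) := norm_integral_le_of_norm_le hI (evf fun t => by
        rw [norm_smul, Real.norm_of_nonneg (h0 _)]
        exact mul_le_of_le_one_right (h0 _) (hb _))
    _ = 1 := by rw [integral_sub_left_eq_self, hi]
end

theorem exists_cut {E : Set (Eu n)} (hE : MeasurableSet E) (hv : volume E ≠ ⊤) {η : ℝ} (hη : 0 < η) :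
    ∃ χ : Eu n → ℝ, ContDiff ℝ 1 χ ∧ HasCompactSupport χ ∧ (∀ x, 0 ≤ χ x) ∧ (∀ x, χ x ≤ 1) ∧ (∀ x, ‖fderiv ℝ χ x‖ ≤ η) ∧ ∫ x in E, (1 - χ x) ≤ η := by
  let b : ContDiffBump (0 : Eu n) := ⟨1, 2, by norm_num, by norm_num⟩
  have bc : ContDiff ℝ 1 b := b.contDiff
  obtain ⟨M, hM⟩ := (b.hasCompactSupport.fderiv ℝ).exists_bound_of_continuous (bc.continuous_fderiv one_ne_zero)
  have L1 : Filter.Tendsto (fun j : ℕ => ∫ x in E, (1 - b ((1/((j:ℝ)+1)) • x))) Filter.atTop (nhds (∫ x in E, (0:ℝ))) := by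
    have fm : IsFiniteMeasure (volume.restrict E) := ⟨by rw [Measure.restrict_apply_univ]; exact hv.lt_top⟩
    refine tendsto_integral_of_dominated_convergence (fun _ => 1) (fun j => ?_) (integrable_const _) (fun j => ?_) ?_
    · exact (continuous_const.sub (bc.continuous.comp bfp)).aestronglyMeasurable
    · refine evf fun x => ?_
      have h0 := b.nonneg (x := (1/((j:ℝ)+1)) • x); have h1 := b.le_one (x := (1/((j:ℝ)+1)) • x)
      rw [Real.norm_eq_abs, abs_le]; constructor <;> linarith
    · refine evf fun x => ?_
      have h2 : Filter.Tendsto (fun j : ℕ => (1/((j:ℝ)+1)) • x) Filter.atTop (nhds ((0:ℝ) • x)) := tendsto_one_div_add_atTop_nhds_zero_nat.smul_const x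
      rw [zero_smul] at h2
      have h3 := (bc.continuous.tendsto 0).comp h2
      have h4 : b 0 = 1 := b.one_of_mem_closedBall (by simp [b])
      rw [h4] at h3
      have := h3.const_sub 1
      simpa using this
  rw [integral_zero] at L1
  have L2 : Filter.Tendsto (fun j : ℕ => (1/((j:ℝ)+1)) * M) Filter.atTop (nhds (0 * M)) := tendsto_one_div_add_atTop_nhds_zero_nat.mul_const M
  rw [zero_mul] at L2
  obtain ⟨j, h1, h2⟩ := ((L1.eventually_le_const hη).and (L2.eventually_le_const hη)).exists
  have jp : 0 < 1/((j:ℝ)+1) := by positivity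
  refine ⟨fun x => b ((1/((j:ℝ)+1)) • x), bc.comp bfp, b.hasCompactSupport.comp_homeomorph (Homeomorph.smulOfNeZero _ jp.ne'), fun x => b.nonneg, fun x => b.le_one, fun x => ?_, h1⟩
  rw [fderiv_comp_smul, norm_smul, Real.norm_of_nonneg jp.le]
  exact (ml (hM _) jp.le).trans h2

theorem cvl_zero {w ρ : Eu n → ℝ} {r e : ℝ} (hw : ∀ x, r < ‖x‖ → w x = 0) (hr : ∀ x, e ≤ ‖x‖ → ρ x = 0) {x : Eu n} (hx : r + e < ‖x‖) : cvl w ρ x = 0 := by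
  unfold cvl
  rw [← integral_zero (Eu n) ℝ]
  congr 1; ext t
  by_cases h : r < ‖t‖
  · rw [hw t h, smul_zero]
  · rw [hr, zero_smul]
    have := norm_sub_norm_le x t
    linarith

theorem moll {w : Eu n → ℝ} {r η : ℝ} (hη : 0 < η) (hw : Integrable w) (w0 : ∀ x, r < ‖x‖ → w x = 0) (w1 : ∀ x, ‖w x‖ ≤ 1) :
    ∃ ρ : Eu n → ℝ, ContDiff ℝ 1 ρ ∧ HasCompactSupport ρ ∧ (∀ x, 0 ≤ ρ x) ∧ (∫ x, ρ x = 1) ∧ (∀ x, ρ (-x) = ρ x) ∧ ∫ x, |cvl w ρ x - w x| ≤ η := by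
  let b : ℕ → ContDiffBump (0 : Eu n) := fun j => ⟨1/((j:ℝ)+1)/2, 1/((j:ℝ)+1), by positivity, by
    have : 0 < 1/((j:ℝ)+1) := by positivity
    linarith⟩
  have bc : ∀ j, ContDiff ℝ 1 ((b j).normed volume) := fun j => (b j).contDiff_normed
  have ae := ContDiffBump.ae_convolution_tendsto_right_of_locallyIntegrable (φ := b) (l := Filter.atTop) (K := 2) (μ := volume) (g := w)
    tendsto_one_div_add_atTop_nhds_zero_nat (evf fun j => by simp only [b]; linarith) hw.locallyIntegrable
  have L : Filter.Tendsto (fun j : ℕ => ∫ x, |cvl w ((b j).normed volume) x - w x|) Filter.atTop (nhds (∫ x : Eu n, (0:ℝ))) := by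
    refine tendsto_integral_of_dominated_convergence ((closedBall (0 : Eu n) (r+1)).indicator fun _ => 2) (fun j => ?_) ?_ (fun j => ?_) ?_
    · exact (((cvl_cd hw.locallyIntegrable (bc j) (b j).hasCompactSupport_normed).continuous.aestronglyMeasurable).sub hw.aestronglyMeasurable).norm
    · exact (integrable_indicator_iff measurableSet_closedBall).2 (integrableOn_const (isCompact_closedBall _ _).measure_lt_top.ne)
    · refine evf fun x => ?_
      by_cases hx : x ∈ closedBall (0 : Eu n) (r+1)
      · rw [indicator_of_mem hx, Real.norm_eq_abs, abs_abs]
        have h1 := cvl_norm (bc j).continuous (b j).hasCompactSupport_normed (fun x => (b j).nonneg_normed x) (b j).integral_normed w1 x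
        have h2 := w1 x
        have := norm_sub_le (cvl w ((b j).normed volume) x) (w x)
        rw [Real.norm_eq_abs] at this
        linarith
      · rw [mem_closedBall_zero_iff, not_le] at hx
        have : cvl w ((b j).normed volume) x = 0 := cvl_zero (r := r) (e := 1) w0 (fun z hz => by
          by_contra h
          have h2 : z ∈ Function.support ((b j).normed volume) := h
          rw [(b j).support_normed_eq, mem_ball_zero_iff] at h2
          have h3 : (b j).rOut ≤ 1 := by
            change 1/((j:ℝ)+1) ≤ 1
            rw [div_le_one bpo]; linarith [(Nat.cast_nonneg j : (0:ℝ) ≤ j)]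
          linarith) hx
        rw [this, w0 x bli]; simp
        exact indicator_nonneg (by simp) _
    · filter_upwards [ae] with x hx
      have e : ∀ j, cvl w ((b j).normed volume) x = MeasureTheory.convolution ((b j).normed volume) w (ContinuousLinearMap.lsmul ℝ ℝ) volume x := fun j => convolution_lsmul_swap.symm
      simp only [e]
      have := (hx.sub_const (w x)).abs
      simpa using this
  rw [integral_zero] at L
  obtain ⟨j, hj⟩ := (L.eventually_le_const hη).exists
  exact ⟨(b j).normed volume, bc j, (b j).hasCompactSupport_normed, fun x => (b j).nonneg_normed x, (b j).integral_normed, fun x => (b j).normed_neg x, hj⟩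

theorem TV_dual {f : Eu n → ℝ} (h : Adm f) {P : ℝ} (H : ∀ φ : Eu n → Eu n, Continuous φ → HasCompactSupport φ → (∀ x, ‖φ x‖ ≤ 1) → - ∫ x, fderiv ℝ f x (φ x) ≤ P) : TV f ≤ P := by
  have fc := h.fcont
  have Kc : IsCompact (tsupport f) := h.cs
  obtain ⟨V, hV⟩ : ∃ V, V = volume.real (tsupport f) := ⟨_, rfl⟩
  have V0 : 0 ≤ V := by rw [hV]; exact measureReal_nonneg
  refine le_of_forall_pos_le_add fun e he => ?_
  obtain ⟨δ, hδ⟩ : ∃ δ, δ = e/(V+1) := ⟨_, rfl⟩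
  have δp : 0 < δ := by rw [hδ]; positivity
  have δV : δ * V ≤ e := by rw [hδ, div_mul_eq_mul_div, div_le_iff₀ bpo]; nlinarith
  let g : Eu n → Eu n := fun x => (InnerProductSpace.toDual ℝ (Eu n)).symm (fderiv ℝ f x)
  have gc : Continuous g := (InnerProductSpace.toDual ℝ (Eu n)).symm.continuous.comp fc
  have gn : ∀ x, ‖g x‖ = ‖fderiv ℝ f x‖ := fun x => LinearIsometryEquiv.norm_map _ _
  have gi : ∀ x v, inner ℝ (g x) v = fderiv ℝ f x v := fun x v => InnerProductSpace.toDual_symm_apply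
  have mp : ∀ x, 0 < max ‖g x‖ δ := fun x => lt_max_of_lt_right δp
  let φ : Eu n → Eu n := fun x => (-(max ‖g x‖ δ)⁻¹) • g x
  have pc : Continuous φ := ((gc.norm.max continuous_const).inv₀ fun x => (mp x).ne').neg.smul gc
  have g0 : ∀ x, x ∉ tsupport f → g x = 0 := fun x hx => by
    have : fderiv ℝ f x = 0 := by
      by_contra h'
      exact hx (support_fderiv_subset ℝ h')
    simp [g, this]
  have := H φ pc (HasCompactSupport.intro Kc fun x hx => by simp only [φ, g0 x hx, smul_zero]) (fun x => by
    rw [norm_smul, norm_neg, norm_inv, Real.norm_of_nonneg (mp x).le, inv_mul_le_iff₀ (mp x), mul_one]; exact le_max_left _ _)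
  have pt : ∀ x, ‖fderiv ℝ f x‖ + (fderiv ℝ f x) (φ x) ≤ (tsupport f).indicator (fun _ => δ) x := fun x => by
    have e1 : fderiv ℝ f x (φ x) = - (‖g x‖^2 / max ‖g x‖ δ) := by
      rw [← gi x, inner_smul_right, real_inner_self_eq_norm_sq, div_eq_mul_inv]; ring
    by_cases hx : x ∈ tsupport f
    · rw [indicator_of_mem hx, e1, ← gn]
      rcases le_total ‖g x‖ δ with c | c
      · have : 0 ≤ ‖g x‖^2 / max ‖g x‖ δ := by positivity
        linarith
      · rw [max_eq_left c, pow_two, mul_self_div_self]; linarith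
    · rw [indicator_of_notMem hx, e1, ← gn, g0 x hx]; simp
  have i1 : Integrable fun x => fderiv ℝ f x (φ x) := by
    refine (Continuous.clm_apply fc pc).integrable_of_hasCompactSupport ?_
    exact h.fcs.mono fun x hx => by
      intro h'; exact hx (by simp [h'])
  have i2 : Integrable ((tsupport f).indicator fun _ => δ) := (integrable_indicator_iff Kc.isClosed.measurableSet).2 (integrableOn_const Kc.measure_lt_top.ne)
  have S := integral_mono (h.tvint.add i1) i2 pt
  rw [integral_add' h.tvint i1, integral_indicator Kc.isClosed.measurableSet, setIntegral_const, ← hV, smul_eq_mul] at S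
  change TV f + _ ≤ _ at S
  linarith

theorem M1 {E : Set (Eu n)} (hE : HasFinitePerimeter E) (hv : volume E ≠ ⊤) {η : ℝ} (hη : 0 < η) :
    ∃ f : Eu n → ℝ, Adm f ∧ ∫ x, |f x - E.indicator (fun _ => (1:ℝ)) x| ≤ η ∧ TV f ≤ perimeter E + η := by
  obtain ⟨hm, hb⟩ := hE
  obtain ⟨V, hV⟩ : ∃ V, V = volume.real E := ⟨_, rfl⟩
  have V0 : 0 ≤ V := by rw [hV]; exact measureReal_nonneg
  obtain ⟨η', hη'⟩ : ∃ e, e = min (η/2) (η/(V+1)) := ⟨_, rfl⟩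
  have ep : 0 < η' := by rw [hη']; positivity
  have e1 : η' ≤ η/2 := by rw [hη']; exact min_le_left _ _
  have e2 : η' * V ≤ η := by
    have : η' ≤ η/(V+1) := by rw [hη']; exact min_le_right _ _
    calc η' * V ≤ η/(V+1) * (V+1) := by gcongr; linarith
      _ = η := by field_simp
  obtain ⟨χ, cd, cs, c0, c1, cf, ci⟩ := exists_cut hm hv ep
  have chi_i : Integrable (E.indicator fun _ => (1:ℝ)) := (integrable_indicator_iff hm).2 (integrableOn_const hv)
  have wi : Integrable (E.indicator χ) := (cd.continuous.integrable_of_hasCompactSupport cs).indicator hm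
  obtain ⟨r, hr⟩ := cs.isCompact.isBounded.subset_closedBall (0 : Eu n)
  have w01 : ∀ x, 0 ≤ E.indicator χ x ∧ E.indicator χ x ≤ 1 := fun x => ⟨indicator_nonneg (fun x _ => c0 x) _, indicator_le' (fun x _ => c1 x) (fun _ _ => zero_le_one) x⟩
  have χ0 : ∀ x, r < ‖x‖ → χ x = 0 := fun x hx => by
    by_contra h
    have := mem_closedBall_zero_iff.1 (hr (subset_tsupport _ h))
    linarith
  have w0 : ∀ x, r < ‖x‖ → E.indicator χ x = 0 := fun x hx => by
    simp [indicator, χ0 x hx]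
  have w1 : ∀ x, ‖E.indicator χ x‖ ≤ 1 := fun x => by rw [Real.norm_of_nonneg (w01 x).1]; exact (w01 x).2
  obtain ⟨ρ, h1, hc, h0, hi, he, hL⟩ := moll ep wi w0 w1
  have wcs : HasCompactSupport (E.indicator χ) := HasCompactSupport.intro (isCompact_closedBall (0 : Eu n) r) fun x hx => w0 x (by simpa using hx)
  have A : Adm (cvl (E.indicator χ) ρ) :=
    ⟨cvl_cd wi.locallyIntegrable h1 hc, cvl_cs wcs hc, fun x => integral_nonneg fun t => smul_nonneg (h0 _) (w01 t).1,
      fun x => (le_abs_self _).trans (cvl_norm h1.continuous hc h0 hi w1 x)⟩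
  refine ⟨_, A, ?_, TV_dual A fun φ pc pcs pn => ?_⟩
  · have t1 : Integrable fun x => |cvl (E.indicator χ) ρ x - E.indicator χ x| := (A.integrable.sub wi).abs
    have t2 : Integrable fun x => E.indicator (fun x => 1 - χ x) x := by
      have : (fun x => E.indicator (fun x => 1 - χ x) x) = fun x => E.indicator (fun _ => (1:ℝ)) x - E.indicator χ x := by
        ext x; by_cases hx : x ∈ E <;> simp [hx]
      rw [this]; exact chi_i.sub wi
    calc _ ≤ ∫ x, (|cvl (E.indicator χ) ρ x - E.indicator χ x| + E.indicator (fun x => 1 - χ x) x) := by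
          refine integral_mono (A.integrable.sub chi_i).abs (t1.add t2) fun x => ?_
          have : E.indicator (fun x => 1 - χ x) x = |E.indicator χ x - E.indicator (fun _ => (1:ℝ)) x| := by
            by_cases hx : x ∈ E
            · simp [hx]; rw [abs_sub_comm, abs_of_nonneg]; linarith [c1 x]
            · simp [hx]
          simp only [this]
          exact abs_sub_le _ _ _
      _ ≤ _ := by
          rw [integral_add t1 t2, integral_indicator hm]; linarith
  · rw [← cvl_dual h1 hc he pc pcs wi]
    have pl := pc.locallyIntegrable (μ := volume)
    have qd := cvl_cd pl h1 hc
    have qn := cvl_norm h1.continuous hc h0 hi pn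
    have m : (∫ x in E, vdiv (fun x => χ x • cvl φ ρ x) x) ≤ perimeter E := by
      refine le_csSup hb ⟨_, cd.smul qd, cs.smul_right, fun x => ?_, rfl⟩
      change ‖χ x • cvl φ ρ x‖ ≤ 1
      rw [norm_smul, Real.norm_of_nonneg (c0 x)]
      exact mul_le_one₀ (c1 x) (norm_nonneg _) (qn x)
    have fm : IsFiniteMeasure (volume.restrict E) := ⟨by rw [Measure.restrict_apply_univ]; exact hv.lt_top⟩
    have a1 : IntegrableOn (fun x => χ x * vdiv (cvl φ ρ) x) E := ((cd.continuous.mul (vdiv_cont qd)).integrable_of_hasCompactSupport cs.mul_right).integrableOn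
    have a2c : Continuous fun x => fderiv ℝ χ x (cvl φ ρ x) := (cd.continuous_fderiv one_ne_zero).clm_apply qd.continuous
    have a2b : ∀ x, ‖fderiv ℝ χ x (cvl φ ρ x)‖ ≤ η' := fun x => ((fderiv ℝ χ x).le_opNorm _).trans ((mul_le_mul (cf x) (qn x) (norm_nonneg _) ep.le).trans_eq (mul_one _))
    have a2 : IntegrableOn (fun x => fderiv ℝ χ x (cvl φ ρ x)) E := (integrable_const η').mono' a2c.aestronglyMeasurable (evf a2b)
    simp only [vdiv_smul (cd.differentiable one_ne_zero) (qd.differentiable one_ne_zero)] at m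
    rw [integral_add a1 a2] at m
    have b := norm_setIntegral_le_of_norm_le_const (μ := volume) (s := E) hv.lt_top (fun x _ => a2b x)
    have b2 := (abs_le.1 b).1
    rw [← hV] at b2
    have : ∫ y, E.indicator χ y * vdiv (cvl φ ρ) y = ∫ x in E, χ x * vdiv (cvl φ ρ) x := by
      rw [← integral_indicator hm]; congr 1; ext x; by_cases hx : x ∈ E <;> simp [hx]
    rw [this]
    linarith

theorem ibp {f : Eu n → ℝ} {φ : Eu n → Eu n} (hf : ContDiff ℝ 1 f) (hφ : ContDiff ℝ 1 φ) (hc : HasCompactSupport φ) :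
    ∫ x, f x * vdiv φ x = - ∫ x, fderiv ℝ f x (φ x) := by
  have fc := hf.continuous_fderiv one_ne_zero
  have pc := hφ.continuous_fderiv one_ne_zero
  have e : ∀ i x, fderiv ℝ (fun x => φ x i) x (EuclideanSpace.single i 1) = fderiv ℝ φ x (EuclideanSpace.single i 1) i := fun i x => by
    have := ((EuclideanSpace.proj i : Eu n →L[ℝ] ℝ).hasFDerivAt.comp x (hφ.differentiable one_ne_zero x).hasFDerivAt).fderiv
    exact congrArg (fun L : Eu n →L[ℝ] ℝ => L (EuclideanSpace.single i 1)) this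
  have i1 : ∀ i, Integrable fun x => fderiv ℝ f x (EuclideanSpace.single i 1) * φ x i := fun i =>
    (Continuous.mul bfp bfp).integrable_of_hasCompactSupport (hc.mono fun x hx h' => hx (by simp [h']))
  have i2 : ∀ i, Integrable fun x => f x * fderiv ℝ φ x (EuclideanSpace.single i 1) i := fun i =>
    (Continuous.mul bfp bfp).integrable_of_hasCompactSupport ((hc.fderiv ℝ).mono fun x hx h' => hx (by simp [h']))
  have i3 : ∀ i, Integrable fun x => f x * φ x i := fun i =>
    (Continuous.mul bfp bfp).integrable_of_hasCompactSupport (hc.mono fun x hx h' => hx (by simp [h']))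
  have key : ∀ i, ∫ x, f x * fderiv ℝ φ x (EuclideanSpace.single i 1) i = - ∫ x, fderiv ℝ f x (EuclideanSpace.single i 1) * φ x i := fun i => by
    have := integral_mul_fderiv_eq_neg_fderiv_mul_of_integrable (μ := (volume : Measure (Eu n)))
      (f := f) (g := fun x => φ x i) (v := EuclideanSpace.single i 1) (i1 i) (by simp only [e]; exact i2 i) (i3 i)
      (fun x _ => hf.differentiable one_ne_zero x) (fun x _ => (by have := hφ.differentiable one_ne_zero; fun_prop))
    simpa only [e] using this
  unfold vdiv
  simp only [Finset.mul_sum]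
  rw [integral_finset_sum _ fun i _ => i2 i]
  simp only [key]
  rw [Finset.sum_neg_distrib, ← integral_finset_sum _ fun i _ => i1 i]
  congr 2; ext x
  conv_rhs => rw [← (EuclideanSpace.basisFun (Fin n) ℝ).sum_repr (φ x), map_sum]
  refine Finset.sum_congr rfl fun i _ => ?_
  simp [mul_comm]

theorem per_ball (hn : 1 ≤ n) : perimeter BB n ≤ n * om n := by
  refine csSup_le ⟨0, 0, contDiff_const, HasCompactSupport.zero, by simp, by simp [vdiv]⟩ ?_
  rintro r ⟨φ, hφ, hc, h1, rfl⟩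
  obtain ⟨M, hM⟩ : ∃ M, ∀ x, ‖vdiv φ x‖ ≤ M := by
    refine HasCompactSupport.exists_bound_of_continuous ?_ (vdiv_cont hφ)
    exact (hc.fderiv ℝ).mono fun x hx h' => hx (by simp [vdiv, show fderiv ℝ φ x = 0 from h'])
  have M0 : 0 ≤ M := (norm_nonneg _).trans (hM 0)
  have key : ∀ s : ℝ, 1 < s → ∫ x in BB n, vdiv φ x ≤ n * (s^n * om n) + M * (s^n * om n - om n) := fun s hs => by
    have q : 0 < s^2 - 1 := by nlinarith
    let f : Eu n → ℝ := fun x => Real.smoothTransition ((s^2 - ‖x‖^2) / (s^2-1))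
    have fd : ContDiff ℝ 1 f := by
      refine Real.smoothTransition.contDiff.comp ?_
      exact (contDiff_const.sub (contDiff_norm_sq ℝ)).div_const _
    have fin : ∀ x, ‖x‖ ≤ 1 → f x = 1 := fun x hx => Real.smoothTransition.one_of_one_le (by
      rw [one_le_div q]; nlinarith [norm_nonneg x])
    have fout : ∀ x, s ≤ ‖x‖ → f x = 0 := fun x hx => Real.smoothTransition.zero_of_nonpos (by
      refine div_nonpos_of_nonpos_of_nonneg ?_ q.le
      nlinarith [norm_nonneg x])
    have f0 : ∀ x, 0 ≤ f x := fun x => Real.smoothTransition.nonneg _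
    have f1 : ∀ x, f x ≤ 1 := fun x => Real.smoothTransition.le_one _
    have fcs : HasCompactSupport f := HasCompactSupport.intro (isCompact_closedBall (0 : Eu n) s) fun x hx => fout x (by
      rw [mem_closedBall_zero_iff, not_le] at hx; exact hx.le)
    have A : Adm f := ⟨fd, fcs, f0, f1⟩
    have vs : volume.real (ball (0 : Eu n) s) = s^n * om n := vol_ball 0 bli hn
    have fI : ∫ x, f x ≤ s^n * om n := by
      rw [← vs, ← integral_indicator_one measurableSet_ball]
      refine integral_mono A.integrable ((integrable_indicator_iff measurableSet_ball).2 (integrableOn_const measure_ball_lt_top.ne)) fun x => ?_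
      by_cases hx : ‖x‖ < s
      · rw [indicator_of_mem (mem_ball_zero_iff.2 hx)]; exact f1 x
      · rw [indicator_of_notMem (by simpa using hx)]; exact (fout x (not_lt.1 hx)).le
    have g1 : ∀ x, - fderiv ℝ f x (φ x) ≤ - fderiv ℝ f x x := fun x => by
      have hd : HasFDerivAt f (deriv Real.smoothTransition ((s^2 - ‖x‖^2) / (s^2-1)) • ((s^2-1)⁻¹ • (-((2:ℝ) • innerSL ℝ x)))) x := by
        have a : HasDerivAt Real.smoothTransition (deriv Real.smoothTransition ((s^2 - ‖x‖^2) / (s^2-1))) ((s^2 - ‖x‖^2) / (s^2-1)) :=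
          (Real.smoothTransition.contDiff.differentiable (n := 1) one_ne_zero _).hasDerivAt
        have b : HasFDerivAt (fun x : Eu n => (s^2 - ‖x‖^2) / (s^2-1)) ((s^2-1)⁻¹ • (-((2:ℝ) • innerSL ℝ x))) x := by
          simp only [div_eq_inv_mul]
          refine HasFDerivAt.const_mul ?_ _
          have := (hasStrictFDerivAt_norm_sq x).hasFDerivAt.const_sub (s^2)
          rw [ofNat_smul_eq_nsmul]; exact this
        exact a.comp_hasFDerivAt x b
      rw [hd.fderiv]
      by_cases hx : ‖x‖ < 1
      · have : fderiv ℝ f x = 0 := by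
          have : f =ᶠ[nhds x] fun _ => (1:ℝ) := by
            filter_upwards [isOpen_ball.mem_nhds (mem_ball_zero_iff.2 hx)] with y hy
            exact fin y (mem_ball_zero_iff.1 hy).le
          rw [this.fderiv_eq]; simp
        rw [← hd.fderiv, this]; simp
      · have dn : 0 ≤ deriv Real.smoothTransition ((s^2 - ‖x‖^2) / (s^2-1)) := Real.smoothTransition.monotone.deriv_nonneg
        have e : inner ℝ x (φ x) ≤ inner ℝ x x := by
          refine (real_inner_le_norm _ _).trans ?_
          rw [real_inner_self_eq_norm_sq]
          have := h1 x
          have := norm_nonneg x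
          nlinarith
        simp only [ContinuousLinearMap.smul_apply, ContinuousLinearMap.neg_apply, innerSL_apply_apply, smul_eq_mul]
        have : 0 ≤ deriv Real.smoothTransition ((s^2 - ‖x‖^2) / (s^2-1)) * ((s^2-1)⁻¹ * 2) := by positivity
        nlinarith [ml e this]
    have ic : ∀ ψ : Eu n → Eu n, Continuous ψ → Integrable fun x => fderiv ℝ f x (ψ x) := fun ψ hψ => by
      refine (A.fcont.clm_apply hψ).integrable_of_hasCompactSupport ?_
      exact A.fcs.mono fun x hx h' => hx (by simp [h'])
    have g2 := integral_mono (ic φ hφ.continuous).neg (ic _ continuous_id).neg g1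
    simp only [Pi.neg_apply, integral_neg, id] at g2
    rw [← ibp fd hφ hc, euler_int fd fcs, neg_neg] at g2
    have vi : Integrable (fun x => f x * vdiv φ x) := (fd.continuous.mul (vdiv_cont hφ)).integrable_of_hasCompactSupport fcs.mul_right
    have bi : Integrable ((BB n).indicator (vdiv φ)) := (integrable_indicator_iff measurableSet_ball).2 ((vdiv_cont hφ).continuousOn.integrableOn_compact (isCompact_closedBall 0 1) |>.mono_set ball_subset_closedBall)
    have g3 := integral_mono (bi.sub vi) ((A.integrable.sub chiB_int).const_mul M) (fun x => by
      have hm := abs_le.1 (hM x)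
      change indicator _ _ x - f x * vdiv φ x ≤ M * (f x - indicator _ _ x)
      by_cases hx : ‖x‖ < 1
      · rw [indicator_of_mem (mem_ball_zero_iff.2 hx), indicator_of_mem (mem_ball_zero_iff.2 hx), fin x hx.le]; linarith
      · rw [indicator_of_notMem (by simpa using hx), indicator_of_notMem (by simpa using hx)]
        nlinarith [f0 x])
    rw [integral_sub' bi vi, integral_const_mul, integral_sub' A.integrable chiB_int, integral_indicator measurableSet_ball, integral_indicator measurableSet_ball, setIntegral_const, smul_eq_mul, mul_one] at g3
    change _ ≤ M * (_ - om n) at g3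
    have g4 := ml fI M0
    have g5 := ml fI (Nat.cast_nonneg n : (0:ℝ) ≤ n)
    linarith
  have c : Continuous fun s : ℝ => n * (s^n * om n) + M * (s^n * om n - om n) := by fun_prop
  have t : Filter.Tendsto (fun s : ℝ => n * (s^n * om n) + M * (s^n * om n - om n)) (nhdsWithin 1 (Ioi 1)) (nhds (n * om n)) := by
    have := (c.tendsto 1).mono_left (nhdsWithin_le_nhds (s := Ioi 1))
    simpa using this
  exact ge_of_tendsto t (by filter_upwards [self_mem_nhdsWithin] with s hs using key s hs)

noncomputable def kn (j : ℕ) (z : Eu n) : ℝ := (‖z‖^j)⁻¹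

theorem kn_nn {n j : ℕ} (z : Eu n) : 0 ≤ kn j z := by unfold kn; positivity

theorem kn_meas {n j : ℕ} : Measurable (kn j : Eu n → ℝ) := by unfold kn; fun_prop

theorem kn_symm {n j : ℕ} (x y : Eu n) : kn j (x - y) = kn j (y - x) := by unfold kn; rw [norm_sub_rev]

theorem kn_rpow (hn : 3 ≤ n) (z : Eu n) : ‖z‖ ^ (2 - (n:ℝ)) = kn (n-2) z := by
  unfold kn
  rw [← Real.rpow_natCast, ← Real.rpow_neg (norm_nonneg _), Nat.cast_sub bom]
  congr 1; push_cast; ring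

theorem kn_ball {n j : ℕ} (hj : j + 1 ≤ n) : IntegrableOn (kn j : Eu n → ℝ) (ball 0 1) := by
  haveI : Nonempty (Fin n) := ⟨⟨0, by omega⟩⟩
  have := (integrableOn_fun_norm_addHaar (E := Eu n) (volume : Measure (Eu n)) (f := fun y : ℝ => (y^j)⁻¹) (r := 1)).2 (by
    rw [finrank_euclideanSpace_fin]
    have : IntegrableOn (fun y : ℝ => y^(n-1-j)) (Ioo 0 1) :=
      ((continuous_pow _).continuousOn.integrableOn_Icc (a := (0:ℝ)) (b := 1)).mono_set Ioo_subset_Icc_self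
    refine this.congr_fun (fun y hy => ?_) measurableSet_Ioo
    have : y ≠ 0 := hy.1.ne'
    change y^(n-1-j) = y^(n-1) * (y^j)⁻¹
    rw [eq_mul_inv_iff_mul_eq₀ bpo, ← pow_add]; congr 1; omega)
  exact this

theorem kn_one {n j : ℕ} {z : Eu n} (hz : 1 ≤ ‖z‖) : kn j z ≤ 1 := by
  unfold kn; exact inv_le_one_of_one_le₀ (one_le_pow₀ hz)

noncomputable def CK (n j : ℕ) : ℝ := ∫ z in BB n, kn j z

theorem kn_le {n j : ℕ} (z : Eu n) : kn j z ≤ (BB n).indicator (kn j) z + 1 := by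
  by_cases h : z ∈ BB n
  · rw [indicator_of_mem h]; linarith
  · rw [indicator_of_notMem h]; rw [mem_ball_zero_iff, not_lt] at h; linarith [kn_one (j := j) h]

theorem kn_aux {n j : ℕ} (hj : j + 1 ≤ n) (x : Eu n) :
    Integrable (fun y => (BB n).indicator (kn j) (x - y)) :=
  ((kn_ball hj).integrable_indicator measurableSet_ball).comp_sub_left x

theorem kn_on {n j : ℕ} (hj : j + 1 ≤ n) {F : Set (Eu n)} (hF : volume F ≠ ⊤) (x : Eu n) :
    IntegrableOn (fun y => kn j (x - y)) F := by
  refine Integrable.mono' ((kn_aux hj x).integrableOn.add (integrableOn_const (C := (1:ℝ)) hF)) ?_ ?_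
  · exact (kn_meas.comp (measurable_const.sub measurable_id)).aestronglyMeasurable
  · filter_upwards with y
    rw [Real.norm_of_nonneg (kn_nn _)]; exact kn_le _

theorem kn_int_le {n j : ℕ} (hj : j + 1 ≤ n) {F : Set (Eu n)} (hF : volume F ≠ ⊤) (x : Eu n) :
    ∫ y in F, kn j (x - y) ≤ CK n j + volume.real F := by
  have i1 := (integrableOn_const (C := (1:ℝ)) hF)
  have i2 := kn_aux hj x
  calc _ ≤ ∫ y in F, ((BB n).indicator (kn j) (x - y) + 1) :=
        setIntegral_mono (kn_on hj hF x) (i2.integrableOn.add i1) fun y => kn_le _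
    _ = (∫ y in F, (BB n).indicator (kn j) (x - y)) + volume.real F := by
        rw [integral_add i2.integrableOn i1]; simp
    _ ≤ (∫ y, (BB n).indicator (kn j) (x - y)) + volume.real F := by
        refine add_le_add ?_ le_rfl
        refine setIntegral_le_integral i2 (evf fun y => ?_)
        exact indicator_nonneg (fun _ _ => kn_nn _) _
    _ = _ := by
        rw [integral_sub_left_eq_self (fun z => (BB n).indicator (kn j) z) volume x, integral_indicator measurableSet_ball]; rfl

theorem CK_nn {n j : ℕ} : 0 ≤ CK n j := integral_nonneg fun _ => kn_nn _

theorem inv_lip {a b : ℝ} (ha : 0 ≤ a) (hb : 0 ≤ b) (m : ℕ) (hm : 1 ≤ m) :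
    |(a^m)⁻¹ - (b^m)⁻¹| ≤ m * |a - b| * ((a^(m+1))⁻¹ + (b^(m+1))⁻¹) := by
  wlog h : a ≤ b generalizing a b
  · have := this hb ha (le_of_not_ge h)
    rw [abs_sub_comm, abs_sub_comm a b, add_comm]; exact this
  rcases ha.eq_or_lt with rfl | ha
  · rcases hb.eq_or_lt with rfl | hb
    · simp
    · have e : |((0:ℝ)^m)⁻¹ - (b^m)⁻¹| = (b^m)⁻¹ := by
        rw [zero_pow bom, inv_zero, zero_sub, abs_neg, abs_of_nonneg bpo]
      have e2 : (m:ℝ) * |0 - b| * (((0:ℝ)^(m+1))⁻¹ + (b^(m+1))⁻¹) = m * (b^m)⁻¹ := by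
        rw [zero_pow bom, inv_zero, zero_sub, abs_neg, abs_of_nonneg hb.le, zero_add, pow_succ]; field_simp
      rw [e, e2]
      have : (1:ℝ) ≤ m := by exact_mod_cast hm
      nlinarith [inv_nonneg.2 (pow_nonneg hb.le m)]
  have hb : 0 < b := by linarith
  rw [← inv_pow, ← inv_pow, ← inv_pow, ← inv_pow]
  have uv : b⁻¹ ≤ a⁻¹ := inv_anti₀ ha h
  have key : ∀ m : ℕ, a⁻¹^m - b⁻¹^m ≤ m * (b - a) * a⁻¹^(m+1) := by
    have e : a⁻¹ - b⁻¹ ≤ (b - a) * a⁻¹^2 := by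
      have : a⁻¹ - b⁻¹ = (b - a) * (a⁻¹ * b⁻¹) := by field_simp
      rw [this, sq]; gcongr
    intro m
    induction m with
    | zero => simp
    | succ m ih =>
      have h1 : a⁻¹^(m+1) - b⁻¹^(m+1) = a⁻¹^m * (a⁻¹ - b⁻¹) + b⁻¹ * (a⁻¹^m - b⁻¹^m) := by ring
      have h2 : b⁻¹ * (a⁻¹^m - b⁻¹^m) ≤ a⁻¹ * (m * (b - a) * a⁻¹^(m+1)) := by
        have : 0 ≤ a⁻¹^m - b⁻¹^m := sub_nonneg.2 (pow_le_pow_left₀ bpo uv m)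
        gcongr
      have h3 : a⁻¹^m * (a⁻¹ - b⁻¹) ≤ a⁻¹^m * ((b - a) * a⁻¹^2) := by gcongr
      rw [h1]; push_cast
      calc _ ≤ a⁻¹^m * ((b - a) * a⁻¹^2) + a⁻¹ * (m * (b - a) * a⁻¹^(m+1)) := add_le_add h3 h2
        _ = _ := by ring
  rw [abs_of_nonneg (sub_nonneg.2 (pow_le_pow_left₀ bpo uv m)), abs_sub_comm, abs_of_nonneg (sub_nonneg.2 h)]
  refine (key m).trans ?_
  have : 0 ≤ b - a := by linarith
  gcongr
  have : 0 ≤ b⁻¹^(m+1) := by positivity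
  linarith

noncomputable def Vb (m : ℕ) (x : Eu n) : ℝ := ∫ y in BB n, kn m (x - y)

theorem bfin : volume BB n ≠ ⊤ := measure_ball_lt_top.ne

theorem Vb_nn {n m : ℕ} (x : Eu n) : 0 ≤ Vb m x := integral_nonneg fun _ => kn_nn _

theorem Vb_lip {n m : ℕ} (hm : 1 ≤ m) (hj : m + 2 ≤ n) (x x' : Eu n) :
    |Vb m x - Vb m x'| ≤ m * ‖x - x'‖ * (2 * (CK n (m+1) + om n)) := by
  have a1 := kn_on (j := m) bom bfin x
  have a2 := kn_on (j := m) bom bfin x'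
  have b1 := kn_on (j := m+1) bom bfin x
  have b2 := kn_on (j := m+1) bom bfin x'
  have c1 := kn_int_le (j := m+1) bom bfin x
  have c2 := kn_int_le (j := m+1) bom bfin x'
  unfold Vb
  rw [← integral_sub a1 a2]
  calc _ ≤ ∫ y in BB n, |kn m (x - y) - kn m (x' - y)| := abs_integral_le_integral_abs
    _ ≤ ∫ y in BB n, m * ‖x - x'‖ * (kn (m+1) (x - y) + kn (m+1) (x' - y)) := by
        refine setIntegral_mono (a1.sub a2).abs ((b1.add b2).const_mul _) fun y => ?_
        refine (inv_lip (norm_nonneg (x - y)) (norm_nonneg (x' - y)) m hm).trans ?_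
        unfold kn
        gcongr
        have := abs_norm_sub_norm_le (x - y) (x' - y)
        rwa [sub_sub_sub_cancel_right] at this
    _ = m * ‖x - x'‖ * ((∫ y in BB n, kn (m+1) (x - y)) + ∫ y in BB n, kn (m+1) (x' - y)) := by
        rw [integral_const_mul, integral_add b1 b2]
    _ ≤ _ := by
        gcongr
        change _ ≤ _ + volume.real _ at c1
        change _ ≤ _ + volume.real _ at c2
        change _ ≤ 2 * (_ + volume.real (ball 0 1))
        linarith

theorem Vb_rad {n m : ℕ} {x x' : Eu n} (h : ‖x‖ = ‖x'‖) : Vb m x = Vb m x' := by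
  obtain ⟨L, hL, -⟩ := exists_iso h
  unfold Vb
  rw [← iso_ball L (fun y => kn m (x' - y))]
  refine integral_congr_ae (evf fun y => ?_)
  change kn m (x - y) = kn m (x' - L y)
  rw [← hL, ← map_sub]; unfold kn; rw [L.norm_map]

theorem Vb_wt {n m : ℕ} (hm : 1 ≤ m) (hj : m + 2 ≤ n) : ∃ C v0 : ℝ, 0 < C ∧ ∀ x : Eu n, |Vb m x - v0| ≤ C * wt x := by
  haveI : Nonempty (Fin n) := ⟨⟨0, by omega⟩⟩
  obtain ⟨e, he⟩ : ∃ e : Eu n, ‖e‖ = 1 := exists_norm_eq _ zero_le_one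
  have o := om_pos n
  have q := CK_nn (n := n) (j := m+1)
  have q' := CK_nn (n := n) (j := m)
  refine ⟨m * (2 * (CK n (m+1) + om n)) + (CK n m + om n), Vb m e, by positivity, fun x => ?_⟩
  have h1 : |Vb m x - Vb m e| ≤ |1 - ‖x‖| * (m * (2 * (CK n (m+1) + om n))) := by
    by_cases hx : x = 0
    · have := Vb_lip hm hj x e
      rw [hx, zero_sub, norm_neg, he] at this
      rw [hx, norm_zero, sub_zero, abs_one]; linarith
    · have hx' : ‖x‖ ≠ 0 := norm_ne_zero_iff.2 hx
      have e1 : Vb m (‖x‖⁻¹ • x) = Vb m e := Vb_rad (by rw [norm_smul, norm_inv, norm_norm, he, inv_mul_cancel₀ hx'])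
      have := Vb_lip hm hj x (‖x‖⁻¹ • x)
      have e2 : ‖x - ‖x‖⁻¹ • x‖ = |1 - ‖x‖| := by
        have : x - ‖x‖⁻¹ • x = (1 - ‖x‖⁻¹) • x := by rw [sub_smul, one_smul]
        rw [this, norm_smul, Real.norm_eq_abs, abs_sub_comm 1 ‖x‖]
        nth_rewrite 2 [← abs_norm x]
        rw [← abs_mul, sub_mul, one_mul, inv_mul_cancel₀ hx']
      rw [e1, e2] at this
      linarith
  have h2 : |Vb m x - Vb m e| ≤ CK n m + om n := by
    have a := Vb_nn (m := m) x
    have b := Vb_nn (m := m) e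
    have c : Vb m x ≤ _ := kn_int_le (j := m) bom bfin x
    have d : Vb m e ≤ _ := kn_int_le (j := m) bom bfin e
    change _ ≤ _ + om n at c
    change _ ≤ _ + om n at d
    rw [abs_le]; constructor <;> linarith
  unfold wt
  rcases le_total |1 - ‖x‖| 1 with h | h
  · rw [min_eq_left h]
    nlinarith [abs_nonneg (1 - ‖x‖), mul_nonneg (abs_nonneg (1 - ‖x‖)) (add_nonneg q' o.le)]
  · rw [min_eq_right h]
    have : 0 ≤ m * (2 * (CK n (m+1) + om n)) := by positivity
    linarith

open scoped ENNReal

noncomputable def ke (j : ℕ) (z : Eu n) : ℝ≥0∞ := ENNReal.ofReal (kn j z)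

theorem ke_meas {n j : ℕ} : Measurable (ke j : Eu n → ℝ≥0∞) := kn_meas.ennreal_ofReal

theorem ke_symm {n j : ℕ} (x y : Eu n) : ke j (x - y) = ke j (y - x) := by unfold ke; rw [kn_symm]

noncomputable def Rz (z : Eu n) : ℝ≥0∞ := ∫⁻ w, ke (n-1) (z - w) * ke (n-1) w

theorem Rz_iso (L : Eu n ≃ₗᵢ[ℝ] Eu n) (z : Eu n) : Rz (L z) = Rz z := by
  unfold Rz
  rw [← L.measurePreserving.lintegral_comp_emb L.toHomeomorph.measurableEmbedding]
  refine lintegral_congr fun w => ?_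
  rw [← map_sub]; unfold ke kn; rw [L.norm_map, L.norm_map]

theorem ke_smul {n j : ℕ} {r : ℝ} (hr : 0 < r) (z : Eu n) : ke j (r • z) = ENNReal.ofReal ((r^j)⁻¹) * ke j z := by
  unfold ke kn
  rw [← ENNReal.ofReal_mul bpo, norm_smul, Real.norm_of_nonneg hr.le, mul_pow, mul_inv]

theorem Rz_smul (hn : 2 ≤ n) {r : ℝ} (hr : 0 < r) (z : Eu n) :
    Rz (r • z) = ENNReal.ofReal ((r^(n-2))⁻¹) * Rz z := by
  unfold Rz
  have m1 : Measurable fun w => ke (n-1) (r • z - w) * ke (n-1) w :=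
    Measurable.mul (ke_meas.comp (measurable_const.sub measurable_id)) ke_meas
  have h := Measure.map_addHaar_smul (volume : Measure (Eu n)) hr.ne'
  have h2 := lintegral_map (μ := (volume : Measure (Eu n))) m1 (measurable_const_smul r)
  have m2 : Measurable fun w => ke (n-1) (z - w) * ke (n-1) w :=
    Measurable.mul (ke_meas.comp (measurable_const.sub measurable_id)) ke_meas
  have e : ∀ w : Eu n, ke (n-1) (r • z - r • w) * ke (n-1) (r • w)
      = (ENNReal.ofReal ((r^(n-1))⁻¹) * ENNReal.ofReal ((r^(n-1))⁻¹)) * (ke (n-1) (z - w) * ke (n-1) w) := fun w => by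
    rw [← smul_sub, ke_smul hr, ke_smul hr]; ring
  change lintegral (Measure.map (fun x => r • x) volume) _ = _ at h2
  rw [h, lintegral_smul_measure, finrank_euclideanSpace_fin, abs_of_nonneg bpo] at h2
  simp_rw [e] at h2
  rw [lintegral_const_mul _ m2, ← ENNReal.ofReal_mul bpo] at h2
  have h3 := congrArg (fun t => ENNReal.ofReal (r^n) * t) h2
  simp only [smul_eq_mul] at h3
  rw [← mul_assoc, ← mul_assoc, ← ENNReal.ofReal_mul bpo, ← ENNReal.ofReal_mul bpo,
    mul_inv_cancel₀ bpo, ENNReal.ofReal_one, one_mul] at h3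
  rw [h3]
  congr 2
  obtain ⟨m, rfl⟩ := Nat.exists_eq_add_of_le hn
  rw [show 2 + m - 1 = m + 1 by omega, show 2 + m - 2 = m by omega]
  field_simp
  ring

theorem Rz_fin (hn : 3 ≤ n) {e : Eu n} (he : ‖e‖ = 1) : Rz e ≠ ⊤ := by
  haveI : Nonempty (Fin n) := ⟨⟨0, by omega⟩⟩
  have i1 : Integrable fun w : Eu n => (ball (0 : Eu n) 3).indicator (fun w => (2:ℝ)^(n-1) * (kn (n-1) w + kn (n-1) (e - w))) w := by
    refine IntegrableOn.integrable_indicator ?_ measurableSet_ball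
    refine Integrable.const_mul (Integrable.add ?_ (kn_on bom measure_ball_lt_top.ne e)) _
    have := kn_on (j := n-1) bom (measure_ball_lt_top (μ := volume) (x := (0 : Eu n)) (r := 3)).ne 0
    refine this.congr (evf fun y => ?_)
    change kn (n-1) (0 - y) = kn (n-1) y
    rw [kn_symm, sub_zero]
  have i2 : Integrable fun w : Eu n => (4:ℝ)^(n-1) * (1 + ‖w‖)^(-(2*n-2:ℝ)) := by
    refine (integrable_one_add_norm ?_).const_mul _
    rw [finrank_euclideanSpace_fin]
    have : (3:ℝ) ≤ n := by exact_mod_cast hn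
    linarith
  have b : ∀ w : Eu n, kn (n-1) (e - w) * kn (n-1) w ≤ (ball (0 : Eu n) 3).indicator (fun w => (2:ℝ)^(n-1) * (kn (n-1) w + kn (n-1) (e - w))) w
      + (4:ℝ)^(n-1) * (1 + ‖w‖)^(-(2*n-2:ℝ)) := by
    intro w
    have hh : ∀ z : Eu n, ∀ c : ℝ, 0 < c → c ≤ ‖z‖ → kn (n-1) z ≤ (c⁻¹)^(n-1) := fun z c hc h => by
      unfold kn; rw [inv_pow]; gcongr
    have tri : ‖e‖ ≤ ‖e - w‖ + ‖w‖ := by simpa using norm_add_le (e - w) w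
    have tri2 : ‖w‖ ≤ ‖e - w‖ + ‖e‖ := by rw [norm_sub_rev]; simpa using norm_add_le (w - e) e
    rw [he] at tri tri2
    have p1 := kn_nn (j := n-1) w
    have p2 := kn_nn (j := n-1) (e - w)
    by_cases hw : w ∈ ball (0 : Eu n) 3
    · rw [indicator_of_mem hw]
      have : 0 ≤ (4:ℝ)^(n-1) * (1 + ‖w‖)^(-(2*n-2:ℝ)) := by positivity
      have t2 : (0:ℝ) ≤ 2^(n-1) := by positivity
      rcases le_total (1/2) ‖w‖ with h | h
      · have := hh w (1/2) bnn h
        rw [one_div, inv_inv] at this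
        nlinarith [mul_nonneg t2 p1, ml this p2]
      · have := hh (e - w) (1/2) bnn bli
        rw [one_div, inv_inv] at this
        nlinarith [mul_nonneg t2 p2, mr this p1]
    · rw [indicator_of_notMem hw, zero_add]
      rw [mem_ball_zero_iff, not_lt] at hw
      have c0 : 0 < (1 + ‖w‖)/2 := by positivity
      have a1 := hh w ((1+‖w‖)/2) c0 bli
      have a2 := hh (e - w) ((1+‖w‖)/2) c0 bli
      have e1 : (4:ℝ)^(n-1) * (1 + ‖w‖)^(-(2*n-2:ℝ)) = (((1+‖w‖)/2)⁻¹)^(n-1) * (((1+‖w‖)/2)⁻¹)^(n-1) := by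
        have : (1 + ‖w‖)^(-(2*n-2:ℝ)) = (((1 + ‖w‖)^2)⁻¹)^(n-1) := by
          rw [inv_pow, ← pow_mul, ← Real.rpow_natCast, ← Real.rpow_neg bpo]
          congr 1; push_cast [Nat.cast_sub (show 1 ≤ n by omega)]; ring
        rw [this, ← mul_pow, ← mul_pow]; congr 1; field_simp; norm_num
      rw [e1]
      exact mul_le_mul a2 a1 p1 bpo
  have i3 := i1.add i2
  have := i3.lintegral_lt_top
  refine (lt_of_le_of_lt (lintegral_mono fun w => ?_) this).ne
  unfold ke
  rw [← ENNReal.ofReal_mul (kn_nn _)]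
  exact ENNReal.ofReal_le_ofReal (b w)

theorem Rz_pos (hn : 3 ≤ n) {e : Eu n} : Rz e ≠ 0 := by
  haveI : Nonempty (Fin n) := ⟨⟨0, by omega⟩⟩
  intro h
  unfold Rz at h
  have m1 : Measurable fun w => ke (n-1) (e - w) * ke (n-1) w :=
    Measurable.mul (ke_meas.comp (measurable_const.sub measurable_id)) ke_meas
  rw [lintegral_eq_zero_iff m1] at h
  have h1 : ∀ᵐ w : Eu n, w ≠ 0 := Measure.ae_ne volume 0
  have h2 : ∀ᵐ w : Eu n, w ≠ e := Measure.ae_ne volume e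
  obtain ⟨w, h, h1, h2⟩ := (h.and (h1.and h2)).exists
  have k : ∀ z : Eu n, z ≠ 0 → ke (n-1) z ≠ 0 := fun z hz => by
    unfold ke kn
    have := norm_pos_iff.2 hz
    exact (ENNReal.ofReal_pos.2 bpo).ne'
  exact mul_ne_zero (k _ (sub_ne_zero.2 (Ne.symm h2))) (k _ h1) h

theorem Rz_eq (hn : 3 ≤ n) : ∃ c : ℝ≥0∞, c ≠ 0 ∧ c ≠ ⊤ ∧ ∀ z : Eu n, z ≠ 0 → c * ke (n-2) z = Rz z := by
  haveI : Nonempty (Fin n) := ⟨⟨0, by omega⟩⟩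
  obtain ⟨e, he⟩ : ∃ e : Eu n, ‖e‖ = 1 := exists_norm_eq _ zero_le_one
  refine ⟨Rz e, Rz_pos hn, Rz_fin hn he, fun z hz => ?_⟩
  have hz' := norm_pos_iff.2 hz
  obtain ⟨L, hL, -⟩ := exists_iso (v := e) (e := ‖z‖⁻¹ • z) (by
    rw [norm_smul, norm_inv, norm_norm, he, inv_mul_cancel₀ hz'.ne'])
  have h1 := Rz_iso L e
  have h2 := Rz_smul (by omega : 2 ≤ n) hz' (‖z‖⁻¹ • z)
  rw [smul_smul, mul_inv_cancel₀ hz'.ne', one_smul, ← hL, h1] at h2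
  rw [h2, mul_comm]; rfl

theorem two_mul_le_sq (a b : ℝ≥0∞) : 2 * (a * b) ≤ a * a + b * b := by
  wlog h : a ≤ b generalizing a b
  · have := this b a (le_of_not_ge h)
    rwa [mul_comm a b, add_comm]
  obtain ⟨c, rfl⟩ := exists_add_of_le h
  have : a * a + (a + c) * (a + c) = 2 * (a * (a + c)) + c * c := by ring
  rw [this]; exact le_self_add

noncomputable def We (E F : Set (Eu n)) : ℝ≥0∞ := ∫⁻ x in E, ∫⁻ y in F, ke (n-2) (x - y)

noncomputable def Ae (E : Set (Eu n)) (w : Eu n) : ℝ≥0∞ := ∫⁻ x in E, ke (n-1) (x - w)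

theorem We_eq (hn : 3 ≤ n) : ∃ c : ℝ≥0∞, c ≠ 0 ∧ c ≠ ⊤ ∧ ∀ E F : Set (Eu n), c * We E F = ∫⁻ w, Ae E w * Ae F w := by
  haveI : Nonempty (Fin n) := ⟨⟨0, by omega⟩⟩
  obtain ⟨c, c0, c1, hc⟩ := Rz_eq hn
  refine ⟨c, c0, c1, fun E F => ?_⟩
  have km : ∀ j, Measurable fun p : Eu n × Eu n => (ke j (p.1 - p.2) : ℝ≥0∞) := fun j => ke_meas.comp (measurable_fst.sub measurable_snd)
  have s1 : ∀ x, c * ∫⁻ y in F, ke (n-2) (x - y) = ∫⁻ w, ke (n-1) (x - w) * Ae F w := fun x => by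
    have m1 : Measurable fun y => (ke (n-2) (x - y) : ℝ≥0∞) := ke_meas.comp (measurable_const.sub measurable_id)
    rw [← lintegral_const_mul _ m1]
    have : ∫⁻ y in F, c * ke (n-2) (x - y) = ∫⁻ y in F, ∫⁻ w, ke (n-1) (x - w) * ke (n-1) (y - w) := by
      refine lintegral_congr_ae (ae_restrict_of_ae ?_)
      filter_upwards [Measure.ae_ne volume x] with y hy
      rw [hc _ (sub_ne_zero.2 (Ne.symm hy)), Rz, ← lintegral_sub_right_eq_self _ y]
      refine lintegral_congr fun w => ?_
      rw [sub_sub_sub_cancel_right, ke_symm w y]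
    rw [this, lintegral_lintegral_swap]
    · refine lintegral_congr fun w => ?_
      rw [lintegral_const_mul]; rfl
      exact ke_meas.comp (measurable_id.sub measurable_const)
    · have : Measurable fun p : Eu n × Eu n => ke (n-1) (x - p.2) * ke (n-1) (p.1 - p.2) :=
        Measurable.mul (ke_meas.comp (measurable_const.sub measurable_snd)) (km _)
      exact this.aemeasurable
  unfold We
  rw [← lintegral_const_mul _ (km _).lintegral_prod_right']
  simp_rw [s1]
  have am : Measurable (Ae F) := (km (n-1)).lintegral_prod_left'
  rw [lintegral_lintegral_swap]
  · refine lintegral_congr fun w => ?_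
    rw [lintegral_mul_const]; rfl
    exact ke_meas.comp (measurable_id.sub measurable_const)
  · exact ((km (n-1)).mul (am.comp measurable_snd)).aemeasurable

theorem We_pos (hn : 3 ≤ n) (E F : Set (Eu n)) : 2 * We E F ≤ We E E + We F F := by
  obtain ⟨c, c0, c1, h⟩ := We_eq hn
  have km : Measurable fun p : Eu n × Eu n => (ke (n-1) (p.1 - p.2) : ℝ≥0∞) := ke_meas.comp (measurable_fst.sub measurable_snd)
  have am : ∀ F : Set (Eu n), Measurable (Ae F) := fun F => km.lintegral_prod_left'
  have am2 : ∀ F G : Set (Eu n), Measurable fun w => Ae F w * Ae G w := fun F G => (am F).mul (am G)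
  rw [← ENNReal.mul_le_mul_iff_right c0 c1, mul_add, mul_left_comm, h, h, h, ← lintegral_add_left (am2 E E),
    ← lintegral_const_mul _ (am2 E F)]
  exact lintegral_mono fun w => two_mul_le_sq _ _

noncomputable def Wr (E F : Set (Eu n)) : ℝ := ∫ x in E, ∫ y in F, kn (n-2) (x - y)

theorem NL_Wr (hn : 3 ≤ n) (E : Set (Eu n)) : NL E = Wr E E := by
  unfold NL Wr; simp_rw [kn_rpow hn]

theorem pot_sm (F : Set (Eu n)) : StronglyMeasurable fun x : Eu n => ∫ y in F, kn (n-2) (x - y) := by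
  have : StronglyMeasurable fun p : Eu n × Eu n => (kn (n-2) (p.1 - p.2) : ℝ) :=
    (kn_meas.comp (measurable_fst.sub measurable_snd)).stronglyMeasurable
  exact this.integral_prod_right (ν := volume.restrict F)

theorem pot_int (hn : 3 ≤ n) {E F : Set (Eu n)} (hE : volume E ≠ ⊤) (hF : volume F ≠ ⊤) :
    IntegrableOn (fun x : Eu n => ∫ y in F, kn (n-2) (x - y)) E := by
  refine Integrable.mono' (integrableOn_const (C := CK n (n-2) + volume.real F) hE) (pot_sm F).aestronglyMeasurable ?_
  filter_upwards with x
  rw [Real.norm_of_nonneg (integral_nonneg fun _ => kn_nn _)]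
  exact kn_int_le bom hF x

theorem We_Wr (hn : 3 ≤ n) {E F : Set (Eu n)} (hE : volume E ≠ ⊤) (hF : volume F ≠ ⊤) :
    We E F = ENNReal.ofReal (Wr E F) := by
  unfold We Wr
  rw [ofReal_integral_eq_lintegral_ofReal (pot_int hn hE hF) (evf fun x => integral_nonneg fun _ => kn_nn _)]
  refine lintegral_congr fun x => ?_
  rw [ofReal_integral_eq_lintegral_ofReal (kn_on bom hF x) (evf fun x => kn_nn _)]
  rfl

theorem Wr_nn (E F : Set (Eu n)) : 0 ≤ Wr E F := integral_nonneg fun _ => integral_nonneg fun _ => kn_nn _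

theorem Wr_pos (hn : 3 ≤ n) {E F : Set (Eu n)} (hE : volume E ≠ ⊤) (hF : volume F ≠ ⊤) :
    2 * Wr E F ≤ Wr E E + Wr F F := by
  have := We_pos hn E F
  rw [We_Wr hn hE hF, We_Wr hn hE hE, We_Wr hn hF hF, ← ENNReal.ofReal_add (Wr_nn _ _) (Wr_nn _ _),
    show (2:ℝ≥0∞) = ENNReal.ofReal 2 by simp, ← ENNReal.ofReal_mul bnn] at this
  exact (ENNReal.ofReal_le_ofReal_iff (add_nonneg (Wr_nn _ _) (Wr_nn _ _))).1 this

noncomputable def chi (E : Set (Eu n)) (x : Eu n) : ℝ := E.indicator (fun _ => (1:ℝ)) x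

theorem chi_int {E : Set (Eu n)} (hm : MeasurableSet E) (hE : volume E ≠ ⊤) : Integrable (chi E) :=
  (integrableOn_const (C := (1:ℝ)) hE).integrable_indicator hm

theorem set_chi {E : Set (Eu n)} (hm : MeasurableSet E) (g : Eu n → ℝ) : ∫ x in E, g x = ∫ x, chi E x * g x := by
  rw [← integral_indicator hm]
  refine integral_congr_ae (evf fun x => ?_)
  change E.indicator g x = chi E x * g x
  unfold chi
  by_cases h : x ∈ E <;> simp [h]

theorem NL_est (hn : 3 ≤ n) : ∃ C : ℝ, 0 < C ∧ ∀ E : Set (Eu n), MeasurableSet E → volume E = volume BB n →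
    NL BB n - NL E ≤ C * ∫ x, |chi E x - chi BB n x| * wt x := by
  obtain ⟨C, v0, hC, hV⟩ := Vb_wt (n := n) (m := n-2) bom bom
  refine ⟨2 * C, by positivity, fun E hm hv => ?_⟩
  have hE : volume E ≠ ⊤ := by rw [hv]; exact bfin
  have mB : MeasurableSet BB n := measurableSet_ball
  rw [NL_Wr hn, NL_Wr hn]
  have h1 := Wr_pos hn hE (bfin (n := n))
  have a1 : Wr E BB n = ∫ x in E, Vb (n-2) x := rfl
  have a2 : Wr BB n BB n = ∫ x in BB n, Vb (n-2) x := rfl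
  have i1 : IntegrableOn (Vb (n-2)) E := pot_int hn hE (bfin (n := n))
  have i2 : IntegrableOn (Vb (n-2)) BB n := pot_int hn bfin (bfin (n := n))
  have e1 : ∀ F : Set (Eu n), MeasurableSet F → volume F = volume BB n → IntegrableOn (Vb (n-2)) F →
      Integrable (fun x => chi F x * (Vb (n-2) x - v0)) ∧ ∫ x in F, Vb (n-2) x = (∫ x, chi F x * (Vb (n-2) x - v0)) + om n * v0 := by
    intro F mF vF iF
    have hF : volume F ≠ ⊤ := by rw [vF]; exact bfin
    have ic := integrableOn_const (s := F) (C := v0) hF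
    constructor
    · have : Integrable (F.indicator (fun x => Vb (n-2) x - v0)) := (iF.sub ic).integrable_indicator mF
      refine this.congr (evf fun x => ?_)
      change F.indicator _ x = chi F x * _
      unfold chi
      by_cases h : x ∈ F <;> simp [h]
    · rw [← set_chi mF, integral_sub iF ic, setIntegral_const, smul_eq_mul]
      have : volume.real F = om n := by unfold om Measure.real; rw [vF]
      rw [this]; ring
  obtain ⟨j1, k1⟩ := e1 E hm hv i1
  obtain ⟨j2, k2⟩ := e1 _ mB rfl i2
  have wi : Integrable fun x : Eu n => |chi E x - chi BB n x| * wt x := by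
    refine ((chi_int hm hE).sub (chi_int mB bfin)).abs.mul_bdd (c := 1) wt_cont.aestronglyMeasurable (evf fun x => ?_)
    rw [Real.norm_of_nonneg (wt_nn x)]; exact wt_le x
  have l : (∫ x, chi BB n x * (Vb (n-2) x - v0)) - (∫ x, chi E x * (Vb (n-2) x - v0))
      ≤ C * ∫ x, |chi E x - chi BB n x| * wt x := by
    rw [← integral_sub j2 j1, ← integral_const_mul]
    refine integral_mono (j2.sub j1) (wi.const_mul C) fun x => ?_
    change chi BB n x * (Vb (n-2) x - v0) - chi E x * (Vb (n-2) x - v0) ≤ C * (|chi E x - chi BB n x| * wt x)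
    rw [← sub_mul]
    refine (le_abs_self _).trans ?_
    rw [abs_mul, abs_sub_comm]
    have := ml (hV x) (abs_nonneg (chi E x - chi BB n x))
    linarith
  rw [a1, k1] at h1
  rw [a2, k2] at h1 ⊢
  linarith

theorem NL_nn (hn : 3 ≤ n) (E : Set (Eu n)) : 0 ≤ NL E := by rw [NL_Wr hn]; exact Wr_nn _ _

theorem NL_trans (E : Set (Eu n)) (c : Eu n) : NL ((fun x => x + c) ⁻¹' E) = NL E := by
  have key : ∀ g : Eu n → ℝ, ∫ x in (fun x => x + c) ⁻¹' E, g (x + c) = ∫ x in E, g x := fun g =>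
    (measurePreserving_add_right volume c).setIntegral_preimage_emb (measurableEmbedding_addRight c) g E
  unfold NL
  rw [← key (fun x => ∫ y in E, ‖x - y‖ ^ (2 - (n:ℝ)))]
  refine integral_congr_ae (evf fun x => ?_)
  change _ = ∫ y in E, ‖x + c - y‖ ^ (2 - (n:ℝ))
  rw [← key (fun y => ‖x + c - y‖ ^ (2 - (n:ℝ)))]
  simp only [add_sub_add_right_eq_sub]

theorem M5n (hn : 2 ≤ n) : ∃ K d1 : ℝ, 0 < K ∧ 0 < d1 ∧ d1 ≤ om n / 2 ∧ ∀ (f : Eu n → ℝ) (d : ℝ), Def f d → d ≤ d1 →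
    ∃ c, Gam (fun x => f (x + c)) ≤ K * d := by
  obtain ⟨k, rfl⟩ : ∃ k, n = k + 1 := ⟨n-1, by omega⟩
  exact M5 bom

theorem approx {E : Set (Eu n)} (hE : HasFinitePerimeter E) (hv : volume E = volume BB n) {η : ℝ} (hη : 0 < η) :
    ∃ f : Eu n → ℝ, Adm f ∧ ∫ x, |f x - chi E x| ≤ η ∧ TV f ≤ perimeter E + η ∧ |(∫ x, f x) - om n| ≤ η ∧ ∫ x, f x * (1 - f x) ≤ η := by
  have hV : volume E ≠ ⊤ := by rw [hv]; exact bfin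
  obtain ⟨f, h, h1, h2⟩ := M1 hE hV hη
  have ic := chi_int hE.1 hV
  have h1' : ∫ x, |f x - chi E x| ≤ η := h1
  refine ⟨f, h, h1, h2, ?_, ?_⟩
  · have : om n = ∫ x, chi E x := by
      have := set_chi hE.1 (fun _ => (1:ℝ))
      simp only [mul_one] at this
      rw [← this, setIntegral_const, smul_eq_mul, mul_one]
      unfold om Measure.real; rw [hv]
    rw [this, ← integral_sub h.integrable ic]
    exact abs_integral_le_integral_abs.trans h1'
  · refine le_trans (integral_mono_of_nonneg (evf fun x => ?_) (h.integrable.sub ic).abs (evf fun x => ?_)) h1'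
    · exact mul_nonneg (h.nn x) (sub_nonneg.2 (h.le x))
    · change f x * (1 - f x) ≤ |f x - chi E x|
      have a := h.nn x
      have b := h.le x
      unfold chi
      by_cases hx : x ∈ E
      · rw [indicator_of_mem hx, abs_sub_comm, abs_of_nonneg bli]; nlinarith
      · rw [indicator_of_notMem hx, sub_zero, abs_of_nonneg a]; nlinarith

theorem isoper (hn : 1 ≤ n) {E : Set (Eu n)} (hE : HasFinitePerimeter E) (hv : volume E = volume BB n) :
    n * om n ≤ perimeter E := by
  have o := om_pos n
  have n1 : (1:ℝ) ≤ n := by exact_mod_cast hn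
  have key : ∀ η : ℝ, 0 < η → n * om n ^ (1/(n:ℝ)) * (om n - 2 * η) ≤ (om n + η) ^ (1/(n:ℝ)) * (perimeter E + η) := by
    intro η hη
    obtain ⟨f, h, -, h2, h3, h4⟩ := approx hE hv hη
    have s := Sob_all hn f h
    rw [abs_le] at h3
    have p1 : 1/(n:ℝ) ≤ 1 := by rw [div_le_one bli]; exact n1
    have p0 : 0 < 1/(n:ℝ) := by positivity
    have i1 : Integrable fun x => f x * (1 - f x) := (h.cont.mul (continuous_const.sub h.cont)).integrable_of_hasCompactSupport h.cs.mul_right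
    have i2 : Integrable fun x => f x ^ (1 + 1/(n:ℝ)) := by
      refine (h.cont.rpow_const fun x => Or.inr bpo).integrable_of_hasCompactSupport (h.cs.mono fun x hx h0 => hx ?_)
      change f x ^ (1 + 1/(n:ℝ)) = 0
      rw [h0, Real.zero_rpow bpo]
    have l : om n - 2 * η ≤ ∫ x, f x ^ (1 + 1/(n:ℝ)) := by
      have : ∫ x, (f x - f x * (1 - f x)) ≤ ∫ x, f x ^ (1 + 1/(n:ℝ)) := by
        refine integral_mono (h.integrable.sub i1) i2 fun x => ?_
        change f x - f x * (1 - f x) ≤ f x ^ (1 + 1/(n:ℝ))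
        rcases (h.nn x).eq_or_lt with h0 | h0
        · rw [← h0, Real.zero_rpow bpo]; simp
        · have := Real.rpow_le_rpow_of_exponent_ge h0 (h.le x) (show 1 + 1/(n:ℝ) ≤ (2:ℕ) by push_cast; linarith)
          rw [Real.rpow_natCast] at this
          nlinarith
      rw [integral_sub h.integrable i1] at this
      linarith
    have f0 : 0 ≤ ∫ x, f x := integral_nonneg h.nn
    calc _ ≤ n * om n ^ (1/(n:ℝ)) * ∫ x, f x ^ (1 + 1/(n:ℝ)) := by gcongr
      _ ≤ (∫ x, f x) ^ (1/(n:ℝ)) * TV f := s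
      _ ≤ _ := by
        have := TV_nonneg f
        gcongr
        linarith
  have t1 : Filter.Tendsto (fun η : ℝ => n * om n ^ (1/(n:ℝ)) * (om n - 2 * η)) (nhdsWithin 0 (Ioi 0)) (nhds (n * om n ^ (1/(n:ℝ)) * (om n - 2 * 0))) :=
    (Continuous.tendsto bfp 0).mono_left nhdsWithin_le_nhds
  have t2 : Filter.Tendsto (fun η : ℝ => (om n + η) ^ (1/(n:ℝ)) * (perimeter E + η)) (nhdsWithin 0 (Ioi 0)) (nhds ((om n + 0) ^ (1/(n:ℝ)) * (perimeter E + 0))) :=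
    (Continuous.tendsto (Continuous.mul (Continuous.rpow_const bfp fun x => Or.inr bpo) bfp) 0).mono_left nhdsWithin_le_nhds
  have := le_of_tendsto_of_tendsto t1 t2 (by filter_upwards [self_mem_nhdsWithin] with η hη using key η hη)
  rw [mul_zero, sub_zero, add_zero, add_zero] at this
  have q : 0 < om n ^ (1/(n:ℝ)) := by positivity
  refine le_of_mul_le_mul_left ?_ q
  linarith

theorem center {E : Set (Eu n)} (hE : HasFinitePerimeter E) (hv : volume E = volume BB n)
    (hP : n * om n ≤ perimeter E) {K d1 : ℝ} (H : ∀ (f : Eu n → ℝ) (d : ℝ), Def f d → d ≤ d1 → ∃ c, Gam (fun x => f (x + c)) ≤ K * d)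
    {d : ℝ} (hd : perimeter E - n * om n < d) (hd1 : d ≤ d1) :
    ∃ c, ∫ x, |chi ((fun x => x + c) ⁻¹' E) x - chi BB n x| * wt x ≤ (K + 1) * d := by
  have hV : volume E ≠ ⊤ := by rw [hv]; exact bfin
  obtain ⟨f, h, h1, h2, h3, h4⟩ := approx hE hv (show 0 < d - (perimeter E - n * om n) by linarith)
  obtain ⟨c, hc⟩ := H f d ⟨h, by linarith, by linarith, by linarith, by linarith⟩ hd1
  refine ⟨c, ?_⟩
  have ic := chi_int hE.1 hV
  have i1 : Integrable fun x => |f (x + c) - chi E (x + c)| := ((h.integrable.sub ic).comp_add_right c).abs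
  have e1 : ∫ x, |f (x + c) - chi E (x + c)| = ∫ x, |f x - chi E x| := integral_add_right_eq_self (fun x => |f x - chi E x|) c
  have i2 := (h.trans c).Gam_int
  calc _ ≤ ∫ x, (|gB (fun x => f (x + c)) x| * wt x + |f (x + c) - chi E (x + c)|) := by
        refine integral_mono_of_nonneg (evf fun x => mul_nonneg (abs_nonneg _) (wt_nn x)) (i2.add i1) (evf fun x => ?_)
        change |chi E (x + c) - chi BB n x| * wt x ≤ |f (x + c) - chi BB n x| * wt x + |f (x + c) - chi E (x + c)|
        have t := abs_sub_le (chi E (x + c)) (f (x + c)) (chi BB n x)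
        rw [abs_sub_comm (chi E (x + c)) (f (x + c))] at t
        have a := wt_nn x
        have b := wt_le x
        nlinarith [abs_nonneg (f (x + c) - chi E (x + c)), mr t a]
    _ ≤ _ := by
        rw [integral_add i2 i1, e1]
        change Gam (fun x => f (x + c)) + _ ≤ _
        linarith

theorem limit_ball (hn : 1 ≤ n) {E : Set (Eu n)} (hm : MeasurableSet E) (hV : volume E ≠ ⊤)
    (H : ∀ ε : ℝ, 0 < ε → ∃ c, ∫ x, |chi E x - chi (ball c 1) x| < ε) : ∃ c, volume (symmDiff E (ball c 1)) = 0 := by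
  haveI : Nonempty (Fin n) := ⟨⟨0, by omega⟩⟩
  have o := om_pos n
  have iE := chi_int hm hV
  have iB : ∀ (c : Eu n) (r : ℝ), Integrable (chi (ball c r)) := fun c r => chi_int measurableSet_ball measure_ball_lt_top.ne
  have vB : ∀ c : Eu n, ∫ x, chi (ball c 1) x = om n := fun c => by
    have := set_chi (n := n) (E := ball c 1) measurableSet_ball (fun _ => (1:ℝ))
    simp only [mul_one] at this
    rw [← this, setIntegral_const, smul_eq_mul, mul_one, vol_ball c zero_le_one hn, one_pow, one_mul]
  have iD : ∀ c : Eu n, Integrable fun x => |chi E x - chi (ball c 1) x| := fun c => (iE.sub (iB c 1)).abs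
  have cont : Continuous fun c : Eu n => ∫ x, |chi E x - chi (ball c 1) x| := by
    rw [continuous_iff_continuousAt]
    intro c
    refine continuousAt_of_dominated (bound := fun x => chi E x + chi (ball c 2) x) ?_ ?_ (iE.add (iB c 2)) ?_
    · exact evf fun c' => (iE.sub (iB c' 1)).abs.aestronglyMeasurable
    · filter_upwards [ball_mem_nhds c one_pos] with c' hc'
      filter_upwards with x
      rw [Real.norm_eq_abs, abs_abs]
      have a0 : ∀ F : Set (Eu n), 0 ≤ chi F x := fun F => indicator_nonneg (fun _ _ => zero_le_one) x
      have s : chi (ball c' 1) x ≤ chi (ball c 2) x := by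
        refine indicator_le_indicator_of_subset (ball_subset_ball' ?_) (fun _ => zero_le_one) x
        rw [mem_ball] at hc'; linarith
      rw [abs_le]; constructor <;> linarith [a0 E, a0 (ball c' 1), a0 (ball c 2)]
    · have : ∀ᵐ x : Eu n, x ∉ sphere c 1 := by
        rw [← measure_eq_zero_iff_ae_notMem]; exact Measure.addHaar_sphere _ _ _
      filter_upwards [this] with x hx
      have hx' : dist x c ≠ 1 := hx
      have : (fun c' => |chi E x - chi (ball c' 1) x|) =ᶠ[nhds c] fun _ => |chi E x - chi (ball c 1) x| := by
        have ct : ContinuousAt (fun c' => dist x c') c := by fun_prop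
        rcases lt_or_gt_of_ne hx' with h | h
        · filter_upwards [ct.eventually_lt continuousAt_const h] with c' hc'
          unfold chi
          rw [indicator_of_mem (show x ∈ ball c' 1 from hc'), indicator_of_mem (show x ∈ ball c 1 from h)]
        · filter_upwards [continuousAt_const.eventually_lt ct h] with c' hc'
          unfold chi
          rw [indicator_of_notMem (show x ∉ ball c' 1 from not_lt.2 (le_of_lt hc')), indicator_of_notMem (show x ∉ ball c 1 from not_lt.2 h.le)]
      exact continuousAt_const.congr this.symm
  have far : ∀ c c' : Eu n, 2 ≤ dist c c' → 2 * om n ≤ (∫ x, |chi E x - chi (ball c 1) x|) + ∫ x, |chi E x - chi (ball c' 1) x| := by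
    intro c c' h
    have : Disjoint (ball c 1) (ball c' 1) := ball_disjoint_ball bli
    have e : 2 * om n = ∫ x, (chi (ball c 1) x + chi (ball c' 1) x) := by
      rw [integral_add (iB _ _) (iB _ _), vB, vB]; ring
    rw [e, ← integral_add (iD c) (iD c')]
    refine integral_mono ((iB _ _).add (iB _ _)) ((iD c).add (iD c')) fun x => ?_
    change chi (ball c 1) x + chi (ball c' 1) x ≤ |chi E x - chi (ball c 1) x| + |chi E x - chi (ball c' 1) x|
    unfold chi
    by_cases h1 : x ∈ ball c 1
    · have h2 := disjoint_left.1 this h1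
      by_cases h3 : x ∈ E <;> simp only [indicator_of_mem, indicator_of_notMem, h1, h2, h3, not_false_eq_true] <;> norm_num
    · by_cases h2 : x ∈ ball c' 1 <;> by_cases h3 : x ∈ E <;> simp only [indicator_of_mem, indicator_of_notMem, h1, h2, h3, not_false_eq_true] <;> norm_num
  obtain ⟨c0, h0⟩ := H (om n) o
  obtain ⟨c, -, hc⟩ := (isCompact_closedBall c0 2).exists_isMinOn (nonempty_closedBall.2 zero_le_two) cont.continuousOn
  refine ⟨c, ?_⟩
  have z : ∫ x, |chi E x - chi (ball c 1) x| = 0 := by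
    refine le_antisymm (le_of_forall_pos_lt_add fun ε hε => ?_) (integral_nonneg fun _ => abs_nonneg _)
    obtain ⟨c', h'⟩ := H (min ε (om n)) (lt_min hε o)
    have m : c' ∈ closedBall c0 2 := by
      by_contra hh
      rw [mem_closedBall, not_le] at hh
      have := far c' c0 hh.le
      linarith [lt_of_lt_of_le h' (min_le_right _ _)]
    have := isMinOn_iff.1 hc c' m
    linarith [lt_of_lt_of_le h' (min_le_left _ _)]
  rw [integral_eq_zero_iff_of_nonneg (fun _ => abs_nonneg _) (iD c)] at z
  rw [measure_symmDiff_eq_zero_iff]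
  filter_upwards [z] with x hx
  have hx' : chi E x - chi (ball c 1) x = 0 := abs_eq_zero.1 hx
  unfold chi at hx'
  by_cases h1 : x ∈ E <;> by_cases h2 : x ∈ ball c 1 <;> simp only [indicator_of_mem, indicator_of_notMem, h1, h2, not_false_eq_true] at hx'
  · exact propext ⟨fun _ => h2, fun _ => h1⟩
  · norm_num at hx'
  · norm_num at hx'
  · exact propext ⟨fun h => absurd h h1, fun h => absurd h h2⟩

theorem final (n : ℕ) (hn : 3 ≤ n) :
    ∃ ln : ℝ, 0 < ln ∧ ∀ l : ℝ, 0 < l → l < ln →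
      (∀ E : Set (Eu n), HasFinitePerimeter E → volume E = volume BB n →
          perimeter BB n + l * NL BB n ≤ perimeter E + l * NL E) ∧
      ∀ E : Set (Eu n), HasFinitePerimeter E → volume E = volume BB n →
          perimeter E + l * NL E = perimeter BB n + l * NL BB n →
          ∃ c : Eu n, volume (symmDiff E (ball c 1)) = 0 := by
  obtain ⟨K, d1, hK, hd1, -, H⟩ := M5n (n := n) bom
  obtain ⟨C, hC, hNL⟩ := NL_est hn
  obtain ⟨C2, hC2, hb⟩ := bath (n := n) bom
  have o := om_pos n
  have nB := NL_nn hn BB n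
  have pB := per_ball (n := n) bom
  have pre : ∀ (E : Set (Eu n)) (c : Eu n), MeasurableSet E → volume E = volume BB n →
      MeasurableSet ((fun x => x + c) ⁻¹' E) ∧ volume ((fun x => x + c) ⁻¹' E) = volume BB n := fun E c hm hv =>
    ⟨(measurable_add_const c) hm, by rw [← hv]; exact measure_preimage_add_right volume c E⟩
  obtain ⟨M, hM⟩ : ∃ M, M = C * (K + 1) + NL BB n / d1 := ⟨_, rfl⟩
  have M0 : 0 < M := by rw [hM]; positivity
  have main : ∀ E : Set (Eu n), HasFinitePerimeter E → volume E = volume BB n →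
      NL BB n - NL E ≤ M * (perimeter E - n * om n) := by
    intro E hE hv
    have hP := isoper bom hE hv
    have q : 0 ≤ NL BB n / d1 := by positivity
    rcases lt_or_ge (perimeter E - n * om n) d1 with h | h
    · have : ∀ d, perimeter E - n * om n < d → d ≤ d1 → NL BB n - NL E ≤ M * d := by
        intro d h1 h2
        obtain ⟨c, hc⟩ := center hE hv hP H h1 h2
        obtain ⟨m, v⟩ := pre E c hE.1 hv
        have := hNL _ m v
        rw [NL_trans] at this
        have h3 := ml hc hC.le
        have h4 : 0 ≤ NL BB n / d1 * d := mul_nonneg q bli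
        rw [hM, add_mul]; linarith
      refine le_of_forall_pos_lt_add fun ε hε => ?_
      obtain ⟨d, h1, h2⟩ := exists_between (show perimeter E - n * om n < min d1 (perimeter E - n * om n + ε / M) from
        lt_min h (by have : 0 < ε / M := by positivity
                     linarith))
      rw [lt_min_iff] at h2
      refine (this d h1 h2.1.le).trans_lt ?_
      have := mul_lt_mul_of_pos_left h2.2 M0
      rw [mul_add, mul_div_cancel₀ _ M0.ne'] at this
      exact this
    · have h1 := NL_nn hn E
      have h2 : NL BB n ≤ NL BB n / d1 * (perimeter E - n * om n) := by
        calc _ = NL BB n / d1 * d1 := by field_simp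
          _ ≤ _ := by gcongr
      have h3 : 0 ≤ C * (K + 1) * (perimeter E - n * om n) := mul_nonneg bpo bli
      rw [hM, add_mul]; linarith
  refine ⟨1 / M, by positivity, fun l l0 l1 => ?_⟩
  rw [lt_div_iff₀ M0] at l1
  constructor
  · intro E hE hv
    have h1 := ml (main E hE hv) l0.le
    have h2 := isoper bom hE hv
    nlinarith
  · intro E hE hv he
    have h1 := ml (main E hE hv) l0.le
    have hP := isoper bom hE hv
    have D0 : perimeter E - n * om n ≤ 0 := by
      by_contra hh
      push Not at hh
      have := mul_lt_mul_of_pos_right l1 hh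
      linarith
    have hV : volume E ≠ ⊤ := by rw [hv]; exact bfin
    refine limit_ball bom hE.1 hV fun ε hε => ?_
    obtain ⟨d, d0, hd⟩ : ∃ d : ℝ, 0 < d ∧ d ≤ d1 ∧ C2 * ((K + 1) * d) < ε^2 := by
      refine ⟨min d1 (ε^2 / (2 * (C2 * (K + 1)))), by positivity, min_le_left _ _, ?_⟩
      calc C2 * ((K + 1) * _) ≤ C2 * ((K + 1) * (ε^2 / (2 * (C2 * (K + 1))))) := by gcongr; exact min_le_right _ _
        _ = ε^2 / 2 := by field_simp
        _ < _ := by linarith [pow_pos hε 2]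
    obtain ⟨c, hc⟩ := center hE hv hP H (d := d) bli hd.1
    refine ⟨c, ?_⟩
    obtain ⟨m, v⟩ := pre E c hE.1 hv
    obtain ⟨F, hF⟩ : ∃ F, F = (fun x => x + c) ⁻¹' E := ⟨_, rfl⟩
    rw [← hF] at m v hc
    have iF := chi_int m (by rw [v]; exact bfin)
    have iB : Integrable (chi BB n) := chi_int measurableSet_ball bfin
    have e1 : ∫ x, |chi E x - chi (ball c 1) x| = ∫ x, |chi F x - chi BB n x| := by
      rw [← integral_add_right_eq_self (fun x => |chi E x - chi (ball c 1) x|) c]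
      refine integral_congr_ae (evf fun x => ?_)
      have a1 : chi F x = chi E (x + c) := by rw [hF]; rfl
      have a2 : chi BB n x = chi (ball c 1) (x + c) := by
        unfold chi
        by_cases h : x ∈ BB n
        · rw [indicator_of_mem h, indicator_of_mem]; simpa using h
        · rw [indicator_of_notMem h, indicator_of_notMem]; simpa using h
      change |chi E (x + c) - chi (ball c 1) (x + c)| = |chi F x - chi BB n x|
      rw [a1, a2]
    have c01 : ∀ (S : Set (Eu n)) x, 0 ≤ chi S x ∧ chi S x ≤ 1 := fun S x =>
      ⟨indicator_nonneg (fun _ _ => zero_le_one) x, indicator_le_self' (fun _ _ => zero_le_one) x⟩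
    have vol1 : ∀ S : Set (Eu n), MeasurableSet S → volume S = volume BB n → ∫ x, chi S x = om n := fun S hS vS => by
      have := set_chi hS (fun _ => (1:ℝ))
      simp only [mul_one] at this
      rw [← this, setIntegral_const, smul_eq_mul, mul_one]
      unfold om Measure.real; rw [vS]
    have b3 : ∫ x, |chi F x - chi BB n x| ≤ 3 * om n := by
      have : ∫ x, |chi F x - chi BB n x| ≤ ∫ x, (chi F x + chi BB n x) := by
        refine integral_mono (iF.sub iB).abs (iF.add iB) fun x => ?_
        change |chi F x - chi BB n x| ≤ chi F x + chi BB n x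
        rw [abs_le]; constructor <;> linarith [(c01 F x).1, (c01 BB n x).1]
      rw [integral_add iF iB, vol1 F m v, vol1 _ measurableSet_ball rfl] at this
      linarith
    have wi : Integrable fun x => |chi F x - chi BB n x| * wt x := by
      refine (iF.sub iB).abs.mul_bdd (c := 1) wt_cont.aestronglyMeasurable (evf fun x => ?_)
      rw [Real.norm_of_nonneg (wt_nn x)]; exact wt_le x
    have := hb (fun x => chi F x - chi BB n x) (iF.sub iB) (fun x => by
      rw [abs_le]; constructor <;> linarith [(c01 F x).1, (c01 BB n x).1, (c01 F x).2, (c01 BB n x).2]) b3 wi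
    rw [e1]
    refine lt_of_pow_lt_pow_left₀ 2 hε.le ?_
    have := ml hc hC2.le
    linarith [hd.2]

/-- Rescaled form: for every sufficiently small `λ > 0` the unit ball uniquely
(up to translation) minimizes `P(E) + λ·NL(E)` among sets of finite perimeter
with the volume of the unit ball. -/
theorem statement1 (n : ℕ) (hn : 3 ≤ n) :
    ∃ ln : ℝ, 0 < ln ∧ ∀ l : ℝ, 0 < l → l < ln →
      (∀ E : Set (EuclideanSpace ℝ (Fin n)), HasFinitePerimeter E →
          volume E = volume (ball (0 : EuclideanSpace ℝ (Fin n)) 1) →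
          perimeter (ball (0 : EuclideanSpace ℝ (Fin n)) 1) +
              l * NL (ball (0 : EuclideanSpace ℝ (Fin n)) 1) ≤ perimeter E + l * NL E) ∧
      ∀ E : Set (EuclideanSpace ℝ (Fin n)), HasFinitePerimeter E →
          volume E = volume (ball (0 : EuclideanSpace ℝ (Fin n)) 1) →
          perimeter E + l * NL E =
            perimeter (ball (0 : EuclideanSpace ℝ (Fin n)) 1) +
              l * NL (ball (0 : EuclideanSpace ℝ (Fin n)) 1) →
          ∃ c : EuclideanSpace ℝ (Fin n), volume (symmDiff E (ball c 1)) = 0 := by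
  exact final n hn
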